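/- Let Ω₁ and Ω₂ be bounded strictly pseudoconvex domains in ℂⁿ whose boundaries bΩ₁ and bΩ₂ are of class C². Then every proper holomorphic mapping f : Ω₁ → Ω₂ extends to a mapping of Hölder class C^α on the closure of Ω₁ for every exponent α with 0 ≤ α < 1; that is, f extends continuously to the closure of Ω₁ and there is a constant C > 0 such that |f(z) − f(w)| ≤ C |z − w|^α for all z, w in the closure of Ω₁. -/

import Mathlib

open Metric Set

/-- The Levi form of a real `C²` function `ρ` at the point `p` in the direction `v`:
`L(ρ,p,v) = Σ ∂²ρ/∂z_j∂z̄_k (p) v_j v̄_k`, expressed via the real second derivative as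
`(1/4) (D²ρ(p)[v,v] + D²ρ(p)[iv,iv])`. -/
noncomputable def leviForm {n : ℕ} (ρ : EuclideanSpace ℂ (Fin n) → ℝ)
    (p v : EuclideanSpace ℂ (Fin n)) : ℝ :=
  (1 / 4) * (iteratedFDeriv ℝ 2 ρ p ![v, v] +
    iteratedFDeriv ℝ 2 ρ p ![Complex.I • v, Complex.I • v])

/-- A bounded strictly pseudoconvex domain in `ℂⁿ` with boundary of class `C²`:
a bounded open connected set `Ω` admitting a defining function `ρ` of class `C²` on a
neighborhood `U` of the closure of `Ω` with `Ω = {ρ < 0}`, `dρ ≠ 0` on `bΩ`, and whose Levi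
form is positive on nonzero complex tangent vectors at every boundary point. -/
def IsStrictlyPseudoconvexDomain {n : ℕ} (Ω : Set (EuclideanSpace ℂ (Fin n))) : Prop :=
  IsOpen Ω ∧ IsConnected Ω ∧ Bornology.IsBounded Ω ∧
  ∃ (U : Set (EuclideanSpace ℂ (Fin n))) (ρ : EuclideanSpace ℂ (Fin n) → ℝ),
    IsOpen U ∧ closure Ω ⊆ U ∧ ContDiffOn ℝ 2 ρ U ∧
    Ω = {z ∈ U | ρ z < 0} ∧
    (∀ p ∈ frontier Ω, fderiv ℝ ρ p ≠ 0) ∧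
    (∀ p ∈ frontier Ω, ∀ v : EuclideanSpace ℂ (Fin n), v ≠ 0 →
      fderiv ℝ ρ p v = 0 → fderiv ℝ ρ p (Complex.I • v) = 0 → 0 < leviForm ρ p v)


namespace PMH
open Filter Topology Asymptotics

open Complex (I I_mul_I I_ne_zero abs_im_le_norm abs_re_le_norm add_re coe_smul conj_ofReal mul_I_re neg_re normSq_apply normSq_eq_norm_sq norm_I norm_real ofReal_add ofReal_im ofReal_mul ofReal_pow ofReal_re ofReal_sub re_add_im re_le_norm re_ofReal_mul sub_re)
open ContinuousLinearMap (opNorm_le_bound toLinearMap_comp)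
open Real (add_one_le_exp contDiff_exp exp exp_le_exp exp_le_one_iff exp_pos exp_zero le_sqrt_of_sq_le log log_div log_exp log_le_log log_mul log_pow mul_rpow mul_self_sqrt norm_eq_abs norm_of_nonneg pi_pos rpow_add rpow_le_rpow_of_exponent_ge rpow_le_rpow_of_nonpos rpow_one rpow_pos_of_pos rpow_sub rpow_sub_one sq_sqrt sqrt sqrt_eq_rpow sqrt_mul sqrt_nonneg sqrt_pos sqrt_zero zero_rpow)

section
section Basics
variable {E F : Type*} [NormedAddCommGroup E] [NormedSpace ℂ E]
  [NormedAddCommGroup F] [NormedSpace ℂ F]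

lemma fderiv_bound {f : E → F} {c:E} {R M:ℝ} (hR : 0 < R)
  (hd : DifferentiableOn ℂ f (ball c R)) (hM : ∀ z ∈ ball c R, ‖f z‖ ≤ M) :
  ‖fderiv ℂ f c‖ ≤ 2 * M / R := by
  apply Complex.norm_fderiv_le_div_of_mapsTo_ball hd _ hR
  intro z hz
  rw [mem_closedBall, dist_eq_norm]
  have h1 := hM z hz
  have h2 := hM c (mem_ball_self hR)
  linarith [norm_sub_le (f z) (f c)]

lemma taylor_bound {f : E → F} {c:E} {R M:ℝ} (hR : 0 < R)
  (hd : DifferentiableOn ℂ f (ball c R)) (hM : ∀ z ∈ ball c R, ‖f z‖ ≤ M)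
  {z:E} (hz : z ∈ ball c R) :
  ‖f z - f c - fderiv ℂ f c (z - c)‖ ≤ 4 * M * (‖z - c‖ / R) ^ 2 := by
  have hfd : HasFDerivAt f (fderiv ℂ f c) c :=
    (hd.differentiableAt (ball_mem_nhds c hR)).hasFDerivAt
  have hb := fderiv_bound hR hd hM
  set h : E → F := fun z => f z - fderiv ℂ f c (z - c) with hh
  have hdh : DifferentiableOn ℂ h (ball c R) := by
    apply hd.sub
    exact ((fderiv ℂ f c).differentiable.comp (differentiable_id.sub_const c)).differentiableOn
  have hc : h c = f c := by simp [hh]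
  have := Complex.dist_le_mul_div_pow_of_mapsTo_ball_of_isLittleO (n := 1) (R₂ := 4 * M) hdh ?_ ?_ hz
  · rw [dist_eq_norm, dist_eq_norm, hc] at this
    have e : f z - f c - fderiv ℂ f c (z - c) = h z - f c := by simp only [hh]; abel
    rw [e]; exact this
  · intro w hw
    rw [mem_closedBall, dist_eq_norm, hc]
    have h1 := hM w hw
    have h2 := hM c (mem_ball_self hR)
    have h3 : ‖fderiv ℂ f c (w - c)‖ ≤ 2 * M := by
      refine ((fderiv ℂ f c).le_opNorm _).trans ?_
      have : ‖w - c‖ ≤ R := by rw [← dist_eq_norm]; exact (mem_ball.1 hw).le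
      have hM0 : 0 ≤ M := (norm_nonneg _).trans h2
      calc _ ≤ 2 * M / R * R := by gcongr
        _ = 2 * M := by field_simp
    calc ‖h w - f c‖ ≤ ‖h w‖ + ‖f c‖ := norm_sub_le _ _
      _ ≤ ‖f w‖ + ‖fderiv ℂ f c (w - c)‖ + ‖f c‖ := by gcongr; exact norm_sub_le _ _
      _ ≤ _ := by linarith
  · have := hfd.isLittleO
    have h2 := this.norm_right
    simp only [pow_one]
    refine h2.congr_left ?_
    intro x; simp only [hh]; simp; abel

lemma lip_bound {f : E → F} {c:E} {R M:ℝ} (hR : 0 < R)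
  (hd : DifferentiableOn ℂ f (ball c R)) (hM : ∀ z ∈ ball c R, ‖f z‖ ≤ M)
  {z w:E} (hz : z ∈ ball c (R / 2)) (hw : w ∈ ball c (R / 2)) :
  ‖f z - f w‖ ≤ 4 * M / R * ‖z - w‖ := by
  have hsub : ball w (R / 2) ⊆ ball c R := by
    apply ball_subset_ball'
    have := mem_ball.1 hw; linarith
  have hz' : z ∈ ball c R := ball_subset_ball (by linarith) hz
  have hw' : w ∈ ball c R := ball_subset_ball (by linarith) hw
  have hzw : ‖f z - f w‖ ≤ 2 * M := by
    linarith [norm_sub_le (f z) (f w), hM z hz', hM w hw']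
  rcases lt_or_ge ‖z - w‖ (R / 2) with h | h
  · have := Complex.dist_le_div_mul_dist_of_mapsTo_ball (R₂ := 2 * M) (hd.mono hsub) ?_
      (by rw [mem_ball, dist_eq_norm]; exact h : z ∈ ball w (R / 2))
    · rw [dist_eq_norm, dist_eq_norm] at this
      refine this.trans (le_of_eq ?_)
      field_simp; ring
    · intro y hy
      rw [mem_closedBall, dist_eq_norm]
      linarith [norm_sub_le (f y) (f w), hM y (hsub hy), hM w hw']
  · have hM0 : 0 ≤ M := (norm_nonneg _).trans (hM z hz')
    calc _ ≤ 2 * M := hzw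
      _ = 4 * M / R * (R / 2) := by field_simp; ring
      _ ≤ _ := by gcongr

lemma exists_bdd_ball {f : E → F} {U : Set E} (hU : IsOpen U) (hd : DifferentiableOn ℂ f U)
  {c:E} (hc : c ∈ U) : ∃ R > 0, ∃ M, ball c R ⊆ U ∧ ∀ z ∈ ball c R, ‖f z‖ ≤ M := by
  have hcont : ContinuousAt f c := (hd.differentiableAt (hU.mem_nhds hc)).continuousAt
  have h1 : ∀ᶠ z in 𝓝 c, ‖f z‖ < ‖f c‖ + 1 :=
    hcont.norm.eventually_lt_const (by linarith)
  obtain ⟨R, hR, h⟩ := Metric.eventually_nhds_iff_ball.1 (h1.and (hU.mem_nhds hc))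
  exact ⟨R, hR, ‖f c‖ + 1, fun z hz => (h z hz).2, fun z hz => (h z hz).1.le⟩

variable {ι : Type*}

lemma ultra_lim [ProperSpace F] (𝒰 : Ultrafilter ι) (g : ι → F) (M:ℝ)
  (h : ∀ᶠ j in 𝒰, ‖g j‖ ≤ M) : ∃ L, Tendsto g 𝒰 (𝓝 L) ∧ ‖L‖ ≤ M := by
  obtain ⟨L, hL, h2⟩ := (isCompact_closedBall (0 : F) M).ultrafilter_le_nhds (𝒰.map g) (by
    rw [Ultrafilter.coe_map, le_principal_iff, mem_map]
    filter_upwards [h] with j hj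
    simpa using hj)
  exact ⟨L, h2, by simpa using hL⟩

lemma limit_hasFDerivAt [FiniteDimensional ℂ E] [FiniteDimensional ℂ F]
  (𝒰 : Ultrafilter ι) (g : ι → E → F) (g0 : E → F) {c:E} {R M:ℝ} (hR : 0 < R)
  (hd : ∀ᶠ j in 𝒰, DifferentiableOn ℂ (g j) (ball c R))
  (hM : ∀ᶠ j in 𝒰, ∀ z ∈ ball c R, ‖g j z‖ ≤ M)
  (hlim : ∀ z ∈ ball c R, Tendsto (fun j => g j z) 𝒰 (𝓝 (g0 z))) :
  HasFDerivAt g0 (fderiv ℂ g0 c) c ∧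
  Tendsto (fun j => fderiv ℂ (g j) c) 𝒰 (𝓝 (fderiv ℂ g0 c)) := by
  have : ProperSpace (E →L[ℂ] F) := FiniteDimensional.proper ℂ _
  obtain ⟨L, hL, -⟩ := ultra_lim 𝒰 (fun j => fderiv ℂ (g j) c) (2 * M / R) (by
    filter_upwards [hd, hM] with j h1 h2 using fderiv_bound hR h1 h2)
  have key : ∀ z ∈ ball c R, ‖g0 z - g0 c - L (z - c)‖ ≤ 4 * M * (‖z - c‖ / R) ^ 2 := by
    intro z hz
    have t1 : Tendsto (fun j => ‖g j z - g j c - fderiv ℂ (g j) c (z - c)‖) 𝒰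
        (𝓝 ‖g0 z - g0 c - L (z - c)‖) :=
      (((hlim z hz).sub (hlim c (mem_ball_self hR))).sub
        ((ContinuousLinearMap.apply ℂ F (z - c)).continuous.continuousAt.tendsto.comp hL)).norm
    refine le_of_tendsto t1 ?_
    filter_upwards [hd, hM] with j h1 h2 using taylor_bound hR h1 h2 hz
  have hfd : HasFDerivAt g0 L c := by
    rw [hasFDerivAt_iff_isLittleO]
    have h1 : (fun z => g0 z - g0 c - L (z - c)) =O[𝓝 c] fun z => ‖z - c‖ ^ 2 := by
      apply Asymptotics.IsBigO.of_bound (4 * M / R ^ 2)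
      filter_upwards [ball_mem_nhds c hR] with z hz
      refine (key z hz).trans (le_of_eq ?_)
      simp; field_simp
    refine h1.trans_isLittleO ?_
    have h2 : (fun z : E => ‖z - c‖ ^ 2) =o[𝓝 c] fun z => ‖z - c‖ ^ 1 := by
      refine (Asymptotics.isLittleO_pow_pow (𝕜 := ℝ) (m := 1) (n := 2) (by norm_num)).comp_tendsto ?_
      have : ContinuousAt (fun z : E => ‖z - c‖) c := by fun_prop
      simpa [ContinuousAt] using this
    simp only [pow_one] at h2
    exact h2.trans_isBigO (Asymptotics.isBigO_refl _ _).norm_left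
  rw [hfd.fderiv]
  exact ⟨hfd, hL⟩

lemma fderiv_apply_differentiableOn [FiniteDimensional ℂ E] [FiniteDimensional ℂ F]
  {f : E → F} {U : Set E} (hU : IsOpen U) (hd : DifferentiableOn ℂ f U) (v:E) :
  DifferentiableOn ℂ (fun x => fderiv ℂ f x v) U := by
  intro c hc
  obtain ⟨R, hR, M, hsub, hM⟩ := exists_bdd_ball hU hd hc
  let 𝒰 : Ultrafilter ℂ := Ultrafilter.of (𝓝[≠] (0:ℂ))
  have hU0 : (𝒰 : Filter ℂ) ≤ 𝓝[≠] (0:ℂ) := Ultrafilter.of_le _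
  have hsmall : ∀ᶠ t : ℂ in 𝒰, t ≠ 0 ∧ ‖t‖ * ‖v‖ < R / 4 := by
    apply hU0
    refine Filter.Eventually.and ?_ ?_
    · exact eventually_mem_nhdsWithin
    · apply nhdsWithin_le_nhds
      have : ContinuousAt (fun t : ℂ => ‖t‖ * ‖v‖) 0 := by fun_prop
      exact this.eventually_lt_const (by simpa using by positivity)
  have := limit_hasFDerivAt 𝒰 (fun t x => t⁻¹ • (f (x + t • v) - f x))
    (fun x => fderiv ℂ f x v) (c := c) (R := R / 4) (M := 4 * M / R * ‖v‖) (by positivity) ?_ ?_ ?_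
  · exact this.1.differentiableAt.differentiableWithinAt
  · filter_upwards [hsmall] with t ht
    refine DifferentiableOn.const_smul ?_ _
    apply DifferentiableOn.sub
    · refine hd.comp (by fun_prop) ?_
      intro x hx
      apply hsub
      rw [mem_ball, dist_eq_norm] at hx ⊢
      calc ‖x + t • v - c‖ = ‖(x - c) + t • v‖ := by congr 1; abel
        _ ≤ ‖x - c‖ + ‖t • v‖ := norm_add_le _ _
        _ < R := by rw [norm_smul]; linarith [ht.2]
    · exact hd.mono ((ball_subset_ball (by linarith)).trans hsub)
  · filter_upwards [hsmall] with t ht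
    intro x hx
    have hx1 : x ∈ ball c (R / 2) := ball_subset_ball (by linarith) hx
    have hx2 : x + t • v ∈ ball c (R / 2) := by
      rw [mem_ball, dist_eq_norm] at hx ⊢
      calc ‖x + t • v - c‖ = ‖(x - c) + t • v‖ := by congr 1; abel
        _ ≤ ‖x - c‖ + ‖t • v‖ := norm_add_le _ _
        _ < R / 2 := by rw [norm_smul]; linarith [ht.2]
    have := lip_bound hR (hd.mono hsub) hM hx2 hx1
    rw [norm_smul, norm_inv]
    have ht0 : 0 < ‖t‖ := norm_pos_iff.2 ht.1
    rw [inv_mul_le_iff₀ ht0]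
    refine this.trans (le_of_eq ?_)
    rw [add_sub_cancel_left, norm_smul]; ring
  · intro x hx
    have hx1 : x ∈ U := hsub (ball_subset_ball (by linarith) hx)
    have hfd := (hd.differentiableAt (hU.mem_nhds hx1)).hasFDerivAt
    have h1 : HasDerivAt (fun t : ℂ => f (x + t • v)) (fderiv ℂ f x v) 0 := by
      have h2 : HasDerivAt (fun t : ℂ => x + t • v) v 0 := by
        simpa using ((hasDerivAt_id (0:ℂ)).smul_const v).const_add x
      have h3 : HasFDerivAt f (fderiv ℂ f x) (x + (0:ℂ) • v) := by simpa using hfd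
      exact h3.comp_hasDerivAt 0 h2
    have h2 := (hasDerivAt_iff_tendsto_slope.1 h1).mono_left hU0
    refine h2.congr ?_
    intro t
    simp [slope_def_module]

lemma contDiffOn_of_hol [FiniteDimensional ℂ E] [FiniteDimensional ℂ F]
  {U : Set E} (hU : IsOpen U) (n:ℕ) : ∀ {f : E → F}, DifferentiableOn ℂ f U →
  ContDiffOn ℂ n f U := by
  induction n with
  | zero => intro f hd; simpa using hd.continuousOn
  | succ n ih =>
    intro f hd
    have : ((n + 1:ℕ) : WithTop ℕ∞) = (n : WithTop ℕ∞) + 1 := by norm_cast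
    rw [this, contDiffOn_succ_iff_fderiv_of_isOpen hU]
    refine ⟨hd, by simp, ?_⟩
    rw [contDiffOn_clm_apply]
    intro v
    exact ih (fderiv_apply_differentiableOn hU hd v)

lemma fderiv_differentiableOn [FiniteDimensional ℂ E] [FiniteDimensional ℂ F]
  {f : E → F} {U : Set E} (hU : IsOpen U) (hd : DifferentiableOn ℂ f U) :
  DifferentiableOn ℂ (fun x => fderiv ℂ f x) U := by
  have := contDiffOn_of_hol hU 2 hd
  exact (this.fderiv_of_isOpen hU (m := 1) (by norm_num)).differentiableOn (by norm_num)

/-- Complex Jacobian. -/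
noncomputable def Jac (f : E → E) (x:E) : ℂ := (fderiv ℂ f x).det

lemma det_eq_matrix [FiniteDimensional ℂ E] (A : E →L[ℂ] E) :
  A.det = Matrix.det (LinearMap.toMatrix (Module.finBasis ℂ E) (Module.finBasis ℂ E) (A : E →ₗ[ℂ] E)) := by
  rw [LinearMap.det_toMatrix]

lemma det_differentiable [FiniteDimensional ℂ E] :
  Differentiable ℂ (fun A : E →L[ℂ] E => A.det) := by
  simp_rw [det_eq_matrix, Matrix.det_apply]
  apply Differentiable.fun_sum
  intro σ _
  apply Differentiable.const_smul
  intro A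
  refine (HasFDerivAt.finsetProd (fun i _ => DifferentiableAt.hasFDerivAt ?_)).differentiableAt
  simp only [LinearMap.toMatrix_apply]
  let l : (E →L[ℂ] E) →ₗ[ℂ] ℂ :=
    { toFun := fun A => (Module.finBasis ℂ E).repr (A (Module.finBasis ℂ E i)) (σ i)
      map_add' := by intro a b; simp
      map_smul' := by intro a b; simp }
  exact (LinearMap.toContinuousLinearMap l).differentiable.differentiableAt

lemma Jac_differentiableOn [FiniteDimensional ℂ E]
  {f : E → E} {U : Set E} (hU : IsOpen U) (hd : DifferentiableOn ℂ f U) :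
  DifferentiableOn ℂ (Jac f) U :=
  det_differentiable.comp_differentiableOn (fderiv_differentiableOn hU hd)

lemma Jac_ne_zero_iff [FiniteDimensional ℂ E] {f : E → E} {x:E} :
  Jac f x ≠ 0 ↔ ∀ v, fderiv ℂ f x v = 0 → v = 0 := by
  unfold Jac
  have h1 : (fderiv ℂ f x).det ≠ 0 ↔ IsUnit (LinearMap.det (fderiv ℂ f x : E →ₗ[ℂ] E)) := by
    rw [isUnit_iff_ne_zero]
  rw [h1, ← LinearMap.isUnit_iff_isUnit_det, LinearMap.isUnit_iff_ker_eq_bot, LinearMap.ker_eq_bot']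
  rfl

lemma inv_curve [FiniteDimensional ℂ E] {f : E → E} {U : Set E} (hU : IsOpen U)
  (hd : DifferentiableOn ℂ f U) {x:E} (hx : x ∈ U) (hJ : Jac f x ≠ 0) (e:E) :
  ∃ γ : ℂ → E, γ 0 = x ∧ (∃ R > 0, DifferentiableOn ℂ γ (ball 0 R)) ∧
  ∀ᶠ ζ in 𝓝 (0:ℂ), f (γ ζ) = f x + ζ • e := by
  have : CompleteSpace E := FiniteDimensional.complete ℂ E
  have hC : ContDiffAt ℂ 1 f x := ((contDiffOn_of_hol hU 1 hd).contDiffAt (hU.mem_nhds hx))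
  let A : E ≃L[ℂ] E := ContinuousLinearEquiv.ofBijective (fderiv ℂ f x)
    (LinearMap.ker_eq_bot'.2 (fun v hv => Jac_ne_zero_iff.1 hJ v hv))
    (by
      have : Function.Injective (fderiv ℂ f x : E →ₗ[ℂ] E) :=
        LinearMap.ker_eq_bot.1 (LinearMap.ker_eq_bot'.2 (fun v hv => Jac_ne_zero_iff.1 hJ v hv))
      exact LinearMap.range_eq_top.2 (LinearMap.injective_iff_surjective.1 this))
  have hA : HasFDerivAt f (A : E →L[ℂ] E) x := by
    have := (hd.differentiableAt (hU.mem_nhds hx)).hasFDerivAt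
    convert this using 1
    ext v; simp [A]
  have hS : HasStrictFDerivAt f (A : E →L[ℂ] E) x :=
    hC.hasStrictFDerivAt' hA (by norm_num)
  set g := hS.localInverse f A x with hg
  have hgC : ContDiffAt ℂ 1 g (f x) := hC.to_localInverse hA (by norm_num)
  have hγC : ContDiffAt ℂ 1 (fun ζ : ℂ => g (f x + ζ • e)) 0 := by
    have h1 : ContDiffAt ℂ 1 g (f x + (0:ℂ) • e) := by simpa using hgC
    exact h1.comp (0:ℂ) (by fun_prop)
  refine ⟨fun ζ => g (f x + ζ • e), ?_, ?_, ?_⟩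
  · simp [hg, hS.localInverse_apply_image]
  · obtain ⟨u, hu, hu2⟩ := hγC.contDiffOn (m := 1) le_rfl (by simp)

    obtain ⟨R, hR, hRu⟩ := Metric.mem_nhds_iff.1 hu
    exact ⟨R, hR, (hu2.differentiableOn (by norm_num)).mono hRu⟩
  · have h1 := hS.eventually_right_inverse
    have h2 : Tendsto (fun ζ : ℂ => f x + ζ • e) (𝓝 0) (𝓝 (f x)) := by
      have : ContinuousAt (fun ζ : ℂ => f x + ζ • e) 0 := by fun_prop
      simpa [ContinuousAt] using this
    exact h2.eventually h1

end Basics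
end

section
section Taylor
variable {E : Type*} [NormedAddCommGroup E] [NormedSpace ℝ E]

/-- The second derivative as a bilinear map. -/
noncomputable def Hess (κ : E → ℝ) (x:E) : E →L[ℝ] E →L[ℝ] ℝ := fderiv ℝ (fderiv ℝ κ) x

lemma hess_facts {κ : E → ℝ} {V : Set E} (hV : IsOpen V) (hκ : ContDiffOn ℝ 2 κ V) :
  DifferentiableOn ℝ κ V ∧ DifferentiableOn ℝ (fderiv ℝ κ) V ∧
  ContinuousOn (fderiv ℝ κ) V ∧ ContinuousOn (Hess κ) V := by
  have h1 : ContDiffOn ℝ 1 (fderiv ℝ κ) V := hκ.fderiv_of_isOpen hV (by norm_num)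
  have h2 : ContDiffOn ℝ 0 (fderiv ℝ (fderiv ℝ κ)) V := h1.fderiv_of_isOpen hV (by norm_num)
  exact ⟨hκ.differentiableOn (by norm_num), h1.differentiableOn (by norm_num), h1.continuousOn,
    h2.continuousOn⟩

lemma eval_deriv {G : Type*} [NormedAddCommGroup G] [NormedSpace ℝ G] {g : E → G}
  {g' : E →L[ℝ] G} (T : G →L[ℝ] ℝ) {l : ℝ → E} {v:E} {t:ℝ} (hg : HasFDerivAt g g' (l t))
  (hl : HasDerivAt l v t) : HasDerivAt (fun t => T (g (l t))) (T (g' v)) t :=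
  T.hasFDerivAt.comp_hasDerivAt t (hg.comp_hasDerivAt t hl)

lemma taylor2 {κ : E → ℝ} {V : Set E} (hV : IsOpen V) (hκ : ContDiffOn ℝ 2 κ V)
  {x:E} {δ ε:ℝ} (hδ : ball x δ ⊆ V)
  (hε : ∀ y ∈ ball x δ, ∀ v : E, |Hess κ y v v - Hess κ x v v| ≤ ε * ‖v‖ ^ 2)
  {v:E} (hv : ‖v‖ < δ) :
  |κ (x + v) - κ x - fderiv ℝ κ x v - 1 / 2 * Hess κ x v v| ≤ ε * ‖v‖ ^ 2 := by
  obtain ⟨hd1, hd2, -, -⟩ := hess_facts hV hκ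
  have hδ0 : 0 < δ := (norm_nonneg v).trans_lt hv
  have hxb : x ∈ ball x δ := mem_ball_self hδ0
  have hε0 : 0 ≤ ε * ‖v‖ ^ 2 := (abs_nonneg _).trans (hε x hxb v)
  have hseg : ∀ t ∈ Icc (0:ℝ) 1, x + t • v ∈ ball x δ := by
    intro t ht
    rw [mem_ball, dist_eq_norm, add_sub_cancel_left, norm_smul, norm_of_nonneg ht.1]
    nlinarith [ht.2, norm_nonneg v]
  have hl : ∀ t : ℝ, HasDerivAt (fun t : ℝ => x + t • v) v t := by
    intro t
    simpa using ((hasDerivAt_id t).smul_const v).const_add x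
  have step1 : ∀ t ∈ Icc (0:ℝ) 1,
      |fderiv ℝ κ (x + t • v) v - fderiv ℝ κ x v - t * Hess κ x v v| ≤ ε * ‖v‖ ^ 2 := by
    intro t ht
    have hder : ∀ t ∈ Icc (0:ℝ) 1, HasDerivWithinAt
        (fun t : ℝ => fderiv ℝ κ (x + t • v) v - t * Hess κ x v v)
        (Hess κ (x + t • v) v v - Hess κ x v v) (Icc 0 1) t := by
      intro t ht
      have h1 : HasFDerivAt (fderiv ℝ κ) (Hess κ (x + t • v)) (x + t • v) :=
        (hd2.differentiableAt (hV.mem_nhds (hδ (hseg t ht)))).hasFDerivAt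
      have h3 : HasDerivAt (fun t : ℝ => fderiv ℝ κ (x + t • v) v) (Hess κ (x + t • v) v v) t :=
        eval_deriv (G := E →L[ℝ] ℝ) (ContinuousLinearMap.apply ℝ ℝ v) h1 (hl t)
      have h4 : HasDerivAt (fun t : ℝ => t * Hess κ x v v) (Hess κ x v v) t := by
        simpa using (hasDerivAt_id t).mul_const (Hess κ x v v)
      exact (h3.sub h4).hasDerivWithinAt (s := Icc 0 1)
    have := norm_image_sub_le_of_norm_deriv_le_segment' (C := ε * ‖v‖ ^ 2) hder
      (fun t ht => by
        rw [norm_eq_abs]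
        exact hε _ (hseg t ⟨ht.1, ht.2.le⟩) v) t ht
    rw [norm_eq_abs] at this
    simp only [zero_smul, add_zero, zero_mul, sub_zero] at this
    rw [show fderiv ℝ κ (x + t • v) v - fderiv ℝ κ x v - t * Hess κ x v v =
      fderiv ℝ κ (x + t • v) v - t * Hess κ x v v - fderiv ℝ κ x v by ring]
    refine this.trans ?_
    nlinarith [ht.2]
  have hder : ∀ t ∈ Icc (0:ℝ) 1, HasDerivWithinAt
      (fun t : ℝ => κ (x + t • v) - t * fderiv ℝ κ x v - t ^ 2 / 2 * Hess κ x v v)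
      (fderiv ℝ κ (x + t • v) v - fderiv ℝ κ x v - t * Hess κ x v v) (Icc 0 1) t := by
    intro t ht
    have h1 : HasFDerivAt κ (fderiv ℝ κ (x + t • v)) (x + t • v) :=
      (hd1.differentiableAt (hV.mem_nhds (hδ (hseg t ht)))).hasFDerivAt
    have h3 := h1.comp_hasDerivAt t (hl t)
    have h4 : HasDerivAt (fun t : ℝ => t * fderiv ℝ κ x v) (fderiv ℝ κ x v) t := by
      simpa using (hasDerivAt_id t).mul_const (fderiv ℝ κ x v)
    have h5 : HasDerivAt (fun t : ℝ => t ^ 2 / 2 * Hess κ x v v) (t * Hess κ x v v) t := by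
      refine (((hasDerivAt_pow 2 t).div_const 2).mul_const (Hess κ x v v)).congr_deriv ?_
      norm_num
    exact ((h3.sub h4).sub h5).hasDerivWithinAt
  have := norm_image_sub_le_of_norm_deriv_le_segment_01' (C := ε * ‖v‖ ^ 2) hder
    (fun t ht => step1 t ⟨ht.1, ht.2.le⟩)
  simp only [one_smul, one_mul, one_pow, zero_smul, add_zero, zero_mul] at this
  rw [norm_eq_abs] at this
  convert this using 2
  ring

lemma unif_cont_compact {F : Type*} [NormedAddCommGroup F] {h : E → F} {V K : Set E}
  (hV : IsOpen V) (hh : ContinuousOn h V) (hK : IsCompact K) (hKV : K ⊆ V) {ε:ℝ} (hε : 0 < ε) :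
  ∃ δ > 0, ∀ x ∈ K, ball x δ ⊆ V ∧ ∀ y ∈ ball x δ, ‖h y - h x‖ ≤ ε := by
  have h1 := hK.uniformContinuousAt_of_continuousAt h
    (fun x hx => hh.continuousAt (hV.mem_nhds (hKV hx))) (Metric.dist_mem_uniformity hε)
  obtain ⟨δ1, hδ1, h1⟩ := Metric.mem_uniformity_dist.1 h1
  obtain ⟨δ2, hδ2, h2⟩ := hK.exists_thickening_subset_open hV hKV
  refine ⟨min δ1 δ2, lt_min hδ1 hδ2, fun x hx => ?_⟩
  have hb : ball x (min δ1 δ2) ⊆ V := by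
    refine Subset.trans ?_ h2
    intro y hy
    exact mem_thickening_iff.2 ⟨x, hx, (mem_ball.1 hy).trans_le (min_le_right _ _)⟩
  refine ⟨hb, fun y hy => ?_⟩
  have := h1 (a := x) (b := y) (by rw [dist_comm]; exact (mem_ball.1 hy).trans_le (min_le_left _ _)) hx
  rw [← dist_eq_norm, dist_comm]
  exact le_of_lt this

lemma opNorm2_sub_le {F G : Type*} [NormedAddCommGroup F] [NormedSpace ℝ F]
  [NormedAddCommGroup G] [NormedSpace ℝ G] (A B : E →L[ℝ] F →L[ℝ] G) (a:E) (b : F) :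
  ‖A a b - B a b‖ ≤ ‖A - B‖ * ‖a‖ * ‖b‖ := (A - B).le_opNorm₂ a b

lemma hess_unif {κ : E → ℝ} {V K : Set E} (hV : IsOpen V) (hκ : ContDiffOn ℝ 2 κ V)
  (hK : IsCompact K) (hKV : K ⊆ V) {ε:ℝ} (hε : 0 < ε) :
  ∃ δ > 0, ∀ x ∈ K, ball x δ ⊆ V ∧ ∀ y ∈ ball x δ, ∀ a b : E,
  |Hess κ y a b - Hess κ x a b| ≤ ε * ‖a‖ * ‖b‖ := by
  obtain ⟨-, -, -, hc⟩ := hess_facts hV hκ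
  obtain ⟨δ, hδ, h⟩ := unif_cont_compact (F := E →L[ℝ] E →L[ℝ] ℝ) hV hc hK hKV hε
  refine ⟨δ, hδ, fun x hx => ⟨(h x hx).1, fun y hy a b => ?_⟩⟩
  refine (opNorm2_sub_le (Hess κ y) (Hess κ x) a b).trans ?_
  have := (h x hx).2 y hy
  gcongr

lemma taylor2_unif {κ : E → ℝ} {V K : Set E} (hV : IsOpen V) (hκ : ContDiffOn ℝ 2 κ V)
  (hK : IsCompact K) (hKV : K ⊆ V) {ε:ℝ} (hε : 0 < ε) :
  ∃ δ > 0, ∀ x ∈ K, ball x δ ⊆ V ∧ ∀ v : E, ‖v‖ < δ →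
  |κ (x + v) - κ x - fderiv ℝ κ x v - 1 / 2 * Hess κ x v v| ≤ ε * ‖v‖ ^ 2 := by
  obtain ⟨δ, hδ, h⟩ := hess_unif hV hκ hK hKV hε
  refine ⟨δ, hδ, fun x hx => ⟨(h x hx).1, fun v hv => taylor2 hV hκ (h x hx).1 (fun y hy v => ?_) hv⟩⟩
  refine ((h x hx).2 y hy v v).trans (le_of_eq ?_)
  ring

lemma taylor2_isLittleO {κ : E → ℝ} {V : Set E} (hV : IsOpen V) (hκ : ContDiffOn ℝ 2 κ V)
  {x:E} (hx : x ∈ V) :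
  (fun v => κ (x + v) - κ x - fderiv ℝ κ x v - 1 / 2 * Hess κ x v v) =o[𝓝 0]
  fun v => ‖v‖ ^ 2 := by
  rw [isLittleO_iff]
  intro ε hε
  obtain ⟨δ, hδ, h⟩ := taylor2_unif hV hκ (isCompact_singleton (x := x)) (by simpa using hx) hε
  filter_upwards [ball_mem_nhds 0 hδ] with v hv
  have := (h x rfl).2 v (by simpa using hv)
  rw [norm_eq_abs]
  simpa using this

end Taylor

section Lap

/-- second order expansion at `0` : `c` is a quarter of the Laplacian, `b` encodes the gradient -/
def HasLap (s : ℂ → ℝ) (c:ℝ) (b:ℂ) : Prop :=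
  ∃ a : ℂ, (fun ζ : ℂ => s ζ - s 0 - (b * ζ).re - (a * ζ ^ 2).re - c * ‖ζ‖ ^ 2) =o[𝓝 0]
    fun ζ => ‖ζ‖ ^ 2

lemma HasLap.congr {s t : ℂ → ℝ} {c:ℝ} {b:ℂ} (h : HasLap s c b) (hst : s =ᶠ[𝓝 0] t) :
  HasLap t c b := by
  obtain ⟨a, ha⟩ := h
  refine ⟨a, ha.congr' ?_ (EventuallyEq.refl _ _)⟩
  filter_upwards [hst] with ζ hζ
  rw [hζ, hst.self_of_nhds]

lemma HasLap.add {s t : ℂ → ℝ} {c d:ℝ} {b b':ℂ} (hs : HasLap s c b) (ht : HasLap t d b') :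
  HasLap (fun ζ => s ζ + t ζ) (c + d) (b + b') := by
  obtain ⟨a, ha⟩ := hs
  obtain ⟨a', ha'⟩ := ht
  refine ⟨a + a', (ha.add ha').congr_left fun ζ => ?_⟩
  simp only [add_mul, add_re]; ring

lemma HasLap.const_mul {s : ℂ → ℝ} {c:ℝ} {b:ℂ} (hs : HasLap s c b) (k:ℝ) :
  HasLap (fun ζ => k * s ζ) (k * c) (k * b) := by
  obtain ⟨a, ha⟩ := hs
  refine ⟨k * a, (ha.const_mul_left k).congr_left fun ζ => ?_⟩
  simp only [mul_assoc, re_ofReal_mul]; ring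

lemma HasLap.const (k:ℝ) : HasLap (fun _ => k) 0 0 :=
  ⟨0, by simpa using isLittleO_zero _ _⟩

lemma HasLap.sub {s t : ℂ → ℝ} {c d:ℝ} {b b':ℂ} (hs : HasLap s c b) (ht : HasLap t d b') :
  HasLap (fun ζ => s ζ - t ζ) (c - d) (b - b') := by
  have := hs.add (ht.const_mul (-1))
  convert this using 1
  · ext; ring
  · ring
  · push_cast; ring

lemma HasLap.sum {ι : Type*} (u : Finset ι) {s : ι → ℂ → ℝ} {c : ι → ℝ} {b : ι → ℂ}
  (h : ∀ i ∈ u, HasLap (s i) (c i) (b i)) :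
  HasLap (fun ζ => ∑ i ∈ u, s i ζ) (∑ i ∈ u, c i) (∑ i ∈ u, b i) := by
  classical
  induction u using Finset.induction_on with
  | empty => simpa using HasLap.const 0
  | insert i u hi ih =>
    simp only [Finset.sum_insert hi]
    exact (h i (by simp)).add (ih fun j hj => h j (by simp [hj]))

lemma HasLap.nonpos {s : ℂ → ℝ} {c:ℝ} {b:ℂ} (hs : HasLap s c b)
  (hmax : ∀ᶠ ζ in 𝓝 0, s ζ ≤ s 0) : c ≤ 0 := by
  obtain ⟨a, ha⟩ := hs
  by_contra hc
  push Not at hc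
  have h1 := (isLittleO_iff.1 ha (half_pos hc)).and hmax
  obtain ⟨δ, hδ, h⟩ := Metric.eventually_nhds_iff_ball.1 h1
  have hd : 0 < δ / 2 := by positivity
  have hh : ∀ ζ : ℂ, ‖ζ‖ = δ / 2 → s ζ ≤ s 0 ∧
      |s ζ - s 0 - (b * ζ).re - (a * ζ ^ 2).re - c * (δ / 2) ^ 2| ≤ c / 2 * (δ / 2) ^ 2 := by
    intro ζ hζ
    have := h ζ (by rw [mem_ball_zero_iff, hζ]; linarith)
    refine ⟨this.2, ?_⟩
    have h2 := this.1
    rw [hζ] at h2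
    simpa [abs_of_pos hd, abs_of_pos hδ] using h2
  have e1 := hh ((δ / 2:ℝ):ℂ) (by rw [norm_real, norm_of_nonneg hd.le])
  have e2 := hh (-((δ / 2:ℝ):ℂ)) (by rw [norm_neg, norm_real, norm_of_nonneg hd.le])
  have e3 := hh (((δ / 2:ℝ):ℂ) * I)
    (by rw [norm_mul, norm_real, norm_of_nonneg hd.le]; simp)
  have e4 := hh (-(((δ / 2:ℝ):ℂ) * I))
    (by rw [norm_neg, norm_mul, norm_real, norm_of_nonneg hd.le]; simp)
  set t := δ / 2
  have f1 := (abs_le.1 e1.2).1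
  have f2 := (abs_le.1 e2.2).1
  have f3 := (abs_le.1 e3.2).1
  have f4 := (abs_le.1 e4.2).1
  simp only [mul_neg, neg_re, neg_sq, mul_pow, Complex.I_sq, mul_one] at f1 f2 f3 f4
  nlinarith [e1.1, e2.1, e3.1, e4.1, pow_pos hd 2, mul_pos hc (pow_pos hd 2)]

lemma HasLap.chain {s : ℂ → ℝ} {c:ℝ} {b:ℂ} (hs : HasLap s c b) {φ : ℝ → ℝ} {p q:ℝ}
  (hφ : (fun t => φ (s 0 + t) - φ (s 0) - p * t - q * t ^ 2) =o[𝓝 0] fun t => t ^ 2) :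
  HasLap (fun ζ => φ (s ζ)) (p * c + q * ‖b‖ ^ 2 / 2) (p * b) := by
  obtain ⟨a, ha⟩ := hs
  set R : ℂ → ℝ := fun ζ => s ζ - s 0 - (b * ζ).re with hR
  have hRO : R =O[𝓝 0] fun ζ : ℂ => ‖ζ‖ ^ 2 := by
    have h1 : (fun ζ : ℂ => (a * ζ ^ 2).re + c * ‖ζ‖ ^ 2) =O[𝓝 0] fun ζ : ℂ => ‖ζ‖ ^ 2 := by
      apply IsBigO.of_bound (‖a‖ + |c|)
      filter_upwards with ζ
      rw [norm_eq_abs, norm_eq_abs, abs_of_nonneg (sq_nonneg ‖ζ‖)]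
      calc _ ≤ |(a * ζ ^ 2).re| + |c * ‖ζ‖ ^ 2| := abs_add_le _ _
        _ ≤ ‖a * ζ ^ 2‖ + |c| * ‖ζ‖ ^ 2 := by
            gcongr
            · exact abs_re_le_norm _
            · rw [abs_mul, abs_of_nonneg (sq_nonneg ‖ζ‖)]
        _ = _ := by rw [norm_mul, norm_pow]; ring
    refine (ha.isBigO.add h1).congr_left fun ζ => ?_
    simp only [hR]; ring
  have h21 : (fun ζ : ℂ => ‖ζ‖ ^ 2) =O[𝓝 0] fun ζ : ℂ => ‖ζ‖ := by
    apply IsBigO.of_bound 1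
    filter_upwards [ball_mem_nhds (0:ℂ) one_pos] with ζ hζ
    have : ‖ζ‖ < 1 := by simpa using hζ
    simp only [norm_pow, norm_norm]
    nlinarith [norm_nonneg ζ]
  have hbO : (fun ζ : ℂ => (b * ζ).re) =O[𝓝 0] fun ζ : ℂ => ‖ζ‖ := by
    apply IsBigO.of_bound ‖b‖
    filter_upwards with ζ
    rw [norm_eq_abs, norm_norm, ← norm_mul]
    exact abs_re_le_norm _
  have hT : (fun ζ => s ζ - s 0) =O[𝓝 0] fun ζ : ℂ => ‖ζ‖ := by
    refine (hbO.add (hRO.trans h21)).congr_left fun ζ => ?_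
    simp only [hR]; ring
  have hT0 : Tendsto (fun ζ => s ζ - s 0) (𝓝 0) (𝓝 0) := by
    refine hT.trans_tendsto ?_
    simpa using (continuous_norm (E := ℂ)).tendsto 0
  have m1 := (hφ.comp_tendsto hT0).trans_isBigO (hT.pow 2)
  have m2 : (fun ζ => R ζ * (2 * (b * ζ).re + R ζ)) =o[𝓝 0] fun ζ : ℂ => ‖ζ‖ ^ 2 := by
    have h1 : (fun ζ => 2 * (b * ζ).re + R ζ) =O[𝓝 0] fun ζ : ℂ => ‖ζ‖ :=
      (hbO.const_mul_left 2).add (hRO.trans h21)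
    have h2 : (fun ζ => 2 * (b * ζ).re + R ζ) =o[𝓝 0] fun ζ : ℂ => (1:ℝ) := by
      rw [isLittleO_one_iff]
      refine h1.trans_tendsto ?_
      simpa using (continuous_norm (E := ℂ)).tendsto 0
    simpa using hRO.mul_isLittleO h2
  refine ⟨p * a + q * b ^ 2 / 2, ((m1.add (m2.const_mul_left q)).add (ha.const_mul_left p)).congr_left
    fun ζ => ?_⟩
  have hsq : (b * ζ).re ^ 2 = ‖b‖ ^ 2 * ‖ζ‖ ^ 2 / 2 + (b ^ 2 * ζ ^ 2).re / 2 := by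
    rw [← mul_pow, ← mul_pow, ← norm_mul, ← normSq_eq_norm_sq, normSq_apply, sq (b * ζ),
      Complex.mul_re (b * ζ) (b * ζ)]
    ring
  have e1 : (((p:ℂ) * a + q * b ^ 2 / 2) * ζ ^ 2).re = p * (a * ζ ^ 2).re + q * (b ^ 2 * ζ ^ 2).re / 2 := by
    have : ((p:ℂ) * a + q * b ^ 2 / 2) * ζ ^ 2 = (p:ℂ) * (a * ζ ^ 2) + ((q / 2:ℝ):ℂ) * (b ^ 2 * ζ ^ 2) := by
      push_cast; ring
    rw [this, add_re, re_ofReal_mul, re_ofReal_mul]; ring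
  have e2 : ((p:ℂ) * b * ζ).re = p * (b * ζ).re := by rw [mul_assoc, re_ofReal_mul]
  simp only [Function.comp_apply, add_sub_cancel, e1, e2, hR]
  linear_combination -q * hsq

lemma HasLap.comp_contDiff {s : ℂ → ℝ} {c:ℝ} {b:ℂ} (hs : HasLap s c b) {φ : ℝ → ℝ}
  {I : Set ℝ} (hI : IsOpen I) (hφ : ContDiffOn ℝ 2 φ I) (h0 : s 0 ∈ I) :
  HasLap (fun ζ => φ (s ζ)) (deriv φ (s 0) * c + deriv (deriv φ) (s 0) * ‖b‖ ^ 2 / 4)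
  (deriv φ (s 0) * b) := by
  have h := taylor2_isLittleO hI hφ h0
  have h2 : Hess φ (s 0) 1 1 = deriv (deriv φ) (s 0) := by
    unfold Hess
    have hd : DifferentiableAt ℝ (fderiv ℝ φ) (s 0) :=
      (hess_facts hI hφ).2.1.differentiableAt (hI.mem_nhds h0)
    have e : deriv φ = fun x => fderiv ℝ φ x 1 := by ext x; simp
    rw [e]
    have := (hd.hasFDerivAt.clm_apply (hasFDerivAt_const (1:ℝ) (s 0))).hasDerivAt.deriv
    rw [this]
    simp
  have := hs.chain (φ := φ) (p := deriv φ (s 0)) (q := deriv (deriv φ) (s 0) / 2) (by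
    refine (h.congr_left ?_).congr_right ?_
    · intro t
      have e1 : fderiv ℝ φ (s 0) t = deriv φ (s 0) * t := by
        rw [← fderiv_apply_one_eq_deriv]
        have : fderiv ℝ φ (s 0) t = t • fderiv ℝ φ (s 0) 1 := by
          rw [← map_smul]; simp
        rw [this]; simp [mul_comm]
      have e2 : Hess φ (s 0) t t = deriv (deriv φ) (s 0) * t ^ 2 := by
        rw [← h2]
        have : Hess φ (s 0) t t = (t * t) • Hess φ (s 0) 1 1 := by
          conv_lhs => rw [show t = t • (1:ℝ) by simp]
          simp only [map_smul, smul_apply, smul_smul]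
        rw [this]; simp; ring
      rw [e1, e2]; ring
    · intro t; simp)
  convert this using 1
  ring

lemma HasLap.exp {s : ℂ → ℝ} {c:ℝ} {b:ℂ} (hs : HasLap s c b) :
  HasLap (fun ζ => exp (s ζ)) (exp (s 0) * (c + ‖b‖ ^ 2 / 4)) (exp (s 0) * b) := by
  have := hs.comp_contDiff isOpen_univ (φ := Real.exp) contDiff_exp.contDiffOn (mem_univ _)
  simp only [Real.deriv_exp] at this
  convert this using 1
  ring

end Lap
end

section
section Levi
variable {E : Type*} [NormedAddCommGroup E] [NormedSpace ℂ E] [CompleteSpace E]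

/-- Levi form -/
noncomputable def levi (κ : E → ℝ) (x v:E) : ℝ :=
  1 / 4 * (Hess κ x v v + Hess κ x (I • v) (I • v))

/-- `2 ∂κ(v)` -/
noncomputable def dl (κ : E → ℝ) (x:E) : E →ₗ[ℂ] ℂ where
  toFun v := (fderiv ℝ κ x v:ℂ) - I * (fderiv ℝ κ x (I • v):ℂ)
  map_add' u v := by simp only [smul_add, map_add, ofReal_add]; ring
  map_smul' c v := by
    have hv : c • v = (c.re:ℝ) • v + (c.im:ℝ) • (I • v) := by
      rw [← coe_smul, ← coe_smul, smul_smul, ← add_smul, re_add_im]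
    have hIv : I • (c • v) = (c.re:ℝ) • (I • v) - (c.im:ℝ) • v := by
      rw [← coe_smul, ← coe_smul, smul_smul, smul_smul, ← sub_smul]
      congr 1
      conv_lhs => rw [← re_add_im c]
      linear_combination (c.im:ℂ) * I_mul_I
    rw [hv, ← hv, hIv, hv]
    simp only [map_add, map_sub, map_smul, smul_eq_mul, ofReal_add, ofReal_sub,
      ofReal_mul, RingHom.id_apply]
    conv_rhs => rw [← re_add_im c]
    linear_combination ((c.im:ℂ) * (fderiv ℝ κ x) (I • v)) * I_mul_I

lemma dl_apply (κ : E → ℝ) (x v:E) :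
  dl κ x v = (fderiv ℝ κ x v:ℂ) - I * (fderiv ℝ κ x (I • v):ℂ) := rfl

lemma dl_re (κ : E → ℝ) (x v:E) : (dl κ x v).re = fderiv ℝ κ x v := by
  simp [dl_apply]

lemma dl_im (κ : E → ℝ) (x v:E) : (dl κ x v).im = - fderiv ℝ κ x (I • v) := by
  simp [dl_apply]

lemma dl_norm_le (κ : E → ℝ) (x v:E) : ‖dl κ x v‖ ≤ 2 * ‖fderiv ℝ κ x‖ * ‖v‖ := by
  rw [dl_apply]
  refine (norm_sub_le _ _).trans ?_
  rw [norm_mul, norm_I, one_mul, norm_real, norm_real]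
  have h1 := (fderiv ℝ κ x).le_opNorm v
  have h2 := (fderiv ℝ κ x).le_opNorm (I • v)
  rw [norm_smul, norm_I, one_mul] at h2
  linarith

/-- the complex bilinear part of the Hessian, on the diagonal: `½H(v,v) = Re bq(v) + levi(v)` -/
noncomputable def bq (κ : E → ℝ) (x v:E) : ℂ :=
  ((1 / 4 * (Hess κ x v v - Hess κ x (I • v) (I • v)):ℝ):ℂ) -
    ((1 / 4 * (Hess κ x v (I • v) + Hess κ x (I • v) v):ℝ):ℂ) * I

lemma half_hess (κ : E → ℝ) (x v:E) :
  1 / 2 * Hess κ x v v = (bq κ x v).re + levi κ x v := by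
  simp only [bq, levi, sub_re, ofReal_re, mul_I_re, ofReal_im]
  ring

lemma smul_decomp (c:ℂ) (v:E) : c • v = (c.re:ℝ) • v + (c.im:ℝ) • (I • v) := by
  rw [← coe_smul, ← coe_smul, smul_smul, ← add_smul, re_add_im]

lemma bq_smul (κ : E → ℝ) (x v:E) (c:ℂ) : bq κ x (c • v) = c ^ 2 * bq κ x v := by
  have hv := smul_decomp c v
  have hIv : I • (c • v) = (c.re:ℝ) • (I • v) - (c.im:ℝ) • v := by
    rw [← coe_smul, ← coe_smul, smul_smul, smul_smul, ← sub_smul]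
    congr 1
    conv_lhs => rw [← re_add_im c]
    linear_combination (c.im:ℂ) * I_mul_I
  apply Complex.ext <;>
  · simp only [bq, hIv]
    rw [hv]
    simp only [map_add, map_sub, map_smul, add_apply, sub_apply,
      smul_apply, smul_eq_mul, sub_re, Complex.sub_im, ofReal_re, Complex.mul_re,
      Complex.mul_im, mul_I_re, Complex.mul_I_im, ofReal_im, Complex.I_re,
      Complex.I_im, sq]
    ring

lemma levi_smul (κ : E → ℝ) (x v:E) (c:ℂ) : levi κ x (c • v) = ‖c‖ ^ 2 * levi κ x v := by
  have hv := smul_decomp c v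
  have hIv : I • (c • v) = (c.re:ℝ) • (I • v) - (c.im:ℝ) • v := by
    rw [← coe_smul, ← coe_smul, smul_smul, smul_smul, ← sub_smul]
    congr 1
    conv_lhs => rw [← re_add_im c]
    linear_combination (c.im:ℂ) * I_mul_I
  rw [← normSq_eq_norm_sq, normSq_apply]
  simp only [levi, hIv]
  rw [hv]
  simp only [map_add, map_sub, map_smul, add_apply, sub_apply,
      smul_apply, smul_eq_mul]
  ring

/-- Second-order expansion of a holomorphic curve. -/
lemma curve_taylor {γ : ℂ → E} {R:ℝ} (hR : 0 < R) (hγ : DifferentiableOn ℂ γ (ball 0 R)) :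
  ∃ w : E, (fun ζ : ℂ => γ ζ - γ 0 - ζ • deriv γ 0 - ζ ^ 2 • w) =o[𝓝 0] fun ζ => ‖ζ‖ ^ 2 := by
  have hb : ball (0:ℂ) R ∈ 𝓝 0 := ball_mem_nhds 0 hR
  have h1 : DifferentiableOn ℂ (dslope γ 0) (ball 0 R) :=
    (Complex.differentiableOn_dslope hb).2 hγ
  have h2 := (h1.differentiableAt hb).hasDerivAt.isLittleO
  simp only [dslope_same, sub_zero] at h2
  refine ⟨deriv (dslope γ 0) 0, ?_⟩
  have h3 : (fun ζ : ℂ => ζ • (dslope γ 0 ζ - deriv γ 0 - ζ • deriv (dslope γ 0) 0)) =o[𝓝 0]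
      fun ζ : ℂ => ζ * ζ := (isBigO_refl (fun ζ : ℂ => ζ) (𝓝 0)).smul_isLittleO h2
  have h4 := h3.norm_right
  refine (h4.congr_right fun ζ => by rw [norm_mul, sq]).congr_left fun ζ => ?_
  have := sub_smul_dslope γ 0 ζ
  rw [sub_zero] at this
  rw [smul_sub, smul_sub, this, smul_smul, ← sq]

lemma isBigO_bilin {F : Type*} [NormedAddCommGroup F] [NormedSpace ℝ F] (B : F →L[ℝ] F →L[ℝ] ℝ) {p q : ℂ → F} {f g : ℂ → ℝ}
  (hp : p =O[𝓝 0] f) (hq : q =o[𝓝 0] g) : (fun ζ => B (p ζ) (q ζ)) =o[𝓝 0] fun ζ => f ζ * g ζ := by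
  have h1 : (fun ζ => B (p ζ) (q ζ)) =O[𝓝 0] fun ζ => ‖p ζ‖ * ‖q ζ‖ := by
    apply IsBigO.of_bound ‖B‖
    filter_upwards with ζ
    have := B.le_opNorm₂ (p ζ) (q ζ)
    simpa [mul_assoc] using this
  exact h1.trans_isLittleO (hp.norm_left.mul_isLittleO hq.norm_left)

lemma isBigO_bilin' {F : Type*} [NormedAddCommGroup F] [NormedSpace ℝ F] (B : F →L[ℝ] F →L[ℝ] ℝ) {p q : ℂ → F} {f g : ℂ → ℝ}
  (hp : p =o[𝓝 0] f) (hq : q =O[𝓝 0] g) : (fun ζ => B (p ζ) (q ζ)) =o[𝓝 0] fun ζ => f ζ * g ζ := by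
  have h1 : (fun ζ => B (p ζ) (q ζ)) =O[𝓝 0] fun ζ => ‖p ζ‖ * ‖q ζ‖ := by
    apply IsBigO.of_bound ‖B‖
    filter_upwards with ζ
    have := B.le_opNorm₂ (p ζ) (q ζ)
    simpa [mul_assoc] using this
  exact h1.trans_isLittleO (hp.norm_left.mul_isBigO hq.norm_left)

/-- Levi form along holomorphic curves. -/
lemma HasLap.comp_curve {κ : E → ℝ} {V : Set E} (hV : IsOpen V) (hκ : ContDiffOn ℝ 2 κ V)
  {γ : ℂ → E} {R:ℝ} (hR : 0 < R) (hγ : DifferentiableOn ℂ γ (ball 0 R)) (hx : γ 0 ∈ V) :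
  HasLap (fun ζ => κ (γ ζ)) (levi κ (γ 0) (deriv γ 0)) (dl κ (γ 0) (deriv γ 0)) := by
  obtain ⟨w, hw⟩ := curve_taylor hR hγ
  set x := γ 0
  set v := deriv γ 0
  have hγd : HasDerivAt γ v 0 := (hγ.differentiableAt (ball_mem_nhds 0 hR)).hasDerivAt
  have hη : (fun ζ => γ ζ - x) =O[𝓝 0] fun ζ : ℂ => ‖ζ‖ := by
    have := hγd.isBigO_sub
    simp only [sub_zero] at this
    exact this.norm_right
  have hη1 : (fun ζ : ℂ => γ ζ - x - ζ • v) =o[𝓝 0] fun ζ : ℂ => ‖ζ‖ := by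
    have := hγd.isLittleO
    simp only [sub_zero] at this
    exact this.norm_right
  have hv : (fun ζ : ℂ => ζ • v) =O[𝓝 0] fun ζ : ℂ => ‖ζ‖ := by
    apply IsBigO.of_bound ‖v‖
    filter_upwards with ζ
    rw [norm_smul, norm_norm, mul_comm]
  have hη0 : Tendsto (fun ζ => γ ζ - x) (𝓝 0) (𝓝 0) := by
    have := hγd.continuousAt.tendsto.sub_const x
    simpa [x] using this
  have t1 := ((taylor2_isLittleO hV hκ hx).comp_tendsto hη0).trans_isBigO (hη.norm_left.pow 2)
  have t2 : (fun ζ : ℂ => fderiv ℝ κ x (γ ζ - x - ζ • v - ζ ^ 2 • w)) =o[𝓝 0] fun ζ => ‖ζ‖ ^ 2 :=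
    ((fderiv ℝ κ x).isBigO_comp _ _).trans_isLittleO hw
  have t3 := isBigO_bilin' (Hess κ x) hη1 hη
  have t4 := isBigO_bilin (Hess κ x) hv hη1
  refine ⟨dl κ x w + bq κ x v, (((t1.add t2).add ((t3.congr_right fun ζ => (sq _).symm).const_mul_left (1/2))).add
    ((t4.congr_right fun ζ => (sq _).symm).const_mul_left (1/2))).congr_left fun ζ => ?_⟩
  have e1 : (dl κ x v * ζ).re = fderiv ℝ κ x (ζ • v) := by
    rw [← dl_re, map_smul, smul_eq_mul, mul_comm]
  have e2 : ((dl κ x w + bq κ x v) * ζ ^ 2).re = fderiv ℝ κ x (ζ ^ 2 • w) + (bq κ x (ζ • v)).re := by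
    rw [← dl_re, map_smul, smul_eq_mul, bq_smul, ← add_re]
    congr 1; ring
  have e3 : levi κ x v * ‖ζ‖ ^ 2 = levi κ x (ζ • v) := by rw [levi_smul]; ring
  rw [e1, e2, e3]
  have e4 := half_hess κ x (ζ • v)
  simp only [Function.comp_apply, add_sub_cancel, map_sub, sub_apply]
  linarith

end Levi

section Lap2

lemma HasLap.re_hol {F : ℂ → ℂ} {R:ℝ} (hR : 0 < R) (hF : DifferentiableOn ℂ F (ball 0 R)) :
  HasLap (fun ζ => (F ζ).re) 0 (deriv F 0) := by
  obtain ⟨w, hw⟩ := curve_taylor hR hF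
  refine ⟨w, ?_⟩
  refine (IsBigO.trans_isLittleO (IsBigO.of_bound 1 ?_) hw)
  filter_upwards with ζ
  rw [one_mul]
  refine le_trans (le_of_eq ?_) (abs_re_le_norm _)
  rw [norm_eq_abs]
  congr 1
  simp only [sub_re, smul_eq_mul, mul_comm ζ, mul_comm (ζ ^ 2)]
  ring

lemma HasLap.normSq_hol {F : ℂ → ℂ} {R:ℝ} (hR : 0 < R) (hF : DifferentiableOn ℂ F (ball 0 R)) :
  ∃ b, HasLap (fun ζ => ‖F ζ‖ ^ 2) (‖deriv F 0‖ ^ 2) b := by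
  have hd := hF.differentiableAt (ball_mem_nhds (0:ℂ) hR)
  have key : ∀ s : ℂ → ℝ, ∀ b, HasLap s 0 b → HasLap (fun ζ => s ζ ^ 2) (‖b‖ ^ 2 / 2) ((2 * s 0:ℝ) * b) := by
    intro s b hs
    have := hs.chain (φ := fun t => t ^ 2) (p := 2 * s 0) (q := 1)
      ((isLittleO_zero _ _).congr_left fun t => by ring)
    simpa using this
  have h1 := key _ _ (HasLap.re_hol hR hF)
  have h2 := key _ _ (HasLap.re_hol hR (hF.const_mul I))
  rw [deriv_const_mul _ hd] at h2
  have h := (h1.add h2).congr (t := fun ζ => ‖F ζ‖ ^ 2) (Eventually.of_forall fun ζ => by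
    simp only []
    rw [← normSq_eq_norm_sq, normSq_apply]
    simp; ring)
  rw [norm_mul, norm_I, one_mul, add_halves] at h
  exact ⟨_, h⟩

lemma HasLap.norm_sq_curve {E : Type*} [NormedAddCommGroup E] [InnerProductSpace ℂ E]
  [FiniteDimensional ℂ E] {γ : ℂ → E} {R:ℝ} (hR : 0 < R)
  (hγ : DifferentiableOn ℂ γ (ball 0 R)) :
  ∃ b, HasLap (fun ζ => ‖γ ζ‖ ^ 2) (‖deriv γ 0‖ ^ 2) b := by
  let B := stdOrthonormalBasis ℂ E
  have hd := hγ.differentiableAt (ball_mem_nhds (0:ℂ) hR)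
  have h1 : ∀ i, ∃ b, HasLap (fun ζ => ‖inner ℂ (B i) (γ ζ)‖ ^ 2) (‖inner ℂ (B i) (deriv γ 0)‖ ^ 2) b := by
    intro i
    have h2 : DifferentiableOn ℂ (fun ζ => inner ℂ (B i) (γ ζ)) (ball 0 R) :=
      (innerSL ℂ (B i)).differentiable.comp_differentiableOn hγ
    have h3 : deriv (fun ζ => inner ℂ (B i) (γ ζ)) 0 = inner ℂ (B i) (deriv γ 0) :=
      ((innerSL ℂ (B i)).hasFDerivAt.comp_hasDerivAt (0:ℂ) hd.hasDerivAt).deriv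
    have := HasLap.normSq_hol hR h2
    rwa [h3] at this
  choose b hb using h1
  have := HasLap.sum Finset.univ (fun i _ => hb i)
  simp only [B.sum_sq_norm_inner_right] at this
  exact ⟨_, this⟩

lemma HasLap.log_norm {F : ℂ → ℂ} {R:ℝ} (hR : 0 < R) (hF : DifferentiableOn ℂ F (ball 0 R))
  (h0 : F 0 ≠ 0) : HasLap (fun ζ => log ‖F ζ‖) 0 (deriv F 0 / F 0) := by
  have hd := hF.differentiableAt (ball_mem_nhds (0:ℂ) hR)
  have hc : Tendsto (fun ζ => F ζ / F 0) (𝓝 0) (𝓝 1) := by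
    have := (hd.continuousAt.tendsto).div_const (F 0)
    rwa [div_self h0] at this
  have hev : ∀ᶠ ζ in 𝓝 (0:ℂ), F ζ / F 0 ∈ Complex.slitPlane :=
    hc.eventually (Complex.isOpen_slitPlane.mem_nhds Complex.one_mem_slitPlane)
  obtain ⟨δ, hδ, hh⟩ := Metric.eventually_nhds_iff_ball.1 (hev.and (ball_mem_nhds 0 hR))
  have hG : DifferentiableOn ℂ (fun ζ => Complex.log (F ζ / F 0)) (ball 0 δ) := by
    apply DifferentiableOn.clog
    · exact (hF.mono fun z hz => (hh z hz).2).div_const _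
    · exact fun z hz => (hh z hz).1
  have h1 := HasLap.re_hol hδ hG
  have h2 : deriv (fun ζ => Complex.log (F ζ / F 0)) 0 = deriv F 0 / F 0 := by
    have := ((hd.hasDerivAt.div_const (F 0)).clog (by rw [div_self h0]; exact Complex.one_mem_slitPlane)).deriv
    rw [this, div_self h0, div_one]
  rw [h2] at h1
  have h3 := (h1.add (HasLap.const (log ‖F 0‖)))
  rw [add_zero, add_zero] at h3
  refine h3.congr ?_
  filter_upwards [ball_mem_nhds 0 hδ] with ζ hζ
  have hne : F ζ ≠ 0 := by
    intro h
    have := (hh ζ hζ).1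
    rw [h, zero_div] at this
    exact Complex.zero_notMem_slitPlane this
  rw [Complex.log_re, norm_div, log_div (norm_ne_zero_iff.2 hne) (norm_ne_zero_iff.2 h0)]
  ring

end Lap2
end

section
lemma HasLap.unique {s : ℂ → ℝ} {c d:ℝ} {b b':ℂ} (h : HasLap s c b) (h' : HasLap s d b') :
  c = d := by
  have h1 := (h.sub h').nonpos (Eventually.of_forall fun ζ => by simp)
  have h2 := (h'.sub h).nonpos (Eventually.of_forall fun ζ => by simp)
  linarith

lemma compact_penalty {X : Type*} [TopologicalSpace X] {K : Set X} (hK : IsCompact K) {f g : X → ℝ}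
  (hf : ContinuousOn f K) (hg : ContinuousOn g K) (hg0 : ∀ x ∈ K, 0 ≤ g x)
  (h : ∀ x ∈ K, g x = 0 → 0 < f x) :
  ∃ M > 0, ∃ c > 0, ∀ x ∈ K, c ≤ f x + M * g x := by
  by_contra hcon
  push Not at hcon
  have h1 : ∀ k : ℕ, ∃ x ∈ K, f x + (k + 1) * g x < 1 / (k + 1) := fun k =>
    hcon (k + 1) (by positivity) (1 / (k + 1)) (by positivity)
  choose x hxK hx using h1
  haveI : CompactSpace K := isCompact_iff_compactSpace.1 hK
  obtain ⟨y, -, hy⟩ := isCompact_univ (X := K) (f := Filter.map (fun k => (⟨x k, hxK k⟩ : K)) atTop)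
    (by simp)
  have hfc : Continuous fun y : K => f y := continuousOn_iff_continuous_restrict.1 hf
  have hgc : Continuous fun y : K => g y := continuousOn_iff_continuous_restrict.1 hg
  have hfreq : ∀ s ∈ 𝓝 y, ∃ᶠ k in atTop, (⟨x k, hxK k⟩ : K) ∈ s := fun s hs =>
    (mapClusterPt_iff_frequently.1 hy) s hs
  -- lower bound of f near y
  by_cases hgy : g y = 0
  · have hfy := h y y.2 hgy
    have h2 : ∀ᶠ z : K in 𝓝 y, f y / 2 < f z := hfc.continuousAt.eventually (lt_mem_nhds (half_lt_self hfy))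
    obtain ⟨k0, hk0⟩ := exists_nat_gt (2 / f y)
    obtain ⟨k, hk, hkk⟩ := ((hfreq _ h2).and_eventually (eventually_ge_atTop k0)).exists
    have h3 := hx k
    have h4 := hg0 _ (hxK k)
    have h5 : (k0:ℝ) ≤ k := by exact_mod_cast hkk
    have h6 : f y / 2 < f (x k) := hk
    have h7 : 1 / ((k:ℝ) + 1) < f y / 2 := by
      rw [div_lt_iff₀ (by positivity)]
      rw [div_lt_iff₀ hfy] at hk0
      nlinarith
    nlinarith [mul_nonneg (by positivity : (0:ℝ) ≤ (k:ℝ) + 1) h4]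
  · have hgp : 0 < g y := lt_of_le_of_ne (hg0 y y.2) (Ne.symm hgy)
    have h2 : ∀ᶠ z : K in 𝓝 y, f y - 1 < f z := hfc.continuousAt.eventually (lt_mem_nhds (by linarith))
    have h2' : ∀ᶠ z : K in 𝓝 y, g y / 2 < g z := hgc.continuousAt.eventually (lt_mem_nhds (by linarith))
    obtain ⟨k0, hk0⟩ := exists_nat_gt ((2 + |f y|) / (g y / 2))
    obtain ⟨k, hk, hkk⟩ := ((hfreq _ (h2.and h2')).and_eventually (eventually_ge_atTop k0)).exists
    have h3 := hx k
    have h5 : (k0:ℝ) ≤ k := by exact_mod_cast hkk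
    have h6 : f y - 1 < f (x k) := hk.1
    have h6' : g y / 2 < g (x k) := hk.2
    have h7 : 1 / ((k:ℝ) + 1) ≤ 1 := by
      rw [div_le_one (by positivity)]; linarith [Nat.cast_nonneg (α := ℝ) k]
    rw [div_lt_iff₀ (by positivity)] at hk0
    have h8 : (k0:ℝ) * (g y / 2) ≤ ((k:ℝ) + 1) * g (x k) := by
      apply mul_le_mul <;> first | linarith | positivity
    linarith [neg_abs_le (f y)]

section
variable {E : Type*} [NormedAddCommGroup E] [NormedSpace ℂ E] [CompleteSpace E]

lemma line_curve (x v:E) : Differentiable ℂ (fun ζ : ℂ => x + ζ • v) ∧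
  deriv (fun ζ : ℂ => x + ζ • v) 0 = v := by
  have h : ∀ ζ : ℂ, HasDerivAt (fun ζ : ℂ => x + ζ • v) v ζ := fun ζ => by
    simpa using ((hasDerivAt_id ζ).smul_const v).const_add x
  exact ⟨fun ζ => (h ζ).differentiableAt, (h 0).deriv⟩

lemma HasLap.comp_line {κ : E → ℝ} {V : Set E} (hV : IsOpen V) (hκ : ContDiffOn ℝ 2 κ V)
  {x:E} (hx : x ∈ V) (v:E) :
  HasLap (fun ζ => κ (x + ζ • v)) (levi κ x v) (dl κ x v) := by
  have := HasLap.comp_curve hV hκ one_pos ((line_curve x v).1.differentiableOn) (by simpa using hx)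
  simpa [(line_curve x v).2] using this

lemma levi_exp {κ : E → ℝ} {V : Set E} (hV : IsOpen V) (hκ : ContDiffOn ℝ 2 κ V) (M:ℝ)
  {x:E} (hx : x ∈ V) (v:E) :
  levi (fun z => exp (M * κ z) - 1) x v =
  exp (M * κ x) * (M * levi κ x v + M ^ 2 * ‖dl κ x v‖ ^ 2 / 4) := by
  have hC : ContDiffOn ℝ 2 (fun z => exp (M * κ z) - 1) V :=
    (contDiff_exp.comp_contDiffOn (contDiffOn_const.mul hκ)).sub contDiffOn_const
  have h1 := HasLap.comp_line hV hC hx v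
  have h2 := (((HasLap.comp_line hV hκ hx v).const_mul M).exp).sub (HasLap.const 1)
  have := h1.unique h2
  rw [this]
  simp only [zero_smul, add_zero, sub_zero, norm_mul, norm_real, norm_eq_abs, mul_pow, sq_abs]

lemma contOn_apply {X F G : Type*} [TopologicalSpace X] [NormedAddCommGroup F] [NormedSpace ℝ F]
  [NormedAddCommGroup G] [NormedSpace ℝ G] {h : X → F →L[ℝ] G} {v : X → F} {s : Set X}
  (hh : ContinuousOn h s) (hv : ContinuousOn v s) : ContinuousOn (fun x => h x (v x)) s :=
  hh.clm_apply hv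

lemma hess_contOn {κ : E → ℝ} {V : Set E} (hV : IsOpen V) (hκ : ContDiffOn ℝ 2 κ V)
  {X : Type*} [TopologicalSpace X] {s : Set X} {p u v : X → E} (hp : ContinuousOn p s)
  (hu : ContinuousOn u s) (hv : ContinuousOn v s) (hm : MapsTo p s V) :
  ContinuousOn (fun x => Hess κ (p x) (u x) (v x)) s := by
  have h1 : ContinuousOn (fun x => Hess κ (p x)) s := (hess_facts hV hκ).2.2.2.comp hp hm
  have h2 : ContinuousOn (fun x => Hess κ (p x) (u x)) s :=
    contOn_apply (F := E) (G := E →L[ℝ] ℝ) h1 hu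
  exact contOn_apply h2 hv

lemma levi_contOn {κ : E → ℝ} {V : Set E} (hV : IsOpen V) (hκ : ContDiffOn ℝ 2 κ V)
  {X : Type*} [TopologicalSpace X] {s : Set X} {p v : X → E} (hp : ContinuousOn p s)
  (hv : ContinuousOn v s) (hm : MapsTo p s V) :
  ContinuousOn (fun x => levi κ (p x) (v x)) s := by
  unfold levi
  exact continuousOn_const.mul ((hess_contOn hV hκ hp hv hv hm).add
    (hess_contOn hV hκ hp (hv.const_smul _) (hv.const_smul _) hm))

lemma dl_contOn {κ : E → ℝ} {V : Set E} (hV : IsOpen V) (hκ : ContDiffOn ℝ 2 κ V)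
  {X : Type*} [TopologicalSpace X] {s : Set X} {p v : X → E} (hp : ContinuousOn p s)
  (hv : ContinuousOn v s) (hm : MapsTo p s V) :
  ContinuousOn (fun x => dl κ (p x) (v x)) s := by
  have h1 : ContinuousOn (fun x => fderiv ℝ κ (p x)) s := (hess_facts hV hκ).2.2.1.comp hp hm
  simp only [dl_apply]
  exact (Complex.continuous_ofReal.comp_continuousOn (contOn_apply h1 hv)).sub
    (continuousOn_const.mul (Complex.continuous_ofReal.comp_continuousOn (contOn_apply h1 (hv.const_smul _))))

end

/-- A bounded strictly pseudoconvex domain with a defining function that is strictly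
plurisubharmonic near the boundary. -/
structure Dom (E : Type*) [NormedAddCommGroup E] [InnerProductSpace ℂ E] where
  Ω : Set E
  U : Set E
  r : E → ℝ
  c : ℝ
  δ : ℝ
  isOpen : IsOpen Ω
  conn : IsConnected Ω
  cpt : IsCompact (closure Ω)
  openU : IsOpen U
  sub : closure Ω ⊆ U
  C2 : ContDiffOn ℝ 2 r U
  eq : Ω = {z ∈ U | r z < 0}
  c_pos : 0 < c
  δ_pos : 0 < δ
  levi_ge : ∀ z ∈ closure Ω, -δ ≤ r z → ∀ v, c * ‖v‖ ^ 2 ≤ levi r z v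
  grad_ge : ∀ z ∈ closure Ω, -δ ≤ r z → c ≤ ‖fderiv ℝ r z‖

section
variable {E : Type*} [NormedAddCommGroup E] [InnerProductSpace ℂ E] [FiniteDimensional ℂ E]

lemma exists_dom {Ω U : Set E} {ρ : E → ℝ} (hΩ : IsOpen Ω) (hconn : IsConnected Ω)
  (hb : Bornology.IsBounded Ω) (hU : IsOpen U) (hsub : closure Ω ⊆ U) (hρ : ContDiffOn ℝ 2 ρ U)
  (heq : Ω = {z ∈ U | ρ z < 0}) (hgrad : ∀ p ∈ frontier Ω, fderiv ℝ ρ p ≠ 0)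
  (hlev : ∀ p ∈ frontier Ω, ∀ v : E, v ≠ 0 → fderiv ℝ ρ p v = 0 →
  fderiv ℝ ρ p (I • v) = 0 → 0 < levi ρ p v) : ∃ D : Dom E, D.Ω = Ω := by
  haveI : ProperSpace E := FiniteDimensional.proper ℂ E
  have hcpt : IsCompact (closure Ω) := hb.isCompact_closure
  have hle : ∀ z ∈ closure Ω, ρ z ≤ 0 := by
    intro z hz
    have hc : ContinuousWithinAt ρ Ω z :=
      (hρ.continuousOn z (hsub hz)).mono (subset_closure.trans hsub)
    have hz' : (𝓝[Ω] z).NeBot := mem_closure_iff_nhdsWithin_neBot.1 hz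
    refine le_of_tendsto hc ?_
    filter_upwards [self_mem_nhdsWithin] with y hy
    rw [heq] at hy
    exact hy.2.le
  have hfr : ∀ z ∈ closure Ω, ρ z = 0 → z ∈ frontier Ω := by
    intro z hz h0
    rw [hΩ.frontier_eq]
    refine ⟨hz, fun hzΩ => ?_⟩
    rw [heq] at hzΩ
    linarith [hzΩ.2]
  have hfr0 : ∀ z ∈ frontier Ω, ρ z = 0 := by
    intro z hz
    rw [hΩ.frontier_eq] at hz
    refine le_antisymm (hle z hz.1) ?_
    by_contra hcon
    push Not at hcon
    apply hz.2
    rw [heq]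
    exact ⟨hsub hz.1, hcon⟩
  have hfc : IsCompact (frontier Ω) := hcpt.of_isClosed_subset isClosed_frontier frontier_subset_closure
  have hS : IsCompact (sphere (0:E) 1) := isCompact_sphere 0 1
  obtain ⟨M', hM', c1, hc1, h1⟩ := compact_penalty (K := frontier Ω ×ˢ sphere (0:E) 1) (hfc.prod hS)
    (f := fun q => levi ρ q.1 q.2) (g := fun q => ‖dl ρ q.1 q.2‖)
    (levi_contOn hU hρ continuousOn_fst continuousOn_snd
      (fun q hq => hsub (frontier_subset_closure hq.1)))
    (dl_contOn hU hρ continuousOn_fst continuousOn_snd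
      (fun q hq => hsub (frontier_subset_closure hq.1))).norm
    (fun q hq => norm_nonneg _) (by
      rintro ⟨p, v⟩ ⟨hp, hv⟩ h0
      simp only [] at h0 hp hv ⊢
      rw [norm_eq_zero] at h0
      refine hlev p hp v ?_ ?_ ?_
      · rintro rfl; simp at hv
      · rw [← dl_re, h0]; rfl
      · have := dl_im ρ p v
        rw [h0] at this; simpa using this.symm)
  -- choose M
  obtain ⟨M, hM0, hM⟩ : ∃ M : ℝ, 0 < M ∧ ∀ t : ℝ, 0 ≤ t → M' * t ≤ c1 / 2 + M / 4 * t ^ 2 := by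
    refine ⟨2 * M' ^ 2 / c1, by positivity, fun t ht => ?_⟩
    have : c1 / 2 + 2 * M' ^ 2 / c1 / 4 * t ^ 2 - M' * t = (c1 - M' * t) ^ 2 / (2 * c1) := by
      field_simp; ring
    have h2 : 0 ≤ (c1 - M' * t) ^ 2 / (2 * c1) := by positivity
    linarith
  set r : E → ℝ := fun z => exp (M * ρ z) - 1 with hr
  have hrC : ContDiffOn ℝ 2 r U :=
    (contDiff_exp.comp_contDiffOn (contDiffOn_const.mul hρ)).sub contDiffOn_const
  have hrneg : ∀ z, r z < 0 ↔ ρ z < 0 := by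
    intro z
    simp only [hr, sub_neg, Real.exp_lt_one_iff]
    exact ⟨fun h => by by_contra hh; push Not at hh; nlinarith, fun h => by nlinarith⟩
  have hr0 : ∀ z, r z = 0 → ρ z = 0 := by
    intro z hz
    simp only [hr, sub_eq_zero, Real.exp_eq_one_iff] at hz
    rcases mul_eq_zero.1 hz with h | h
    · exact absurd h hM0.ne'
    · exact h
  have hrle : ∀ z ∈ closure Ω, r z ≤ 0 := by
    intro z hz
    have := hle z hz
    simp only [hr, sub_nonpos, exp_le_one_iff]
    nlinarith
  have hlevr : ∀ p ∈ frontier Ω, ∀ v ∈ sphere (0:E) 1, 0 < levi r p v := by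
    intro p hp v hv
    rw [levi_exp hU hρ M (hsub (frontier_subset_closure hp)) v, hfr0 p hp]
    have h2 := h1 (p, v) ⟨hp, hv⟩
    have h3 := hM ‖dl ρ p v‖ (norm_nonneg _)
    simp only [] at h2
    rw [mul_zero, exp_zero, one_mul]
    have : 0 < M * (levi ρ p v + M / 4 * ‖dl ρ p v‖ ^ 2) := mul_pos hM0 (by linarith)
    linarith
  have hgr : ∀ p ∈ frontier Ω, fderiv ℝ r p ≠ 0 := by
    intro p hp h0
    have hd : HasFDerivAt ρ (fderiv ℝ ρ p) p :=
      ((hess_facts hU hρ).1.differentiableAt (hU.mem_nhds (hsub (frontier_subset_closure hp)))).hasFDerivAt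
    have h2 := ((hd.const_mul M).exp.sub_const 1).fderiv
    have h3 : fderiv ℝ r p = exp (M * ρ p) • M • fderiv ℝ ρ p := h2
    rw [h3, hfr0 p hp, mul_zero, exp_zero, one_smul] at h0
    exact hgrad p hp ((smul_eq_zero.1 h0).resolve_left hM0.ne')
  obtain ⟨M2, hM2, c2, hc2, h2⟩ := compact_penalty (K := closure Ω ×ˢ sphere (0:E) 1) (hcpt.prod hS)
    (f := fun q => levi r q.1 q.2) (g := fun q => -r q.1)
    (levi_contOn hU hrC continuousOn_fst continuousOn_snd (fun q hq => hsub hq.1))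
    ((hrC.continuousOn.comp continuousOn_fst (fun q hq => hsub hq.1)).neg)
    (fun q hq => by linarith [hrle q.1 hq.1])
    (fun q hq h0 => hlevr _ (hfr _ hq.1 (hr0 _ (by simpa using h0))) _ hq.2)
  obtain ⟨M3, hM3, c3, hc3, h3⟩ := compact_penalty (K := closure Ω) hcpt
    (f := fun q => ‖fderiv ℝ r q‖) (g := fun q => -r q)
    (((hess_facts hU hrC).2.2.1.mono hsub).norm)
    ((hrC.continuousOn.mono hsub).neg)
    (fun q hq => by linarith [hrle q hq])
    (fun q hq h0 => norm_pos_iff.2 (hgr _ (hfr _ hq (hr0 _ (by simpa using h0)))))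
  refine ⟨⟨Ω, U, r, min (c2 / 2) (c3 / 2), min (c2 / (2 * M2)) (c3 / (2 * M3)), hΩ, hconn, hcpt, hU, hsub,
    hrC, ?_, by positivity, by positivity, ?_, ?_⟩, rfl⟩
  · rw [heq]; ext z; simp only [mem_setOf_eq, hrneg]
  · intro z hz hzr v
    by_cases hv : v = 0
    · subst hv; simp [levi]
    have hvn : 0 < ‖v‖ := norm_pos_iff.2 hv
    have h4 := h2 (z, ((‖v‖⁻¹:ℝ):ℂ) • v) ⟨hz, by
      rw [mem_sphere_zero_iff_norm, norm_smul, norm_real, norm_inv, norm_norm,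
        inv_mul_cancel₀ hvn.ne']⟩
    simp only [] at h4
    rw [levi_smul, norm_real, norm_inv, norm_norm, inv_pow] at h4
    have h5 : M2 * -r z ≤ c2 / 2 := by
      have h6 : -r z ≤ c2 / (2 * M2) := by linarith [min_le_left (c2 / (2 * M2)) (c3 / (2 * M3))]
      calc M2 * -r z ≤ M2 * (c2 / (2 * M2)) := by gcongr
        _ = c2 / 2 := by field_simp
    have h7 : c2 / 2 ≤ (‖v‖ ^ 2)⁻¹ * levi r z v := by linarith
    rw [inv_mul_eq_div, le_div_iff₀ (by positivity)] at h7
    exact (mul_le_mul_of_nonneg_right (min_le_left _ _) (sq_nonneg _)).trans h7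
  · intro z hz hzr
    have h4 := h3 z hz
    have h5 : M3 * -r z ≤ c3 / 2 := by
      have h6 : -r z ≤ c3 / (2 * M3) := by linarith [min_le_right (c2 / (2 * M2)) (c3 / (2 * M3))]
      calc M3 * -r z ≤ M3 * (c3 / (2 * M3)) := by gcongr
        _ = c3 / 2 := by field_simp
    exact (min_le_right _ _).trans (by linarith)

namespace Dom
variable (D : Dom E)

lemma subU : D.Ω ⊆ D.U := subset_closure.trans D.sub

lemma mem {z:E} (hz : z ∈ D.U) : z ∈ D.Ω ↔ D.r z < 0 := by
  constructor
  · intro h; rw [D.eq] at h; exact h.2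
  · intro h; rw [D.eq]; exact ⟨hz, h⟩

lemma neg {z:E} (hz : z ∈ D.Ω) : D.r z < 0 := (D.mem (D.subU hz)).1 hz

lemma cont : ContinuousOn D.r D.U := D.C2.continuousOn

lemma contC : ContinuousOn D.r (closure D.Ω) := D.cont.mono D.sub

lemma le {z:E} (hz : z ∈ closure D.Ω) : D.r z ≤ 0 := by
  have hc : ContinuousWithinAt D.r D.Ω z := (D.cont z (D.sub hz)).mono D.subU
  have hz' : (𝓝[D.Ω] z).NeBot := mem_closure_iff_nhdsWithin_neBot.1 hz
  refine le_of_tendsto hc ?_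
  filter_upwards [self_mem_nhdsWithin] with y hy
  exact (D.neg hy).le

lemma mem_frontier {z:E} : z ∈ frontier D.Ω ↔ z ∈ closure D.Ω ∧ D.r z = 0 := by
  rw [D.isOpen.frontier_eq]
  constructor
  · intro h
    refine ⟨h.1, le_antisymm (D.le h.1) ?_⟩
    by_contra hcon
    push Not at hcon
    exact h.2 ((D.mem (D.sub h.1)).2 hcon)
  · intro h
    exact ⟨h.1, fun hz => by linarith [D.neg hz, h.2]⟩

lemma frontier_cpt : IsCompact (frontier D.Ω) :=
  D.cpt.of_isClosed_subset isClosed_frontier frontier_subset_closure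

lemma cpt_sub (t:ℝ) : IsCompact {z ∈ closure D.Ω | D.r z ≤ t} := by
  have := D.contC.preimage_isClosed_of_isClosed isClosed_closure (isClosed_Iic (a := t))
  exact D.cpt.of_isClosed_subset this inter_subset_left

lemma cpt_shell (s t:ℝ) : IsCompact {z ∈ closure D.Ω | s ≤ D.r z ∧ D.r z ≤ t} := by
  have := D.contC.preimage_isClosed_of_isClosed isClosed_closure (isClosed_Icc (a := s) (b := t))
  exact D.cpt.of_isClosed_subset this inter_subset_left

lemma mem_of_neg {z:E} (hz : z ∈ closure D.Ω) (h : D.r z < 0) : z ∈ D.Ω :=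
  (D.mem (D.sub hz)).2 h

end Dom
end
end

variable {E : Type*} [NormedAddCommGroup E] [InnerProductSpace ℂ E] [FiniteDimensional ℂ E]

section
section
variable {E : Type*} [NormedAddCommGroup E] [NormedSpace ℂ E]
variable {F : Type*} [NormedAddCommGroup F] [NormedSpace ℂ F]

lemma curve_comp {f : E → F} {Ω : Set E} (hΩ : IsOpen Ω) (hf : DifferentiableOn ℂ f Ω)
  {γ : ℂ → E} {R:ℝ} (hR : 0 < R) (hγ : DifferentiableOn ℂ γ (ball 0 R)) (hx : γ 0 ∈ Ω) :
  ∃ R' > 0, R' ≤ R ∧ MapsTo γ (ball 0 R') Ω ∧ DifferentiableOn ℂ (fun ζ => f (γ ζ)) (ball 0 R') ∧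
  deriv (fun ζ => f (γ ζ)) 0 = fderiv ℂ f (γ 0) (deriv γ 0) := by
  have h0 : DifferentiableAt ℂ γ 0 := hγ.differentiableAt (isOpen_ball.mem_nhds (mem_ball_self hR))
  have h1 : γ ⁻¹' Ω ∈ 𝓝 (0:ℂ) := h0.continuousAt.preimage_mem_nhds (hΩ.mem_nhds hx)
  obtain ⟨s, hs, hsub⟩ := Metric.mem_nhds_iff.1 h1
  refine ⟨min s R, lt_min hs hR, min_le_right _ _, fun ζ hζ => hsub (ball_subset_ball (min_le_left _ _) hζ),
    ?_, ?_⟩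
  · exact hf.comp (hγ.mono (ball_subset_ball (min_le_right _ _)))
      (fun ζ hζ => hsub (ball_subset_ball (min_le_left _ _) hζ))
  · have h2 : HasFDerivAt f (fderiv ℂ f (γ 0)) (γ 0) := (hf.differentiableAt (hΩ.mem_nhds hx)).hasFDerivAt
    exact (h2.comp_hasDerivAt 0 h0.hasDerivAt).deriv

/-- identity theorem -/
lemma hol_identity {g : E → F} [CompleteSpace F] {Ω : Set E} (hΩ : IsOpen Ω) (hc : IsPreconnected Ω)
  (hg : DifferentiableOn ℂ g Ω) {z0:E} (hz0 : z0 ∈ Ω) (h0 : ∀ᶠ z in 𝓝 z0, g z = 0) :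
  ∀ z ∈ Ω, g z = 0 := by
  have key : Ω ⊆ {z | ∀ᶠ y in 𝓝 z, g y = 0} := by
    refine hc.subset_of_closure_inter_subset ?_ ⟨z0, hz0, h0⟩ ?_
    · exact isOpen_setOfPred_eventually_nhds
    · rintro x ⟨hx, hxΩ⟩
      obtain ⟨R, hR, hball⟩ := Metric.isOpen_iff.1 hΩ x hxΩ
      obtain ⟨y, hy, hxy⟩ := Metric.mem_closure_iff.1 hx R hR
      have hyb : y ∈ ball x R := by rwa [mem_ball, dist_comm]
      filter_upwards [isOpen_ball.mem_nhds (mem_ball_self hR)] with z hz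
      -- one dimensional identity theorem
      let l : ℂ → E := fun ζ => y + ζ • (z - y)
      have hl : Differentiable ℂ l := by simp only [l]; fun_prop
      let V : Set ℂ := l ⁻¹' ball x R
      have hV : IsOpen V := isOpen_ball.preimage hl.continuous
      have hconv : Convex ℝ V := by
        intro a ha b hb s t hs ht hst
        have : l (s • a + t • b) = s • l a + t • l b := by
          simp only [l, smul_add]
          rw [add_add_add_comm, ← add_smul, hst, one_smul, add_smul, smul_assoc, smul_assoc]
        refine mem_preimage.2 ?_
        rw [this]
        exact convex_ball x R ha hb hs ht hst
      have hd : DifferentiableOn ℂ (fun ζ => g (l ζ)) V :=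
        hg.comp hl.differentiableOn (fun ζ hζ => hball hζ)
      have hana : AnalyticOnNhd ℂ (fun ζ => g (l ζ)) V := hd.analyticOnNhd hV
      have l0 : l 0 = y := by simp [l]
      have l1 : l 1 = z := by simp [l]
      have hev : (fun ζ => g (l ζ)) =ᶠ[𝓝 0] 0 := by
        have : Tendsto l (𝓝 0) (𝓝 y) := by
          have := hl.continuous.tendsto 0
          rwa [l0] at this
        exact this.eventually hy
      have := hana.eqOn_zero_of_preconnected_of_eventuallyEq_zero hconv.isPreconnected
        (show (0:ℂ) ∈ V from mem_preimage.2 (by rwa [l0])) hev (show (1:ℂ) ∈ V from mem_preimage.2 (by rwa [l1]))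
      simpa [l1] using this
  intro z hz
  exact (key hz).self_of_nhds
end

section

/-- direction in which the barrier is subharmonic -/
lemma Dom.barrier (D : Dom E) : ∃ Λ > 0, ∀ t : ℝ, ∀ x ∈ closure D.Ω, -D.δ ≤ D.r x →
  ∃ e : E, 0 < levi (fun z => exp (-Λ * (D.r z + t)) - 1) x e := by
  have hK : IsCompact (closure D.Ω ×ˢ closedBall (0:E) 1) := D.cpt.prod (isCompact_closedBall 0 1)
  have hc : ContinuousOn (fun q : E × E => levi D.r q.1 q.2) (closure D.Ω ×ˢ closedBall (0:E) 1) :=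
    levi_contOn D.openU D.C2 continuousOn_fst continuousOn_snd (fun q hq => D.sub hq.1)
  obtain ⟨B, hB⟩ := hK.exists_bound_of_continuousOn hc
  have hc0 := D.c_pos
  refine ⟨16 * (|B| + 1) / D.c ^ 2, by positivity, fun t x hx hr => ?_⟩
  set Λ := 16 * (|B| + 1) / D.c ^ 2 with hΛ
  have hΛ0 : 0 < Λ := by positivity
  have hg := D.grad_ge x hx hr
  obtain ⟨e, he, hec⟩ := ContinuousLinearMap.exists_lt_apply_of_lt_opNorm (fderiv ℝ D.r x)
    (show D.c / 2 < ‖fderiv ℝ D.r x‖ by linarith)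
  refine ⟨e, ?_⟩
  have h1 := levi_exp D.openU (κ := fun z => D.r z + t) (D.C2.add contDiffOn_const) (-Λ) (D.sub hx) e
  rw [h1]
  have hf : fderiv ℝ (fun z => D.r z + t) = fderiv ℝ D.r := by
    funext z; exact fderiv_add_const t
  have hl : levi (fun z => D.r z + t) x e = levi D.r x e := by simp only [levi, Hess, hf]
  have hd : dl (fun z => D.r z + t) x e = dl D.r x e := by simp only [dl_apply, hf]
  rw [hl, hd]
  have h2 : levi D.r x e ≤ |B| := by
    have := hB (x, e) ⟨hx, by simpa using he.le⟩
    exact (le_abs_self _).trans (this.trans (le_abs_self _))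
  have h3 : D.c / 2 ≤ ‖dl D.r x e‖ := by
    have := abs_re_le_norm (dl D.r x e)
    rw [dl_re] at this
    rw [norm_eq_abs] at hec
    linarith
  have h4 : D.c ^ 2 / 4 ≤ ‖dl D.r x e‖ ^ 2 := by nlinarith
  refine mul_pos (exp_pos _) ?_
  have h5 : Λ * D.c ^ 2 = 16 * (|B| + 1) := by rw [hΛ]; field_simp
  have h6 : Λ * (D.c ^ 2 / 4) ≤ Λ * ‖dl D.r x e‖ ^ 2 := by gcongr
  have : -Λ * levi D.r x e + (-Λ) ^ 2 * ‖dl D.r x e‖ ^ 2 / 4 =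
    Λ * (Λ * ‖dl D.r x e‖ ^ 2 / 4 - levi D.r x e) := by ring
  rw [this]
  refine mul_pos hΛ0 ?_
  have := abs_nonneg B
  linarith

structure PMap (D1 D2 : Dom E) (f : E → E) : Prop where
  hol : DifferentiableOn ℂ f D1.Ω
  maps : MapsTo f D1.Ω D2.Ω
  proper : ∀ K : Set E, K ⊆ D2.Ω → IsCompact K → IsCompact {z ∈ D1.Ω | f z ∈ K}

namespace PMap
variable {D1 D2 : Dom E} {f : E → E} (P : PMap D1 D2 f)
include P

lemma cpt_le {t:ℝ} (ht : t < 0) : IsCompact {z ∈ D1.Ω | D2.r (f z) ≤ t} := by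
  have h := P.proper {z ∈ closure D2.Ω | D2.r z ≤ t}
    (fun z hz => D2.mem_of_neg hz.1 (lt_of_le_of_lt hz.2 ht)) (D2.cpt_sub t)
  convert h using 1
  ext z
  constructor
  · intro hz
    exact ⟨hz.1, subset_closure (P.maps hz.1), hz.2⟩
  · intro hz
    exact ⟨hz.1, hz.2.2⟩

lemma near12 {δ:ℝ} (hδ : 0 < δ) : ∃ δ' > 0, ∀ z ∈ D1.Ω, -δ' ≤ D1.r z → -δ < D2.r (f z) := by
  have hK := P.cpt_le (t := -δ) (by linarith)
  rcases eq_empty_or_nonempty {z ∈ D1.Ω | D2.r (f z) ≤ -δ} with he | hne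
  · refine ⟨1, one_pos, fun z hz _ => ?_⟩
    by_contra hcon
    push Not at hcon
    have : z ∈ ({z ∈ D1.Ω | D2.r (f z) ≤ -δ} : Set E) := ⟨hz, hcon⟩
    rw [he] at this
    exact this
  · obtain ⟨x, hx, hmax⟩ := hK.exists_isMaxOn hne (D1.cont.mono (fun z hz => D1.subU hz.1))
    have hneg := D1.neg hx.1
    refine ⟨-D1.r x / 2, by linarith, fun z hz h => ?_⟩
    by_contra hcon
    push Not at hcon
    have : D1.r z ≤ D1.r x := hmax (show z ∈ {z ∈ D1.Ω | D2.r (f z) ≤ -δ} from ⟨hz, hcon⟩)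
    linarith

lemma contRf : ContinuousOn (fun z => D2.r (f z)) D1.Ω :=
  D2.cont.comp P.hol.continuousOn (fun z hz => D2.subU (P.maps hz))

lemma near21 {δ:ℝ} (hδ : 0 < δ) : ∃ δ' > 0, ∀ z ∈ D1.Ω, -δ' ≤ D2.r (f z) → -δ < D1.r z := by
  have hK := D1.cpt_sub (-δ)
  have hsub : {z ∈ closure D1.Ω | D1.r z ≤ -δ} ⊆ D1.Ω := fun z hz => D1.mem_of_neg hz.1 (by linarith [hz.2])
  rcases eq_empty_or_nonempty {z ∈ closure D1.Ω | D1.r z ≤ -δ} with he | hne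
  · refine ⟨1, one_pos, fun z hz _ => ?_⟩
    by_contra hcon
    push Not at hcon
    have : z ∈ ({z ∈ closure D1.Ω | D1.r z ≤ -δ} : Set E) := ⟨subset_closure hz, hcon⟩
    rw [he] at this
    exact this
  · obtain ⟨x, hx, hmax⟩ := hK.exists_isMaxOn hne (P.contRf.mono hsub)
    have hneg := D2.neg (P.maps (hsub hx))
    refine ⟨-D2.r (f x) / 2, by linarith, fun z hz h => ?_⟩
    by_contra hcon
    push Not at hcon
    have : D2.r (f z) ≤ D2.r (f x) := hmax (show z ∈ {z ∈ closure D1.Ω | D1.r z ≤ -δ} from ⟨subset_closure hz, hcon⟩)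
    linarith

lemma jac_ne : ∃ x ∈ D1.Ω, Jac f x ≠ 0 := by
  obtain ⟨z0, hz0⟩ := D1.conn.nonempty
  obtain ⟨B, hB⟩ := D1.cpt.isBounded.exists_norm_le
  have hB' : ∀ z ∈ D1.Ω, ‖z‖ ^ 2 ≤ B ^ 2 := fun z hz => by
    have := hB z (subset_closure hz)
    gcongr
  let G : E → ℝ := fun z => ‖z‖ ^ 2 + (D2.r (f z))⁻¹
  have n0 := D2.neg (P.maps hz0)
  have hGc : ContinuousOn G D1.Ω := by
    refine (continuous_norm.pow 2).continuousOn.add (P.contRf.inv₀ fun z hz => ?_)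
    exact (D2.neg (P.maps hz)).ne
  -- level
  let t : ℝ := -(B ^ 2 + 1 - G z0)⁻¹
  have hpos : 0 < B ^ 2 + 1 - G z0 := by
    have := hB' z0 hz0
    have h2 : (D2.r (f z0))⁻¹ < 0 := inv_lt_zero.2 n0
    simp only [G]; linarith
  have ht : t < 0 := by simp only [t]; rw [neg_lt_zero]; positivity
  have hlow : ∀ z ∈ D1.Ω, t < D2.r (f z) → G z < G z0 := by
    intro z hz h
    have h1 := hB' z hz
    have h2 := D2.neg (P.maps hz)
    have h3 : (-D2.r (f z))⁻¹ > B ^ 2 + 1 - G z0 := by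
      rw [gt_iff_lt, lt_inv_comm₀ hpos (by linarith)]
      simp only [t] at h; linarith
    rw [inv_neg] at h3
    simp only [G] at h3 ⊢
    linarith
  have hK := P.cpt_le ht
  have hz0K : z0 ∈ {z ∈ D1.Ω | D2.r (f z) ≤ t} := by
    refine ⟨hz0, ?_⟩
    by_contra hcon
    push Not at hcon
    exact lt_irrefl _ (hlow z0 hz0 hcon)
  obtain ⟨x, hx, hmax⟩ := hK.exists_isMaxOn ⟨z0, hz0K⟩ (hGc.mono (fun z hz => hz.1))
  refine ⟨x, hx.1, ?_⟩
  rw [Jac_ne_zero_iff]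
  intro v hv
  by_contra hv0
  have hmaxall : ∀ z ∈ D1.Ω, G z ≤ G x := by
    intro z hz
    by_cases h : D2.r (f z) ≤ t
    · exact hmax (show z ∈ {z ∈ D1.Ω | D2.r (f z) ≤ t} from ⟨hz, h⟩)
    · push Not at h
      exact (hlow z hz h).le.trans (hmax hz0K)
  have hl := line_curve x v
  obtain ⟨R, hR, -, hmap, hd, hder⟩ := curve_comp D1.isOpen P.hol (γ := fun ζ : ℂ => x + ζ • v) one_pos
    hl.1.differentiableOn (by simpa using hx.1)
  rw [hl.2] at hder
  simp only [zero_smul, add_zero] at hder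
  rw [hv] at hder
  obtain ⟨b, h1⟩ := HasLap.norm_sq_curve (γ := fun ζ : ℂ => x + ζ • v) one_pos hl.1.differentiableOn
  have hC : ContDiffOn ℝ 2 (fun y => (D2.r y)⁻¹) D2.Ω :=
    (D2.C2.mono D2.subU).inv (fun y hy => (D2.neg hy).ne)
  have h2 := HasLap.comp_curve D2.isOpen hC hR hd (by simpa using P.maps hx.1)
  rw [hder] at h2
  have h3 := (h1.add h2).nonpos (by
    filter_upwards [isOpen_ball.mem_nhds (mem_ball_self hR)] with ζ hζ
    have := hmaxall _ (hmap hζ)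
    simpa [G] using this)
  rw [hl.2] at h3
  have : levi (fun y => (D2.r y)⁻¹) (f (x + (0:ℂ) • v)) 0 = 0 := by simp [levi]
  rw [this, add_zero] at h3
  have : 0 < ‖v‖ ^ 2 := by have := norm_pos_iff.2 hv0; positivity
  linarith

end PMap
end
end

section
lemma exists_gap {X : Type*} [TopologicalSpace X] {K : Set X} (hK : IsCompact K) {g : X → ℝ}
  (hg : ContinuousOn g K) (h : ∀ x ∈ K, g x < 0) : ∃ c > 0, ∀ x ∈ K, g x ≤ -c := by
  rcases eq_empty_or_nonempty K with he | hne
  · exact ⟨1, one_pos, fun x hx => by rw [he] at hx; exact absurd hx (notMem_empty x)⟩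
  · obtain ⟨x, hx, hmax⟩ := hK.exists_isMaxOn hne hg
    refine ⟨-g x, by linarith [h x hx], fun y hy => ?_⟩
    have : g y ≤ g x := hmax hy
    linarith

section

lemma Dom.exists_bound (D : Dom E) : ∃ B > 0, ∀ z ∈ closure D.Ω, -D.r z ≤ B := by
  obtain ⟨B, hB⟩ := D.cpt.exists_bound_of_continuousOn D.contC
  refine ⟨|B| + 1, by positivity, fun z hz => ?_⟩
  have := hB z hz
  rw [norm_eq_abs] at this
  linarith [neg_le_abs (D.r z), le_abs_self B]

lemma Dom.bC2 (D : Dom E) (Λ t:ℝ) : ContDiffOn ℝ 2 (fun z => exp (-Λ * (D.r z + t)) - 1) D.U :=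
  (contDiff_exp.comp_contDiffOn (contDiffOn_const.mul (D.C2.add contDiffOn_const))).sub contDiffOn_const

namespace PMap
variable {D1 D2 : Dom E} {f : E → E} (P : PMap D1 D2 f)
include P

lemma hopf1 : ∃ c > 0, ∀ z ∈ D1.Ω, c * (-D1.r z) ≤ -D2.r (f z) := by
  obtain ⟨δ', hδ', hnear⟩ := P.near12 D2.δ_pos
  obtain ⟨Λ, hΛ, hbar⟩ := D1.barrier
  set δ0 := min δ' D1.δ with hδ0
  have hδ0p : 0 < δ0 := lt_min hδ' D1.δ_pos
  have hsub : {z ∈ closure D1.Ω | D1.r z ≤ -δ0} ⊆ D1.Ω := fun z hz => D1.mem_of_neg hz.1 (by linarith [hz.2])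
  obtain ⟨c0, hc0, hgap⟩ := exists_gap (D1.cpt_sub (-δ0)) (P.contRf.mono hsub)
    (fun z hz => D2.neg (P.maps (hsub hz)))
  have hE : 0 < exp (Λ * δ0) := exp_pos _
  set ε := c0 / exp (Λ * δ0) with hε
  have hεp : 0 < ε := by positivity
  have hεE : ε * exp (Λ * δ0) = c0 := by rw [hε]; field_simp
  have key : ∀ t > 0, ∀ z ∈ D1.Ω, -δ0 ≤ D1.r z → D1.r z ≤ -t →
      D2.r (f z) + ε * (exp (-Λ * (D1.r z + t)) - 1) ≤ 0 := by
    intro t ht z hz hz1 hz2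
    by_contra hcon
    push Not at hcon
    let R : Set E := {z ∈ closure D1.Ω | -δ0 ≤ D1.r z ∧ D1.r z ≤ -t}
    have hR : IsCompact R := D1.cpt_shell _ _
    have hRsub : R ⊆ D1.Ω := fun y hy => D1.mem_of_neg hy.1 (by linarith [hy.2.2])
    let G : E → ℝ := fun z => D2.r (f z) + ε * (exp (-Λ * (D1.r z + t)) - 1)
    have hGc : ContinuousOn G R := by
      refine (P.contRf.mono hRsub).add (continuousOn_const.mul ?_)
      exact (D1.bC2 Λ t).continuousOn.mono (fun y hy => D1.subU (hRsub hy))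
    obtain ⟨x, hx, hmax⟩ := hR.exists_isMaxOn ⟨z, show z ∈ R from ⟨subset_closure hz, hz1, hz2⟩⟩ hGc
    have hGx : 0 < G x := lt_of_lt_of_le hcon (hmax (show z ∈ R from ⟨subset_closure hz, hz1, hz2⟩))
    have hxΩ := hRsub hx
    have hneg := D2.neg (P.maps hxΩ)
    have h1 : D1.r x < -t := by
      refine lt_of_le_of_ne hx.2.2 fun h => ?_
      simp only [G, h] at hGx
      simp at hGx
      linarith
    have h2 : -δ0 < D1.r x := by
      refine lt_of_le_of_ne hx.2.1 fun h => ?_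
      have h3 := hgap x ⟨hx.1, h.symm.le⟩
      have h4 : exp (-Λ * (D1.r x + t)) ≤ exp (Λ * δ0) := by
        rw [exp_le_exp, ← h]; nlinarith
      have : ε * (exp (-Λ * (D1.r x + t)) - 1) ≤ ε * exp (Λ * δ0) := by gcongr; linarith
      simp only [G] at hGx
      linarith
    obtain ⟨e, he⟩ := hbar t x hx.1 (by have := min_le_right δ' D1.δ; linarith)
    have hl := line_curve x e
    obtain ⟨r, hr, -, hmap, hd, hder⟩ := curve_comp D1.isOpen P.hol (γ := fun ζ : ℂ => x + ζ • e) one_pos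
      hl.1.differentiableOn (by simpa using hxΩ)
    have L1 := HasLap.comp_curve D2.openU D2.C2 hr hd (by simpa using D2.subU (P.maps hxΩ))
    have L2 := (HasLap.comp_line D1.openU (D1.bC2 Λ t) (D1.subU hxΩ) e).const_mul ε
    have hev : ∀ᶠ ζ in 𝓝 (0:ℂ), x + ζ • e ∈ R := by
      have hc : ContinuousAt D1.r x := D1.cont.continuousAt (D1.openU.mem_nhds (D1.subU hxΩ))
      have hev : ∀ᶠ y in 𝓝 x, y ∈ R := by
        filter_upwards [D1.isOpen.mem_nhds hxΩ, hc.eventually (gt_mem_nhds h1), hc.eventually (lt_mem_nhds h2)] with y hy hy1 hy2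
        exact ⟨subset_closure hy, hy2.le, hy1.le⟩
      have : Tendsto (fun ζ : ℂ => x + ζ • e) (𝓝 0) (𝓝 x) := by
        have := hl.1.continuous.tendsto 0
        simpa using this
      exact this.eventually hev
    have := (L1.add L2).nonpos (by
      filter_upwards [hev] with ζ hζ
      have := hmax hζ
      simpa [G] using this)
    simp only [zero_smul, add_zero] at this
    have h5 := D2.levi_ge (f x) (subset_closure (P.maps hxΩ))
      (hnear x hxΩ (by have := min_le_left δ' D1.δ; linarith)).le
      (deriv (fun ζ : ℂ => f (x + ζ • e)) 0)
    have h6 : 0 ≤ D2.c * ‖deriv (fun ζ : ℂ => f (x + ζ • e)) 0‖ ^ 2 := by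
      have := D2.c_pos; positivity
    nlinarith [mul_pos hεp he]
  obtain ⟨B, hB, hBb⟩ := D1.exists_bound
  refine ⟨min (ε * Λ / 2) (c0 / B), by positivity, fun z hz => ?_⟩
  have hneg := D1.neg hz
  by_cases h : -δ0 ≤ D1.r z
  · have h1 := key (-D1.r z / 2) (by linarith) z hz h (by linarith)
    have h2 := add_one_le_exp (-Λ * (D1.r z + -D1.r z / 2))
    have h3 : ε * (-Λ * (D1.r z + -D1.r z / 2)) ≤ ε * (exp (-Λ * (D1.r z + -D1.r z / 2)) - 1) := by
      gcongr; linarith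
    calc min (ε * Λ / 2) (c0 / B) * (-D1.r z) ≤ (ε * Λ / 2) * (-D1.r z) := by
          gcongr
          · linarith
          · exact min_le_left _ _
      _ = ε * (-Λ * (D1.r z + -D1.r z / 2)) := by ring
      _ ≤ _ := by linarith
  · push Not at h
    have h1 := hgap z ⟨subset_closure hz, h.le⟩
    have h2 := hBb z (subset_closure hz)
    calc min (ε * Λ / 2) (c0 / B) * (-D1.r z) ≤ (c0 / B) * B := by
          gcongr
          · linarith
          · exact min_le_right _ _
      _ = c0 := by field_simp
      _ ≤ _ := by linarith

lemma jac_dense {z:E} (hz : z ∈ D1.Ω) {S : Set E} (hS : S ∈ 𝓝 z) : ∃ y ∈ S, Jac f y ≠ 0 := by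
  by_contra hcon
  push Not at hcon
  obtain ⟨x, hx, hJ⟩ := P.jac_ne
  exact hJ (hol_identity D1.isOpen D1.conn.isPreconnected (Jac_differentiableOn D1.isOpen P.hol) hz
    (by filter_upwards [hS] with y hy using hcon y hy) x hx)

lemma hopf2 : ∃ c > 0, ∀ z ∈ D1.Ω, c * (-D2.r (f z)) ≤ -D1.r z := by
  obtain ⟨δ', hδ', hnear⟩ := P.near21 D1.δ_pos
  obtain ⟨Λ, hΛ, hbar⟩ := D2.barrier
  set δ0 := min δ' D2.δ with hδ0
  have hδ0p : 0 < δ0 := lt_min hδ' D2.δ_pos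
  obtain ⟨c0, hc0, hgap⟩ := exists_gap (P.cpt_le (t := -δ0) (by linarith))
    (D1.cont.mono (fun z hz => D1.subU hz.1)) (fun z hz => D1.neg hz.1)
  have hE : 0 < exp (Λ * δ0) := exp_pos _
  set ε := c0 / exp (Λ * δ0) with hε
  have hεp : 0 < ε := by positivity
  have hεE : ε * exp (Λ * δ0) = c0 := by rw [hε]; field_simp
  have hJd := Jac_differentiableOn D1.isOpen P.hol
  have key0 : ∀ t > 0, ∀ z ∈ D1.Ω, Jac f z ≠ 0 → -δ0 ≤ D2.r (f z) → D2.r (f z) ≤ -t →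
      D1.r z + ε * (exp (-Λ * (D2.r (f z) + t)) - 1) ≤ 0 := by
    intro t ht z hz hJz hz1 hz2
    by_contra hcon
    push Not at hcon
    let R : Set E := {z ∈ D1.Ω | D2.r (f z) ≤ -t} ∩ {z | -δ0 ≤ D2.r (f z)}
    have hRt := P.cpt_le (t := -t) (by linarith)
    have hclosed : ∀ {g : E → ℝ} (_ : ContinuousOn g D1.Ω) (κ:ℝ) {K : Set E} (_ : IsCompact K) (_ : K ⊆ D1.Ω),
        IsCompact (K ∩ {z | κ ≤ g z}) := by
      intro g hg κ K hK hKs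
      have := (hg.mono hKs).preimage_isClosed_of_isClosed hK.isClosed (isClosed_Ici (a := κ))
      exact hK.of_isClosed_subset this inter_subset_left
    have hR : IsCompact R := hclosed P.contRf _ hRt (fun z hz => hz.1)
    have hRsub : R ⊆ D1.Ω := fun y hy => hy.1.1
    obtain ⟨B, hB⟩ := hR.exists_bound_of_continuousOn (hJd.continuousOn.mono hRsub)
    have hB1 : ∀ y ∈ R, ‖Jac f y‖ ≤ |B| + 1 := fun y hy => (hB y hy).trans (by linarith [le_abs_self B])
    set B1 := |B| + 1 with hB1d
    have hB1p : 0 < B1 := by positivity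
    let Q : E → ℝ := fun z => D1.r z + ε * (exp (-Λ * (D2.r (f z) + t)) - 1)
    have hQc : ContinuousOn Q D1.Ω := by
      refine (D1.cont.mono D1.subU).add (continuousOn_const.mul ?_)
      exact (D2.bC2 Λ t).continuousOn.comp P.hol.continuousOn (fun y hy => D2.subU (P.maps hy))
    obtain ⟨M, hM⟩ := hR.exists_bound_of_continuousOn (hQc.mono hRsub)
    -- ε' small
    obtain ⟨ε', hε', hpos⟩ : ∃ ε' > 0, 0 < Q z + ε' * (log ‖Jac f z‖ - log B1) := by
      refine ⟨Q z / (2 * (|log ‖Jac f z‖ - log B1| + 1)), by positivity, ?_⟩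
      set a := log ‖Jac f z‖ - log B1
      have h1 : Q z / (2 * (|a| + 1)) * (|a| + 1) = Q z / 2 := by field_simp
      have h2 : 0 < Q z / (2 * (|a| + 1)) := by positivity
      have h3 : -(|a| + 1) ≤ a := by linarith [neg_abs_le a]
      have := mul_le_mul_of_nonneg_left h3 h2.le
      have hq : 0 < Q z := hcon
      linarith
    let G : E → ℝ := fun y => Q y + ε' * (log ‖Jac f y‖ - log B1)
    set κ : ℝ := B1 * exp (-(|M| + 1) / ε') with hκ
    have hκp : 0 < κ := by positivity
    have hsmall : ∀ y ∈ R, Jac f y ≠ 0 → ‖Jac f y‖ ≤ κ → G y < 0 := by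
      intro y hy hJ hyκ
      have h1 : log ‖Jac f y‖ ≤ log B1 + -(|M| + 1) / ε' := by
        have := log_le_log (norm_pos_iff.2 hJ) hyκ
        rwa [hκ, log_mul hB1p.ne' (exp_pos _).ne', log_exp] at this
      have h2 : ε' * (log ‖Jac f y‖ - log B1) ≤ ε' * (-(|M| + 1) / ε') := by gcongr; linarith
      have h3 : ε' * (-(|M| + 1) / ε') = -(|M| + 1) := by field_simp
      have h4 := hM y hy
      rw [norm_eq_abs] at h4
      simp only [G]
      linarith [le_abs_self (Q y), le_abs_self M]
    have hzR : z ∈ R := ⟨⟨hz, hz2⟩, hz1⟩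
    let K : Set E := R ∩ {y | κ ≤ ‖Jac f y‖}
    have hK : IsCompact K := hclosed hJd.continuousOn.norm κ hR hRsub
    have hKne : ∀ y ∈ K, Jac f y ≠ 0 := fun y hy => norm_pos_iff.1 (lt_of_lt_of_le hκp hy.2)
    have hzK : z ∈ K := by
      refine ⟨hzR, ?_⟩
      by_contra h
      have h' : ‖Jac f z‖ < κ := not_le.1 h
      exact absurd (hsmall z hzR hJz h'.le) (not_lt.2 hpos.le)
    have hGc : ContinuousOn G K := by
      refine (hQc.mono fun y hy => hRsub hy.1).add (continuousOn_const.mul (ContinuousOn.sub ?_ continuousOn_const))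
      exact ((hJd.continuousOn.mono fun y hy => hRsub hy.1).norm).log (fun y hy => (norm_pos_iff.2 (hKne y hy)).ne')
    obtain ⟨x, hx, hmax⟩ := hK.exists_isMaxOn ⟨z, hzK⟩ hGc
    have hGx : 0 < G x := lt_of_lt_of_le hpos (hmax hzK)
    have hxΩ := hRsub hx.1
    have hJx := hKne x hx
    have hneg := D1.neg hxΩ
    have hlog : ε' * (log ‖Jac f x‖ - log B1) ≤ 0 := by
      have := log_le_log (norm_pos_iff.2 hJx) (hB1 x hx.1)
      exact mul_nonpos_of_nonneg_of_nonpos hε'.le (by linarith)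
    have hQx : 0 < Q x := by simp only [G] at hGx; linarith
    have h1 : D2.r (f x) < -t := by
      refine lt_of_le_of_ne hx.1.1.2 fun h => ?_
      simp only [Q, h] at hQx
      simp at hQx
      linarith
    have h2 : -δ0 < D2.r (f x) := by
      refine lt_of_le_of_ne hx.1.2 fun h => ?_
      have h3 := hgap x ⟨hxΩ, h.symm.le⟩
      have h4 : exp (-Λ * (D2.r (f x) + t)) ≤ exp (Λ * δ0) := by
        rw [exp_le_exp, ← h]; nlinarith
      have : ε * (exp (-Λ * (D2.r (f x) + t)) - 1) ≤ ε * exp (Λ * δ0) := by gcongr; linarith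
      simp only [Q] at hQx
      linarith
    have h3 : κ < ‖Jac f x‖ := by
      refine lt_of_le_of_ne hx.2 fun h => ?_
      exact absurd (hsmall x hx.1 hJx h.symm.le) (not_lt.2 hGx.le)
    obtain ⟨e, he⟩ := hbar t (f x) (subset_closure (P.maps hxΩ)) (by have := min_le_right δ' D2.δ; linarith)
    obtain ⟨γ, hγ0, ⟨ρ, hρ, hγd⟩, hγ⟩ := inv_curve D1.isOpen P.hol hxΩ hJx e
    have hγx : γ 0 ∈ D1.Ω := by rwa [hγ0]
    obtain ⟨r, hr, -, hmap, hd, hder⟩ := curve_comp D1.isOpen hJd hρ hγd hγx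
    have L1 := HasLap.comp_curve D1.openU D1.C2 hρ hγd (D1.subU hγx)
    have L2 := ((HasLap.comp_line D2.openU (D2.bC2 Λ t) (D2.subU (P.maps hxΩ)) e).const_mul ε).congr
      (t := fun ζ => ε * (exp (-Λ * (D2.r (f (γ ζ)) + t)) - 1)) (by
        filter_upwards [hγ] with ζ hζ
        rw [hζ])
    have L3 := ((HasLap.log_norm hr hd (by rwa [hγ0])).sub (HasLap.const (log B1))).const_mul ε'
    have hev : ∀ᶠ ζ in 𝓝 (0:ℂ), γ ζ ∈ K := by
      have hev : ∀ᶠ y in 𝓝 x, y ∈ K := by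
        have hc := P.contRf.continuousAt (D1.isOpen.mem_nhds hxΩ)
        have hcJ := hJd.continuousOn.norm.continuousAt (D1.isOpen.mem_nhds hxΩ)
        filter_upwards [D1.isOpen.mem_nhds hxΩ, hc.eventually (gt_mem_nhds h1), hc.eventually (lt_mem_nhds h2),
          hcJ.eventually (lt_mem_nhds h3)] with y hy hy1 hy2 hy3
        exact ⟨⟨⟨hy, hy1.le⟩, hy2.le⟩, hy3.le⟩
      have : Tendsto γ (𝓝 0) (𝓝 x) := by
        have := (hγd.differentiableAt (isOpen_ball.mem_nhds (mem_ball_self hρ))).continuousAt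
        rwa [ContinuousAt, hγ0] at this
      exact this.eventually hev
    have := ((L1.add L2).add L3).nonpos (by
      filter_upwards [hev] with ζ hζ
      have := hmax hζ
      rw [hγ0]
      exact this)
    rw [hγ0] at this
    have h5 := D1.levi_ge x (subset_closure hxΩ)
      (hnear x hxΩ (by have := min_le_left δ' D2.δ; linarith)).le (deriv γ 0)
    have h6 : 0 ≤ D1.c * ‖deriv γ 0‖ ^ 2 := by
      have := D1.c_pos; positivity
    nlinarith [mul_pos hεp he]
  have key : ∀ t > 0, ∀ z ∈ D1.Ω, -δ0 < D2.r (f z) → D2.r (f z) < -t →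
      D1.r z + ε * (exp (-Λ * (D2.r (f z) + t)) - 1) ≤ 0 := by
    intro t ht z hz h2 h1
    by_contra hcon
    push Not at hcon
    have hc := P.contRf.continuousAt (D1.isOpen.mem_nhds hz)
    have hQ : ContinuousAt (fun z => D1.r z + ε * (exp (-Λ * (D2.r (f z) + t)) - 1)) z :=
      (D1.cont.continuousAt (D1.openU.mem_nhds (D1.subU hz))).add
        (continuousAt_const.mul (((continuousAt_const.mul (hc.add continuousAt_const)).rexp).sub continuousAt_const))
    obtain ⟨y, hy, hJ⟩ := P.jac_dense hz (inter_mem (inter_mem (D1.isOpen.mem_nhds hz)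
      (hQ.eventually (lt_mem_nhds hcon))) (inter_mem (hc.eventually (gt_mem_nhds h1)) (hc.eventually (lt_mem_nhds h2))))
    exact absurd (key0 t ht y hy.1.1 hJ hy.2.2.le hy.2.1.le) (not_le.2 hy.1.2)
  obtain ⟨B, hB, hBb⟩ := D2.exists_bound
  refine ⟨min (ε * Λ / 2) (c0 / B), by positivity, fun z hz => ?_⟩
  have hneg := D2.neg (P.maps hz)
  by_cases h : -δ0 < D2.r (f z)
  · have h1 := key (-D2.r (f z) / 2) (by linarith) z hz h (by linarith)
    have h2 := add_one_le_exp (-Λ * (D2.r (f z) + -D2.r (f z) / 2))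
    have h3 : ε * (-Λ * (D2.r (f z) + -D2.r (f z) / 2)) ≤ ε * (exp (-Λ * (D2.r (f z) + -D2.r (f z) / 2)) - 1) := by
      gcongr; linarith
    calc min (ε * Λ / 2) (c0 / B) * (-D2.r (f z)) ≤ (ε * Λ / 2) * (-D2.r (f z)) := by
          gcongr
          · linarith
          · exact min_le_left _ _
      _ = ε * (-Λ * (D2.r (f z) + -D2.r (f z) / 2)) := by ring
      _ ≤ _ := by linarith
  · push Not at h
    have h1 := hgap z ⟨hz, h⟩
    have h2 := hBb (f z) (subset_closure (P.maps hz))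
    calc min (ε * Λ / 2) (c0 / B) * (-D2.r (f z)) ≤ (c0 / B) * B := by
          gcongr
          · linarith
          · exact min_le_right _ _
      _ = c0 := by field_simp
      _ ≤ _ := by linarith

end PMap
end
end

section
/-- maximum principle in viscosity form -/
lemma sub_max {u : ℂ → ℝ} {ρ:ℝ} (hρ : 0 < ρ) (hu : ContinuousOn u (closedBall 0 ρ))
  (hsub : ∀ ζ0 ∈ ball (0:ℂ) ρ, ∃ (s : ℂ → ℝ) (c:ℝ) (b:ℂ), HasLap s c b ∧ 0 ≤ c ∧ s 0 = u ζ0 ∧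
  ∀ᶠ ζ in 𝓝 0, s ζ ≤ u (ζ0 + ζ))
  (hbd : ∀ ζ ∈ sphere (0:ℂ) ρ, u ζ ≤ 0) : ∀ ζ ∈ closedBall (0:ℂ) ρ, u ζ ≤ 0 := by
  intro z hz
  by_contra hcon
  push Not at hcon
  set η := u z / (2 * ρ ^ 2) with hη
  have hηp : 0 < η := by positivity
  have hηρ : η * ρ ^ 2 = u z / 2 := by rw [hη]; field_simp
  let G : ℂ → ℝ := fun ζ => u ζ + η * ‖ζ‖ ^ 2
  have hG : ContinuousOn G (closedBall 0 ρ) := hu.add (by fun_prop)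
  obtain ⟨x, hx, hmax⟩ := (isCompact_closedBall (0:ℂ) ρ).exists_isMaxOn ⟨z, hz⟩ hG
  have h1 : u z ≤ G x := by
    have : G z ≤ G x := hmax hz
    have h2 : 0 ≤ η * ‖z‖ ^ 2 := by positivity
    simp only [G] at this ⊢; linarith
  have hxb : x ∈ ball (0:ℂ) ρ := by
    rw [mem_ball_zero_iff]
    rw [mem_closedBall_zero_iff] at hx
    refine lt_of_le_of_ne hx fun h => ?_
    have := hbd x (by simpa using h)
    simp only [G, h] at h1
    linarith
  obtain ⟨s, c, b, hs, hc, hs0, hle⟩ := hsub x hxb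
  have hl : Differentiable ℂ (fun ζ : ℂ => x + ζ) := by fun_prop
  have hd : deriv (fun ζ : ℂ => x + ζ) 0 = 1 := by simp
  obtain ⟨b', hL⟩ := HasLap.norm_sq_curve (γ := fun ζ : ℂ => x + ζ) one_pos hl.differentiableOn
  rw [hd] at hL
  have := (hs.add (hL.const_mul η)).nonpos (by
    have hev : ∀ᶠ ζ in 𝓝 (0:ℂ), x + ζ ∈ ball (0:ℂ) ρ := by
      have : Tendsto (fun ζ : ℂ => x + ζ) (𝓝 0) (𝓝 x) := by
        have := hl.continuous.tendsto 0
        simpa using this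
      exact this.eventually (isOpen_ball.mem_nhds hxb)
    filter_upwards [hle, hev] with ζ h1 h2
    have h3 : G (x + ζ) ≤ G x := hmax (ball_subset_closedBall h2)
    simp only [G] at h3
    simp only [add_zero, hs0]
    linarith)
  simp at this
  linarith

section

lemma Dom.disc_lemma (D : Dom E) : ∃ C > 0, ∀ g : ℂ → E, DifferentiableOn ℂ g (ball 0 1) →
  MapsTo g (ball 0 1) D.Ω → ‖deriv g 0‖ ^ 2 ≤ C * (-D.r (g 0)) := by
  obtain ⟨B, hB⟩ := D.cpt.isBounded.exists_norm_le
  have hcp := D.c_pos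
  have hδp := D.δ_pos
  set ε := D.c with hε
  set W := (2 * |B| + 1) ^ 2 with hW
  have hWp : 0 < W := by positivity
  set c3 := min ε (D.δ / W) with hc3
  have hc3p : 0 < c3 := by positivity
  refine ⟨1 / c3, by positivity, fun g hg hmap => ?_⟩
  have h01 : (0:ℂ) ∈ ball (0:ℂ) 1 := by simp
  have hg0 : DifferentiableAt ℂ g 0 := hg.differentiableAt (isOpen_ball.mem_nhds h01)
  have hw0 := hmap h01
  set w0 := g 0 with hw0d
  have hWb : ∀ y ∈ D.Ω, ‖y - w0‖ ^ 2 ≤ W := by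
    intro y hy
    have h1 := hB y (subset_closure hy)
    have h2 := hB w0 (subset_closure hw0)
    have : ‖y - w0‖ ≤ 2 * |B| + 1 := (norm_sub_le _ _).trans (by linarith [le_abs_self B])
    rw [hW]; gcongr
  let T : E → ℝ := fun y => D.r y - ε * ‖y - w0‖ ^ 2
  have hT0 : ∀ y ∈ D.Ω, max (T y) (-D.δ) ≤ -c3 * ‖y - w0‖ ^ 2 := by
    intro y hy
    have h1 := D.neg hy
    have h2 := sq_nonneg ‖y - w0‖
    refine max_le ?_ ?_
    · have : c3 * ‖y - w0‖ ^ 2 ≤ ε * ‖y - w0‖ ^ 2 := by gcongr; exact min_le_left _ _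
      simp only [T]; linarith
    · have : c3 * ‖y - w0‖ ^ 2 ≤ D.δ / W * W := by
        gcongr
        · exact min_le_right _ _
        · exact hWb y hy
      rw [div_mul_cancel₀ _ hWp.ne'] at this
      linarith
  let k : ℂ → E := dslope g 0
  have hkd : DifferentiableOn ℂ k (ball 0 1) :=
    (Complex.differentiableOn_dslope (isOpen_ball.mem_nhds h01)).2 hg
  have hk0 : k 0 = deriv g 0 := dslope_same g 0
  have hk : ∀ ζ, g ζ - w0 = ζ • k ζ := by
    intro ζ
    have := sub_smul_dslope g 0 ζ
    simp only [sub_zero] at this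
    exact this.symm
  -- main claim
  have claim : ∀ ρ ∈ Ioo (0:ℝ) 1, c3 * ρ ^ 2 * ‖deriv g 0‖ ^ 2 ≤ -D.r w0 := by
    rintro ρ ⟨hρ0, hρ1⟩
    have hcb : closedBall (0:ℂ) ρ ⊆ ball 0 1 := closedBall_subset_ball hρ1
    let u : ℂ → ℝ := fun ζ => max (T (g ζ)) (-D.δ) + c3 * ρ ^ 2 * ‖k ζ‖ ^ 2
    have huc : ContinuousOn u (closedBall 0 ρ) := by
      have hgc := hg.continuousOn.mono hcb
      have hkc := hkd.continuousOn.mono hcb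
      refine ContinuousOn.add (ContinuousOn.sup (ContinuousOn.sub ?_ ?_) continuousOn_const)
        (continuousOn_const.mul (hkc.norm.pow 2))
      · exact D.cont.comp hgc (fun ζ hζ => D.subU (hmap (hcb hζ)))
      · exact continuousOn_const.mul ((hgc.sub continuousOn_const).norm.pow 2)
    have hmain := sub_max hρ0 huc (by
      intro ζ0 hζ0
      have hζ1 : ζ0 ∈ ball (0:ℂ) 1 := hcb (ball_subset_closedBall hζ0)
      have hpos : 0 < 1 - ‖ζ0‖ := by rw [mem_ball_zero_iff] at hζ1; linarith
      have htr : MapsTo (fun ζ : ℂ => ζ0 + ζ) (ball 0 (1 - ‖ζ0‖)) (ball 0 1) := by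
        intro ζ hζ
        rw [mem_ball_zero_iff] at hζ ⊢
        exact (norm_add_le _ _).trans_lt (by linarith)
      have hl : Differentiable ℂ (fun ζ : ℂ => ζ0 + ζ) := by fun_prop
      have hgγ : DifferentiableOn ℂ (fun ζ => g (ζ0 + ζ)) (ball 0 (1 - ‖ζ0‖)) := hg.comp hl.differentiableOn htr
      have hkγ : DifferentiableOn ℂ (fun ζ => k (ζ0 + ζ)) (ball 0 (1 - ‖ζ0‖)) := hkd.comp hl.differentiableOn htr
      obtain ⟨b2, L2⟩ := HasLap.norm_sq_curve hpos hkγ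
      have L2' := L2.const_mul (c3 * ρ ^ 2)
      have hnn : 0 ≤ c3 * ρ ^ 2 * ‖deriv (fun ζ => k (ζ0 + ζ)) 0‖ ^ 2 := by positivity
      by_cases hcase : T (g ζ0) ≤ -D.δ
      · refine ⟨_, _, _, (HasLap.const (-D.δ)).add L2', by linarith, ?_, ?_⟩
        · simp [u, max_eq_right hcase]
        · exact Eventually.of_forall fun ζ => by
            simp only [u]; gcongr; exact le_max_right _ _
      · push Not at hcase
        obtain ⟨b1, L1⟩ := HasLap.norm_sq_curve hpos (hgγ.sub_const w0)
        have L0 := HasLap.comp_curve D.openU D.C2 hpos hgγ (by simpa using D.subU (hmap hζ1))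
        refine ⟨_, _, _, ((L0.sub (L1.const_mul ε)).add L2'), ?_, ?_, ?_⟩
        · simp only [add_zero, deriv_sub_const]
          have hr : -D.δ ≤ D.r (g ζ0) := by
            have : 0 ≤ ε * ‖g ζ0 - w0‖ ^ 2 := by positivity
            simp only [T] at hcase; linarith
          have := D.levi_ge (g ζ0) (subset_closure (hmap hζ1)) hr (deriv (fun ζ => g (ζ0 + ζ)) 0)
          linarith
        · simp [u, T, max_eq_left hcase.le]

        · exact Eventually.of_forall fun ζ => by
            simp only [u]; gcongr; exact le_max_left _ _) (by
      intro ζ hζ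
      have hζ1 : ζ ∈ ball (0:ℂ) 1 := hcb (sphere_subset_closedBall hζ)
      have h1 := hT0 _ (hmap hζ1)
      have h2 : ‖g ζ - w0‖ ^ 2 = ρ ^ 2 * ‖k ζ‖ ^ 2 := by
        rw [hk, norm_smul, mul_pow]; rw [mem_sphere_zero_iff_norm] at hζ; rw [hζ]
      rw [h2] at h1
      simp only [u]; linarith) 0 (by simp [hρ0.le])
    have hT : T (g 0) = D.r w0 := by simp [T, ← hw0d]
    have h3 : D.r w0 ≤ max (T (g 0)) (-D.δ) := by rw [hT]; exact le_max_left _ _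
    simp only [u, hk0] at hmain
    linarith
  have hlim : Tendsto (fun ρ : ℝ => c3 * ρ ^ 2 * ‖deriv g 0‖ ^ 2) (𝓝[<] 1) (𝓝 (c3 * 1 ^ 2 * ‖deriv g 0‖ ^ 2)) := by
    refine Tendsto.mono_left ?_ nhdsWithin_le_nhds
    exact Continuous.tendsto (by fun_prop) 1
  have h4 := le_of_tendsto hlim (by
    filter_upwards [Ioo_mem_nhdsLT (show (0:ℝ) < 1 by norm_num)] with ρ hρ using claim ρ hρ)
  rw [one_pow, mul_one] at h4
  rw [one_div, inv_mul_eq_div, le_div_iff₀ hc3p]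
  linarith

lemma Dom.lip (D : Dom E) : ∃ L > 0, ∃ δ > 0, ∀ p ∈ closure D.Ω, ball p δ ⊆ D.U ∧
  ∀ x ∈ ball p δ, ‖fderiv ℝ D.r x‖ ≤ L := by
  have hc := (hess_facts D.openU D.C2).2.2.1
  obtain ⟨δ, hδ, h⟩ := unif_cont_compact (F := E →L[ℝ] ℝ) D.openU hc D.cpt D.sub one_pos
  obtain ⟨B, hB⟩ := D.cpt.exists_bound_of_continuousOn (hc.mono D.sub)
  refine ⟨|B| + 1, by positivity, δ, hδ, fun p hp => ⟨(h p hp).1, fun x hx => ?_⟩⟩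
  have h1 := (h p hp).2 x hx
  have h2 := hB p hp
  calc ‖fderiv ℝ D.r x‖ = ‖(fderiv ℝ D.r x - fderiv ℝ D.r p) + fderiv ℝ D.r p‖ := by rw [sub_add_cancel]
    _ ≤ _ := norm_add_le _ _
    _ ≤ |B| + 1 := by linarith [le_abs_self B]

lemma Dom.lip' (D : Dom E) : ∃ L > 0, ∃ δ > 0, ∀ p ∈ closure D.Ω, ball p δ ⊆ D.U ∧
  (∀ x ∈ ball p δ, ‖fderiv ℝ D.r x‖ ≤ L) ∧
  ∀ x ∈ ball p δ, ∀ y ∈ ball p δ, |D.r x - D.r y| ≤ L * ‖x - y‖ := by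
  obtain ⟨L, hL, δ, hδ, h⟩ := D.lip
  refine ⟨L, hL, δ, hδ, fun p hp => ⟨(h p hp).1, (h p hp).2, fun x hx y hy => ?_⟩⟩
  have := Convex.norm_image_sub_le_of_norm_fderiv_le (𝕜 := ℝ) (f := D.r) (s := ball p δ) (C := L)
    (fun z hz => (hess_facts D.openU D.C2).1.differentiableAt (D.openU.mem_nhds ((h p hp).1 hz)))
    (h p hp).2 (convex_ball p δ) hy hx
  simpa using this

lemma Dom.ball_sub (D : Dom E) : ∃ c > 0, ∀ z ∈ D.Ω, ball z (c * (-D.r z)) ⊆ D.Ω := by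
  obtain ⟨L, hL, δ, hδ, h⟩ := D.lip'
  obtain ⟨B, hB, hBb⟩ := D.exists_bound
  refine ⟨min (1 / L) (δ / B), by positivity, fun z hz => ?_⟩
  have hneg := D.neg hz
  have hdis : ∀ p ∈ frontier D.Ω, p ∉ ball z (min (1 / L) (δ / B) * (-D.r z)) := by
    intro p hp hpb
    rw [mem_ball, dist_comm, dist_eq_norm] at hpb
    have hp' := D.mem_frontier.1 hp
    have h1 : ‖z - p‖ < δ := by
      refine hpb.trans_le ?_
      calc min (1 / L) (δ / B) * (-D.r z) ≤ δ / B * B := by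
            gcongr
            · linarith
            · exact min_le_right _ _
            · exact hBb z (subset_closure hz)
        _ = δ := by field_simp
    have h2 := (h p hp'.1).2.2 z (by rwa [mem_ball, dist_eq_norm]) p (mem_ball_self hδ)
    rw [hp'.2, sub_zero, abs_of_neg hneg] at h2
    have h3 : L * ‖z - p‖ < L * (1 / L * (-D.r z)) := by
      gcongr
      refine hpb.trans_le ?_
      gcongr
      · linarith
      · exact min_le_left _ _
    have h4 : L * (1 / L * (-D.r z)) = -D.r z := by field_simp
    linarith
  have hpc : IsPreconnected (ball z (min (1 / L) (δ / B) * (-D.r z))) := (convex_ball _ _).isPreconnected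
  refine hpc.subset_of_closure_inter_subset D.isOpen ⟨z, mem_ball_self ?_, hz⟩ ?_
  · have : 0 < -D.r z := by linarith
    positivity
  · rintro p ⟨hp1, hp2⟩
    by_contra hpn
    exact hdis p (by rw [D.isOpen.frontier_eq]; exact ⟨hp1, hpn⟩) hp2

end
end

section

lemma Dom.near_frontier (D : Dom E) {δ:ℝ} (hδ : 0 < δ) : ∃ c > 0, ∀ z ∈ D.Ω, -D.r z < c →
  ∃ p ∈ frontier D.Ω, ‖z - p‖ < δ := by
  let K : Set E := closure D.Ω ∩ ⋂ p ∈ frontier D.Ω, {z | δ ≤ ‖z - p‖}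
  have hcl : IsClosed (⋂ p ∈ frontier D.Ω, {z : E | δ ≤ ‖z - p‖}) :=
    isClosed_biInter fun p _ => isClosed_le continuous_const (by fun_prop)
  have hK : IsCompact K := D.cpt.inter_right hcl
  obtain ⟨c, hc, h⟩ := exists_gap hK (D.contC.mono inter_subset_left) (by
    intro z hz
    refine lt_of_le_of_ne (D.le hz.1) fun h0 => ?_
    have h1 := mem_iInter₂.1 hz.2 z (D.mem_frontier.2 ⟨hz.1, h0⟩)
    have h2 : δ ≤ ‖z - z‖ := h1
    rw [sub_self, norm_zero] at h2
    linarith)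
  refine ⟨c, hc, fun z hz hzc => ?_⟩
  by_contra hcon
  push Not at hcon
  have := h z ⟨subset_closure hz, mem_iInter₂.2 hcon⟩
  linarith

lemma Dom.inward (D : Dom E) : ∃ κ > 0, ∃ L > 0, ∃ δ > 0, ∀ p ∈ frontier D.Ω, ball p δ ⊆ D.U ∧
  (∀ x ∈ ball p δ, ∀ y ∈ ball p δ, |D.r x - D.r y| ≤ L * ‖x - y‖) ∧
  ∃ η : E, ‖η‖ ≤ 1 ∧ ∀ x ∈ ball p δ, ∀ t : ℝ, 0 ≤ t → x + t • η ∈ ball p δ →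
  D.r (x + t • η) ≤ D.r x - κ * t := by
  obtain ⟨L, hL, δ1, hδ1, h⟩ := D.lip'
  have hcp := D.c_pos
  have hc := (hess_facts D.openU D.C2).2.2.1
  obtain ⟨δ2, hδ2, h2⟩ := unif_cont_compact (F := E →L[ℝ] ℝ) D.openU hc D.cpt D.sub
    (show 0 < D.c / 4 by positivity)
  refine ⟨D.c / 4, by positivity, L, hL, min δ1 δ2, by positivity, fun p hp => ?_⟩
  have hp' := D.mem_frontier.1 hp
  have hs1 : ball p (min δ1 δ2) ⊆ ball p δ1 := ball_subset_ball (min_le_left _ _)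
  have hs2 : ball p (min δ1 δ2) ⊆ ball p δ2 := ball_subset_ball (min_le_right _ _)
  refine ⟨hs1.trans (h p hp'.1).1, fun x hx y hy => (h p hp'.1).2.2 x (hs1 hx) y (hs1 hy), ?_⟩
  have hg := D.grad_ge p hp'.1 (by rw [hp'.2]; linarith [D.δ_pos])
  obtain ⟨e, he, hec⟩ := ContinuousLinearMap.exists_lt_apply_of_lt_opNorm (fderiv ℝ D.r p)
    (show D.c / 2 < ‖fderiv ℝ D.r p‖ by linarith)
  obtain ⟨η, hη, hηc⟩ : ∃ η : E, ‖η‖ ≤ 1 ∧ fderiv ℝ D.r p η ≤ -(D.c / 2) := by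
    rw [norm_eq_abs, lt_abs] at hec
    rcases hec with h3 | h3
    · exact ⟨-e, by rw [norm_neg]; exact he.le, by rw [map_neg]; linarith⟩
    · exact ⟨e, he.le, by linarith⟩
  refine ⟨η, hη, fun x hx t ht hxt => ?_⟩
  have hder : ∀ y ∈ ball p (min δ1 δ2), fderiv ℝ D.r y η ≤ -(D.c / 4) := by
    intro y hy
    have h3 := (h2 p hp'.1).2 y (hs2 hy)
    have h4 := (fderiv ℝ D.r y - fderiv ℝ D.r p).le_opNorm η
    have h5 : ‖(fderiv ℝ D.r y - fderiv ℝ D.r p) η‖ ≤ D.c / 4 := by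
      refine h4.trans ?_
      calc _ ≤ D.c / 4 * 1 := by gcongr
        _ = _ := mul_one _
    rw [ContinuousLinearMap.sub_apply, norm_eq_abs] at h5
    linarith [le_abs_self (fderiv ℝ D.r y η - fderiv ℝ D.r p η)]
  -- mean value along the segment
  have hseg : ∀ s ∈ Icc (0:ℝ) t, x + s • η ∈ ball p (min δ1 δ2) := by
    intro s hs
    rcases eq_or_lt_of_le ht with h0 | h0
    · have : s = 0 := le_antisymm (h0 ▸ hs.2) hs.1
      simpa [this] using hx
    have : x + s • η = (1 - s / t) • x + (s / t) • (x + t • η) := by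
      rw [smul_add, smul_smul, div_mul_cancel₀ _ h0.ne', ← add_assoc, ← add_smul, sub_add_cancel, one_smul]
    rw [this]
    exact convex_ball p _ hx hxt (by rw [sub_nonneg, div_le_one h0]; exact hs.2) (div_nonneg hs.1 ht) (by ring)
  have hd : ∀ s ∈ Icc (0:ℝ) t, HasDerivAt (fun s : ℝ => D.r (x + s • η)) (fderiv ℝ D.r (x + s • η) η) s := by
    intro s hs
    have h3 : HasFDerivAt D.r (fderiv ℝ D.r (x + s • η)) (x + s • η) :=
      ((hess_facts D.openU D.C2).1.differentiableAt (D.openU.mem_nhds ((h p hp'.1).1 (hs1 (hseg s hs))))).hasFDerivAt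
    have h4 : HasDerivAt (fun s : ℝ => x + s • η) η s := by
      simpa using ((hasDerivAt_id s).smul_const η).const_add x
    exact h3.comp_hasDerivAt s h4
  have := image_le_of_deriv_right_le_deriv_boundary (f := fun s : ℝ => D.r (x + s • η)) (a := 0) (b := t)
    (f' := fun s => fderiv ℝ D.r (x + s • η) η) (B := fun s => D.r x - D.c / 4 * s) (B' := fun _ => -(D.c / 4))
    (fun s hs => (hd s hs).continuousAt.continuousWithinAt)
    (fun s hs => (hd s ⟨hs.1, hs.2.le⟩).hasDerivWithinAt) (by simp)
    (by fun_prop)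
    (fun s _ => by
      have h5 := (((hasDerivAt_id s).const_mul (D.c / 4)).const_sub (D.r x)).hasDerivWithinAt (s := Ici s)
      simpa using h5)
    (fun s hs => hder _ (hseg s ⟨hs.1, hs.2.le⟩)) (show t ∈ Icc 0 t from ⟨ht, le_rfl⟩)
  exact this

variable {F : Type*} [NormedAddCommGroup F] [NormedSpace ℂ F]

lemma rpow_diff_le {m κ t α:ℝ} (hm : 0 < m) (hκ : 0 < κ) (ht : 0 ≤ t) (hα : 0 < α) (hα1 : α ≤ 1) :
  (m + κ * t) ^ α - m ^ α ≤ κ ^ α * t ^ α := by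
  have := Real.rpow_add_le_add_rpow hm.le (mul_nonneg hκ.le ht) hα.le hα1
  rw [mul_rpow hκ.le ht] at this
  linarith

lemma Dom.HL (D : Dom E) {α β:ℝ} (hα : 0 < α) (hα1 : α ≤ 1) (hβ : 0 < β) (hβ1 : β ≤ 1) :
  ∃ C > 0, ∃ δ > 0, ∀ (f : E → F) (A B:ℝ), 0 ≤ A → 0 ≤ B → DifferentiableOn ℂ f D.Ω →
  (∀ z ∈ D.Ω, ‖fderiv ℂ f z‖ ≤ A * (-D.r z) ^ (α - 1) + B * (-D.r z) ^ (β - 1)) →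
  ∀ z ∈ D.Ω, ∀ w ∈ D.Ω, ‖z - w‖ < δ → ‖f z - f w‖ ≤ C * (A * ‖z - w‖ ^ α + B * ‖z - w‖ ^ β) := by
  letI : NormedSpace ℝ F := NormedSpace.restrictScalars ℝ ℂ F
  obtain ⟨κ, hκ, L, hL, δ, hδ, hin⟩ := D.inward
  obtain ⟨c0, hc0, hnear⟩ := D.near_frontier (show 0 < δ / 4 by positivity)
  obtain ⟨cb, hcb, hball⟩ := D.ball_sub
  obtain ⟨L', hL', δ', hδ', hlip⟩ := D.lip'
  set K := 2 * L / κ with hK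
  have hKp : 0 < K := by positivity
  have hKκ : κ * K = 2 * L := by rw [hK]; field_simp
  -- constants
  set V : ℝ → ℝ := fun a => κ ^ a * K ^ a / (a * κ) with hV
  set H : ℝ → ℝ := fun a => L ^ (a - 1) with hH
  set I : ℝ → ℝ := fun a => (c0 / 2) ^ (a - 1) with hI
  have hVp : ∀ a, 0 < a → 0 < V a := fun a ha => by simp only [hV]; positivity
  have hHp : ∀ a, 0 < H a := fun a => rpow_pos_of_pos hL _
  have hIp : ∀ a, 0 < I a := fun a => rpow_pos_of_pos (by positivity) _
  set Q : ℝ → ℝ := fun a => 2 * V a + H a + I a with hQ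
  have hQp : ∀ a, 0 < a → 0 < Q a := fun a ha => by
    have := hVp a ha; have := hHp a; have := hIp a; simp only [hQ]; positivity
  set δf := min (min (δ / (4 * (K + 1))) 1) (min (cb * c0) (min δ' (c0 / (2 * L')))) with hδf
  have hδfp : 0 < δf := by positivity
  refine ⟨Q α + Q β, add_pos (hQp α hα) (hQp β hβ), δf, hδfp, fun f A B hA hB hf hbd z hz w hw hzw => ?_⟩
  set s := ‖z - w‖ with hs
  have hs0 : 0 ≤ s := norm_nonneg _
  -- reduce to a sharper bound
  suffices hsuf : ‖f z - f w‖ ≤ Q α * (A * s ^ α) + Q β * (B * s ^ β) by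
    have h1 : 0 ≤ Q α * (B * s ^ β) := by have := hQp α hα; positivity
    have h2 : 0 ≤ Q β * (A * s ^ α) := by have := hQp β hβ; positivity
    nlinarith
  rcases eq_or_lt_of_le hs0 with h0 | hspos
  · have : z = w := by rw [← sub_eq_zero, ← norm_eq_zero]; exact h0.symm
    subst this
    simp only [sub_self, norm_zero]
    have h1 := hQp α hα; have h2 := hQp β hβ
    positivity
  have hfd : ∀ y ∈ D.Ω, HasFDerivAt f (fderiv ℂ f y) y := fun y hy =>
    (hf.differentiableAt (D.isOpen.mem_nhds hy)).hasFDerivAt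
  -- bound on a segment where -r ≥ m
  have hseg : ∀ (a b:E) (m:ℝ), 0 < m → (∀ y ∈ segment ℝ a b, y ∈ D.Ω ∧ m ≤ -D.r y) →
      ‖f b - f a‖ ≤ (A * m ^ (α - 1) + B * m ^ (β - 1)) * ‖b - a‖ := by
    intro a b m hm hab
    refine Convex.norm_image_sub_le_of_norm_hasFDerivWithin_le (𝕜 := ℝ) (s := segment ℝ a b)
      (f' := fun y => (fderiv ℂ f y).restrictScalars ℝ)
      (fun y hy => ((hfd y (hab y hy).1).restrictScalars ℝ).hasFDerivWithinAt) (fun y hy => ?_)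
      (convex_segment a b) (left_mem_segment ℝ a b) (right_mem_segment ℝ a b)
    rw [ContinuousLinearMap.norm_restrictScalars]
    refine (hbd y (hab y hy).1).trans ?_
    have h1 := rpow_le_rpow_of_nonpos hm (hab y hy).2 (show α - 1 ≤ 0 by linarith)
    have h2 := rpow_le_rpow_of_nonpos hm (hab y hy).2 (show β - 1 ≤ 0 by linarith)
    gcongr
  by_cases hcase : -D.r z < c0
  · -- near the boundary
    obtain ⟨p, hp, hzp⟩ := hnear z hz hcase
    obtain ⟨hU, hLip, η, hη, hηr⟩ := hin p hp
    have hδ1 : (K + 1) * s ≤ δ / 4 := by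
      have h1 : s ≤ δ / (4 * (K + 1)) := hzw.le.trans ((min_le_left _ _).trans (min_le_left _ _))
      calc (K + 1) * s ≤ (K + 1) * (δ / (4 * (K + 1))) := by gcongr
        _ = δ / 4 := by field_simp
    have hsδ : s ≤ δ / 4 := by nlinarith
    have hKs : K * s ≤ δ / 4 := by nlinarith
    set T := K * s with hT
    have hTp : 0 < T := by positivity
    have hzb : ‖z - p‖ < δ / 2 := by linarith
    have hwb : ‖w - p‖ < δ / 2 := by
      calc ‖w - p‖ = ‖(z - p) - (z - w)‖ := by congr 1; abel
        _ ≤ ‖z - p‖ + ‖z - w‖ := norm_sub_le _ _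
        _ < _ := by linarith
    have hup : ∀ x : E, ‖x - p‖ < δ / 2 → ∀ t ∈ Icc 0 T, x + t • η ∈ ball p δ := by
      intro x hx t ht
      rw [mem_ball, dist_eq_norm]
      calc ‖x + t • η - p‖ = ‖(x - p) + t • η‖ := by congr 1; abel
        _ ≤ ‖x - p‖ + ‖t • η‖ := norm_add_le _ _
        _ ≤ ‖x - p‖ + t * 1 := by
          rw [norm_smul, norm_of_nonneg ht.1]
          have := ht.1
          gcongr
        _ < δ := by linarith [ht.2]
    have hvert : ∀ x ∈ D.Ω, ‖x - p‖ < δ / 2 →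
        ‖f (x + T • η) - f x‖ ≤ V α * (A * s ^ α) + V β * (B * s ^ β) := by
      intro x hx hxp
      set m := -D.r x with hm
      have hmp : 0 < m := by have := D.neg hx; linarith
      have hxb : x ∈ ball p δ := by simpa using hup x hxp 0 ⟨le_rfl, hTp.le⟩
      have hin2 : ∀ t ∈ Icc 0 T, x + t • η ∈ D.Ω ∧ m + κ * t ≤ -D.r (x + t • η) := by
        intro t ht
        have h1 := hηr x hxb t ht.1 (hup x hxp t ht)
        have h2 : m + κ * t ≤ -D.r (x + t • η) := by linarith
        refine ⟨(D.mem (hU (hup x hxp t ht))).2 ?_, h2⟩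
        have := mul_nonneg hκ.le ht.1
        linarith
      have hd : ∀ t ∈ Icc 0 T, HasDerivAt (fun t : ℝ => f (x + t • η) - f x) (fderiv ℂ f (x + t • η) η) t := by
        intro t ht
        have h3 := (hfd _ (hin2 t ht).1).restrictScalars ℝ
        have h4 : HasDerivAt (fun s : ℝ => x + s • η) η t := by
          simpa using ((hasDerivAt_id t).smul_const η).const_add x
        exact (h3.comp_hasDerivAt t h4).sub_const _
      let Bf : ℝ → ℝ → ℝ := fun a t => ((m + κ * t) ^ a - m ^ a) / (a * κ)
      have hBf : ∀ a, 0 < a → ∀ t, 0 ≤ t → HasDerivAt (Bf a) ((m + κ * t) ^ (a - 1)) t := by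
        intro a ha t ht
        have h5 : HasDerivAt (fun t : ℝ => m + κ * t) κ t := by
          simpa using ((hasDerivAt_id t).const_mul κ).const_add m
        have h6 := ((h5.rpow_const (p := a) (Or.inl (by positivity))).sub_const (m ^ a)).div_const (a * κ)
        have h7 : κ * a * (m + κ * t) ^ (a - 1) / (a * κ) = (m + κ * t) ^ (a - 1) := by
          rw [div_eq_iff (by positivity)]; ring
        rw [h7] at h6
        exact h6
      have := image_norm_le_of_norm_deriv_right_le_deriv_boundary' (f := fun t : ℝ => f (x + t • η) - f x)
        (a := 0) (b := T) (f' := fun t => fderiv ℂ f (x + t • η) η)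
        (B := fun t => A * Bf α t + B * Bf β t)
        (B' := fun t => A * (m + κ * t) ^ (α - 1) + B * (m + κ * t) ^ (β - 1))
        (fun t ht => (hd t ht).continuousAt.continuousWithinAt)
        (fun t ht => (hd t ⟨ht.1, ht.2.le⟩).hasDerivWithinAt)
        (by simp [Bf])
        (fun t ht => (((hBf α hα t ht.1).const_mul A).add ((hBf β hβ t ht.1).const_mul B)).continuousAt.continuousWithinAt)
        (fun t ht => (((hBf α hα t ht.1).const_mul A).add ((hBf β hβ t ht.1).const_mul B)).hasDerivWithinAt)
        (fun t ht => by
          have h7 := hin2 t ⟨ht.1, ht.2.le⟩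
          have hpos : 0 < m + κ * t := by have := mul_nonneg hκ.le ht.1; linarith
          have h8 := rpow_le_rpow_of_nonpos hpos h7.2 (show α - 1 ≤ 0 by linarith)
          have h9 := rpow_le_rpow_of_nonpos hpos h7.2 (show β - 1 ≤ 0 by linarith)
          calc ‖fderiv ℂ f (x + t • η) η‖ ≤ ‖fderiv ℂ f (x + t • η)‖ * ‖η‖ := ContinuousLinearMap.le_opNorm _ _
            _ ≤ ‖fderiv ℂ f (x + t • η)‖ * 1 := by gcongr
            _ ≤ _ := by
              rw [mul_one]
              refine (hbd _ h7.1).trans ?_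
              gcongr) (show T ∈ Icc 0 T from ⟨hTp.le, le_rfl⟩)
      refine this.trans ?_
      have hB2 : ∀ a, 0 < a → a ≤ 1 → Bf a T ≤ V a * s ^ a := by
        intro a ha ha1
        have h1 := rpow_diff_le hmp hκ hTp.le ha ha1
        simp only [Bf, hV]
        rw [div_mul_eq_mul_div]
        gcongr
        rw [hT, mul_rpow hKp.le hs0] at h1
        linarith
      have h1 := mul_le_mul_of_nonneg_left (hB2 α hα hα1) hA
      have h2 := mul_le_mul_of_nonneg_left (hB2 β hβ hβ1) hB
      linarith
    have hmid : ‖f (w + T • η) - f (z + T • η)‖ ≤ H α * (A * s ^ α) + H β * (B * s ^ β) := by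
      have hTT : T ∈ Icc 0 T := ⟨hTp.le, le_rfl⟩
      have h1 := hseg (z + T • η) (w + T • η) (L * s) (by positivity) (by
        intro y hy
        have hyb : y ∈ ball p δ := (convex_ball p δ).segment_subset (hup z hzb T hTT) (hup w hwb T hTT) hy
        obtain ⟨θ, hθ, rfl⟩ := (segment_eq_image' ℝ (z + T • η) (w + T • η)) ▸ hy
        have heq : z + T • η + θ • (w + T • η - (z + T • η)) = (z + θ • (w - z)) + T • η := by
          rw [add_sub_add_right_eq_sub]; abel
        simp only [heq] at hyb ⊢
        have hx2 : ‖θ • (w - z)‖ ≤ s := by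
          rw [norm_smul, norm_of_nonneg hθ.1, ← norm_neg (w - z), neg_sub]
          calc θ * s ≤ 1 * s := by gcongr; exact hθ.2
            _ = s := one_mul s
        have hxb : z + θ • (w - z) ∈ ball p δ := by
          rw [mem_ball, dist_eq_norm]
          calc ‖z + θ • (w - z) - p‖ = ‖(z - p) + θ • (w - z)‖ := by congr 1; abel
            _ ≤ _ := norm_add_le _ _
            _ < δ := by linarith
        have h2 := hηr _ hxb T hTp.le hyb
        have h3 := hLip _ hxb z (by rw [mem_ball, dist_eq_norm]; linarith)
        rw [add_sub_cancel_left] at h3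
        have h4 : L * ‖θ • (w - z)‖ ≤ L * s := by gcongr
        have h5 := D.neg hz
        have h6 := le_abs_self (D.r (z + θ • (w - z)) - D.r z)
        have h7 : κ * T = 2 * L * s := by rw [hT, ← mul_assoc, hKκ]
        have h8 : L * s ≤ -D.r (z + θ • (w - z) + T • η) := by linarith
        refine ⟨(D.mem (hU hyb)).2 ?_, h8⟩
        have : 0 < L * s := by positivity
        linarith)
      have h2 : ‖w + T • η - (z + T • η)‖ = s := by rw [add_sub_add_right_eq_sub, norm_sub_rev]
      rw [h2] at h1
      refine h1.trans (le_of_eq ?_)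
      have h3 : ∀ a : ℝ, (L * s) ^ (a - 1) * s = H a * s ^ a := by
        intro a
        rw [mul_rpow hL.le hs0]
        simp only [hH]
        rw [mul_assoc, rpow_sub_one hspos.ne', div_mul_cancel₀ _ hspos.ne']
      linear_combination A * h3 α + B * h3 β
    have hzv := hvert z hz hzb
    have hwv := hvert w hw hwb
    have hle : ‖f z - f w‖ ≤ ‖f (z + T • η) - f z‖ + ‖f (w + T • η) - f (z + T • η)‖ + ‖f (w + T • η) - f w‖ := by
      calc ‖f z - f w‖ = ‖(f (w + T • η) - f w) - (f (w + T • η) - f (z + T • η)) - (f (z + T • η) - f z)‖ := by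
            congr 1; abel
        _ ≤ ‖(f (w + T • η) - f w) - (f (w + T • η) - f (z + T • η))‖ + ‖f (z + T • η) - f z‖ := norm_sub_le _ _
        _ ≤ ‖f (w + T • η) - f w‖ + ‖f (w + T • η) - f (z + T • η)‖ + ‖f (z + T • η) - f z‖ := by
          gcongr; exact norm_sub_le _ _
        _ = _ := by ring
    have h1 : 0 ≤ I α * (A * s ^ α) := by have := hIp α; positivity
    have h2 : 0 ≤ I β * (B * s ^ β) := by have := hIp β; positivity
    simp only [hQ]
    linarith
  · push Not at hcase
    have hs1 : s ≤ 1 := hzw.le.trans ((min_le_left _ _).trans (min_le_right _ _))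
    have hd1 : s < cb * c0 := hzw.trans_le ((min_le_right _ _).trans (min_le_left _ _))
    have hd2 : s < δ' := hzw.trans_le ((min_le_right _ _).trans ((min_le_right _ _).trans (min_le_left _ _)))
    have hd3 : s ≤ c0 / (2 * L') := hzw.le.trans ((min_le_right _ _).trans ((min_le_right _ _).trans (min_le_right _ _)))
    have hL3 : L' * s ≤ c0 / 2 := by
      calc L' * s ≤ L' * (c0 / (2 * L')) := by gcongr
        _ = c0 / 2 := by field_simp
    have h1 := hseg z w (c0 / 2) (by positivity) (by
      intro y hy
      have hyz : ‖y - z‖ ≤ s := by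
        obtain ⟨θ, hθ, rfl⟩ := (segment_eq_image' ℝ z w) ▸ hy
        simp only [add_sub_cancel_left]
        rw [norm_smul, norm_of_nonneg hθ.1, ← norm_neg (w - z), neg_sub]
        calc θ * s ≤ 1 * s := by gcongr; exact hθ.2
          _ = s := one_mul s
      have h2 : y ∈ D.Ω := hball z hz (by
        rw [mem_ball, dist_eq_norm]
        refine (hyz.trans_lt hd1).trans_le ?_
        gcongr)
      refine ⟨h2, ?_⟩
      have h3 := (hlip z (subset_closure hz)).2.2 y (by rw [mem_ball, dist_eq_norm]; linarith) z (mem_ball_self hδ')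
      have h4 : L' * ‖y - z‖ ≤ L' * s := by gcongr
      have h6 := le_abs_self (D.r y - D.r z)
      linarith)
    rw [← norm_sub_rev] at h1
    refine h1.trans ?_
    rw [norm_sub_rev, ← hs]
    have h3 : ∀ a : ℝ, 0 < a → a ≤ 1 → s ≤ s ^ a := fun a ha ha1 => by
      have := rpow_le_rpow_of_exponent_ge hspos hs1 ha1
      simpa using this
    have h4 : ∀ a X : ℝ, 0 < a → a ≤ 1 → 0 ≤ X → X * (c0 / 2) ^ (a - 1) * s ≤ Q a * (X * s ^ a) := by
      intro a X ha ha1 hX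
      have h5 : I a ≤ Q a := by have := hVp a ha; have := hHp a; simp only [hQ]; linarith
      have h6 := h3 a ha ha1
      have h7 := hIp a
      calc X * (c0 / 2) ^ (a - 1) * s = I a * (X * s) := by simp only [hI]; ring
        _ ≤ Q a * (X * s ^ a) := by gcongr
    have h5 := h4 α A hα hα1 hA
    have h6 := h4 β B hβ hβ1 hB
    linarith

end

section

lemma deriv_comp_line {F : Type*} [NormedAddCommGroup F] [NormedSpace ℂ F] {f : E → F} {z:E} (v:E) (hf : DifferentiableAt ℂ f z) :
  HasDerivAt (fun ζ : ℂ => f (z + ζ • v)) (fderiv ℂ f z v) 0 := by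
  have h1 : HasDerivAt (fun ζ : ℂ => z + ζ • v) v 0 := by
    simpa using ((hasDerivAt_id (0:ℂ)).smul_const v).const_add z
  have h2 : HasFDerivAt f (fderiv ℂ f z) (z + (0:ℂ) • v) := by simpa using hf.hasFDerivAt
  exact h2.comp_hasDerivAt 0 h1

lemma line_diffOn {F : Type*} [NormedAddCommGroup F] [NormedSpace ℂ F] {f : E → F} {Ω : Set E} (hΩ : IsOpen Ω) (hf : DifferentiableOn ℂ f Ω)
  {z v:E} {S : Set ℂ} (h : ∀ ζ ∈ S, z + ζ • v ∈ Ω) :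
  DifferentiableOn ℂ (fun ζ : ℂ => f (z + ζ • v)) S := by
  refine hf.comp (t := Ω) ?_ h
  exact (line_curve z v).1.differentiableOn

lemma PMap.deriv_half {D1 D2 : Dom E} {f : E → E} (P : PMap D1 D2 f) :
  ∃ C > 0, ∀ z ∈ D1.Ω, ‖fderiv ℂ f z‖ ≤ C * (-D1.r z) ^ ((1/2:ℝ) - 1) := by
  obtain ⟨c, hc, hball⟩ := D1.ball_sub
  obtain ⟨C, hC, hdisc⟩ := D2.disc_lemma
  obtain ⟨k, hk, hhopf⟩ := P.hopf2
  refine ⟨sqrt (C / k) / c, by positivity, fun z hz => ?_⟩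
  set d := -D1.r z with hd
  have hdp : 0 < d := by have := D1.neg hz; linarith
  have hR : 0 < c * d := by positivity
  have hrp : d ^ ((1/2:ℝ) - 1) = sqrt d / d := by
    rw [rpow_sub_one hdp.ne', sqrt_eq_rpow]
  refine ContinuousLinearMap.opNorm_le_of_unit_norm (by positivity) fun v hv => ?_
  have hin : ∀ ζ ∈ ball (0:ℂ) 1, z + ζ • (((c * d:ℝ):ℂ) • v) ∈ D1.Ω := by
    intro ζ hζ
    apply hball z hz
    rw [mem_ball_zero_iff] at hζ
    rw [mem_ball_iff_norm, add_sub_cancel_left, norm_smul, norm_smul, hv, mul_one, norm_real,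
      norm_of_nonneg hR.le]
    nlinarith
  have h1 := hdisc (fun ζ => f (z + ζ • (((c * d:ℝ):ℂ) • v)))
    (line_diffOn D1.isOpen P.hol hin) (fun ζ hζ => P.maps (hin ζ hζ))
  rw [(deriv_comp_line _ (P.hol.differentiableAt (D1.isOpen.mem_nhds hz))).deriv, map_smul, norm_smul,
    norm_real, norm_of_nonneg hR.le] at h1
  simp only [zero_smul, add_zero] at h1
  have h2 : (c * d * ‖fderiv ℂ f z v‖) ^ 2 ≤ C / k * d := by
    refine h1.trans ?_
    have := hhopf z hz
    rw [div_mul_eq_mul_div, le_div_iff₀ hk]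
    nlinarith
  have h3 := le_sqrt_of_sq_le h2
  rw [sqrt_mul (by positivity)] at h3
  rw [hrp]
  rw [show sqrt (C / k) / c * (sqrt d / d) = sqrt (C/k) * sqrt d / (c * d) by
    field_simp, le_div_iff₀ hR]
  linarith

/-- a bound on the derivative gives the Hölder extension -/
lemma PMap.extend {D1 D2 : Dom E} {f : E → E} (P : PMap D1 D2 f) {α A:ℝ} (hα : 0 < α) (hα1 : α ≤ 1)
  (hA : 0 ≤ A) (h : ∀ z ∈ D1.Ω, ‖fderiv ℂ f z‖ ≤ A * (-D1.r z) ^ (α - 1)) :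
  ∃ C > 0, ∀ z ∈ D1.Ω, ∀ w ∈ D1.Ω, ‖f z - f w‖ ≤ C * ‖z - w‖ ^ α := by
  obtain ⟨C, hC, δ, hδ, hHL⟩ := D1.HL (F := E) hα hα1 hα hα1
  obtain ⟨M, hM⟩ := (D2.cpt.isBounded).exists_norm_le
  have hM0 : 0 ≤ M ∨ M < 0 := le_or_gt 0 M
  refine ⟨C * A + 2 * |M| / δ ^ α + 1, by positivity, fun z hz w hw => ?_⟩
  have hn : 0 ≤ ‖z - w‖ ^ α := by positivity
  rcases lt_or_ge ‖z - w‖ δ with h1 | h1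
  · have := hHL f A 0 hA le_rfl P.hol (by simpa using h) z hz w hw h1
    have h2 : 0 ≤ 2 * |M| / δ ^ α := by positivity
    simp only [zero_mul, add_zero] at this
    nlinarith
  · have h2 : δ ^ α ≤ ‖z - w‖ ^ α := by gcongr
    have h3 : ‖f z - f w‖ ≤ 2 * |M| := by
      have a1 := hM _ (subset_closure (P.maps hz))
      have a2 := hM _ (subset_closure (P.maps hw))
      have := norm_sub_le (f z) (f w)
      have := le_abs_self M
      linarith
    have h4 : 2 * |M| / δ ^ α * δ ^ α = 2 * |M| := by field_simp
    have h5 : 2 * |M| / δ ^ α * δ ^ α ≤ 2 * |M| / δ ^ α * ‖z - w‖ ^ α := by gcongr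
    have : 0 ≤ C * A * ‖z - w‖ ^ α := by positivity
    nlinarith

lemma PMap.half {D1 D2 : Dom E} {f : E → E} (P : PMap D1 D2 f) :
  ∃ C > 0, ∀ z ∈ D1.Ω, ∀ w ∈ D1.Ω, ‖f z - f w‖ ≤ C * ‖z - w‖ ^ (1/2:ℝ) := by
  obtain ⟨A, hA, h⟩ := P.deriv_half
  exact P.extend (by norm_num) (by norm_num) hA.le h

/-- Hölder functions extend to the closure -/
lemma holder_extend {f : E → E} {Ω : Set E} {C α:ℝ} (hα : 0 < α) (hC : 0 < C)
  (h : ∀ z ∈ Ω, ∀ w ∈ Ω, ‖f z - f w‖ ≤ C * ‖z - w‖ ^ α) :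
  ∃ F : E → E, ContinuousOn F (closure Ω) ∧ EqOn F f Ω ∧
  ∀ z ∈ closure Ω, ∀ w ∈ closure Ω, ‖F z - F w‖ ≤ C * ‖z - w‖ ^ α := by
  have hdist : ∀ z ∈ Ω, ∀ w ∈ Ω, dist (f z) (f w) ≤ C * dist z w ^ α := by
    simpa only [dist_eq_norm] using h
  have huc : UniformContinuousOn f Ω := by
    rw [Metric.uniformContinuousOn_iff]
    intro ε hε
    have hcont : Tendsto (fun t : ℝ => C * t ^ α) (𝓝 0) (𝓝 0) := by
      have : ContinuousAt (fun t : ℝ => C * t ^ α) 0 :=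
        (Real.continuousAt_rpow_const 0 α (Or.inr hα.le)).const_mul C
      simpa [ContinuousAt, zero_rpow hα.ne'] using this
    obtain ⟨δ, hδ, hd⟩ := Metric.eventually_nhds_iff.1 (hcont.eventually (gt_mem_nhds hε))
    refine ⟨δ, hδ, fun x hx y hy hxy => (hdist x hx y hy).trans_lt ?_⟩
    exact hd (by simpa using hxy)
  have hex : ∀ x ∈ closure Ω, ∃ y, Tendsto f (𝓝[Ω] x) (𝓝 y) := by
    intro x hx
    haveI : (𝓝[Ω] x).NeBot := mem_closure_iff_nhdsWithin_neBot.1 hx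
    have hc : Cauchy (map f (𝓝[Ω] x)) := by
      have h0 : Cauchy (𝓝[Ω] x) := (cauchy_nhds.mono nhdsWithin_le_nhds)
      refine cauchy_map_iff.2 ⟨inferInstance, ?_⟩
      refine Tendsto.mono_left huc (le_inf h0.2 ?_)
      rw [le_principal_iff]
      exact prod_mem_prod self_mem_nhdsWithin self_mem_nhdsWithin
    exact CompleteSpace.complete hc
  have hcf : ContinuousOn f Ω := huc.continuousOn
  refine ⟨extendFrom Ω f, continuousOn_extendFrom Subset.rfl hex, fun x hx => ?_, ?_⟩
  · exact extendFrom_eq (subset_closure hx) (hcf x hx)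
  · have hF : ContinuousOn (extendFrom Ω f) (closure Ω) := continuousOn_extendFrom Subset.rfl hex
    have heq : ∀ x ∈ Ω, extendFrom Ω f x = f x := fun x hx => extendFrom_eq (subset_closure hx) (hcf x hx)
    intro z hz w hw
    have hcl : (z, w) ∈ closure (Ω ×ˢ Ω) := by rw [closure_prod_eq]; exact ⟨hz, hw⟩
    have hcont : ContinuousOn (fun q : E × E => C * ‖q.1 - q.2‖ ^ α - ‖extendFrom Ω f q.1 - extendFrom Ω f q.2‖)
        (closure (Ω ×ˢ Ω)) := by
      rw [closure_prod_eq]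
      refine ContinuousOn.sub (ContinuousOn.mul continuousOn_const ?_) (ContinuousOn.norm (ContinuousOn.sub ?_ ?_))
      · exact ((continuous_fst.sub continuous_snd).norm.rpow_const (fun _ => Or.inr hα.le)).continuousOn
      · exact hF.comp continuousOn_fst (fun q hq => hq.1)
      · exact hF.comp continuousOn_snd (fun q hq => hq.2)
    have := le_on_closure (f := fun _ : E × E => (0:ℝ)) (s := Ω ×ˢ Ω) (fun q hq => by
      change (0:ℝ) ≤ _
      rw [heq _ hq.1, heq _ hq.2]
      exact sub_nonneg.2 (h _ hq.1 _ hq.2)) continuousOn_const hcont hcl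
    exact sub_nonneg.1 this

/-- closest point representation -/
lemma Dom.normal_rep (D : Dom E) : ∃ C > 0, ∃ L > 0, ∃ η > 0, ∀ z ∈ D.Ω, -D.r z < η →
  ∃ p ∈ frontier D.Ω, ∃ ν : E, ‖ν‖ = 1 ∧ ∃ s > 0, ∃ g : ℝ, D.c ≤ g ∧ g ≤ L ∧ s ≤ C * (-D.r z) ∧
  z = p + (s:ℂ) • ν ∧ ball z s ⊆ D.Ω ∧
  (∀ v, dl D.r p v = -(g:ℂ) * inner ℂ ν v) := by
  obtain ⟨κ, hκ, L, hL, δ, hδ, hin⟩ := D.inward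
  obtain ⟨η, hη, hnear⟩ := D.near_frontier (half_pos hδ)
  obtain ⟨L', hL', δ', hδ', hlip⟩ := D.lip
  refine ⟨1 / κ, by positivity, L', hL', min η (κ * (δ / 2)), by positivity, fun z hz hzη => ?_⟩
  have hdp : 0 < -D.r z := by have := D.neg hz; linarith
  obtain ⟨p0, hp0, hzp0⟩ := hnear z hz (hzη.trans_le (min_le_left _ _))
  have hzη2 := hzη.trans_le (min_le_right _ _)
  obtain ⟨p, hp, hpd⟩ := D.frontier_cpt.exists_infDist_eq_dist ⟨p0, hp0⟩ z
  have hzf : z ∉ frontier D.Ω := by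
    intro h; have := (D.mem_frontier.1 h).2; linarith
  set s := dist z p with hs
  have hspos : 0 < s := dist_pos.2 (fun h => hzf (h ▸ hp))
  have hball : ball z s ⊆ D.Ω := by
    by_contra hcon
    have h1 : (ball z s ∩ frontier D.Ω).Nonempty := by
      by_contra hne
      obtain ⟨x, hx, hx'⟩ := not_subset.1 hcon
      have hpre := (convex_ball z s).isPreconnected D.Ω (closure D.Ω)ᶜ D.isOpen isClosed_closure.isOpen_compl
        (fun y hy => by
          by_cases hyc : y ∈ closure D.Ω
          · left
            by_contra hyn
            exact hne ⟨y, hy, by rw [D.isOpen.frontier_eq]; exact ⟨hyc, hyn⟩⟩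
          · right; exact hyc)
        ⟨z, mem_ball_self hspos, hz⟩
        ⟨x, hx, fun hxc => hne ⟨x, hx, by rw [D.isOpen.frontier_eq]; exact ⟨hxc, hx'⟩⟩⟩
      obtain ⟨y, -, hy1, hy2⟩ := hpre
      exact hy2 (subset_closure hy1)
    obtain ⟨x, hx, hxf⟩ := h1
    have := infDist_le_dist_of_mem (x := z) hxf
    rw [mem_ball, dist_comm] at hx
    linarith
  have hsd : s ≤ 1 / κ * (-D.r z) := by
    obtain ⟨hU, -, e, he, her⟩ := hin p0 hp0
    by_contra hcon
    push Not at hcon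
    set t := 1 / κ * (-D.r z) with ht
    have htp : 0 < t := by positivity
    have hκt : κ * t = -D.r z := by rw [ht]; field_simp
    have htδ : t < δ / 2 := by
      by_contra h; push Not at h; nlinarith
    have hzb : z ∈ ball p0 δ := by rw [mem_ball_iff_norm]; linarith
    have hx : z - t • e ∈ ball z s := by
      rw [mem_ball_iff_norm]
      have : ‖z - t • e - z‖ = t * ‖e‖ := by
        rw [sub_sub_cancel_left, norm_neg, norm_smul, norm_of_nonneg htp.le]
      rw [this]; nlinarith
    have hxb : z - t • e ∈ ball p0 δ := by
      rw [mem_ball_iff_norm]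
      have h2 : ‖z - t • e - p0‖ ≤ ‖z - p0‖ + t * ‖e‖ := by
        have : z - t • e - p0 = (z - p0) - t • e := by abel
        rw [this]
        refine (norm_sub_le _ _).trans ?_
        rw [norm_smul, norm_of_nonneg htp.le]
      nlinarith
    have h3 := her _ hxb t htp.le (by simpa using hzb)
    rw [sub_add_cancel] at h3
    have := D.neg (hball hx)
    linarith
  have hpc : p ∈ closure D.Ω := frontier_subset_closure hp
  have hpU := D.sub hpc
  have hdiff : HasFDerivAt D.r (fderiv ℝ D.r p) p :=
    ((hess_facts D.openU D.C2).1.differentiableAt (D.openU.mem_nhds hpU)).hasFDerivAt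
  set ℓ := fderiv ℝ D.r p with hℓ
  have hrp : D.r p = 0 := (D.mem_frontier.1 hp).2
  have hsn : ‖z - p‖ = s := by rw [hs, dist_eq_norm]
  have key : ∀ e : E, 0 < (inner ℂ (z - p) e:ℂ).re → ℓ e ≤ 0 := by
    intro e he
    by_contra hcon
    push Not at hcon
    have h1 : HasDerivAt (fun t : ℝ => D.r (p + t • e)) (ℓ e) 0 := by
      have h2 : HasDerivAt (fun t : ℝ => p + t • e) e 0 := by
        simpa using ((hasDerivAt_id (0:ℝ)).smul_const e).const_add p
      exact (HasFDerivAt.comp_hasDerivAt 0 (f := fun t : ℝ => p + t • e) (by simpa using hdiff) h2)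
    have h3 : ∀ᶠ t in 𝓝[>] (0:ℝ), 0 < D.r (p + t • e) := by
      have := h1.tendsto_slope_zero_right.eventually (lt_mem_nhds hcon)
      filter_upwards [this, self_mem_nhdsWithin] with t ht ht0
      have ht0' : (0:ℝ) < t := ht0
      simp only [zero_add, zero_smul, add_zero, hrp, sub_zero, smul_eq_mul] at ht
      exact (mul_pos_iff_of_pos_left (inv_pos.2 ht0')).1 ht
    have h4 : ∀ᶠ t in 𝓝[>] (0:ℝ), p + t • e ∈ ball z s := by
      have hlim : ∀ᶠ t in 𝓝[>] (0:ℝ), t * ‖e‖ ^ 2 < 2 * (inner ℂ (z - p) e:ℂ).re := by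
        have : Tendsto (fun t : ℝ => t * ‖e‖ ^ 2) (𝓝[>] 0) (𝓝 0) := by
          have h5 : Continuous (fun t : ℝ => t * ‖e‖ ^ 2) := by fun_prop
          simpa using (h5.tendsto 0).mono_left nhdsWithin_le_nhds
        exact this.eventually (gt_mem_nhds (by linarith))
      filter_upwards [hlim, self_mem_nhdsWithin] with t ht ht0
      have ht0' : (0:ℝ) < t := ht0
      rw [mem_ball_iff_norm, ← sq_lt_sq₀ (norm_nonneg _) hspos.le]
      have h6 : p + t • e - z = -((z - p) - (t:ℂ) • e) := by rw [coe_smul]; abel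
      rw [h6, norm_neg, norm_sub_sq (𝕜 := ℂ), hsn, inner_smul_right, norm_smul, norm_real,
        norm_of_nonneg ht0'.le]
      simp only [RCLike.re_to_complex, re_ofReal_mul]
      nlinarith
    obtain ⟨t, ht1, ht2⟩ := (h3.and h4).exists
    exact absurd (D.neg (hball ht2)) (by linarith)
  set ν : E := ((s⁻¹:ℝ):ℂ) • (z - p) with hν
  have hνn : ‖ν‖ = 1 := by
    rw [hν, norm_smul, norm_real, norm_of_nonneg (by positivity), hsn]; field_simp
  have hzν : z - p = (s:ℂ) • ν := by
    rw [hν, smul_smul, ← ofReal_mul, mul_inv_cancel₀ hspos.ne']; simp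
  clear_value ν
  have key2 : ∀ e : E, 0 < (inner ℂ ν e:ℂ).re → ℓ e ≤ 0 := by
    intro e he
    apply key
    rw [hzν, inner_smul_left, conj_ofReal, re_ofReal_mul]
    positivity
  have hνν : (inner ℂ ν ν:ℂ) = 1 := by
    rw [inner_self_eq_norm_sq_to_K, hνn]; simp
  have hle : ∀ v : E, ℓ v ≤ (inner ℂ ν v:ℂ).re * ℓ ν := by
    intro v
    refine le_of_forall_pos_le_add fun ε hε => ?_
    have hℓν : ℓ ν ≤ 0 := key2 ν (by rw [hνν]; norm_num)
    set ε' := ε / (1 - ℓ ν) with hε'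
    have h1 : 0 < 1 - ℓ ν := by linarith
    have hε'p : 0 < ε' := by positivity
    have h2 := key2 (v - (inner ℂ ν v:ℂ).re • ν + ε' • ν) (by
      rw [inner_add_right, inner_sub_right, ← coe_smul, ← coe_smul, inner_smul_right,
        inner_smul_right, hνν]
      simpa using hε'p)
    simp only [map_add, map_sub, map_smul, smul_eq_mul] at h2
    have h3 : ε' * (1 - ℓ ν) = ε := by rw [hε']; field_simp
    nlinarith
  have heq : ∀ v : E, ℓ v = (inner ℂ ν v:ℂ).re * ℓ ν := by
    intro v
    refine le_antisymm (hle v) ?_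
    have := hle (-v)
    rw [map_neg, inner_neg_right, neg_re] at this
    linarith
  have hg0 : 0 ≤ -ℓ ν := by have := key2 ν (by rw [hνν]; norm_num); linarith
  have hgn : ‖ℓ‖ ≤ -ℓ ν := by
    refine opNorm_le_bound _ hg0 fun v => ?_
    rw [heq v, norm_mul, Real.norm_of_nonpos (by linarith : ℓ ν ≤ 0), mul_comm]
    refine mul_le_mul_of_nonneg_left ?_ hg0
    have h1 : ‖(inner ℂ ν v:ℂ)‖ ≤ ‖ν‖ * ‖v‖ := norm_inner_le_norm _ _
    rw [hνn, one_mul] at h1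
    exact (abs_re_le_norm _).trans h1
  refine ⟨p, hp, ν, hνn, s, hspos, -ℓ ν, ?_, ?_, hsd, ?_, hball, ?_⟩
  · exact (D.grad_ge p hpc (by rw [hrp]; linarith [D.δ_pos])).trans hgn
  · have h1 := (hlip p hpc).2 p (mem_ball_self hδ')
    have h2 := ℓ.le_opNorm ν
    rw [hνn, mul_one, norm_eq_abs] at h2
    exact (neg_le_abs _).trans (h2.trans h1)
  · rw [← hzν]; abel
  · intro v
    rw [dl_apply, ← hℓ, heq v, heq (I • v), inner_smul_right]
    apply Complex.ext <;> simp <;> ring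
end

section
variable {E : Type*} [NormedAddCommGroup E] [NormedSpace ℂ E] [CompleteSpace E]

lemma hess_symm {κ : E → ℝ} {V : Set E} (hV : IsOpen V) (hκ : ContDiffOn ℝ 2 κ V) {x:E}
  (hx : x ∈ V) (a b:E) : Hess κ x a b = Hess κ x b a := by
  have h : ContDiffAt ℝ 2 κ x := hκ.contDiffAt (hV.mem_nhds hx)
  have := h.isSymmSndFDerivAt (by simp)
  exact this a b

/-- complex bilinear part of the second derivative -/
noncomputable def Bf (κ : E → ℝ) (x v Y:E) : ℂ :=
  ((1 / 2 * (Hess κ x v Y - Hess κ x (I • v) (I • Y)):ℝ):ℂ) -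
    ((1 / 2 * (Hess κ x v (I • Y) + Hess κ x (I • v) Y):ℝ):ℂ) * I

/-- sesquilinear part of the second derivative -/
noncomputable def Ls (κ : E → ℝ) (x v Y:E) : ℂ :=
  ((1 / 2 * (Hess κ x v Y + Hess κ x (I • v) (I • Y)):ℝ):ℂ) +
    ((1 / 2 * (Hess κ x (I • v) Y - Hess κ x v (I • Y)):ℝ):ℂ) * I

lemma smul_decomp_I (c:ℂ) (v:E) :
  I • (c • v) = (c.re:ℝ) • (I • v) - (c.im:ℝ) • v := by
  rw [← coe_smul, ← coe_smul, smul_smul, smul_smul, ← sub_smul]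
  congr 1
  conv_lhs => rw [← re_add_im c]
  linear_combination (c.im:ℂ) * I_mul_I

lemma smul_decomp' (c:ℂ) (v:E) : c • v = (c.re:ℝ) • v + (c.im:ℝ) • (I • v) := by
  rw [← coe_smul, ← coe_smul, smul_smul, ← add_smul, re_add_im]

lemma hess_le (κ : E → ℝ) (x a b:E) : |Hess κ x a b| ≤ ‖Hess κ x‖ * ‖a‖ * ‖b‖ := by
  simpa using (Hess κ x).le_opNorm₂ a b

lemma norm_I_smul (v:E) : ‖I • v‖ = ‖v‖ := by rw [norm_smul]; simp

lemma four_bound {h1 h2 h3 h4 M:ℝ} (a1 : |h1| ≤ M) (a2 : |h2| ≤ M) (a3 : |h3| ≤ M) (a4 : |h4| ≤ M) :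
  ‖((1 / 2 * (h1 - h2):ℝ):ℂ) - ((1 / 2 * (h3 + h4):ℝ):ℂ) * I‖ ≤ 2 * M ∧
  ‖((1 / 2 * (h1 + h2):ℝ):ℂ) + ((1 / 2 * (h4 - h3):ℝ):ℂ) * I‖ ≤ 2 * M := by
  rw [abs_le] at a1 a2 a3 a4
  constructor
  · refine (norm_sub_le _ _).trans ?_
    rw [norm_mul, norm_I, mul_one, norm_real, norm_real, norm_eq_abs,
      norm_eq_abs]
    have h5 : |1 / 2 * (h1 - h2)| ≤ M := abs_le.2 ⟨by linarith, by linarith⟩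
    have h6 : |1 / 2 * (h3 + h4)| ≤ M := abs_le.2 ⟨by linarith, by linarith⟩
    linarith
  · refine (norm_add_le _ _).trans ?_
    rw [norm_mul, norm_I, mul_one, norm_real, norm_real, norm_eq_abs,
      norm_eq_abs]
    have h5 : |1 / 2 * (h1 + h2)| ≤ M := abs_le.2 ⟨by linarith, by linarith⟩
    have h6 : |1 / 2 * (h4 - h3)| ≤ M := abs_le.2 ⟨by linarith, by linarith⟩
    linarith

lemma Bf_Ls_le (κ : E → ℝ) (x v Y:E) : ‖Bf κ x v Y‖ ≤ 2 * ‖Hess κ x‖ * ‖v‖ * ‖Y‖ ∧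
  ‖Ls κ x v Y‖ ≤ 2 * ‖Hess κ x‖ * ‖v‖ * ‖Y‖ := by
  have h := four_bound (hess_le κ x v Y)
    (by simpa [norm_I_smul] using hess_le κ x (I • v) (I • Y))
    (by simpa [norm_I_smul] using hess_le κ x v (I • Y))
    (by simpa [norm_I_smul] using hess_le κ x (I • v) Y)
  refine ⟨h.1.trans (le_of_eq (by ring)), h.2.trans (le_of_eq (by ring))⟩

/-- linear version in the second slot -/
noncomputable def LsL (κ : E → ℝ) (x v:E) : E →L[ℂ] ℂ :=
  LinearMap.mkContinuous
    { toFun := fun Y => Ls κ x v Y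
      map_add' := fun Y Z => by
        simp only [Ls, smul_add, map_add]; push_cast; ring
      map_smul' := fun c Y => by
        unfold Ls
        rw [smul_decomp_I c Y, smul_decomp' c Y]
        simp only [map_add, map_sub, map_smul, smul_eq_mul, RingHom.id_apply]
        conv_rhs => rw [← re_add_im c]
        push_cast
        linear_combination (1/2 * c.im * (Hess κ x v (I • Y) - Hess κ x (I • v) Y)) * I_mul_I }
    (2 * ‖Hess κ x‖ * ‖v‖) (fun Y => (Bf_Ls_le κ x v Y).2)

lemma LsL_apply (κ : E → ℝ) (x v Y:E) : LsL κ x v Y = Ls κ x v Y := rfl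

noncomputable def BL (κ : E → ℝ) (x:E) : E →L[ℂ] E →L[ℂ] ℂ :=
  LinearMap.mkContinuous₂ (LinearMap.mk₂ ℂ (Bf κ x)
    (fun a b Y => by simp only [Bf, smul_add, map_add, add_apply]; push_cast; ring)
    (fun c a Y => by
      unfold Bf
      rw [smul_decomp_I c a, smul_decomp' c a]
      simp only [map_add, map_sub, map_smul, smul_eq_mul, add_apply, sub_apply, smul_apply]
      conv_rhs => rw [← re_add_im c]
      push_cast
      linear_combination (1/2 * c.im * (Hess κ x a (I • Y) + Hess κ x (I • a) Y)) * I_mul_I)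
    (fun a Y Z => by simp only [Bf, smul_add, map_add]; push_cast; ring)
    (fun c a Y => by
      unfold Bf
      rw [smul_decomp_I c Y, smul_decomp' c Y]
      simp only [map_add, map_sub, map_smul, smul_eq_mul]
      conv_rhs => rw [← re_add_im c]
      push_cast
      linear_combination (1/2 * c.im * (Hess κ x a (I • Y) + Hess κ x (I • a) Y)) * I_mul_I))
    (2 * ‖Hess κ x‖) (fun v Y => (Bf_Ls_le κ x v Y).1)

lemma BL_apply (κ : E → ℝ) (x v Y:E) : BL κ x v Y = Bf κ x v Y := rfl

lemma Ls_conj {κ : E → ℝ} {V : Set E} (hV : IsOpen V) (hκ : ContDiffOn ℝ 2 κ V) {x:E}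
  (hx : x ∈ V) (a b:E) : Ls κ x a b = (starRingEnd ℂ) (Ls κ x b a) := by
  simp only [Ls, map_add, map_mul, conj_ofReal, Complex.conj_I, hess_symm hV hκ hx a b,
    hess_symm hV hκ hx (I • a) b, hess_symm hV hκ hx a (I • b),
    hess_symm hV hκ hx (I • a) (I • b)]
  push_cast; ring

lemma BL_symm {κ : E → ℝ} {V : Set E} (hV : IsOpen V) (hκ : ContDiffOn ℝ 2 κ V) {x:E}
  (hx : x ∈ V) (a b:E) : BL κ x a b = BL κ x b a := by
  simp only [BL_apply, Bf, hess_symm hV hκ hx a b,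
    hess_symm hV hκ hx (I • a) b, hess_symm hV hκ hx a (I • b),
    hess_symm hV hκ hx (I • a) (I • b)]
  push_cast; ring

lemma Ls_self {κ : E → ℝ} {V : Set E} (hV : IsOpen V) (hκ : ContDiffOn ℝ 2 κ V) {x:E}
  (hx : x ∈ V) (a:E) : Ls κ x a a = ((2 * levi κ x a:ℝ):ℂ) := by
  simp only [Ls, levi, hess_symm hV hκ hx (I • a) a]
  push_cast; ring

lemma bq_eq (κ : E → ℝ) (x v:E) : bq κ x v = 1 / 2 * BL κ x v v := by
  simp only [bq, BL_apply, Bf]; push_cast; ring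

/-- first order expansion of `dl` -/
lemma dl_expand {κ : E → ℝ} {V K : Set E} (hV : IsOpen V) (hκ : ContDiffOn ℝ 2 κ V)
  (hK : IsCompact K) (hKV : K ⊆ V) {ε:ℝ} (hε : 0 < ε) :
  ∃ δ > 0, ∀ x ∈ K, ball x δ ⊆ V ∧ ∀ v : E, ‖v‖ < δ → ∀ Y : E,
  ‖dl κ (x + v) Y - dl κ x Y - BL κ x v Y - Ls κ x v Y‖ ≤ ε * ‖v‖ * ‖Y‖ := by
  obtain ⟨δ, hδ, h⟩ := hess_unif hV hκ hK hKV (ε := ε / 2) (by positivity)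
  refine ⟨δ, hδ, fun x hx => ⟨(h x hx).1, fun v hv Y => ?_⟩⟩
  have hsub := (h x hx).1
  have hd := (hess_facts hV hκ).2.1
  have key : ‖fderiv ℝ κ (x + v) - fderiv ℝ κ x - Hess κ x v‖ ≤ ε / 2 * ‖v‖ := by
    have h1 := (convex_ball x δ).norm_image_sub_le_of_norm_hasFDerivWithin_le'
      (f := fderiv ℝ κ) (f' := fun y => Hess κ y) (φ := Hess κ x) (C := ε / 2) (x := x) (y := x + v)
      (fun y hy => ((hd.differentiableAt (hV.mem_nhds (hsub hy))).hasFDerivAt).hasFDerivWithinAt)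
      (fun y hy => ContinuousLinearMap.opNorm_le_bound₂ _ (by positivity) (fun a b => by
        simpa using (h x hx).2 y hy a b)) (mem_ball_self hδ) (by simpa [mem_ball_iff_norm] using hv)
    simpa using h1
  have key2 : ∀ Z : E, |fderiv ℝ κ (x + v) Z - fderiv ℝ κ x Z - Hess κ x v Z| ≤ ε / 2 * ‖v‖ * ‖Z‖ := by
    intro Z
    have := (fderiv ℝ κ (x + v) - fderiv ℝ κ x - Hess κ x v).le_of_opNorm_le key Z
    simpa using this
  have e : dl κ (x + v) Y - dl κ x Y - BL κ x v Y - Ls κ x v Y =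
      ((fderiv ℝ κ (x + v) Y - fderiv ℝ κ x Y - Hess κ x v Y:ℝ):ℂ) -
      ((fderiv ℝ κ (x + v) (I • Y) - fderiv ℝ κ x (I • Y) - Hess κ x v (I • Y):ℝ):ℂ)
        * I := by
    simp only [dl_apply, BL_apply, Bf, Ls]; push_cast; ring
  rw [e]
  refine (norm_sub_le _ _).trans ?_
  rw [norm_mul, norm_I, mul_one, norm_real, norm_real, norm_eq_abs,
      norm_eq_abs]
  have h1 := key2 Y
  have h2 := key2 (I • Y)
  rw [norm_I_smul] at h2
  linarith
end

section
/-- Holomorphic functions with positive real part. -/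
lemma pos_re_bound {H : ℂ → ℂ} {a:ℝ} (ha : 0 < a) (hH : DifferentiableOn ℂ H (ball 0 a))
  (hpos : ∀ ζ ∈ ball (0:ℂ) a, 0 < (H ζ).re) {z:ℂ} (hz : z ∈ ball (0:ℂ) a) :
  ‖H z - H 0‖ ≤ 2 * (H 0).re * ‖z‖ / (a - ‖z‖) := by
  have h := Complex.borelCaratheodory_zero (f := fun ζ => H 0 - H ζ) (M := (H 0).re) (R := a) (z := z)
    (hpos 0 (mem_ball_self ha)) (hH.const_sub _) (fun ζ hζ => by
      change (H 0 - H ζ).re ≤ _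
      rw [sub_re]; have := hpos ζ hζ; linarith) ha hz (by simp)
  rwa [norm_sub_rev] at h

lemma pos_re_deriv {H : ℂ → ℂ} {a:ℝ} (ha : 0 < a) (hH : DifferentiableOn ℂ H (ball 0 a))
  (hpos : ∀ ζ ∈ ball (0:ℂ) a, 0 < (H ζ).re) : ‖deriv H 0‖ ≤ 2 * (H 0).re / a := by
  have h0 := hpos 0 (mem_ball_self ha)
  have key : ∀ r ∈ Ioo 0 a, ‖deriv H 0‖ ≤ 2 * (H 0).re / (a - r) := by
    intro r hr
    have hr2 : 0 < a - r := by linarith [hr.2]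
    refine norm_deriv_le_of_lip' (by positivity) ?_
    filter_upwards [ball_mem_nhds (0:ℂ) hr.1] with ζ hζ
    rw [mem_ball_zero_iff] at hζ
    refine (pos_re_bound ha hH hpos (by rw [mem_ball_zero_iff]; linarith [hr.2])).trans ?_
    rw [sub_zero, div_mul_eq_mul_div]
    gcongr
  have hlim : Tendsto (fun r : ℝ => 2 * (H 0).re / (a - r)) (𝓝[>] 0) (𝓝 (2 * (H 0).re / (a - 0))) := by
    refine Tendsto.mono_left ?_ nhdsWithin_le_nhds
    exact Tendsto.div tendsto_const_nhds (tendsto_const_nhds.sub tendsto_id) (by simpa using ha.ne')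
  rw [sub_zero] at hlim
  refine ge_of_tendsto hlim ?_
  filter_upwards [Ioo_mem_nhdsGT ha] with r hr using key r hr

lemma Dom.hess_bd (D : Dom E) : ∃ M > 0, ∀ p ∈ closure D.Ω, ‖Hess D.r p‖ ≤ M := by
  obtain ⟨M, hM⟩ := D.cpt.exists_bound_of_continuousOn (E := E →L[ℝ] E →L[ℝ] ℝ)
    ((hess_facts D.openU D.C2).2.2.2.mono D.sub)
  exact ⟨max M 1, by positivity, fun p hp => (hM p hp).trans (le_max_left _ _)⟩

/-- The Levi polynomial -/
noncomputable def Dom.pol (D : Dom E) (q v:E) : ℂ := dl D.r q v + 1 / 2 * BL D.r q v v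

lemma Dom.taylor (D : Dom E) {ε:ℝ} (hε : 0 < ε) : ∃ δ > 0, ∀ q ∈ closure D.Ω, ball q δ ⊆ D.U ∧
  ∀ v : E, ‖v‖ < δ → |D.r (q + v) - D.r q - (D.pol q v).re - levi D.r q v| ≤ ε * ‖v‖ ^ 2 := by
  obtain ⟨δ, hδ, h⟩ := taylor2_unif D.openU D.C2 D.cpt D.sub hε
  refine ⟨δ, hδ, fun q hq => ⟨(h q hq).1, fun v hv => ?_⟩⟩
  have h1 := (h q hq).2 v hv
  rw [half_hess, bq_eq, ← dl_re] at h1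
  unfold Dom.pol
  rw [add_re]
  convert h1 using 2
  ring

lemma Dom.pol_le (D : Dom E) : ∃ δ > 0, ∀ q ∈ frontier D.Ω, ball q δ ⊆ D.U ∧
  ∀ v : E, ‖v‖ < δ → (D.pol q v).re ≤ D.r (q + v) - D.c / 2 * ‖v‖ ^ 2 := by
  obtain ⟨δ, hδ, h⟩ := D.taylor (half_pos D.c_pos)
  refine ⟨δ, hδ, fun q hq => ?_⟩
  obtain ⟨hq1, hq2⟩ := D.mem_frontier.1 hq
  refine ⟨(h q hq1).1, fun v hv => ?_⟩
  have h1 := (h q hq1).2 v hv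
  rw [abs_le] at h1
  have h2 := D.levi_ge q hq1 (by rw [hq2]; linarith [D.δ_pos]) v
  rw [hq2] at h1
  linarith [h1.1]

lemma Dom.dl_bd (D : Dom E) : ∃ C > 0, ∀ p ∈ closure D.Ω, ∀ v, ‖dl D.r p v‖ ≤ C * ‖v‖ := by
  obtain ⟨L, hL, δ, hδ, h⟩ := D.lip
  refine ⟨2 * L, by positivity, fun p hp v => (dl_norm_le _ _ _).trans ?_⟩
  have := (h p hp).2 p (mem_ball_self hδ)
  gcongr

lemma Dom.dl_lip (D : Dom E) : ∃ C > 0, ∃ δ > 0, ∀ q ∈ closure D.Ω, ∀ v : E, ‖v‖ < δ → ∀ Y : E,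
  ‖dl D.r (q + v) Y - dl D.r q Y‖ ≤ C * ‖v‖ * ‖Y‖ := by
  obtain ⟨M, hM, hMb⟩ := D.hess_bd
  obtain ⟨δ, hδ, h⟩ := dl_expand D.openU D.C2 D.cpt D.sub one_pos
  refine ⟨1 + 4 * M, by positivity, δ, hδ, fun q hq v hv Y => ?_⟩
  have h1 := (h q hq).2 v hv Y
  have h2 := Bf_Ls_le D.r q v Y
  rw [← BL_apply] at h2
  have h3 : 2 * ‖Hess D.r q‖ * ‖v‖ * ‖Y‖ ≤ 2 * M * ‖v‖ * ‖Y‖ := by gcongr; exact hMb q hq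
  have h4 : dl D.r (q + v) Y - dl D.r q Y =
      (dl D.r (q + v) Y - dl D.r q Y - BL D.r q v Y - Ls D.r q v Y) + BL D.r q v Y + Ls D.r q v Y := by ring
  rw [h4]
  refine norm_add₃_le.trans ?_
  linarith [h2.1, h2.2]

lemma Dom.disc_in (D : Dom E) : ∃ c0 > 0, ∀ z ∈ D.Ω, ∀ (v:E) (R:ℝ),
  R * ‖dl D.r z v‖ ≤ -D.r z / 2 → R ^ 2 * ‖v‖ ^ 2 ≤ c0 * (-D.r z) →
  ∀ ζ : ℂ, ‖ζ‖ < R → z + ζ • v ∈ D.Ω := by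
  obtain ⟨M, hM, hMb⟩ := D.hess_bd
  obtain ⟨B, hB, hBb⟩ := D.exists_bound
  obtain ⟨δ, hδ, h⟩ := taylor2_unif D.openU D.C2 D.cpt D.sub one_pos
  refine ⟨min (δ ^ 2 / (2 * B)) (1 / (4 * (1 + M))), by positivity, fun z hz v R h1 h2 ζ hζ => ?_⟩
  have hd := D.neg hz
  have hzc := subset_closure hz
  have hR : 0 < R := (norm_nonneg _).trans_lt hζ
  have hn : ‖ζ • v‖ ^ 2 ≤ R ^ 2 * ‖v‖ ^ 2 := by
    rw [norm_smul, mul_pow]; gcongr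
  have h3 : R ^ 2 * ‖v‖ ^ 2 ≤ δ ^ 2 / 2 := by
    refine h2.trans ?_
    calc _ ≤ δ ^ 2 / (2 * B) * B := by
          apply mul_le_mul (min_le_left _ _) (hBb z hzc) (by linarith) (by positivity)
      _ = _ := by field_simp
  have h4 : R ^ 2 * ‖v‖ ^ 2 * (1 + M) ≤ -D.r z / 4 := by
    have : R ^ 2 * ‖v‖ ^ 2 ≤ 1 / (4 * (1 + M)) * (-D.r z) :=
      h2.trans (mul_le_mul_of_nonneg_right (min_le_right _ _) (by linarith))
    calc _ ≤ 1 / (4 * (1 + M)) * (-D.r z) * (1 + M) := by gcongr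
      _ = _ := by field_simp
  have hlt : ‖ζ • v‖ < δ := by
    rw [← sq_lt_sq₀ (norm_nonneg _) hδ.le]
    have : 0 < δ ^ 2 := by positivity
    linarith
  have hU : z + ζ • v ∈ D.U := (h z hzc).1 (by simpa [mem_ball_iff_norm] using hlt)
  rw [D.mem hU]
  have h5 := (abs_le.1 ((h z hzc).2 _ hlt)).2
  have h6 := (abs_le.1 (hess_le D.r z (ζ • v) (ζ • v))).2
  have h7 : ‖Hess D.r z‖ * ‖ζ • v‖ * ‖ζ • v‖ ≤ M * ‖ζ • v‖ ^ 2 := by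
    rw [mul_assoc, ← sq]; gcongr; exact hMb z hzc
  have h8 : fderiv ℝ D.r z (ζ • v) ≤ R * ‖dl D.r z v‖ := by
    rw [← dl_re]
    refine (re_le_norm _).trans ?_
    rw [map_smul, smul_eq_mul, norm_mul]
    gcongr
  nlinarith [norm_nonneg (ζ • v)]

/-- Schwarz lemma in the complex normal direction -/
lemma Dom.normal_disc (D : Dom E) : ∃ C > 0, ∀ g : ℂ → E, DifferentiableOn ℂ g (ball 0 1) →
  MapsTo g (ball 0 1) D.Ω → ‖dl D.r (g 0) (deriv g 0)‖ ≤ C * (-D.r (g 0)) := by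
  obtain ⟨C1, hC1, L, hL, η, hη, hrep⟩ := D.normal_rep
  obtain ⟨δ, hδ, hpol⟩ := D.pol_le
  obtain ⟨C2, hC2, δ2, hδ2, hlip⟩ := D.dl_lip
  obtain ⟨C3, hC3, hdl⟩ := D.dl_bd
  obtain ⟨M, hM, hMb⟩ := D.hess_bd
  obtain ⟨A, hA⟩ := D.cpt.isBounded.exists_norm_le
  set A' := max A 1 with hA'
  have hA'p : 0 < A' := by positivity
  have hA'b : ∀ z ∈ D.Ω, ‖z‖ ≤ A' := fun z hz => (hA z (subset_closure hz)).trans (le_max_left _ _)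
  obtain ⟨B, hB, hBb⟩ := D.exists_bound
  set η' := min η (min (δ / (2 * C1)) (min (δ2 / (2 * C1)) 1)) with hη'
  have hη'p : 0 < η' := by positivity
  set a := min (1/2) (δ / (8 * A')) with haDef
  have hap : 0 < a := by positivity
  set KK := C3 * C1 + M * C1 ^ 2 with hKK
  have hKKp : 0 < KK := by positivity
  set C5 := 2 * A' * C2 * C1 + 2 * KK / a + 2 * M * C1 * (2 * A') with hC5
  refine ⟨max C5 (C3 * (2 * A') / η'), by positivity, fun g hg hmap => ?_⟩
  have h0m : g 0 ∈ D.Ω := hmap (mem_ball_self one_pos)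
  have hdp : 0 < -D.r (g 0) := by have := D.neg h0m; linarith
  have hg' : ‖deriv g 0‖ ≤ 2 * A' := by
    have := fderiv_bound (f := g) (c := 0) (R := 1) (M := A') one_pos hg (fun z hz => hA'b _ (hmap hz))
    rw [norm_deriv_eq_norm_fderiv]; linarith
  by_cases hcase : -D.r (g 0) < η'
  swap
  · push Not at hcase
    calc _ ≤ C3 * ‖deriv g 0‖ := hdl _ (subset_closure h0m) _
      _ ≤ C3 * (2 * A') := by gcongr
      _ = C3 * (2 * A') / η' * η' := by field_simp
      _ ≤ _ := by gcongr; exact le_max_right _ _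
  obtain ⟨q, hq, ν, hν, s, hs, gg, -, -, hsC, hrepq, -, -⟩ := hrep (g 0) h0m
    (hcase.trans_le (min_le_left _ _))
  have hqc := frontier_subset_closure hq
  have hdη2 : -D.r (g 0) < δ / (2 * C1) :=
    hcase.trans_le ((min_le_right _ _).trans (min_le_left _ _))
  have hdη3 : -D.r (g 0) < δ2 / (2 * C1) :=
    hcase.trans_le ((min_le_right _ _).trans ((min_le_right _ _).trans (min_le_left _ _)))
  have hdη4 : -D.r (g 0) < 1 :=
    hcase.trans_le ((min_le_right _ _).trans ((min_le_right _ _).trans (min_le_right _ _)))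
  rw [lt_div_iff₀ (by positivity)] at hdη2 hdη3
  have hgq : ‖g 0 - q‖ ≤ C1 * (-D.r (g 0)) := by
    have : ‖g 0 - q‖ = s := by
      rw [hrepq, add_sub_cancel_left, norm_smul, hν, norm_real, norm_of_nonneg hs.le, mul_one]
    rw [this]; exact hsC
  have hnear : ∀ ζ ∈ ball (0:ℂ) a, ‖g ζ - q‖ < δ := by
    intro ζ hζ
    rw [mem_ball_zero_iff] at hζ
    have h1 := lip_bound (f := g) (c := 0) (R := 1) (M := A') one_pos hg (fun z hz => hA'b _ (hmap hz))
      (z := ζ) (w := 0) (by rw [mem_ball_zero_iff]; exact hζ.trans_le (min_le_left _ _)) (by simp)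
    rw [div_one, sub_zero] at h1
    have h2 : ζ ∈ ball (0:ℂ) a := by simpa using hζ
    have h3 : ‖ζ‖ < δ / (8 * A') := hζ.trans_le (min_le_right _ _)
    rw [lt_div_iff₀ (by positivity)] at h3
    have h4 : ‖g ζ - q‖ ≤ ‖g ζ - g 0‖ + ‖g 0 - q‖ := by
      have : g ζ - q = (g ζ - g 0) + (g 0 - q) := by abel
      rw [this]; exact norm_add_le _ _
    linarith
  have hsub : ball (0:ℂ) a ⊆ ball 0 1 := ball_subset_ball ((min_le_left _ _).trans (by norm_num))
  have hga : DifferentiableOn ℂ g (ball 0 a) := hg.mono hsub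
  have hdat : HasDerivAt g (deriv g 0) 0 := (hg.differentiableAt (ball_mem_nhds _ one_pos)).hasDerivAt
  set T : E →L[ℂ] ℂ := LinearMap.toContinuousLinearMap (dl D.r q) with hT
  set H : ℂ → ℂ := fun ζ => -(T (g ζ - q) + 1 / 2 * BL D.r q (g ζ - q) (g ζ - q)) with hH
  have hHpol : ∀ ζ, H ζ = -D.pol q (g ζ - q) := fun ζ => rfl
  have hHd : DifferentiableOn ℂ H (ball 0 a) := by
    have h1 : DifferentiableOn ℂ (fun ζ => g ζ - q) (ball 0 a) := hga.sub_const q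
    have h2 : DifferentiableOn ℂ (fun ζ => T (g ζ - q)) (ball 0 a) := T.differentiable.comp_differentiableOn h1
    have h3 : DifferentiableOn ℂ (fun ζ => BL D.r q (g ζ - q) (g ζ - q)) (ball 0 a) :=
      DifferentiableOn.clm_apply ((BL D.r q).differentiable.comp_differentiableOn h1) h1
    exact (h2.add (h3.const_mul _)).neg
  have hHpos : ∀ ζ ∈ ball (0:ℂ) a, 0 < (H ζ).re := by
    intro ζ hζ
    rw [hHpol, neg_re]
    have h1 := (hpol q hq).2 (g ζ - q) (hnear ζ hζ)
    rw [add_sub_cancel] at h1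
    have h2 := D.neg (hmap (hsub hζ))
    have : 0 ≤ D.c / 2 * ‖g ζ - q‖ ^ 2 := by have := D.c_pos; positivity
    linarith
  have hHder : deriv H 0 = -(T (deriv g 0) + BL D.r q (g 0 - q) (deriv g 0)) := by
    have h1 : HasDerivAt (fun ζ => g ζ - q) (deriv g 0) 0 := hdat.sub_const q
    have h2 : HasDerivAt (fun ζ => T (g ζ - q)) (T (deriv g 0)) 0 := T.hasFDerivAt.comp_hasDerivAt 0 h1
    have h3 : HasDerivAt (fun ζ => BL D.r q (g ζ - q)) (BL D.r q (deriv g 0)) 0 :=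
      (BL D.r q).hasFDerivAt.comp_hasDerivAt 0 h1
    have h4 := h3.clm_apply h1
    have h5 := (h2.add (h4.const_mul (1/2:ℂ))).neg
    have h6 := h5.deriv
    have h7 := BL_symm D.openU D.C2 (D.sub hqc) (deriv g 0) (g 0 - q)
    have h8 : deriv H 0 = -(T (deriv g 0) + 1 / 2 * (BL D.r q (deriv g 0) (g 0 - q) + BL D.r q (g 0 - q) (deriv g 0))) := h6
    rw [h8, h7]; ring
  have hH0 : (H 0).re ≤ KK * (-D.r (g 0)) := by
    refine (re_le_norm _).trans ?_
    rw [hH, norm_neg]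
    have h1 : ‖T (g 0 - q)‖ ≤ C3 * ‖g 0 - q‖ := hdl q hqc _
    have h2 : ‖BL D.r q (g 0 - q) (g 0 - q)‖ ≤ 2 * M * ‖g 0 - q‖ * ‖g 0 - q‖ := by
      refine (Bf_Ls_le D.r q _ _).1.trans ?_
      gcongr; exact hMb q hqc
    refine (norm_add_le _ _).trans ?_
    rw [norm_mul]
    have h3 : ‖(1 / 2:ℂ)‖ = 1 / 2 := by norm_num
    rw [h3]
    have h4 : ‖g 0 - q‖ * ‖g 0 - q‖ ≤ C1 * (-D.r (g 0)) * (C1 * 1) := by gcongr; exact hgq.trans (by gcongr)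
    have h5 : C3 * ‖g 0 - q‖ ≤ C3 * (C1 * (-D.r (g 0))) := by gcongr
    rw [hKK]
    nlinarith
  have hmain := pos_re_deriv hap hHd hHpos
  rw [hHder, norm_neg] at hmain
  have h9 : ‖BL D.r q (g 0 - q) (deriv g 0)‖ ≤ 2 * M * C1 * (2 * A') * (-D.r (g 0)) := by
    refine (Bf_Ls_le D.r q _ _).1.trans ?_
    calc _ ≤ 2 * M * (C1 * (-D.r (g 0))) * (2 * A') := by
          gcongr; exact hMb q hqc
      _ = _ := by ring
  have h10 : ‖dl D.r (g 0) (deriv g 0) - dl D.r q (deriv g 0)‖ ≤ 2 * A' * C2 * C1 * (-D.r (g 0)) := by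
    have := hlip q hqc (g 0 - q) (hgq.trans_lt (by linarith)) (deriv g 0)
    rw [add_sub_cancel] at this
    refine this.trans ?_
    calc _ ≤ C2 * (C1 * (-D.r (g 0))) * (2 * A') := by gcongr
      _ = _ := by ring
  have h11 : 2 * (H 0).re / a ≤ 2 * KK / a * (-D.r (g 0)) := by
    rw [div_mul_eq_mul_div]
    apply div_le_div_of_nonneg_right _ hap.le
    linarith
  have e : dl D.r (g 0) (deriv g 0) = (dl D.r (g 0) (deriv g 0) - dl D.r q (deriv g 0)) +
    (T (deriv g 0) + BL D.r q (g 0 - q) (deriv g 0)) + (-BL D.r q (g 0 - q) (deriv g 0)) := by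
    have : T (deriv g 0) = dl D.r q (deriv g 0) := rfl
    rw [this]; ring
  rw [e]
  refine norm_add₃_le.trans ?_
  rw [norm_neg]
  calc _ ≤ C5 * (-D.r (g 0)) := by rw [hC5]; linarith
    _ ≤ _ := by gcongr; exact le_max_left _ _

/-- anisotropic derivative estimates -/
lemma PMap.aniso {D1 D2 : Dom E} {f : E → E} (P : PMap D1 D2 f) : ∃ C > 0, ∀ z ∈ D1.Ω, ∀ v : E,
  ‖fderiv ℂ f z v‖ ≤ C * (‖v‖ + ‖dl D1.r z v‖ / √(-D1.r z)) ∧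
  ‖dl D2.r (f z) (fderiv ℂ f z v)‖ ≤ C * (√(-D1.r z) * ‖v‖ + ‖dl D1.r z v‖) := by
  obtain ⟨c0, hc0, hdisc⟩ := D1.disc_in
  obtain ⟨C1, hC1, h1⟩ := D2.disc_lemma
  obtain ⟨C2, hC2, h2⟩ := D2.normal_disc
  obtain ⟨ch, hch, hhopf⟩ := P.hopf2
  set κ := min (1/2) (√c0) with hκ
  have hκp : 0 < κ := by positivity
  have hκ1 : κ ≤ 1/2 := min_le_left _ _
  have hκ2 : κ ^ 2 ≤ c0 := by
    calc κ ^ 2 ≤ (√c0) ^ 2 := by gcongr; exact min_le_right _ _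
      _ = c0 := sq_sqrt hc0.le
  refine ⟨max (√(C1 / ch) / κ) (C2 / ch / κ), by positivity, fun z hz v => ?_⟩
  by_cases hv : v = 0
  · simp [hv]
  have hd : 0 < -D1.r z := by have := D1.neg hz; linarith
  set d := -D1.r z with hdDef
  have hsq : 0 < √d := sqrt_pos.2 hd
  have hsq2 : √d * √d = d := mul_self_sqrt hd.le
  have hvn : 0 < ‖v‖ := norm_pos_iff.2 hv
  set Q := √d * ‖v‖ + ‖dl D1.r z v‖ with hQ
  have hQp : 0 < Q := by positivity
  set R := κ * d / Q with hR
  have hRp : 0 < R := by positivity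
  have hRQ : R * Q = κ * d := by rw [hR]; field_simp
  have a1 : R * ‖dl D1.r z v‖ ≤ d / 2 := by
    have h3 : ‖dl D1.r z v‖ ≤ Q := le_add_of_nonneg_left (mul_pos hsq hvn).le
    have : R * ‖dl D1.r z v‖ ≤ R * Q := mul_le_mul_of_nonneg_left h3 hRp.le
    nlinarith
  have a2 : R * ‖v‖ ≤ κ * √d := by
    have h3 : R * (√d * ‖v‖) ≤ R * Q := by gcongr; rw [hQ]; linarith [norm_nonneg (dl D1.r z v)]
    rw [hRQ] at h3
    have e : √d * (κ * √d) = κ * d := by linear_combination κ * hsq2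
    have h4 : √d * (R * ‖v‖) ≤ √d * (κ * √d) := by rw [e]; linarith
    exact le_of_mul_le_mul_left h4 hsq
  have a3 : R ^ 2 * ‖v‖ ^ 2 ≤ c0 * d := by
    rw [← mul_pow]
    calc (R * ‖v‖) ^ 2 ≤ (κ * √d) ^ 2 := by gcongr
      _ = κ ^ 2 * d := by rw [mul_pow, sq (√d), hsq2]
      _ ≤ _ := by gcongr
  have hin := hdisc z hz v R a1 a3
  have hin' : ∀ ζ ∈ ball (0:ℂ) 1, z + ζ • ((R:ℂ) • v) ∈ D1.Ω := by
    intro ζ hζ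
    rw [smul_smul]
    apply hin
    rw [norm_mul, norm_real, norm_of_nonneg hRp.le]
    rw [mem_ball_zero_iff] at hζ
    nlinarith
  set g : ℂ → E := fun ζ => f (z + ζ • ((R:ℂ) • v)) with hg
  have hgd : DifferentiableOn ℂ g (ball 0 1) := line_diffOn D1.isOpen P.hol hin'
  have hgm : MapsTo g (ball 0 1) D2.Ω := fun ζ hζ => P.maps (hin' ζ hζ)
  have hg0 : g 0 = f z := by simp [hg]
  have hgder : deriv g 0 = (R:ℂ) • fderiv ℂ f z v := by
    have := (deriv_comp_line ((R:ℂ) • v) (P.hol.differentiableAt (D1.isOpen.mem_nhds hz))).deriv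
    rw [map_smul] at this
    exact this
  have b1 := h1 g hgd hgm
  have b2 := h2 g hgd hgm
  rw [hg0, hgder] at b1 b2
  have hh : -D2.r (f z) ≤ d / ch := by rw [le_div_iff₀ hch]; linarith [hhopf z hz]
  rw [norm_smul, norm_real, norm_of_nonneg hRp.le] at b1
  rw [map_smul, norm_smul, norm_real, norm_of_nonneg hRp.le] at b2
  constructor
  · have b3 : (R * ‖fderiv ℂ f z v‖) ^ 2 ≤ (√(C1 / ch) * √d) ^ 2 := by
      rw [mul_pow (√(C1 / ch)), sq_sqrt (by positivity), sq_sqrt hd.le]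
      calc _ ≤ C1 * (d / ch) := b1.trans (by gcongr)
        _ = _ := by ring
    have b4 := abs_le_of_sq_le_sq' b3 (by positivity)
    have b5 := b4.2
    have b6 : ‖fderiv ℂ f z v‖ ≤ √(C1 / ch) * √d / R := by rw [le_div_iff₀ hRp]; linarith
    refine b6.trans ?_
    have b7 : √(C1 / ch) * √d / R = √(C1 / ch) / κ * (‖v‖ + ‖dl D1.r z v‖ / √d) := by
      have h5 : √(C1 / ch) * √d / R = √(C1 / ch) / κ * (√d * (1 / d) * Q) := by
        rw [hR]; field_simp
      have h6 : √d * (1 / d) = 1 / √d := by rw [← hsq2, Real.sqrt_mul_self hsq.le]; field_simp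
      rw [h5, h6, hQ]; field_simp
    rw [b7]
    gcongr
    exact le_max_left _ _
  · have b6 : ‖dl D2.r (f z) (fderiv ℂ f z v)‖ ≤ C2 * (d / ch) / R := by
      rw [le_div_iff₀ hRp, mul_comm]; exact b2.trans (by gcongr)
    refine b6.trans ?_
    have b7 : C2 * (d / ch) / R = C2 / ch / κ * Q := by
      rw [hR]; field_simp
    rw [b7]
    gcongr
    exact le_max_right _ _
end

section
lemma re_cpow_ge {α:ℝ} (h0 : 0 < α) (h1 : α < 1) {ζ:ℂ} (hζ : 0 ≤ ζ.re) :
  Real.cos (Real.pi / 2 * α) * ‖ζ‖ ^ α ≤ (ζ ^ (α:ℂ)).re := by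
  rcases eq_or_ne ζ 0 with rfl | hne
  · rw [Complex.zero_cpow (by exact_mod_cast h0.ne'), norm_zero, zero_rpow h0.ne']; simp
  have harg : |ζ.arg| ≤ Real.pi / 2 := Complex.abs_arg_le_pi_div_two_iff.2 hζ
  have e : (ζ ^ (α:ℂ)).re = ‖ζ‖ ^ α * Real.cos (ζ.arg * α) := by
    rw [Complex.cpow_ofReal_re]
  rw [e, mul_comm]
  refine mul_le_mul_of_nonneg_left ?_ (by positivity)
  rw [← Real.cos_abs (ζ.arg * α), abs_mul, abs_of_pos h0]
  refine Real.cos_le_cos_of_nonneg_of_le_pi (by positivity) ?_ ?_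
  · nlinarith [pi_pos]
  · exact mul_le_mul_of_nonneg_right harg h0.le

lemma cos_pos_aux {α:ℝ} (h0 : 0 < α) (h1 : α < 1) : 0 < Real.cos (Real.pi / 2 * α) := by
  apply Real.cos_pos_of_mem_Ioo
  constructor <;> nlinarith [pi_pos]

lemma disc_re {R:ℝ} (hR : 0 < R) {ζ:ℂ} (h : ‖ζ - R‖ ≤ R) : ‖ζ‖ ^ 2 ≤ 2 * R * ζ.re := by
  have h2 : ‖ζ - R‖ ^ 2 ≤ R ^ 2 := by gcongr
  rw [← normSq_eq_norm_sq, normSq_apply] at h2 ⊢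
  simp at h2
  nlinarith

lemma cpow_dcoc {α:ℝ} (h0 : 0 < α) {R:ℝ} (hR : 0 < R) :
  DiffContOnCl ℂ (fun ζ : ℂ => ζ ^ (α:ℂ)) (ball (R:ℂ) R) := by
  constructor
  · intro ζ hζ
    have h2 := disc_re hR (mem_ball_iff_norm.1 hζ).le
    have hne : 0 < ζ.re := by
      by_contra hc
      have h3 : ‖ζ‖ ^ 2 ≤ 0 := h2.trans (by nlinarith)
      have : ζ = 0 := by
        rw [← norm_eq_zero]; nlinarith [norm_nonneg ζ]
      subst this
      simp [abs_of_pos hR] at hζ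
    exact (((hasDerivAt_id ζ).cpow_const (Or.inl hne)).differentiableAt).differentiableWithinAt
  · intro ζ hζ
    rw [closure_ball _ hR.ne'] at hζ
    have h2 := disc_re hR (mem_closedBall_iff_norm.1 hζ)
    have : 0 ≤ ζ.re := by nlinarith [sq_nonneg ‖ζ‖]
    exact (Complex.continuousAt_cpow_const_of_re_pos (Or.inl this) (by simpa using h0)).continuousWithinAt

lemma im_max_one {α:ℝ} (h0 : 0 < α) (h1 : α < 1) : ∃ C > 0, ∀ R > (0:ℝ), ∀ (F : ℂ → ℂ),
  DiffContOnCl ℂ F (ball (R:ℂ) R) → ∀ K ≥ (0:ℝ), ∀ K' ≥ (0:ℝ),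
  (∀ ζ : ℂ, ‖ζ - R‖ = R → (F ζ).im ≤ K * ‖ζ‖ ^ α + K' * ‖ζ‖ ^ (1/2:ℝ)) →
  ∀ ζ ∈ ball (R:ℂ) R, (F ζ).im ≤ C * (K * ‖ζ‖ ^ α + K' * ‖ζ‖ ^ (1/2:ℝ)) := by
  obtain ⟨c, hc, hcα, hch⟩ : ∃ c > 0, c ≤ Real.cos (Real.pi / 2 * α) ∧ c ≤ Real.cos (Real.pi / 2 * (1/2)) :=
    ⟨min (Real.cos (Real.pi / 2 * α)) (Real.cos (Real.pi / 2 * (1/2))),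
      lt_min (cos_pos_aux h0 h1) (cos_pos_aux (by norm_num) (by norm_num)), min_le_left _ _, min_le_right _ _⟩
  refine ⟨1 / c, by positivity, ?_⟩
  intro R hR F hF K hK K' hK' hb ζ hζ
  set Q : ℂ → ℂ := fun ζ => ((1 / c:ℝ):ℂ) * ((K:ℂ) * ζ ^ (α:ℂ) + (K':ℂ) * ζ ^ ((1/2:ℝ):ℂ)) with hQ
  have hQd : DiffContOnCl ℂ Q (ball (R:ℂ) R) := by
    have a1 := (cpow_dcoc h0 hR).const_smul (K:ℂ)
    have a2 := (cpow_dcoc (α := 1/2) (by norm_num) hR).const_smul (K':ℂ)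
    exact (a1.add a2).const_smul ((1 / c:ℝ):ℂ)
  have hQre : ∀ ζ, (Q ζ).re = 1 / c * (K * (ζ ^ (α:ℂ)).re + K' * (ζ ^ ((1/2:ℝ):ℂ)).re) := by
    intro ζ
    simp only [hQ, re_ofReal_mul, add_re]
  have hg : DiffContOnCl ℂ (fun ζ => Complex.exp (-I * F ζ - Q ζ)) (ball (R:ℂ) R) := by
    have : DiffContOnCl ℂ (fun ζ => (-I) • F ζ - Q ζ) (ball (R:ℂ) R) := (hF.const_smul (-I)).sub hQd
    exact Complex.differentiable_exp.comp_diffContOnCl this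
  have hn : ∀ ζ, ‖Complex.exp (-I * F ζ - Q ζ)‖ = exp ((F ζ).im - (Q ζ).re) := by
    intro ζ
    rw [Complex.norm_exp]; congr 1; simp
  have key := Complex.norm_le_of_forall_mem_frontier_norm_le isBounded_ball hg (C := 1) ?_ (subset_closure hζ)
  · rw [hn, exp_le_one_iff] at key
    have h3 : (Q ζ).re ≤ 1 / c * (K * ‖ζ‖ ^ α + K' * ‖ζ‖ ^ (1/2:ℝ)) := by
      rw [hQre]
      have b1 : (ζ ^ (α:ℂ)).re ≤ ‖ζ‖ ^ α :=
        (re_le_norm _).trans (by rw [Complex.norm_cpow_real])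
      have b2 : (ζ ^ ((1/2:ℝ):ℂ)).re ≤ ‖ζ‖ ^ (1/2:ℝ) :=
        (re_le_norm _).trans (by rw [Complex.norm_cpow_real])
      gcongr
    linarith
  · intro w hw
    rw [frontier_ball _ hR.ne'] at hw
    have hw' := mem_sphere_iff_norm.1 hw
    rw [hn, exp_le_one_iff]
    have hre : 0 ≤ w.re := by nlinarith [disc_re hR hw'.le, sq_nonneg ‖w‖]
    have b1 := re_cpow_ge h0 h1 hre
    have b2 := re_cpow_ge (α := 1/2) (by norm_num) (by norm_num) hre
    have b3 := hb w hw'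
    have b4 : K * ‖w‖ ^ α + K' * ‖w‖ ^ (1/2:ℝ) ≤ (Q w).re := by
      rw [hQre, one_div_mul_eq_div, le_div_iff₀ hc]
      have c1 : c * ‖w‖ ^ α ≤ (w ^ (α:ℂ)).re := le_trans (by gcongr) b1
      have c2 : c * ‖w‖ ^ (1/2:ℝ) ≤ (w ^ ((1/2:ℝ):ℂ)).re := le_trans (by gcongr) b2
      nlinarith [mul_le_mul_of_nonneg_left c1 hK, mul_le_mul_of_nonneg_left c2 hK']
    linarith

lemma im_max {α:ℝ} (h0 : 0 < α) (h1 : α < 1) : ∃ C > 0, ∀ R > (0:ℝ), ∀ (F : ℂ → ℂ),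
  DiffContOnCl ℂ F (ball (R:ℂ) R) → ∀ K ≥ (0:ℝ), ∀ K' ≥ (0:ℝ),
  (∀ ζ : ℂ, ‖ζ - R‖ = R → |(F ζ).im| ≤ K * ‖ζ‖ ^ α + K' * ‖ζ‖ ^ (1/2:ℝ)) →
  ∀ ζ ∈ ball (R:ℂ) R, |(F ζ).im| ≤ C * (K * ‖ζ‖ ^ α + K' * ‖ζ‖ ^ (1/2:ℝ)) := by
  obtain ⟨C, hC, h⟩ := im_max_one h0 h1
  refine ⟨C, hC, ?_⟩
  intro R hR F hF K hK K' hK' hb ζ hζ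
  have a1 := h R hR F hF K hK K' hK' (fun w hw => (le_abs_self _).trans (hb w hw)) ζ hζ
  have a2 := h R hR (fun ζ => - F ζ) hF.neg K hK K' hK' (fun w hw => by
    rw [Complex.neg_im]; exact (neg_le_abs _).trans (hb w hw)) ζ hζ
  rw [Complex.neg_im] at a2
  exact abs_le.2 ⟨by linarith, a1⟩

lemma im_deriv {F : ℂ → ℂ} {s M:ℝ} (hs : 0 < s) (hM : 0 < M)
  (hF : DifferentiableOn ℂ F (ball (s:ℂ) (s/2))) (hb : ∀ ζ ∈ ball (s:ℂ) (s/2), |(F ζ).im| ≤ M) :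
  ‖deriv F s‖ ≤ 12 * M / s := by
  set H : ℂ → ℂ := fun ξ => (2 * M:ℝ) - I * F (s + ξ) with hH
  have hmem : ∀ ξ ∈ ball (0:ℂ) (s/2), (s:ℂ) + ξ ∈ ball (s:ℂ) (s/2) := by
    intro ξ hξ; simpa using hξ
  have hFs : DifferentiableAt ℂ F s := (hF.differentiableAt (isOpen_ball.mem_nhds (mem_ball_self (by positivity))))
  have hre : ∀ ξ, (H ξ).re = 2 * M + (F (s + ξ)).im := by intro ξ; simp [hH]
  have key := pos_re_deriv (H := H) (a := s/2) (by positivity) ?_ ?_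
  · have hd : HasDerivAt H (-(I * deriv F s)) 0 := by
      have h1 : HasDerivAt (fun ξ : ℂ => F (s + ξ)) (deriv F s) 0 := by
        have : HasDerivAt F (deriv F s) ((s:ℂ) + 0) := by simpa using hFs.hasDerivAt
        exact this.comp_const_add (s:ℂ) 0
      exact (h1.const_mul I).const_sub _
    rw [hd.deriv, norm_neg, norm_mul, norm_I, one_mul, hre] at key
    refine key.trans ?_
    have := hb s (mem_ball_self (by positivity))
    rw [add_zero]
    rw [div_le_div_iff₀ (by positivity) hs]
    have := (abs_le.1 this).2
    nlinarith
  · refine (differentiableOn_const _).sub ((differentiableOn_const _).mul ?_)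
    exact hF.comp (by fun_prop) hmem
  · intro ξ hξ
    have := (abs_le.1 (hb _ (hmem ξ hξ))).1
    rw [hre]; linarith

lemma conj_pair {α:ℝ} (h0 : 0 < α) (h1 : α < 1) : ∃ C > 0, ∀ R > (0:ℝ), ∀ (u v : ℂ → ℂ),
  DiffContOnCl ℂ u (ball (R:ℂ) R) → DiffContOnCl ℂ v (ball (R:ℂ) R) → ∀ K > (0:ℝ), ∀ K' ≥ (0:ℝ),
  (∀ ζ : ℂ, ‖ζ - R‖ = R → ‖u ζ + (starRingEnd ℂ) (v ζ)‖ ≤ K * ‖ζ‖ ^ α + K' * ‖ζ‖ ^ (1/2:ℝ)) →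
  ∀ s : ℝ, 0 < s → s ≤ R → ‖deriv v s‖ ≤ C * ((K * s ^ α + K' * s ^ (1/2:ℝ)) / s) := by
  obtain ⟨C, hC, h⟩ := im_max h0 h1
  refine ⟨24 * C, by positivity, ?_⟩
  intro R hR u v hu hv K hK K' hK' hb s hs hsR
  have hsub : ball (s:ℂ) (s/2) ⊆ ball (R:ℂ) R := by
    intro ζ hζ
    rw [mem_ball_iff_norm] at hζ ⊢
    have : ‖ζ - R‖ ≤ ‖ζ - s‖ + ‖(s:ℂ) - R‖ := by
      have := norm_add_le (ζ - s) ((s:ℂ) - R); simpa using this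
    have e : ‖(s:ℂ) - R‖ = R - s := by
      rw [← ofReal_sub, norm_real, norm_eq_abs, abs_of_nonpos (by linarith)]; ring
    linarith
  have hnz : ∀ ζ ∈ ball (s:ℂ) (s/2), ‖ζ‖ ≤ 2 * s := by
    intro ζ hζ
    rw [mem_ball_iff_norm] at hζ
    have : ‖ζ‖ ≤ ‖ζ - s‖ + ‖(s:ℂ)‖ := by
      have := norm_add_le (ζ - s) (s:ℂ); simpa using this
    rw [norm_real, norm_eq_abs, abs_of_pos hs] at this
    linarith
  have hp : ∀ {β:ℝ}, 0 < β → β < 1 → ∀ ζ ∈ ball (s:ℂ) (s/2), ‖ζ‖ ^ β ≤ 2 * s ^ β := by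
    intro β hβ hβ1 ζ hζ
    calc ‖ζ‖ ^ β ≤ (2 * s) ^ β := by gcongr; exact hnz ζ hζ
      _ = 2 ^ β * s ^ β := mul_rpow (by norm_num) hs.le
      _ ≤ 2 ^ (1:ℝ) * s ^ β := by gcongr; norm_num
      _ = 2 * s ^ β := by norm_num
  set M : ℝ := C * (2 * (K * s ^ α + K' * s ^ (1/2:ℝ))) with hM
  have hMp : 0 < M := by
    have : 0 < s ^ α := by positivity
    positivity
  have gen : ∀ F : ℂ → ℂ, DiffContOnCl ℂ F (ball (R:ℂ) R) →
      (∀ ζ : ℂ, ‖ζ - R‖ = R → |(F ζ).im| ≤ ‖u ζ + (starRingEnd ℂ) (v ζ)‖) → ‖deriv F s‖ ≤ 12 * M / s := by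
    intro F hF hle
    refine im_deriv hs hMp (hF.1.mono hsub) ?_
    intro ζ hζ
    refine (h R hR F hF K hK.le K' hK' (fun w hw => (hle w hw).trans (hb w hw)) ζ (hsub hζ)).trans ?_
    rw [hM]
    have b1 := hp h0 h1 ζ hζ
    have b2 := hp (β := 1/2) (by norm_num) (by norm_num) ζ hζ
    refine mul_le_mul_of_nonneg_left ?_ hC.le
    nlinarith [mul_le_mul_of_nonneg_left b1 hK.le, mul_le_mul_of_nonneg_left b2 hK']
  have g1 := gen (fun ζ => v ζ - u ζ) (hv.sub hu) (fun ζ _ => by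
    have := abs_im_le_norm (u ζ + (starRingEnd ℂ) (v ζ))
    refine le_trans (le_of_eq ?_) this
    rw [← abs_neg]; congr 1; simp; ring)
  have g2 := gen (fun ζ => I * (v ζ + u ζ)) ((hv.add hu).const_smul I) (fun ζ _ => by
    have := abs_re_le_norm (u ζ + (starRingEnd ℂ) (v ζ))
    refine le_trans (le_of_eq ?_) this
    congr 1; simp; ring)
  have hsmem : (s:ℂ) ∈ ball (R:ℂ) R := hsub (mem_ball_self (by positivity))
  have du := hu.1.differentiableAt (isOpen_ball.mem_nhds hsmem)
  have dv := hv.1.differentiableAt (isOpen_ball.mem_nhds hsmem)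
  have e1 : deriv (fun ζ => v ζ - u ζ) s = deriv v s - deriv u s := (dv.hasDerivAt.sub du.hasDerivAt).deriv
  have e2 : deriv (fun ζ => I * (v ζ + u ζ)) s = I * (deriv v s + deriv u s) :=
    ((dv.hasDerivAt.add du.hasDerivAt).const_mul I).deriv
  rw [e1] at g1
  rw [e2, norm_mul, norm_I, one_mul] at g2
  have : ‖deriv v s‖ ≤ 12 * M / s := by
    have e : (2:ℂ) * deriv v s = (deriv v s - deriv u s) + (deriv v s + deriv u s) := by ring
    have := norm_add_le (deriv v s - deriv u s) (deriv v s + deriv u s)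
    rw [← e, norm_mul] at this
    simp at this; linarith
  refine this.trans (le_of_eq ?_)
  rw [hM]; ring
end

section

lemma Dom.exists_m (D : Dom E) {q:E} (hq : q ∈ frontier D.Ω) :
  ∃ m : E, dl D.r q m = 1 ∧ ‖m‖ ≤ 2 / D.c := by
  by_contra hcon
  push Not at hcon
  have hcp := D.c_pos
  have hb : ∀ v : E, ‖fderiv ℝ D.r q v‖ ≤ D.c / 2 * ‖v‖ := by
    intro v
    have h1 : ‖fderiv ℝ D.r q v‖ ≤ ‖dl D.r q v‖ := by
      rw [← dl_re]; exact abs_re_le_norm _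
    refine h1.trans ?_
    rcases eq_or_ne (dl D.r q v) 0 with h0 | h0
    · rw [h0]; simp; positivity
    · have := hcon ((dl D.r q v)⁻¹ • v) (by rw [map_smul, smul_eq_mul, inv_mul_cancel₀ h0])
      rw [norm_smul, norm_inv, div_lt_iff₀ hcp] at this
      have hp : 0 < ‖dl D.r q v‖ := norm_pos_iff.2 h0
      have e : 2 * ‖dl D.r q v‖ < ‖v‖ * D.c := by
        calc 2 * ‖dl D.r q v‖ < ‖dl D.r q v‖⁻¹ * ‖v‖ * D.c * ‖dl D.r q v‖ := by gcongr
          _ = ‖v‖ * D.c := by field_simp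
      linarith
  have h2 := opNorm_le_bound _ (by positivity) hb
  have h3 := D.mem_frontier.1 hq
  have h4 := D.grad_ge q h3.1 (by rw [h3.2]; linarith [D.δ_pos])
  linarith

def Cfg (D : Dom E) (L:ℝ) (p ν:E) : Prop := p ∈ frontier D.Ω ∧ ‖ν‖ = 1 ∧
  ∃ g : ℝ, D.c ≤ g ∧ g ≤ L ∧ ∀ v, dl D.r p v = -(g:ℂ) * inner ℂ ν v

lemma levi_abs (D : Dom E) {p:E} (hp : p ∈ closure D.Ω) (v:E) :
  |levi D.r p v| ≤ ‖Hess D.r p‖ * ‖v‖ ^ 2 := by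
  have h1 := (Bf_Ls_le D.r p v v).2
  rw [Ls_self D.openU D.C2 (D.sub hp), norm_real, norm_eq_abs, abs_mul] at h1
  norm_num at h1
  nlinarith

lemma Dom.geom (D : Dom E) {L:ℝ} (hL : 0 < L) : ∃ R0 > 0, R0 ≤ 1 ∧ ∃ c1 > 0, ∃ C1 ≥ (1:ℝ), ∀ p ν, Cfg D L p ν →
  ∀ ζ : ℂ, ζ ≠ 0 → ‖ζ‖ ^ 2 ≤ 2 * R0 * ζ.re → p + ζ • ν ∈ D.Ω ∧ c1 * ζ.re ≤ -D.r (p + ζ • ν) ∧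
  -D.r (p + ζ • ν) ≤ C1 * ζ.re := by
  obtain ⟨M, hM, hMb⟩ := D.hess_bd
  obtain ⟨δ, hδ, ht⟩ := D.taylor (ε := 1) one_pos
  have hcp := D.c_pos
  obtain ⟨R0, hR0, hR1, hR2, hR3⟩ : ∃ R0 > 0, R0 ≤ 1 ∧ R0 ≤ δ / 4 ∧ R0 ≤ D.c / (4 * (1 + 2 * M)) :=
    ⟨min 1 (min (δ / 4) (D.c / (4 * (1 + 2 * M)))), by positivity, min_le_left _ _,
      (min_le_right _ _).trans (min_le_left _ _), (min_le_right _ _).trans (min_le_right _ _)⟩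
  refine ⟨R0, hR0, hR1, D.c / 2, by positivity, L + D.c + 1, by linarith, ?_⟩
  rintro p ν ⟨hp, hν, g, hg1, hg2, hdl⟩ ζ hζ hle
  have hn : 0 < ‖ζ‖ := norm_pos_iff.2 hζ
  have hre : 0 < ζ.re := by
    by_contra hc
    have : 2 * R0 * ζ.re ≤ 0 := by nlinarith
    nlinarith
  have hsm : ‖ζ‖ ≤ 2 * R0 := by
    have : ‖ζ‖ * ‖ζ‖ ≤ 2 * R0 * ‖ζ‖ := by
      have := re_le_norm ζ
      nlinarith
    exact le_of_mul_le_mul_right this hn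
  have hpc := frontier_subset_closure hp
  have hv : ‖ζ • ν‖ = ‖ζ‖ := by rw [norm_smul, hν, mul_one]
  have h1 := (ht p hpc).2 (ζ • ν) (by rw [hv]; linarith)
  have hU : p + ζ • ν ∈ D.U := (ht p hpc).1 (by rw [mem_ball_iff_norm, add_sub_cancel_left, hv]; linarith)
  rw [(D.mem_frontier.1 hp).2, hv, sub_zero] at h1
  have h2 := levi_abs D hpc (ζ • ν)
  have h3 : ‖1 / 2 * BL D.r p (ζ • ν) (ζ • ν)‖ ≤ M * ‖ζ‖ ^ 2 := by
    rw [norm_mul, BL_apply]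
    have := (Bf_Ls_le D.r p (ζ • ν) (ζ • ν)).1
    rw [hv] at this
    have hb := hMb p hpc
    norm_num
    nlinarith [sq_nonneg ‖ζ‖]
  rw [hv] at h2
  have h4 : (D.pol p (ζ • ν)).re = - g * ζ.re + (1 / 2 * BL D.r p (ζ • ν) (ζ • ν)).re := by
    rw [Dom.pol, add_re, hdl, inner_smul_right, inner_self_eq_norm_sq_to_K, hν]
    simp
  have h5 := (abs_re_le_norm _).trans h3
  have h6 : M * ‖ζ‖ ^ 2 ≥ ‖Hess D.r p‖ * ‖ζ‖ ^ 2 := by gcongr; exact hMb p hpc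
  have h7 : |D.r (p + ζ • ν) + g * ζ.re| ≤ (1 + 2 * M) * ‖ζ‖ ^ 2 := by
    rw [abs_le] at *
    rw [h4] at h1
    constructor <;> linarith [h1.1, h1.2, h2.1, h2.2, h5.1, h5.2]
  have h8 : (1 + 2 * M) * ‖ζ‖ ^ 2 ≤ D.c / 2 * ζ.re := by
    have : (1 + 2 * M) * R0 ≤ D.c / 4 := by
      calc (1 + 2 * M) * R0 ≤ (1 + 2 * M) * (D.c / (4 * (1 + 2 * M))) := by gcongr
        _ = D.c / 4 := by field_simp
    nlinarith
  have h9 := abs_le.1 (h7.trans h8)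
  have g1 : D.c * ζ.re ≤ g * ζ.re := by gcongr
  have g2 : g * ζ.re ≤ L * ζ.re := by gcongr
  have hc2 : 0 < D.c / 2 * ζ.re := by positivity
  refine ⟨(D.mem hU).2 (by linarith [h9.1, h9.2]), by linarith [h9.1, h9.2], by nlinarith [h9.1, h9.2]⟩

lemma PMap.exists_F {D1 D2 : Dom E} {f : E → E} (P : PMap D1 D2 f) : ∃ F : E → E,
  (∀ p ∈ frontier D1.Ω, F p ∈ frontier D2.Ω) ∧ ∃ C > 0, ∀ z ∈ D1.Ω, ∀ p ∈ frontier D1.Ω,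
  ‖f z - F p‖ ≤ C * ‖z - p‖ ^ (1/2:ℝ) := by
  obtain ⟨C, hC, h⟩ := P.half
  obtain ⟨F, hFc, hFe, hF⟩ := holder_extend (by norm_num) hC h
  obtain ⟨c, hc, hh⟩ := P.hopf2
  refine ⟨F, ?_, C, hC, ?_⟩
  · intro p hp
    have hpc := frontier_subset_closure hp
    have hne : (𝓝[D1.Ω] p).NeBot := mem_closure_iff_nhdsWithin_neBot.1 hpc
    have ht : Tendsto f (𝓝[D1.Ω] p) (𝓝 (F p)) := by
      have : Tendsto F (𝓝[D1.Ω] p) (𝓝 (F p)) := (hFc p hpc).mono subset_closure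
      exact this.congr' (by filter_upwards [self_mem_nhdsWithin] with y hy using hFe hy)
    have hmem : F p ∈ closure D2.Ω := mem_closure_of_tendsto ht
      (by filter_upwards [self_mem_nhdsWithin] with y hy using P.maps hy)
    refine D2.mem_frontier.2 ⟨hmem, le_antisymm (D2.le hmem) ?_⟩
    have h1 : Tendsto (fun z => D1.r z) (𝓝[D1.Ω] p) (𝓝 0) := by
      have := ((D1.cont p (D1.sub hpc)).mono D1.subU).tendsto
      rwa [(D1.mem_frontier.1 hp).2] at this
    have h2 : Tendsto (fun z => D2.r (f z)) (𝓝[D1.Ω] p) (𝓝 (D2.r (F p))) := by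
      have := D2.contC (F p) hmem
      refine this.tendsto.comp (tendsto_nhdsWithin_iff.2 ⟨ht, ?_⟩)
      filter_upwards [self_mem_nhdsWithin] with y hy using subset_closure (P.maps hy)
    have h3 : D1.r p ≤ c * D2.r (F p) := by
      rw [(D1.mem_frontier.1 hp).2]
      refine le_of_tendsto_of_tendsto h1 (h2.const_mul c) ?_
      filter_upwards [self_mem_nhdsWithin] with y hy
      have := hh y hy
      linarith
    rw [(D1.mem_frontier.1 hp).2] at h3
    by_contra hcon
    push Not at hcon
    nlinarith
  · intro z hz p hp
    rw [← hFe hz]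
    exact hF z (subset_closure hz) p (frontier_subset_closure hp)

lemma PMap.HLF {D1 D2 : Dom E} {f : E → E} (P : PMap D1 D2 f) {F : E → E} {C0:ℝ}
  (hF : ∀ z ∈ D1.Ω, ∀ p ∈ frontier D1.Ω, ‖f z - F p‖ ≤ C0 * ‖z - p‖ ^ (1/2:ℝ))
  {α:ℝ} (h0 : 0 < α) (h1 : α < 1) : ∃ C > 0, ∃ δ > 0, ∀ A B : ℝ, 0 ≤ A → 0 ≤ B →
  (∀ z ∈ D1.Ω, ‖fderiv ℂ f z‖ ≤ A * (-D1.r z) ^ (α - 1) + B * (-D1.r z) ^ ((1/2:ℝ) - 1)) →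
  ∀ z ∈ D1.Ω, ∀ p ∈ frontier D1.Ω, ‖z - p‖ < δ →
  ‖f z - F p‖ ≤ C * (A * ‖z - p‖ ^ α + B * ‖z - p‖ ^ (1/2:ℝ)) := by
  obtain ⟨C, hC, δ, hδ, h⟩ := D1.HL (F := E) h0 h1.le (β := 1/2) (by norm_num) (by norm_num)
  refine ⟨C, hC, δ, hδ, ?_⟩
  intro A B hA hB hd z hz p hp hzp
  have hpc := frontier_subset_closure hp
  have hne : (𝓝[D1.Ω] p).NeBot := mem_closure_iff_nhdsWithin_neBot.1 hpc
  have hid : Tendsto (fun w : E => w) (𝓝[D1.Ω] p) (𝓝 p) := tendsto_id.mono_left nhdsWithin_le_nhds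
  have hn : Tendsto (fun w => ‖w - p‖) (𝓝[D1.Ω] p) (𝓝 0) := by
    have := (hid.sub_const p).norm
    simpa using this
  have ht : Tendsto f (𝓝[D1.Ω] p) (𝓝 (F p)) := by
    rw [tendsto_iff_norm_sub_tendsto_zero]
    refine squeeze_zero' (g := fun w => C0 * ‖w - p‖ ^ (1/2:ℝ)) (Eventually.of_forall fun _ => norm_nonneg _)
      (by filter_upwards [self_mem_nhdsWithin] with y hy using hF y hy p hp) ?_
    have := (hn.rpow_const (p := 1/2) (Or.inr (by norm_num))).const_mul C0
    simpa using this
  have hz' : Tendsto (fun w => ‖z - w‖) (𝓝[D1.Ω] p) (𝓝 ‖z - p‖) := (hid.const_sub z).norm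
  have hl : Tendsto (fun w => ‖f z - f w‖) (𝓝[D1.Ω] p) (𝓝 ‖f z - F p‖) := (ht.const_sub (f z)).norm
  have hr : Tendsto (fun w => C * (A * ‖z - w‖ ^ α + B * ‖z - w‖ ^ (1/2:ℝ))) (𝓝[D1.Ω] p)
      (𝓝 (C * (A * ‖z - p‖ ^ α + B * ‖z - p‖ ^ (1/2:ℝ)))) :=
    (((hz'.rpow_const (Or.inr h0.le)).const_mul A).add
      ((hz'.rpow_const (Or.inr (by norm_num))).const_mul B)).const_mul C
  refine le_of_tendsto_of_tendsto hl hr ?_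
  filter_upwards [self_mem_nhdsWithin, hz'.eventually (gt_mem_nhds hzp)] with w hw hw2
  exact h f A B hA hB P.hol hd z hz w hw hw2

/-- tangential estimates on the disc -/
lemma PMap.tang {D1 D2 : Dom E} {f : E → E} (P : PMap D1 D2 f) {L:ℝ} (hL : 0 < L) :
  ∃ R0 > 0, R0 ≤ 1 ∧ ∃ C1 ≥ (1:ℝ), ∃ Ct > 0, ∀ p ν, Cfg D1 L p ν →
  ∀ ζ : ℂ, ζ ≠ 0 → ‖ζ‖ ^ 2 ≤ 2 * R0 * ζ.re → p + ζ • ν ∈ D1.Ω ∧ -D1.r (p + ζ • ν) ≤ C1 * ζ.re ∧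
  ζ.re ≤ C1 * (-D1.r (p + ζ • ν)) ∧
  ∀ X : E, inner ℂ ν X = 0 → ‖dl D1.r (p + ζ • ν) X‖ ≤ Ct * ‖ζ‖ * ‖X‖ ∧
  ‖fderiv ℂ f (p + ζ • ν) X‖ ≤ Ct * ‖X‖ ∧
  ‖dl D2.r (f (p + ζ • ν)) (fderiv ℂ f (p + ζ • ν) X)‖ ≤ Ct * (√(-D1.r (p + ζ • ν)) + ‖ζ‖) * ‖X‖ := by
  obtain ⟨R0, hR0, hR01, c1, hc1, C1, hC1, hg⟩ := D1.geom hL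
  obtain ⟨C2, hC2, δ, hδ, hlip⟩ := D1.dl_lip
  obtain ⟨C3, hC3, han⟩ := P.aniso
  obtain ⟨R, hR, hRR0, hRδ⟩ : ∃ R > 0, R ≤ R0 ∧ R ≤ δ / 4 :=
    ⟨min R0 (δ / 4), by positivity, min_le_left _ _, min_le_right _ _⟩
  refine ⟨R, hR, by linarith, max C1 (1 / c1), le_max_of_le_left hC1,
    C2 + C3 * (1 + C2 * √(2 / c1)) + C3 * (1 + C2), by positivity, ?_⟩
  intro p ν hcfg ζ hζ hle
  have hn : 0 < ‖ζ‖ := norm_pos_iff.2 hζ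
  have hre : 0 < ζ.re := by
    by_contra hc
    have : 2 * R * ζ.re ≤ 0 := by nlinarith
    nlinarith
  have hsm : ‖ζ‖ ≤ 2 * R := by
    have : ‖ζ‖ * ‖ζ‖ ≤ 2 * R * ‖ζ‖ := by
      have := re_le_norm ζ
      nlinarith
    exact le_of_mul_le_mul_right this hn
  obtain ⟨hm, ha, hb⟩ := hg p ν hcfg ζ hζ (hle.trans (by gcongr))
  set z := p + ζ • ν with hz
  have hd : 0 < -D1.r z := by linarith [D1.neg hm]
  refine ⟨hm, hb.trans (by gcongr; exact le_max_left _ _), ?_, ?_⟩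
  · have : ζ.re ≤ 1 / c1 * (-D1.r z) := by
      rw [one_div_mul_eq_div, le_div_iff₀ hc1]; linarith
    exact this.trans (by gcongr; exact le_max_right _ _)
  intro X hX
  obtain ⟨hp, hν, g, hg1, hg2, hdl⟩ := hcfg
  have hv : ‖ζ • ν‖ = ‖ζ‖ := by rw [norm_smul, hν, mul_one]
  have e1 : ‖dl D1.r z X‖ ≤ C2 * ‖ζ‖ * ‖X‖ := by
    have := hlip p (frontier_subset_closure hp) (ζ • ν) (by rw [hv]; linarith) X
    rw [hdl X, hX, mul_zero, sub_zero, hv] at this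
    exact this
  have hsd : 0 < √(-D1.r z) := sqrt_pos.2 hd
  have e2 : ‖ζ‖ ≤ √(2 / c1) * √(-D1.r z) := by
    rw [← sqrt_mul (by positivity)]
    apply le_sqrt_of_sq_le
    have : ζ.re ≤ 1 / c1 * (-D1.r z) := by
      rw [one_div_mul_eq_div, le_div_iff₀ hc1]; linarith
    calc ‖ζ‖ ^ 2 ≤ 2 * R * ζ.re := hle
      _ ≤ 2 * 1 * (1 / c1 * (-D1.r z)) := by gcongr; linarith
      _ = _ := by ring
  obtain ⟨a1, a2⟩ := han z hm X
  refine ⟨e1.trans ?_, a1.trans ?_, a2.trans ?_⟩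
  · gcongr
    have : 0 ≤ C3 * (1 + C2 * √(2 / c1)) + C3 * (1 + C2) := by positivity
    linarith
  · have : ‖dl D1.r z X‖ / √(-D1.r z) ≤ C2 * √(2 / c1) * ‖X‖ := by
      rw [div_le_iff₀ hsd]
      calc _ ≤ C2 * ‖ζ‖ * ‖X‖ := e1
        _ ≤ C2 * (√(2 / c1) * √(-D1.r z)) * ‖X‖ := by gcongr
        _ = _ := by ring
    calc C3 * (‖X‖ + ‖dl D1.r z X‖ / √(-D1.r z)) ≤ C3 * (‖X‖ + C2 * √(2 / c1) * ‖X‖) := by gcongr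
      _ = C3 * (1 + C2 * √(2 / c1)) * ‖X‖ := by ring
      _ ≤ _ := by
        gcongr
        have : 0 ≤ C3 * (1 + C2) := by positivity
        linarith
  · calc C3 * (√(-D1.r z) * ‖X‖ + ‖dl D1.r z X‖) ≤ C3 * (√(-D1.r z) * ‖X‖ + C2 * ‖ζ‖ * ‖X‖) := by gcongr
      _ = (C3 * √(-D1.r z) + C3 * C2 * ‖ζ‖) * ‖X‖ := by ring
      _ ≤ (C3 * (1 + C2) * √(-D1.r z) + C3 * (1 + C2) * ‖ζ‖) * ‖X‖ := by
        gcongr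
        · nlinarith
        · nlinarith
      _ = C3 * (1 + C2) * (√(-D1.r z) + ‖ζ‖) * ‖X‖ := by ring
      _ ≤ _ := by
        gcongr
        have : 0 ≤ C2 + C3 * (1 + C2 * √(2 / c1)) := by positivity
        linarith

end

section

def InD (R:ℝ) (ζ:ℂ) : Prop := ζ ≠ 0 ∧ ‖ζ‖ ^ 2 ≤ 2 * R * ζ.re

lemma InD.re_pos {R:ℝ} (hR : 0 < R) {ζ:ℂ} (h : InD R ζ) : 0 < ζ.re := by
  have hn : 0 < ‖ζ‖ := norm_pos_iff.2 h.1
  by_contra hc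
  have : 2 * R * ζ.re ≤ 0 := by nlinarith
  nlinarith [h.2]

lemma InD.le {R:ℝ} (hR : 0 < R) {ζ:ℂ} (h : InD R ζ) : ‖ζ‖ ≤ 2 * R := by
  have hn : 0 < ‖ζ‖ := norm_pos_iff.2 h.1
  have : ‖ζ‖ * ‖ζ‖ ≤ 2 * R * ‖ζ‖ := by
    have := re_le_norm ζ
    nlinarith [h.2]
  exact le_of_mul_le_mul_right this hn

lemma InD.mono {R R':ℝ} (hR : 0 < R) (hRR : R ≤ R') {ζ:ℂ} (h : InD R ζ) : InD R' ζ := by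
  refine ⟨h.1, h.2.trans ?_⟩
  have := h.re_pos hR
  gcongr

lemma inD_ball {R:ℝ} (hR : 0 < R) {ζ:ℂ} (h : ζ ∈ ball (R:ℂ) R) : InD R ζ := by
  refine ⟨?_, disc_re hR (mem_ball_iff_norm.1 h).le⟩
  rintro rfl
  simp [abs_of_pos hR] at h

lemma inD_closedBall {R:ℝ} (hR : 0 < R) {ζ:ℂ} (h : ‖ζ - R‖ ≤ R) (h0 : ζ ≠ 0) : InD R ζ :=
  ⟨h0, disc_re hR h⟩

lemma InD.mem_ball {R R':ℝ} (hR : 0 < R) (hRR : R < R') {ζ:ℂ} (h : InD R ζ) : ζ ∈ ball (R':ℂ) R' := by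
  have h1 := h.re_pos hR
  have h2 := h.2
  rw [mem_ball_iff_norm]
  have h3 : ‖ζ - R'‖ ^ 2 < R' ^ 2 := by
    rw [← normSq_eq_norm_sq, normSq_apply] at h2 ⊢
    simp
    nlinarith
  exact lt_of_pow_lt_pow_left₀ 2 (by linarith) h3

lemma small_R (B:ℝ) {ε R0:ℝ} (hε : 0 < ε) (hR0 : 0 < R0) : ∃ R > 0, R ≤ R0 ∧ B * √(2 * R) ≤ ε := by
  have h : Tendsto (fun R : ℝ => B * √(2 * R)) (𝓝[>] 0) (𝓝 0) := by
    have : Continuous (fun R : ℝ => B * √(2 * R)) := by fun_prop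
    have h0 : Tendsto (fun R : ℝ => B * √(2 * R)) (𝓝 0) (𝓝 (B * √(2 * 0))) := this.tendsto 0
    rw [mul_zero, sqrt_zero, mul_zero] at h0
    exact h0.mono_left nhdsWithin_le_nhds
  have h1 := h.eventually (gt_mem_nhds hε)
  have h2 : ∀ᶠ R : ℝ in 𝓝[>] 0, R ≤ R0 := (Iic_mem_nhds hR0 : Iic R0 ∈ 𝓝 (0:ℝ)) |> fun h => nhdsWithin_le_nhds h
  obtain ⟨R, ⟨a, b⟩, c⟩ := ((h1.and h2).and self_mem_nhdsWithin).exists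
  exact ⟨R, c, b, a.le⟩

lemma dcoc_of {G : ℂ → ℂ} {R R0 C:ℝ} (hR : 0 < R) (hRR : R < R0) (hG : DifferentiableOn ℂ G (ball (R0:ℂ) R0))
  (hb : ∀ ζ ∈ ball (R0:ℂ) R0, ‖G ζ‖ ≤ C * √‖ζ‖) :
  DiffContOnCl ℂ (fun ζ => if ζ = 0 then 0 else G ζ) (ball (R:ℂ) R) := by
  have hev : ∀ ζ : ℂ, ζ ≠ 0 → (fun ζ => if ζ = 0 then 0 else G ζ) =ᶠ[𝓝 ζ] G := by
    intro ζ hζ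
    filter_upwards [isOpen_ne.mem_nhds hζ] with w hw
    simp [show w ≠ 0 from hw]
  constructor
  · intro ζ hζ
    have h := inD_ball hR hζ
    have := hG.differentiableAt (isOpen_ball.mem_nhds (h.mem_ball hR hRR))
    exact ((hev ζ h.1).differentiableAt_iff.2 this).differentiableWithinAt
  · intro ζ hζ
    rw [closure_ball _ hR.ne'] at hζ ⊢
    rcases eq_or_ne ζ 0 with rfl | h0
    · rw [ContinuousWithinAt]
      simp only [if_true]
      rw [tendsto_zero_iff_norm_tendsto_zero]
      have hC : Tendsto (fun ζ : ℂ => C * √‖ζ‖) (𝓝[closedBall (R:ℂ) R] 0) (𝓝 0) := by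
        have : Continuous (fun ζ : ℂ => C * √‖ζ‖) := by fun_prop
        have := this.tendsto 0
        simp at this
        exact this.mono_left nhdsWithin_le_nhds
      refine squeeze_zero' (Eventually.of_forall fun _ => norm_nonneg _) ?_ hC
      filter_upwards [self_mem_nhdsWithin] with w hw
      rcases eq_or_ne w 0 with rfl | hw0
      · simp
      · rw [if_neg hw0]
        exact hb w ((inD_closedBall hR (mem_closedBall_iff_norm.1 hw) hw0).mem_ball hR hRR)
    · have h := inD_closedBall hR (mem_closedBall_iff_norm.1 hζ) h0
      have := hG.differentiableAt (isOpen_ball.mem_nhds (h.mem_ball hR hRR))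
      exact ((hev ζ h0).differentiableAt_iff.2 this).continuousAt.continuousWithinAt

variable {D1 D2 : Dom E} {f : E → E}

/-- smallness of the normal component -/
lemma PMap.nrm (P : PMap D1 D2 f) {F : E → E} {C0 L:ℝ} (hC0 : 0 < C0)
  (hFf : ∀ p ∈ frontier D1.Ω, F p ∈ frontier D2.Ω)
  (hF : ∀ z ∈ D1.Ω, ∀ p ∈ frontier D1.Ω, ‖f z - F p‖ ≤ C0 * ‖z - p‖ ^ (1/2:ℝ)) (hL : 0 < L) :
  ∃ R0 > 0, R0 ≤ 1 ∧ ∃ C > 0, ∀ p ν, Cfg D1 L p ν → ∀ ζ : ℂ, InD R0 ζ →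
  (∀ X : E, inner ℂ ν X = 0 → ‖dl D2.r (F p) (fderiv ℂ f (p + ζ • ν) X)‖ ≤
  C * (√(-D1.r (p + ζ • ν)) + ‖ζ‖ + ‖f (p + ζ • ν) - F p‖) * ‖X‖) ∧
  √(-D1.r (p + ζ • ν)) + ‖ζ‖ + ‖f (p + ζ • ν) - F p‖ ≤ C * √‖ζ‖ := by
  obtain ⟨R0, hR0, hR01, C1, hC1, Ct, hCt, ht⟩ := P.tang hL
  obtain ⟨Cl, hCl, δ, hδ, hlip⟩ := D2.dl_lip
  obtain ⟨R, hR, hRR0, hRs⟩ := small_R C0 (half_pos hδ) hR0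
  refine ⟨R, hR, by linarith, Ct + Cl * Ct + (√C1 + √2 + C0), by positivity, ?_⟩
  intro p ν hcfg ζ hζ
  have hζ0 := hζ.mono hR hRR0
  obtain ⟨hm, hd1, hd2, hX⟩ := ht p ν hcfg ζ hζ0.1 hζ0.2
  have hz1 := hζ.le hR
  obtain ⟨hp, hν, -⟩ := hcfg
  have hfz := hF _ hm p hp
  rw [add_sub_cancel_left, norm_smul, hν, mul_one, ← sqrt_eq_rpow] at hfz
  have hsm : ‖f (p + ζ • ν) - F p‖ < δ := by
    have : C0 * √‖ζ‖ ≤ C0 * √(2 * R) := by gcongr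
    linarith
  set z := p + ζ • ν with hz
  set w := f z - F p with hw
  constructor
  · intro X hXν
    obtain ⟨a1, a2, a3⟩ := hX X hXν
    have b1 := hlip (F p) (frontier_subset_closure (hFf p hp)) w hsm (fderiv ℂ f z X)
    rw [show F p + w = f z by rw [hw]; abel] at b1
    have b2 : ‖dl D2.r (F p) (fderiv ℂ f z X)‖ ≤ ‖dl D2.r (f z) (fderiv ℂ f z X)‖ +
        ‖dl D2.r (f z) (fderiv ℂ f z X) - dl D2.r (F p) (fderiv ℂ f z X)‖ := by
      have := norm_sub_le (dl D2.r (f z) (fderiv ℂ f z X)) (dl D2.r (f z) (fderiv ℂ f z X) - dl D2.r (F p) (fderiv ℂ f z X))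
      simpa using this
    have b3 : Cl * ‖w‖ * ‖fderiv ℂ f z X‖ ≤ Cl * ‖w‖ * (Ct * ‖X‖) := by gcongr
    have s0 := sqrt_nonneg (-D1.r z)
    calc _ ≤ Ct * (√(-D1.r z) + ‖ζ‖) * ‖X‖ + Cl * ‖w‖ * (Ct * ‖X‖) := by linarith
      _ = (Ct * (√(-D1.r z) + ‖ζ‖) + Cl * Ct * ‖w‖) * ‖X‖ := by ring
      _ ≤ ((Ct + Cl * Ct) * (√(-D1.r z) + ‖ζ‖) + (Ct + Cl * Ct) * ‖w‖) * ‖X‖ := by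
        gcongr
        · linarith [mul_pos hCl hCt]
        · linarith [mul_pos hCl hCt]
      _ = (Ct + Cl * Ct) * (√(-D1.r z) + ‖ζ‖ + ‖w‖) * ‖X‖ := by ring
      _ ≤ _ := by
        have : 0 ≤ √C1 + √2 + C0 := by positivity
        refine mul_le_mul_of_nonneg_right (mul_le_mul_of_nonneg_right ?_ (by positivity)) (norm_nonneg _)
        linarith
  · have c1 : √(-D1.r z) ≤ √C1 * √‖ζ‖ := by
      rw [← sqrt_mul (by linarith)]
      apply Real.sqrt_le_sqrt
      have := re_le_norm ζ
      nlinarith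
    have c2 : ‖ζ‖ ≤ √2 * √‖ζ‖ := by
      rw [← sqrt_mul (by norm_num)]
      apply le_sqrt_of_sq_le
      nlinarith [norm_nonneg ζ]
    calc _ ≤ √C1 * √‖ζ‖ + √2 * √‖ζ‖ + C0 * √‖ζ‖ := by linarith
      _ = (√C1 + √2 + C0) * √‖ζ‖ := by ring
      _ ≤ _ := by
        have : 0 ≤ Ct + Cl * Ct := by positivity
        refine mul_le_mul_of_nonneg_right ?_ (by positivity)
        linarith

end

section

def NDp (D1 : Dom E) (f : E → E) : Prop := ∃ C > 0, ∃ η > 0, ∀ z ∈ D1.Ω, -D1.r z < η →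
  ∀ X : E, ‖X‖ ≤ C * (‖fderiv ℂ f z X‖ + ‖dl D1.r z X‖ / √(-D1.r z))

variable {D1 D2 : Dom E} {f : E → E}

lemma isUnit_of_bound {A : E →L[ℂ] E} {C:ℝ} (h : ∀ x, ‖x‖ ≤ C * ‖A x‖) : IsUnit A := by
  rw [ContinuousLinearMap.isUnit_iff_isUnit_toLinearMap, LinearMap.isUnit_iff_ker_eq_bot, LinearMap.ker_eq_bot']
  intro x hx
  have := h x
  rw [show A x = 0 from hx, norm_zero, mul_zero] at this
  exact norm_le_zero_iff.1 this

/-- lower bound of the projected derivative on the disc -/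
lemma PMap.lower (P : PMap D1 D2 f) (hND : NDp D1 f) {F : E → E} {C0 L:ℝ} (hC0 : 0 < C0)
  (hFf : ∀ p ∈ frontier D1.Ω, F p ∈ frontier D2.Ω)
  (hF : ∀ z ∈ D1.Ω, ∀ p ∈ frontier D1.Ω, ‖f z - F p‖ ≤ C0 * ‖z - p‖ ^ (1/2:ℝ)) (hL : 0 < L) :
  ∃ R0 > (0:ℝ), R0 ≤ 1 ∧ ∃ C > 0, ∀ p ν, Cfg D1 L p ν → ∀ m : E, ‖m‖ ≤ 2 / D2.c → ∀ ζ : ℂ, InD R0 ζ →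
  p + ζ • ν ∈ D1.Ω ∧
  ∀ X : E, inner ℂ ν X = 0 → ‖X‖ ≤ C * ‖fderiv ℂ f (p + ζ • ν) X -
  dl D2.r (F p) (fderiv ℂ f (p + ζ • ν) X) • m‖ := by
  obtain ⟨R1, hR1, hR11, C1, hC1, Ct, hCt, ht⟩ := P.tang hL
  obtain ⟨R2, hR2, hR21, Cn, hCn, hn⟩ := P.nrm hC0 hFf hF hL
  obtain ⟨CN, hCN, η, hη, hN⟩ := hND
  have hc2 := D2.c_pos
  obtain ⟨R3, hR3, -, hs3⟩ := small_R (CN * Ct * √C1) (ε := 1/2) (by norm_num) hR1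
  obtain ⟨R4, hR4, -, hs4⟩ := small_R (2 * CN * (2 / D2.c) * Cn * Cn) (ε := 1/2) (by norm_num) hR1
  obtain ⟨R, hR, k1, k2, k3, k4, k5⟩ : ∃ R > 0, R ≤ R1 ∧ R ≤ R2 ∧ R ≤ R3 ∧ R ≤ R4 ∧ R ≤ η / (4 * C1) := by
    have : 0 < C1 := by linarith
    exact ⟨min R1 (min R2 (min R3 (min R4 (η / (4 * C1))))), by positivity, by simp, by simp, by simp, by simp, by simp⟩
  refine ⟨R, hR, by linarith, 4 * CN, by positivity, ?_⟩
  intro p ν hcfg m hm ζ hζ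
  have z1 := hζ.mono hR k1
  obtain ⟨hmem, hd1, hd2, hX⟩ := ht p ν hcfg ζ z1.1 z1.2
  obtain ⟨n1, n2⟩ := hn p ν hcfg ζ (hζ.mono hR k2)
  have hre := hζ.re_pos hR
  have hle := hζ.le hR
  set z := p + ζ • ν with hz
  refine ⟨hmem, ?_⟩
  intro X hXν
  have hd : 0 < -D1.r z := by linarith [D1.neg hmem]
  have hdη : -D1.r z < η := by
    have := re_le_norm ζ
    have h3 : R * (4 * C1) ≤ η := by rwa [le_div_iff₀ (by positivity)] at k5
    nlinarith
  have b1 := hN z hmem hdη X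
  obtain ⟨a1, a2, a3⟩ := hX X hXν
  have hsd : 0 < √(-D1.r z) := sqrt_pos.2 hd
  have e2 : ‖ζ‖ ≤ √C1 * √(2 * R) * √(-D1.r z) := by
    rw [← sqrt_mul (by linarith), ← sqrt_mul (by positivity)]
    apply le_sqrt_of_sq_le
    calc ‖ζ‖ ^ 2 ≤ 2 * R * ζ.re := hζ.2
      _ ≤ 2 * R * (C1 * (-D1.r z)) := by gcongr
      _ = _ := by ring
  have b2 : CN * (‖dl D1.r z X‖ / √(-D1.r z)) ≤ 1 / 2 * ‖X‖ := by
    have q1 : ‖dl D1.r z X‖ / √(-D1.r z) ≤ Ct * (√C1 * √(2 * R)) * ‖X‖ := by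
      rw [div_le_iff₀ hsd]
      calc _ ≤ Ct * ‖ζ‖ * ‖X‖ := a1
        _ ≤ Ct * (√C1 * √(2 * R) * √(-D1.r z)) * ‖X‖ := by gcongr
        _ = _ := by ring
    have q2 : √(2 * R) ≤ √(2 * R3) := by gcongr
    calc _ ≤ CN * (Ct * (√C1 * √(2 * R3)) * ‖X‖) := by
          refine mul_le_mul_of_nonneg_left (q1.trans ?_) hCN.le
          gcongr
      _ = (CN * Ct * √C1 * √(2 * R3)) * ‖X‖ := by ring
      _ ≤ _ := by gcongr
  set Y := fderiv ℂ f z X with hY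
  set a := dl D2.r (F p) Y with ha
  have b3 : ‖X‖ ≤ 2 * CN * ‖Y‖ := by nlinarith
  have b4 : ‖Y‖ ≤ ‖Y - a • m‖ + ‖a‖ * ‖m‖ := by
    have := norm_add_le (Y - a • m) (a • m)
    rwa [sub_add_cancel, norm_smul] at this
  have b5 : 2 * CN * (‖a‖ * ‖m‖) ≤ 1 / 2 * ‖X‖ := by
    have q1 : ‖a‖ ≤ Cn * (Cn * √(2 * R4)) * ‖X‖ := by
      refine (n1 X hXν).trans ?_
      gcongr
      refine n2.trans ?_
      gcongr
      linarith
    calc 2 * CN * (‖a‖ * ‖m‖) ≤ 2 * CN * ((Cn * (Cn * √(2 * R4)) * ‖X‖) * (2 / D2.c)) := by gcongr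
      _ = (2 * CN * (2 / D2.c) * Cn * Cn * √(2 * R4)) * ‖X‖ := by ring
      _ ≤ _ := by gcongr
  nlinarith

lemma PMap.frame (P : PMap D1 D2 f) (hND : NDp D1 f) {F : E → E} {C0 L:ℝ} (hC0 : 0 < C0)
  (hFf : ∀ p ∈ frontier D1.Ω, F p ∈ frontier D2.Ω)
  (hF : ∀ z ∈ D1.Ω, ∀ p ∈ frontier D1.Ω, ‖f z - F p‖ ≤ C0 * ‖z - p‖ ^ (1/2:ℝ)) (hL : 0 < L) :
  ∃ R0 > (0:ℝ), R0 ≤ 1 ∧ ∃ C > 0, ∀ p ν, Cfg D1 L p ν → ∀ m : E, ‖m‖ ≤ 2 / D2.c → dl D2.r (F p) m = 1 →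
  ∀ Y, ‖Y‖ = 1 → dl D2.r (F p) Y = 0 → ∃ X : ℂ → E, DifferentiableOn ℂ X (ball (R0:ℂ) R0) ∧
  ∀ ζ ∈ ball (R0:ℂ) R0, ‖X ζ‖ ≤ C ∧ inner ℂ ν (X ζ) = 0 ∧
  fderiv ℂ f (p + ζ • ν) (X ζ) = Y + dl D2.r (F p) (fderiv ℂ f (p + ζ • ν) (X ζ)) • m := by
  obtain ⟨R0, hR0, hR01, C, hC, h⟩ := P.lower hND hC0 hFf hF hL
  refine ⟨R0, hR0, hR01, C, hC, ?_⟩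
  intro p ν hcfg m hm hm1 Y hY1 hY
  set ℓ : E →L[ℂ] ℂ := LinearMap.toContinuousLinearMap (dl D2.r (F p)) with hℓ
  have hℓa : ∀ x, ℓ x = dl D2.r (F p) x := fun x => rfl
  set iν : E →L[ℂ] ℂ := innerSL ℂ ν with hiν
  have hia : ∀ x, iν x = inner ℂ ν x := fun x => rfl
  have hνν : inner ℂ ν ν = (1:ℂ) := by
    rw [inner_self_eq_norm_sq_to_K, hcfg.2.1]; simp
  set T : E →L[ℂ] E := ContinuousLinearMap.id ℂ E - ℓ.smulRight m with hT
  set Pν : E →L[ℂ] E := ContinuousLinearMap.id ℂ E - iν.smulRight ν with hPν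
  set A : ℂ → E →L[ℂ] E := fun ζ => (T.comp (fderiv ℂ f (p + ζ • ν))).comp Pν + iν.smulRight m with hA
  have hPa : ∀ x, Pν x = x - inner ℂ ν x • ν := by intro x; simp [hPν, hia]
  have hTa : ∀ x, T x = x - dl D2.r (F p) x • m := by intro x; simp [hT, hℓa]
  have hAa : ∀ ζ x, A ζ x = (fderiv ℂ f (p + ζ • ν) (Pν x) - dl D2.r (F p) (fderiv ℂ f (p + ζ • ν) (Pν x)) • m)
      + inner ℂ ν x • m := by
    intro ζ x
    rw [← hTa]; simp [hA, hia]
  have hin : ∀ x, inner ℂ ν (Pν x) = (0:ℂ) := by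
    intro x; rw [hPa, inner_sub_right, inner_smul_right, hνν]; simp
  have hdA : ∀ ζ x, ℓ (A ζ x) = inner ℂ ν x := by
    intro ζ x
    rw [hAa, hℓa, map_add, map_sub, map_smul, map_smul, hm1]
    simp
  have hmem : ∀ ζ ∈ ball (R0:ℂ) R0, p + ζ • ν ∈ D1.Ω := fun ζ hζ => (h p ν hcfg m hm ζ (inD_ball hR0 hζ)).1
  have hU : ∀ ζ ∈ ball (R0:ℂ) R0, IsUnit (A ζ) := by
    intro ζ hζ
    have hl := (h p ν hcfg m hm ζ (inD_ball hR0 hζ)).2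
    refine isUnit_of_bound (C := C * (1 + ‖m‖ * ‖ℓ‖) + ‖ℓ‖) ?_
    intro x
    have h1 := hl (Pν x) (hin x)
    have h2 : ‖inner ℂ ν x‖ ≤ ‖ℓ‖ * ‖A ζ x‖ := by rw [← hdA ζ x]; exact ℓ.le_opNorm _
    have h3 : ‖fderiv ℂ f (p + ζ • ν) (Pν x) - dl D2.r (F p) (fderiv ℂ f (p + ζ • ν) (Pν x)) • m‖ ≤
        ‖A ζ x‖ + ‖inner ℂ ν x‖ * ‖m‖ := by
      have := norm_sub_le (A ζ x) (inner ℂ ν x • m)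
      rw [hAa ζ x, add_sub_cancel_right, norm_smul] at this
      rw [hAa ζ x]; exact this
    have h4 : ‖x‖ ≤ ‖Pν x‖ + ‖inner ℂ ν x‖ := by
      have := norm_add_le (Pν x) (inner ℂ ν x • ν)
      rw [norm_smul, hcfg.2.1, mul_one] at this
      rwa [hPa, sub_add_cancel, ← hPa] at this
    calc ‖x‖ ≤ C * (‖A ζ x‖ + ‖ℓ‖ * ‖A ζ x‖ * ‖m‖) + ‖ℓ‖ * ‖A ζ x‖ := by
          refine h4.trans (add_le_add (h1.trans ?_) h2)
          refine mul_le_mul_of_nonneg_left (h3.trans ?_) hC.le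
          gcongr
      _ = _ := by ring
  have hAd : DifferentiableOn ℂ A (ball (R0:ℂ) R0) := by
    have h1 : DifferentiableOn ℂ (fun ζ : ℂ => fderiv ℂ f (p + ζ • ν)) (ball (R0:ℂ) R0) :=
      line_diffOn D1.isOpen (fderiv_differentiableOn D1.isOpen P.hol) hmem
    have h2 := ((differentiableOn_const (c := T)).clm_comp h1).clm_comp (differentiableOn_const (c := Pν))
    exact h2.add_const _
  refine ⟨fun ζ => Ring.inverse (A ζ) Y, ?_, ?_⟩
  · intro ζ hζ
    have h1 := (hAd.differentiableAt (isOpen_ball.mem_nhds hζ)).inverse (hU ζ hζ)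
    exact (h1.clm_apply (differentiableAt_const Y)).differentiableWithinAt
  · intro ζ hζ
    have e1 : A ζ (Ring.inverse (A ζ) Y) = Y := by
      have := Ring.mul_inverse_cancel (A ζ) (hU ζ hζ)
      have := congrArg (fun B : E →L[ℂ] E => B Y) this
      simpa using this
    set x := Ring.inverse (A ζ) Y with hx
    have e2 : inner ℂ ν x = (0:ℂ) := by rw [← hdA ζ x, e1, hℓa, hY]
    have e3 : Pν x = x := by rw [hPa, e2, zero_smul, sub_zero]
    have e4 := hAa ζ x
    rw [e1, e3, e2, zero_smul, add_zero] at e4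
    refine ⟨?_, e2, ?_⟩
    · have := (h p ν hcfg m hm ζ (inD_ball hR0 hζ)).2 x e2
      rw [← e4, hY1, mul_one] at this
      exact this
    · nth_rw 2 [e4]; rw [sub_add_cancel]

end

section
variable {D1 D2 : Dom E} {f : E → E}

lemma circle_re {R:ℝ} (hR : 0 < R) {ζ:ℂ} (h : ‖ζ - R‖ = R) : ζ.re = ‖ζ‖ ^ 2 / (2 * R) := by
  have h1 : ‖ζ - R‖ ^ 2 = R ^ 2 := by rw [h]
  rw [← normSq_eq_norm_sq, normSq_apply] at h1
  rw [← normSq_eq_norm_sq, normSq_apply]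
  simp at h1
  field_simp
  linarith

lemma PMap.circ (P : PMap D1 D2 f) (hND : NDp D1 f) {F : E → E} {C0 L:ℝ} (hC0 : 0 < C0)
  (hFf : ∀ p ∈ frontier D1.Ω, F p ∈ frontier D2.Ω)
  (hF : ∀ z ∈ D1.Ω, ∀ p ∈ frontier D1.Ω, ‖f z - F p‖ ≤ C0 * ‖z - p‖ ^ (1/2:ℝ)) (hL : 0 < L)
  {ε Rm:ℝ} (hε : 0 < ε) (hRm : 0 < Rm) :
  ∃ R > (0:ℝ), R ≤ Rm ∧ R ≤ 1 ∧ ∃ CR > 0, ∀ p ν, Cfg D1 L p ν → ∀ Y, ‖Y‖ = 1 → dl D2.r (F p) Y = 0 →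
  ∃ u v : ℂ → ℂ, DiffContOnCl ℂ u (ball (R:ℂ) R) ∧ DiffContOnCl ℂ v (ball (R:ℂ) R) ∧ u 0 = 0 ∧ v 0 = 0 ∧
  (∀ ζ : ℂ, ζ ≠ 0 → v ζ = LsL D2.r (F p) Y (f (p + ζ • ν) - F p)) ∧
  (∀ ζ : ℂ, ζ ≠ 0 → ‖ζ - R‖ ≤ R → p + ζ • ν ∈ D1.Ω) ∧
  ∀ ζ : ℂ, ζ ≠ 0 → ‖ζ - R‖ = R → ‖u ζ + (starRingEnd ℂ) (v ζ)‖ ≤ CR * ‖ζ‖ + ε * ‖f (p + ζ • ν) - F p‖ := by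
  obtain ⟨R1, hR1, hR11, C1, hC1, Ct, hCt, ht⟩ := P.tang hL
  obtain ⟨R2, hR2, hR21, Cn, hCn, hn⟩ := P.nrm hC0 hFf hF hL
  obtain ⟨R3, hR3, hR31, Cf, hCf, hfr⟩ := P.frame hND hC0 hFf hF hL
  obtain ⟨M, hM, hMb⟩ := D2.hess_bd
  have hc2 := D2.c_pos
  have hε1 : 0 < ε / (2 * Ct * Cf) := by positivity
  obtain ⟨δ, hδ, hexp⟩ := dl_expand D2.openU D2.C2 D2.cpt D2.sub hε1
  obtain ⟨R4, hR4, -, hs4⟩ := small_R Cn (half_pos hδ) hR1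
  obtain ⟨R5, hR5, -, hs5⟩ := small_R (Cn * Cn * Cf * (2 * M * (2 / D2.c))) (half_pos hε) hR1
  obtain ⟨R', hR', j1, j2, j3⟩ : ∃ R > 0, R < R1 ∧ R < R2 ∧ R < R3 := by
    refine ⟨min R1 (min R2 R3) / 2, by positivity, ?_, ?_, ?_⟩
    · have : min R1 (min R2 R3) ≤ R1 := by simp
      linarith
    · have : min R1 (min R2 R3) ≤ R2 := by simp
      linarith
    · have : min R1 (min R2 R3) ≤ R3 := by simp
      linarith
  obtain ⟨R, hR, k1, k2, k3, k4⟩ : ∃ R > 0, R < R' ∧ R ≤ R4 ∧ R ≤ R5 ∧ R ≤ Rm := by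
    refine ⟨min (R' / 2) (min R4 (min R5 Rm)), by positivity, ?_, by simp, by simp, by simp⟩
    have : min (R' / 2) (min R4 (min R5 Rm)) ≤ R' / 2 := by simp
    linarith
  refine ⟨R, hR, k4, by linarith, Ct * (√(C1 / (2 * R)) + 1) * Cf, by positivity, ?_⟩
  intro p ν hcfg Y hY1 hY
  have hq := hFf p hcfg.1
  have hqc : F p ∈ closure D2.Ω := (D2.mem_frontier.1 hq).1
  obtain ⟨m, hm1, hm⟩ := D2.exists_m hq
  obtain ⟨X, hXd, hX⟩ := hfr p ν hcfg m hm hm1 Y hY1 hY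
  set q := F p with hqdef
  have hmem : ∀ ζ, InD R' ζ → p + ζ • ν ∈ D1.Ω := fun ζ hζ => by
    have z1 := hζ.mono hR' j1.le
    exact (ht p ν hcfg ζ z1.1 z1.2).1
  have hmem' : ∀ ζ ∈ ball (R':ℂ) R', p + ζ • ν ∈ D1.Ω := fun ζ hζ => hmem ζ (inD_ball hR' hζ)
  set W : ℂ → E := fun ζ => fderiv ℂ f (p + ζ • ν) (X ζ) with hW
  have hfd : DifferentiableOn ℂ (fun ζ : ℂ => f (p + ζ • ν) - q) (ball (R':ℂ) R') :=
    (line_diffOn D1.isOpen P.hol hmem').sub_const _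
  have hWd : DifferentiableOn ℂ W (ball (R':ℂ) R') := by
    have h1 : DifferentiableOn ℂ (fun ζ : ℂ => fderiv ℂ f (p + ζ • ν)) (ball (R':ℂ) R') :=
      line_diffOn D1.isOpen (fderiv_differentiableOn D1.isOpen P.hol) hmem'
    exact h1.clm_apply (hXd.mono fun ζ hζ => (inD_ball hR' hζ).mem_ball hR' j3)
  -- pointwise facts
  have hpt : ∀ ζ, InD R' ζ → ‖W ζ‖ ≤ Ct * Cf ∧ ‖dl D2.r q (W ζ)‖ ≤ Cn * Cn * Cf * √‖ζ‖ ∧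
      ‖f (p + ζ • ν) - q‖ ≤ Cn * √‖ζ‖ ∧ W ζ = Y + dl D2.r q (W ζ) • m ∧
      ‖dl D2.r (f (p + ζ • ν)) (W ζ)‖ ≤ Ct * (√(-D1.r (p + ζ • ν)) + ‖ζ‖) * Cf := by
    intro ζ hζ
    have z1 := hζ.mono hR' j1.le
    obtain ⟨-, -, -, hT⟩ := ht p ν hcfg ζ z1.1 z1.2
    obtain ⟨n1, n2⟩ := hn p ν hcfg ζ (hζ.mono hR' j2.le)
    obtain ⟨x1, x2, x3⟩ := hX ζ (hζ.mem_ball hR' j3)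
    obtain ⟨a1, a2, a3⟩ := hT (X ζ) x2
    have n3 := n1 (X ζ) x2
    refine ⟨a2.trans (by gcongr), n3.trans ?_, ?_, x3, a3.trans (by gcongr)⟩
    · calc _ ≤ Cn * (Cn * √‖ζ‖) * Cf := by gcongr
        _ = _ := by ring
    · have := sqrt_nonneg (-D1.r (p + ζ • ν))
      have := norm_nonneg ζ
      linarith
  have hBn : ∀ a b, ‖BL D2.r q a b‖ ≤ 2 * M * ‖a‖ * ‖b‖ := fun a b => by
    rw [BL_apply]
    refine (Bf_Ls_le D2.r q a b).1.trans ?_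
    gcongr; exact hMb q hqc
  have hLn : ∀ a b, ‖Ls D2.r q a b‖ ≤ 2 * M * ‖a‖ * ‖b‖ := fun a b => by
    refine (Bf_Ls_le D2.r q a b).2.trans ?_
    gcongr; exact hMb q hqc
  set Gu : ℂ → ℂ := fun ζ => dl D2.r q (W ζ) + BL D2.r q (f (p + ζ • ν) - q) (W ζ) with hGu
  set Gv : ℂ → ℂ := fun ζ => LsL D2.r q Y (f (p + ζ • ν) - q) with hGv
  have hGud : DifferentiableOn ℂ Gu (ball (R':ℂ) R') := by
    have h1 : DifferentiableOn ℂ (fun ζ => LinearMap.toContinuousLinearMap (dl D2.r q) (W ζ)) (ball (R':ℂ) R') :=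
      (ContinuousLinearMap.differentiable _).comp_differentiableOn hWd
    have h2 : DifferentiableOn ℂ (fun ζ : ℂ => BL D2.r q (f (p + ζ • ν) - q)) (ball (R':ℂ) R') :=
      (ContinuousLinearMap.differentiable _).comp_differentiableOn hfd
    exact h1.add (h2.clm_apply hWd)
  have hGvd : DifferentiableOn ℂ Gv (ball (R':ℂ) R') :=
    (ContinuousLinearMap.differentiable _).comp_differentiableOn hfd
  have hGub : ∀ ζ ∈ ball (R':ℂ) R', ‖Gu ζ‖ ≤ (Cn * Cn * Cf + 2 * M * Cn * (Ct * Cf)) * √‖ζ‖ := by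
    intro ζ hζ
    obtain ⟨w1, w2, w3, -, -⟩ := hpt ζ (inD_ball hR' hζ)
    calc ‖Gu ζ‖ ≤ ‖dl D2.r q (W ζ)‖ + ‖BL D2.r q (f (p + ζ • ν) - q) (W ζ)‖ := norm_add_le _ _
      _ ≤ Cn * Cn * Cf * √‖ζ‖ + 2 * M * (Cn * √‖ζ‖) * (Ct * Cf) := by
          refine add_le_add w2 ((hBn _ _).trans ?_)
          gcongr
      _ = _ := by ring
  have hGvb : ∀ ζ ∈ ball (R':ℂ) R', ‖Gv ζ‖ ≤ (2 * M * Cn) * √‖ζ‖ := by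
    intro ζ hζ
    obtain ⟨w1, w2, w3, -, -⟩ := hpt ζ (inD_ball hR' hζ)
    calc ‖Gv ζ‖ ≤ 2 * M * ‖Y‖ * ‖f (p + ζ • ν) - q‖ := hLn _ _
      _ ≤ 2 * M * 1 * (Cn * √‖ζ‖) := by rw [hY1]; gcongr
      _ = _ := by ring
  refine ⟨_, _, dcoc_of hR k1 hGud hGub, dcoc_of hR k1 hGvd hGvb, by simp, by simp, ?_, ?_, ?_⟩
  · intro ζ h0; simp [h0, hGv]
  · intro ζ h0 h1
    exact hmem ζ ((inD_closedBall hR h1 h0).mono hR k1.le)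
  · intro ζ h0 h1
    simp only [h0, if_false]
    have hD := inD_closedBall hR h1.le h0
    have hD' := hD.mono hR k1.le
    obtain ⟨w1, w2, w3, w4, w5⟩ := hpt ζ hD'
    have z1 := hD'.mono hR' j1.le
    obtain ⟨-, d1, -, -⟩ := ht p ν hcfg ζ z1.1 z1.2
    have hle := hD.le hR
    set v := f (p + ζ • ν) - q with hv
    have hfv : f (p + ζ • ν) = q + v := by rw [hv]; abel
    have hvδ : ‖v‖ < δ := by
      have : √‖ζ‖ ≤ √(2 * R4) := by gcongr; linarith
      calc ‖v‖ ≤ Cn * √(2 * R4) := w3.trans (by gcongr)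
        _ < δ := by linarith
    have he := (hexp q hqc).2 v hvδ (W ζ)
    rw [← hfv] at he
    have e1 : Ls D2.r q v (W ζ) = Ls D2.r q v Y + dl D2.r q (W ζ) * Ls D2.r q v m := by
      nth_rw 1 [w4]
      rw [← LsL_apply, map_add, map_smul, LsL_apply, LsL_apply, smul_eq_mul]
    have e2 : (starRingEnd ℂ) (Gv ζ) = Ls D2.r q v Y := by
      rw [Ls_conj D2.openU D2.C2 (D2.sub hqc) v Y]; rfl
    have e3 : Gu ζ + (starRingEnd ℂ) (Gv ζ) = dl D2.r (f (p + ζ • ν)) (W ζ) -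
        (dl D2.r (f (p + ζ • ν)) (W ζ) - dl D2.r q (W ζ) - BL D2.r q v (W ζ) - Ls D2.r q v (W ζ)) -
        dl D2.r q (W ζ) * Ls D2.r q v m := by
      rw [e2, e1]; simp only [hGu]; ring
    have e4 : √(-D1.r (p + ζ • ν)) ≤ √(C1 / (2 * R)) * ‖ζ‖ := by
      rw [Real.sqrt_le_left (by positivity), mul_pow, sq_sqrt (by positivity)]
      rw [circle_re hR h1] at d1
      refine d1.trans (le_of_eq (by ring))
    have e5 : ‖dl D2.r q (W ζ) * Ls D2.r q v m‖ ≤ ε / 2 * ‖v‖ := by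
      have : √‖ζ‖ ≤ √(2 * R5) := by gcongr; linarith
      rw [norm_mul]
      calc _ ≤ (Cn * Cn * Cf * √(2 * R5)) * (2 * M * ‖v‖ * (2 / D2.c)) := by
            refine mul_le_mul (w2.trans (by gcongr)) ((hLn _ _).trans (by gcongr)) (norm_nonneg _) (by positivity)
        _ = (Cn * Cn * Cf * (2 * M * (2 / D2.c)) * √(2 * R5)) * ‖v‖ := by ring
        _ ≤ _ := by gcongr
    have e6 : ε / (2 * Ct * Cf) * ‖v‖ * ‖W ζ‖ ≤ ε / 2 * ‖v‖ := by
      calc _ ≤ ε / (2 * Ct * Cf) * ‖v‖ * (Ct * Cf) := by gcongr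
        _ = _ := by field_simp
    rw [e3]
    have e7 : Ct * (√(-D1.r (p + ζ • ν)) + ‖ζ‖) * Cf ≤ Ct * (√(C1 / (2 * R)) + 1) * Cf * ‖ζ‖ := by
      calc _ ≤ Ct * (√(C1 / (2 * R)) * ‖ζ‖ + ‖ζ‖) * Cf := by gcongr
        _ = _ := by ring
    refine (norm_sub_le _ _).trans ?_
    have := norm_sub_le (dl D2.r (f (p + ζ • ν)) (W ζ)) (dl D2.r (f (p + ζ • ν)) (W ζ) - dl D2.r q (W ζ) - BL D2.r q v (W ζ) - Ls D2.r q v (W ζ))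
    linarith

end

section
variable {D1 D2 : Dom E} {f : E → E}

lemma PMap.near (P : PMap D1 D2 f) {F : E → E} {C0 L:ℝ} (hC0 : 0 < C0)
  (hFf : ∀ p ∈ frontier D1.Ω, F p ∈ frontier D2.Ω)
  (hF : ∀ z ∈ D1.Ω, ∀ p ∈ frontier D1.Ω, ‖f z - F p‖ ≤ C0 * ‖z - p‖ ^ (1/2:ℝ)) (hL : 0 < L) :
  ∃ R > (0:ℝ), ∃ C1 ≥ (1:ℝ), ∃ B > (0:ℝ), ∀ p ν, Cfg D1 L p ν → ∀ s : ℝ, 0 < s → s ≤ R →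
  p + (s:ℂ) • ν ∈ D1.Ω ∧ -D1.r (p + (s:ℂ) • ν) ≤ C1 * s ∧
  ∀ V : ℝ, 0 ≤ V → (∀ Y, ‖Y‖ = 1 → dl D2.r (F p) Y = 0 → ‖LsL D2.r (F p) Y (fderiv ℂ f (p + (s:ℂ) • ν) ν)‖ ≤ V) →
  ‖fderiv ℂ f (p + (s:ℂ) • ν)‖ ≤ V / D2.c + B := by
  obtain ⟨R1, hR1, hR11, C1, hC1, Ct, hCt, ht⟩ := P.tang hL
  obtain ⟨Ca, hCa, ha⟩ := P.aniso
  obtain ⟨Cl, hCl, δl, hδl, hl⟩ := D2.dl_lip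
  obtain ⟨Cd, hCd, hd⟩ := D1.dl_bd
  obtain ⟨M, hM, hMb⟩ := D2.hess_bd
  have hc := D2.c_pos
  set A2 := 2 * M / D2.c ^ 2 + 2 / D2.c with hA2
  have hA2p : 0 < A2 := by positivity
  set B1 := Ca * (√C1 + Cd) with hB1
  have hB1p : 0 < B1 := by positivity
  obtain ⟨R2, hR2, -, hs2⟩ := small_R C0 (half_pos hδl) hR1
  obtain ⟨R3, hR3, -, hs3⟩ := small_R (A2 * (Cl * C0)) (ε := 1/2) (by norm_num) hR1
  refine ⟨min R1 (min R2 (min R3 1)), by positivity, C1, hC1, 2 * A2 * B1 + 2 * Ct, by positivity, ?_⟩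
  intro p ν hcfg s hs hsR
  have k1 : s ≤ R1 := hsR.trans (by simp)
  have k2 : s ≤ R2 := hsR.trans (by simp)
  have k3 : s ≤ R3 := hsR.trans (by simp)
  have k4 : s ≤ 1 := hsR.trans (by simp)
  obtain ⟨hmem, d1, d2, hT⟩ := ht p ν hcfg (s:ℂ) (by exact_mod_cast hs.ne') (by
    rw [norm_real, norm_of_nonneg hs.le, ofReal_re]; nlinarith)
  rw [ofReal_re] at d1 d2
  refine ⟨hmem, d1, ?_⟩
  intro V hV hY
  set z := p + (s:ℂ) • ν with hz
  have hν := hcfg.2.1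
  have hνν : inner ℂ ν ν = (1:ℂ) := by rw [inner_self_eq_norm_sq_to_K, hν]; simp
  have hq := hFf p hcfg.1
  have hqc : F p ∈ closure D2.Ω := (D2.mem_frontier.1 hq).1
  obtain ⟨m, hm1, hm⟩ := D2.exists_m hq
  have hfz : ‖f z - F p‖ ≤ C0 * √s := by
    have h1 := hF z hmem p hcfg.1
    have : ‖z - p‖ = s := by rw [hz, add_sub_cancel_left, norm_smul, hν, norm_real, norm_of_nonneg hs.le, mul_one]
    rwa [this, ← sqrt_eq_rpow] at h1
  set q := F p with hqd
  set T := fderiv ℂ f z ν with hTd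
  set b := dl D2.r q T with hb
  have hbb : ‖b‖ ≤ B1 + Cl * C0 * √s * ‖T‖ := by
    have h1 := (ha z hmem ν).2
    have h2 := hd z (subset_closure hmem) ν
    rw [hν, mul_one] at h2 h1
    have h3 : √(-D1.r z) ≤ √C1 := by gcongr; nlinarith
    have h4 := hl q hqc (f z - q) (by
      have : √s ≤ √(2 * R2) := by gcongr; linarith
      calc _ ≤ C0 * √(2 * R2) := hfz.trans (by gcongr)
        _ < δl := by linarith) T
    rw [add_sub_cancel] at h4
    have h5 : ‖b‖ ≤ ‖dl D2.r (f z) T‖ + ‖dl D2.r (f z) T - dl D2.r q T‖ := by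
      have := norm_sub_le (dl D2.r (f z) T) (dl D2.r (f z) T - dl D2.r q T)
      rwa [sub_sub_cancel] at this
    have h6 : ‖dl D2.r (f z) T‖ ≤ B1 := h1.trans (by rw [hB1]; gcongr)
    have h7 : Cl * ‖f z - q‖ * ‖T‖ ≤ Cl * (C0 * √s) * ‖T‖ := by gcongr
    calc _ ≤ _ := h5
      _ ≤ B1 + Cl * (C0 * √s) * ‖T‖ := add_le_add h6 (h4.trans h7)
      _ = _ := by ring
  have hLn : ∀ a b, ‖LsL D2.r q a b‖ ≤ 2 * M * ‖a‖ * ‖b‖ := fun a b => by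
    refine (Bf_Ls_le D2.r q a b).2.trans ?_
    gcongr; exact hMb q hqc
  set y := T - b • m with hy
  have hyk : dl D2.r q y = 0 := by rw [hy, map_sub, map_smul, hm1]; simp [hb]
  have hyb : 2 * D2.c * ‖y‖ ≤ V + ‖b‖ * (2 * M * (2 / D2.c)) := by
    by_cases h0 : y = 0
    · rw [h0, norm_zero, mul_zero]; positivity
    have hyp : 0 < ‖y‖ := norm_pos_iff.2 h0
    set Y : E := ((‖y‖⁻¹:ℝ):ℂ) • y with hYd
    have hY1 : ‖Y‖ = 1 := by
      rw [hYd, norm_smul, norm_real, norm_of_nonneg (by positivity), inv_mul_cancel₀ hyp.ne']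
    have hyY : y = ((‖y‖:ℝ):ℂ) • Y := by
      rw [hYd, smul_smul, ← ofReal_mul, mul_inv_cancel₀ hyp.ne']; simp
    have hYk : dl D2.r q Y = 0 := by rw [hYd, map_smul, hyk, smul_zero]
    clear_value Y
    have h1 := hY Y hY1 hYk
    have h2 : T = ((‖y‖:ℝ):ℂ) • Y + b • m := by rw [← hyY, hy]; abel
    have h3 : LsL D2.r q Y T = ((‖y‖ * (2 * levi D2.r q Y):ℝ):ℂ) + b * LsL D2.r q Y m := by
      rw [h2, map_add, map_smul, map_smul, LsL_apply D2.r q Y Y, Ls_self D2.openU D2.C2 (D2.sub hqc)]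
      simp
    have h4 := D2.levi_ge q hqc (by rw [(D2.mem_frontier.1 hq).2]; linarith [D2.δ_pos]) Y
    rw [hY1] at h4
    have h5 : ‖((‖y‖ * (2 * levi D2.r q Y):ℝ):ℂ)‖ ≤ V + ‖b * LsL D2.r q Y m‖ := by
      have := norm_sub_le (LsL D2.r q Y T) (b * LsL D2.r q Y m)
      rw [h3, add_sub_cancel_right, ← h3] at this
      linarith
    rw [norm_real] at h5
    have h6 := (le_abs_self _).trans h5
    have h7 : ‖b * LsL D2.r q Y m‖ ≤ ‖b‖ * (2 * M * (2 / D2.c)) := by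
      rw [norm_mul]
      gcongr
      refine (hLn _ _).trans ?_
      rw [hY1, mul_one]; gcongr
    nlinarith
  have hTn : ‖T‖ ≤ V / (2 * D2.c) + A2 * ‖b‖ := by
    have h1 : ‖T‖ ≤ ‖y‖ + ‖b‖ * (2 / D2.c) := by
      have := norm_add_le y (b • m)
      rw [hy, sub_add_cancel, ← hy, norm_smul] at this
      refine this.trans ?_
      gcongr
    have h2 : ‖y‖ ≤ (V + ‖b‖ * (2 * M * (2 / D2.c))) / (2 * D2.c) := by
      rw [le_div_iff₀ (by positivity)]; linarith
    calc ‖T‖ ≤ (V + ‖b‖ * (2 * M * (2 / D2.c))) / (2 * D2.c) + ‖b‖ * (2 / D2.c) := by linarith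
      _ = _ := by rw [hA2]; field_simp; ring
  have hTn2 : ‖T‖ ≤ V / D2.c + 2 * A2 * B1 := by
    have h1 : A2 * (Cl * C0) * √s ≤ 1 / 2 := by
      refine le_trans ?_ hs3
      gcongr; linarith
    have h2 : A2 * ‖b‖ ≤ A2 * B1 + 1 / 2 * ‖T‖ := by
      calc A2 * ‖b‖ ≤ A2 * (B1 + Cl * C0 * √s * ‖T‖) := by gcongr
        _ = A2 * B1 + (A2 * (Cl * C0) * √s) * ‖T‖ := by ring
        _ ≤ _ := by gcongr
    have h3 : V / (2 * D2.c) = V / D2.c / 2 := by field_simp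
    linarith
  refine opNorm_le_bound _ (by positivity) fun v => ?_
  set a := inner ℂ ν v with hadef
  have hav : ‖a‖ ≤ ‖v‖ := by
    have := norm_inner_le_norm (𝕜 := ℂ) ν v
    rwa [hν, one_mul] at this
  have hv' : inner ℂ ν (v - a • ν) = (0:ℂ) := by
    rw [inner_sub_right, inner_smul_right, hνν]; simp [hadef]
  have h1 := (hT _ hv').2.1
  have h2 : ‖v - a • ν‖ ≤ 2 * ‖v‖ := by
    refine (norm_sub_le _ _).trans ?_
    rw [norm_smul, hν]; linarith
  have h3 : fderiv ℂ f z v = fderiv ℂ f z (v - a • ν) + a • T := by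
    rw [map_sub, map_smul]; simp [hTd]
  rw [h3]
  calc _ ≤ ‖fderiv ℂ f z (v - a • ν)‖ + ‖a‖ * ‖T‖ := by rw [← norm_smul]; exact norm_add_le _ _
    _ ≤ Ct * (2 * ‖v‖) + ‖v‖ * (V / D2.c + 2 * A2 * B1) := by
        refine add_le_add (h1.trans (by gcongr)) ?_
        gcongr
    _ = _ := by ring

end

section
variable {D1 D2 : Dom E} {f : E → E}

lemma rpow_neg_comp {s d C1 a:ℝ} (hs : 0 < s) (hd : 0 < d) (hC1 : 1 ≤ C1) (h : d ≤ C1 * s) (ha0 : -1 ≤ a) (ha : a ≤ 0) :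
  s ^ a ≤ C1 * d ^ a := by
  have hC : 0 < C1 := by linarith
  have h1 : d / C1 ≤ s := by rw [div_le_iff₀ hC]; linarith
  calc s ^ a ≤ (d / C1) ^ a := rpow_le_rpow_of_nonpos (by positivity) h1 ha
    _ = C1 ^ (-a) * d ^ a := by
      rw [Real.div_rpow hd.le hC.le, Real.rpow_neg hC.le]; field_simp
    _ ≤ C1 ^ (1:ℝ) * d ^ a := by
      gcongr
      linarith
    _ = _ := by rw [rpow_one]

set_option maxHeartbeats 800000 in
lemma PMap.step (P : PMap D1 D2 f) (hND : NDp D1 f) {α:ℝ} (h0 : 1/2 < α) (h1 : α < 1) :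
  ∃ K > (0:ℝ), ∀ τ : ℝ, 0 < τ → ∀ N : ℝ, 0 ≤ N →
  (∀ z ∈ D1.Ω, ‖fderiv ℂ f z‖ ≤ N * (-D1.r z) ^ (α - 1) + N * τ * (-D1.r z) ^ ((1/2:ℝ) - 1)) →
  (∀ z ∈ D1.Ω, ‖fderiv ℂ f z‖ ≤ (N / 2 + K) * (-D1.r z) ^ (α - 1) + (N / 2 + K) * τ * (-D1.r z) ^ ((1/2:ℝ) - 1)) := by
  obtain ⟨F, hFf, C0, hC0, hF⟩ := P.exists_F
  obtain ⟨CC, hCC, L, hL, η, hη, hrep⟩ := D1.normal_rep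
  obtain ⟨R1, hR1, C1, hC1, B, hB, hnear⟩ := P.near hC0 hFf hF hL
  obtain ⟨CH, hCH, δ, hδ, hHL⟩ := P.HLF hF (by linarith) h1
  obtain ⟨Ca, hCa, hcp⟩ := conj_pair (α := α) (by linarith) h1
  obtain ⟨Ch, hCh, hhalf⟩ := P.deriv_half
  have hc := D2.c_pos
  have hC1p : 0 < C1 := by linarith
  set ε := D2.c / (2 * Ca * C1 * CH) with hε
  have hεp : 0 < ε := by positivity
  obtain ⟨R, hR, hRm, -, CR, hCR, hcirc⟩ := P.circ hND hC0 hFf hF hL hεp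
    (Rm := min (δ / 4) (1/2)) (by positivity)
  have hRδ : R ≤ δ / 4 := hRm.trans (min_le_left _ _)
  have hRh : R ≤ 1 / 2 := hRm.trans (min_le_right _ _)
  obtain ⟨η', hη', j1, j2, j3, j4⟩ : ∃ η' > 0, η' ≤ η ∧ η' ≤ 1 ∧ CC * η' ≤ R1 ∧ CC * η' ≤ R := by
    refine ⟨min η (min 1 (min (R1 / CC) (R / CC))), by positivity, by simp, by simp, ?_, ?_⟩
    · have : min η (min 1 (min (R1 / CC) (R / CC))) ≤ R1 / CC := by simp
      rw [le_div_iff₀ hCC] at this; linarith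
    · have : min η (min 1 (min (R1 / CC) (R / CC))) ≤ R / CC := by simp
      rw [le_div_iff₀ hCC] at this; linarith
  set K := Ca * C1 * CR / D2.c + B + Ch * η' ^ (1/2 - α) with hK
  have hKp : 0 < K := by positivity
  refine ⟨K, hKp, ?_⟩
  intro τ hτ N hN hN1 z hz
  have hd : 0 < -D1.r z := by linarith [D1.neg hz]
  set d := -D1.r z with hdd
  by_cases hdη : d < η'
  · obtain ⟨p, hp, ν, hν, s, hs, g, g1, g2, hsd, hzp, -, hdl⟩ := hrep z hz (lt_of_lt_of_le hdη j1)
    have hcfg : Cfg D1 L p ν := ⟨hp, hν, g, g1, g2, hdl⟩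
    have hsη : s ≤ CC * η' := hsd.trans (by gcongr)
    obtain ⟨-, hds, hV⟩ := hnear p ν hcfg s hs (hsη.trans j3)
    rw [← hzp] at hds hV
    have hVb := hV (Ca * (((CR + ε * CH * N) * s ^ α + ε * CH * (N * τ) * s ^ (1/2:ℝ)) / s)) (by positivity) (by
      intro Y hY1 hYk
      obtain ⟨u, v, hu, hv, hu0, hv0, hvd, hmem, hb⟩ := hcirc p ν hcfg Y hY1 hYk
      have hder : deriv v s = LsL D2.r (F p) Y (fderiv ℂ f z ν) := by
        have hs0 : (s:ℂ) ≠ 0 := by exact_mod_cast hs.ne'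
        have q1 : HasDerivAt (fun ζ : ℂ => p + ζ • ν) ν (s:ℂ) := by
          have := ((hasDerivAt_id (s:ℂ)).smul_const ν).const_add p
          simpa using this
        have q2 : HasFDerivAt f (fderiv ℂ f z) (p + (s:ℂ) • ν) := by
          rw [← hzp]
          exact (P.hol.differentiableAt (D1.isOpen.mem_nhds hz)).hasFDerivAt
        have q3 := (q2.comp_hasDerivAt (s:ℂ) q1).sub_const (F p)
        have q4 := (LsL D2.r (F p) Y).hasFDerivAt.comp_hasDerivAt (s:ℂ) q3
        refine (q4.congr_of_eventuallyEq ?_).deriv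
        filter_upwards [isOpen_ne.mem_nhds hs0] with ζ hζ
        exact hvd ζ hζ
      rw [← hder]
      refine hcp R hR u v hu hv _ (by positivity) _ (by positivity) ?_ s hs (hsη.trans j4)
      intro ζ hζ
      by_cases hζ0 : ζ = 0
      · rw [hζ0, hu0, hv0]; simp; positivity
      have w1 := hb ζ hζ0 hζ
      have w2 : ‖ζ‖ ≤ 2 * R := (inD_closedBall hR hζ.le hζ0).le hR
      have w3 : ‖p + ζ • ν - p‖ = ‖ζ‖ := by rw [add_sub_cancel_left, norm_smul, hν, mul_one]
      have w4 := hHL N (N * τ) hN (by positivity) hN1 (p + ζ • ν) (hmem ζ hζ0 hζ.le) p hp (by rw [w3]; linarith)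
      rw [w3] at w4
      have w5 : ‖ζ‖ ≤ ‖ζ‖ ^ α := by
        have := rpow_le_rpow_of_exponent_ge (norm_pos_iff.2 hζ0) (by linarith) h1.le
        rwa [rpow_one] at this
      calc _ ≤ CR * ‖ζ‖ ^ α + ε * (CH * (N * ‖ζ‖ ^ α + N * τ * ‖ζ‖ ^ (1/2:ℝ))) := by
            refine w1.trans ?_
            gcongr
        _ = _ := by ring)
    have e1 : s ^ α / s = s ^ (α - 1) := by rw [rpow_sub hs, rpow_one]
    have e2 : s ^ (1/2:ℝ) / s = s ^ ((1/2:ℝ) - 1) := by rw [rpow_sub hs, rpow_one]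
    have e3 := rpow_neg_comp hs hd hC1 hds (a := α - 1) (by linarith) (by linarith)
    have e4 := rpow_neg_comp hs hd hC1 hds (a := (1/2:ℝ) - 1) (by norm_num) (by norm_num)
    have e5 : 1 ≤ d ^ (α - 1) := Real.one_le_rpow_of_pos_of_le_one_of_nonpos hd (by linarith) (by linarith)
    have e6 : 0 < d ^ ((1/2:ℝ) - 1) := by positivity
    have e7 : 0 < η' ^ (1/2 - α) := by positivity
    calc _ ≤ _ := hVb
      _ = Ca * ((CR + ε * CH * N) * (s ^ α / s) + ε * CH * (N * τ) * (s ^ (1/2:ℝ) / s)) / D2.c + B := by ring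
      _ ≤ Ca * ((CR + ε * CH * N) * (C1 * d ^ (α - 1)) + ε * CH * (N * τ) * (C1 * d ^ ((1/2:ℝ) - 1))) / D2.c
          + B * d ^ (α - 1) := by
          rw [e1, e2]
          refine add_le_add ?_ (by nlinarith)
          gcongr
      _ = (N / 2 + (Ca * C1 * CR / D2.c + B)) * d ^ (α - 1) + N / 2 * τ * d ^ ((1/2:ℝ) - 1) := by
          rw [hε]; field_simp; ring
      _ ≤ _ := by
          have k1 : Ca * C1 * CR / D2.c + B ≤ K := by
            rw [hK]; exact le_add_of_nonneg_right (mul_pos hCh e7).le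
          have k2 : N / 2 ≤ N / 2 + K := by linarith
          gcongr
  · push Not at hdη
    have e1 : d ^ ((1/2:ℝ) - 1) ≤ η' ^ (1/2 - α) * d ^ (α - 1) := by
      have : d ^ ((1/2:ℝ) - 1) = d ^ (1/2 - α) * d ^ (α - 1) := by
        rw [← rpow_add hd]; congr 1; ring
      rw [this]
      gcongr ?_ * _
      exact rpow_le_rpow_of_nonpos hη' hdη (by linarith)
    have e2 := hhalf z hz
    have e3 : Ch * η' ^ (1/2 - α) ≤ K := by
      rw [hK]
      have : 0 < Ca * C1 * CR / D2.c := by positivity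
      linarith
    have e6 : 0 < d ^ ((1/2:ℝ) - 1) := by positivity
    calc _ ≤ _ := e2
      _ ≤ Ch * (η' ^ (1/2 - α) * d ^ (α - 1)) := by gcongr
      _ = (Ch * η' ^ (1/2 - α)) * d ^ (α - 1) + 0 := by ring
      _ ≤ _ := by
          gcongr
          · linarith
          · positivity

lemma PMap.deriv_alpha (P : PMap D1 D2 f) (hND : NDp D1 f) {α:ℝ} (h0 : 1/2 < α) (h1 : α < 1) :
  ∃ A > 0, ∀ z ∈ D1.Ω, ‖fderiv ℂ f z‖ ≤ A * (-D1.r z) ^ (α - 1) := by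
  obtain ⟨K, hK, hst⟩ := P.step hND h0 h1
  obtain ⟨Ch, hCh, hhalf⟩ := P.deriv_half
  refine ⟨2 * K, by positivity, ?_⟩
  have key : ∀ τ : ℝ, 0 < τ → ∀ z ∈ D1.Ω, ‖fderiv ℂ f z‖ ≤ 2 * K * (-D1.r z) ^ (α - 1) + 2 * K * τ * (-D1.r z) ^ ((1/2:ℝ) - 1) := by
    intro τ hτ z hz
    have it : ∀ n : ℕ, ∀ z ∈ D1.Ω, ‖fderiv ℂ f z‖ ≤ ((Ch / τ) * (1/2) ^ n + 2 * K) * (-D1.r z) ^ (α - 1)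
        + ((Ch / τ) * (1/2) ^ n + 2 * K) * τ * (-D1.r z) ^ ((1/2:ℝ) - 1) := by
      intro n
      induction n with
      | zero =>
        intro z hz
        have hd : 0 < -D1.r z := by linarith [D1.neg hz]
        have e1 : 0 < (-D1.r z) ^ (α - 1) := by positivity
        have e2 : 0 < (-D1.r z) ^ ((1/2:ℝ) - 1) := by positivity
        calc _ ≤ _ := hhalf z hz
          _ = 0 + (Ch / τ) * τ * (-D1.r z) ^ ((1/2:ℝ) - 1) := by field_simp; ring
          _ ≤ _ := by
            gcongr
            · positivity
            · simp; positivity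
      | succ n ih =>
        intro z hz
        have := hst τ hτ _ (by positivity) ih z hz
        convert this using 2 <;> ring
    have l1 : Tendsto (fun n : ℕ => (Ch / τ) * (1/2:ℝ) ^ n + 2 * K) atTop (𝓝 ((Ch / τ) * 0 + 2 * K)) :=
      ((tendsto_pow_atTop_nhds_zero_of_lt_one (by norm_num) (by norm_num)).const_mul _).add_const _
    have l2 := (l1.mul_const ((-D1.r z) ^ (α - 1))).add ((l1.mul_const τ).mul_const ((-D1.r z) ^ ((1/2:ℝ) - 1)))
    have := ge_of_tendsto' l2 fun n => it n z hz
    simpa using this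
  intro z hz
  have l1 : Tendsto (fun τ : ℝ => 2 * K * (-D1.r z) ^ (α - 1) + 2 * K * τ * (-D1.r z) ^ ((1/2:ℝ) - 1)) (𝓝[>] 0)
      (𝓝 (2 * K * (-D1.r z) ^ (α - 1) + 2 * K * 0 * (-D1.r z) ^ ((1/2:ℝ) - 1))) := by
    apply Tendsto.mono_left _ nhdsWithin_le_nhds
    apply Continuous.tendsto
    fun_prop
  have := ge_of_tendsto l1 (by
    filter_upwards [self_mem_nhdsWithin] with τ hτ
    exact key τ hτ z hz)
  simpa using this

lemma PMap.final (P : PMap D1 D2 f) (hND : NDp D1 f) {α:ℝ} (h0 : 0 ≤ α) (h1 : α < 1) :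
  ∃ F : E → E, ContinuousOn F (closure D1.Ω) ∧ EqOn F f D1.Ω ∧
  ∃ C > 0, ∀ z ∈ closure D1.Ω, ∀ w ∈ closure D1.Ω, ‖F z - F w‖ ≤ C * ‖z - w‖ ^ α := by
  set β := max α (3/4) with hβ
  have b0 : 1/2 < β := lt_of_lt_of_le (by norm_num) (le_max_right _ _)
  have b1 : β < 1 := max_lt h1 (by norm_num)
  obtain ⟨A, hA, hd⟩ := P.deriv_alpha hND b0 b1
  obtain ⟨C, hC, hh⟩ := P.extend (by linarith) b1.le hA.le hd
  obtain ⟨F, F1, F2, F3⟩ := holder_extend (by linarith) hC hh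
  refine ⟨F, F1, F2, ?_⟩
  obtain ⟨Q, hQ⟩ := D1.cpt.isBounded.exists_norm_le
  set Q' := max (2 * Q) 1 with hQ'
  have hQp : 0 < Q' := by positivity
  refine ⟨C * Q' ^ (β - α), by positivity, fun z hz w hw => (F3 z hz w hw).trans ?_⟩
  have hn : ‖z - w‖ ≤ Q' := by
    refine (norm_sub_le _ _).trans (le_trans ?_ (le_max_left _ _))
    linarith [hQ z hz, hQ w hw]
  rw [mul_assoc]
  gcongr
  by_cases h : ‖z - w‖ = 0
  · rw [h, zero_rpow (by linarith)]; positivity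
  have hp : 0 < ‖z - w‖ := lt_of_le_of_ne (norm_nonneg _) (Ne.symm h)
  have hαβ : α ≤ β := le_max_left _ _
  calc ‖z - w‖ ^ β = ‖z - w‖ ^ (β - α) * ‖z - w‖ ^ α := by rw [← rpow_add hp]; congr 1; ring
    _ ≤ _ := by gcongr

end

section
variable {e:E}
section

/-- the coordinate along `e` -/
noncomputable def wc (e:E) : E →L[ℂ] ℂ := innerSL ℂ e
/-- the projection to the complement of `e` -/
noncomputable def pz (e:E) : E →L[ℂ] E := ContinuousLinearMap.id ℂ E - (wc e).smulRight e
/-- the defining function of the Siegel domain -/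
noncomputable def rr (e:E) (x:E) : ℝ := (wc e x).im - ‖pz e x‖ ^ 2
def Sg (e:E) : Set E := {x | 0 < rr e x}

lemma wc_apply (e x:E) : wc e x = inner ℂ e x := rfl
lemma pz_apply (e x:E) : pz e x = x - wc e x • e := by simp [pz]

lemma wc_e (he : ‖e‖ = 1) : wc e e = 1 := by
  rw [wc_apply, inner_self_eq_norm_sq_to_K, he]; simp
lemma pz_e (he : ‖e‖ = 1) : pz e e = 0 := by rw [pz_apply, wc_e he]; simp
lemma wc_pz (he : ‖e‖ = 1) (x:E) : wc e (pz e x) = 0 := by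
  rw [pz_apply, map_sub, map_smul, wc_e he]; simp
lemma pz_of {e x:E} (h : wc e x = 0) : pz e x = x := by rw [pz_apply, h]; simp
lemma decomp (e x:E) : pz e x + wc e x • e = x := by rw [pz_apply]; abel

lemma norm_sq_mk (he : ‖e‖ = 1) {z:E} (hz : wc e z = 0) (w:ℂ) :
  ‖z + w • e‖ ^ 2 = ‖z‖ ^ 2 + ‖w‖ ^ 2 := by
  have h1 : inner ℂ z (w • e) = (0:ℂ) := by
    rw [inner_smul_right, ← inner_conj_symm, ← wc_apply, hz]; simp
  have := norm_add_sq_eq_norm_sq_add_norm_sq_of_inner_eq_zero z (w • e) h1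
  rw [norm_smul, he, mul_one] at this
  nlinarith
lemma norm_sq_decomp (he : ‖e‖ = 1) (x:E) : ‖x‖ ^ 2 = ‖pz e x‖ ^ 2 + ‖wc e x‖ ^ 2 := by
  conv_lhs => rw [← decomp e x]
  exact norm_sq_mk he (wc_pz he x) _
lemma wc_mk (he : ‖e‖ = 1) {z:E} (hz : wc e z = 0) (w:ℂ) : wc e (z + w • e) = w := by
  rw [map_add, map_smul, hz, wc_e he]; simp
lemma pz_mk (he : ‖e‖ = 1) {z:E} (hz : wc e z = 0) (w:ℂ) : pz e (z + w • e) = z := by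
  rw [map_add, map_smul, pz_of hz, pz_e he]; simp
lemma wc_smul_pz (he : ‖e‖ = 1) (c:ℂ) (x:E) : wc e (c • pz e x) = 0 := by
  rw [map_smul, wc_pz he]; simp

lemma rr_mk (he : ‖e‖ = 1) {z:E} (hz : wc e z = 0) (w:ℂ) : rr e (z + w • e) = w.im - ‖z‖ ^ 2 := by
  rw [rr, wc_mk he hz, pz_mk he hz]

lemma rr_cont (e:E) : Continuous (rr e) := by unfold rr; fun_prop
lemma Sg_open (e:E) : IsOpen (Sg e) := isOpen_lt continuous_const (rr_cont e)
lemma Sg_im {e x:E} (hx : x ∈ Sg e) : 0 < (wc e x).im := by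
  have h : 0 < rr e x := hx
  unfold rr at h
  have := sq_nonneg ‖pz e x‖
  linarith
lemma rr_o (he : ‖e‖ = 1) : rr e (I • e) = 1 := by
  rw [rr, map_smul, map_smul, wc_e he, pz_e he]; simp
lemma o_mem (he : ‖e‖ = 1) : I • e ∈ Sg e := by
  change 0 < rr e _; rw [rr_o he]; exact one_pos

/-- Cayley transform -/
noncomputable def cay (e:E) (b:E) : E :=
  (1 + wc e b)⁻¹ • pz e b + (I * (1 - wc e b) / (1 + wc e b)) • e
noncomputable def cayi (e:E) (x:E) : E :=
  (2 * I / (I + wc e x)) • pz e x + ((I - wc e x) / (I + wc e x)) • e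

lemma wc_norm_le (he : ‖e‖ = 1) (b:E) : ‖wc e b‖ ≤ ‖b‖ := by
  have := norm_inner_le_norm (𝕜 := ℂ) e b
  rwa [he, one_mul] at this

lemma one_add_wc_ne (he : ‖e‖ = 1) {b:E} (hb : ‖b‖ < 1) : 1 + wc e b ≠ 0 := by
  intro h
  have h1 : wc e b = -1 := by linear_combination h
  have := wc_norm_le he b
  rw [h1, norm_neg, norm_one] at this
  linarith

lemma I_add_wc_ne {e x:E} (hx : x ∈ Sg e) : I + wc e x ≠ 0 := by
  intro h
  have h1 := congrArg Complex.im h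
  have := Sg_im hx
  simp at h1
  linarith

lemma rr_cay (he : ‖e‖ = 1) {b:E} (hb : ‖b‖ < 1) :
  rr e (cay e b) = (1 - ‖b‖ ^ 2) / ‖1 + wc e b‖ ^ 2 := by
  have h := one_add_wc_ne he hb
  rw [cay, rr_mk he (wc_smul_pz he _ _), norm_smul, norm_inv, norm_sq_decomp he b]
  set β := wc e b
  have hn : 0 < ‖1 + β‖ ^ 2 := by have := norm_pos_iff.2 h; positivity
  have h1 : (I * (1 - β) / (1 + β)).im = (1 - ‖β‖ ^ 2) / ‖1 + β‖ ^ 2 := by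
    rw [Complex.div_im, ← normSq_eq_norm_sq, ← normSq_eq_norm_sq, ← sub_div]
    congr 1
    simp [normSq_apply]; ring
  rw [h1, mul_pow]
  field_simp
  ring

lemma cay_mem (he : ‖e‖ = 1) {b:E} (hb : ‖b‖ < 1) : cay e b ∈ Sg e := by
  change 0 < rr e _
  rw [rr_cay he hb]
  have := norm_pos_iff.2 (one_add_wc_ne he hb)
  have : ‖b‖ ^ 2 < 1 := by nlinarith [norm_nonneg b]
  apply div_pos <;> [linarith; positivity]

lemma cayi_norm (he : ‖e‖ = 1) {x:E} (hx : x ∈ Sg e) :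
  1 - ‖cayi e x‖ ^ 2 = 4 * rr e x / ‖I + wc e x‖ ^ 2 := by
  have h := I_add_wc_ne hx
  rw [cayi, norm_sq_mk he (wc_smul_pz he _ _), norm_smul, norm_div, norm_div, rr]
  set w := wc e x
  have hn : 0 < ‖I + w‖ := norm_pos_iff.2 h
  have h1 : ‖I + w‖ ^ 2 - ‖I - w‖ ^ 2 = 4 * w.im := by
    rw [← normSq_eq_norm_sq, ← normSq_eq_norm_sq]
    simp [normSq_apply]; ring
  have h2 : ‖2 * I‖ = 2 := by simp
  rw [h2]
  field_simp
  linear_combination h1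

lemma cayi_lt (he : ‖e‖ = 1) {x:E} (hx : x ∈ Sg e) : ‖cayi e x‖ < 1 := by
  have h := cayi_norm he hx
  have h1 : 0 < 4 * rr e x / ‖I + wc e x‖ ^ 2 := by
    have := norm_pos_iff.2 (I_add_wc_ne hx)
    have : 0 < rr e x := hx
    positivity
  nlinarith [norm_nonneg (cayi e x)]

lemma cay_cayi (he : ‖e‖ = 1) {x:E} (hx : x ∈ Sg e) : cay e (cayi e x) = x := by
  have h := I_add_wc_ne hx
  have h2 : wc e (cayi e x) = (I - wc e x) / (I + wc e x) := wc_mk he (wc_smul_pz he _ _) _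
  have h3 : pz e (cayi e x) = (2 * I / (I + wc e x)) • pz e x := pz_mk he (wc_smul_pz he _ _) _
  conv_rhs => rw [← decomp e x]
  have hI : I ≠ 0 := I_ne_zero
  have h4 : 1 + (I - wc e x) / (I + wc e x) = 2 * I / (I + wc e x) := by
    field_simp; ring
  rw [cay, h2, h3, h4, smul_smul]
  congr 2
  · rw [inv_mul_cancel₀ (div_ne_zero (mul_ne_zero two_ne_zero hI) h), one_smul]
  · field_simp; ring

lemma cay_diff (he : ‖e‖ = 1) : DifferentiableOn ℂ (cay e) (ball 0 1) := by
  intro b hb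
  have h := one_add_wc_ne he (mem_ball_zero_iff.1 hb)
  unfold cay
  refine DifferentiableAt.differentiableWithinAt ?_
  fun_prop (disch := assumption)

lemma cayi_diff (e:E) : DifferentiableOn ℂ (cayi e) (Sg e) := by
  intro x hx
  have h := I_add_wc_ne hx
  unfold cayi
  refine DifferentiableAt.differentiableWithinAt ?_
  fun_prop (disch := assumption)

lemma cay_zero (e:E) : cay e 0 = I • e := by simp [cay]
lemma cayi_o (he : ‖e‖ = 1) : cayi e (I • e) = 0 := by
  simp [cayi, wc_e he, pz_e he]

noncomputable def Tc (e:E) : E →L[ℂ] E := pz e + (-2 * I) • (wc e).smulRight e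
noncomputable def Tci (e:E) : E →L[ℂ] E := pz e + (I / 2) • (wc e).smulRight e
lemma Tc_apply (e v:E) : Tc e v = pz e v + (-2 * I * wc e v) • e := by
  simp [Tc, smul_smul]
lemma Tci_apply (e v:E) : Tci e v = pz e v + (I / 2 * wc e v) • e := by
  simp [Tci, smul_smul]

lemma cay_fderiv (he : ‖e‖ = 1) : fderiv ℂ (cay e) 0 = Tc e := by
  have hd : DifferentiableAt ℂ (cay e) 0 := (cay_diff he).differentiableAt (ball_mem_nhds _ one_pos)
  ext v
  have h1 := deriv_comp_line v hd
  refine h1.unique ?_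
  rw [Tc_apply]
  have h2 : HasDerivAt (fun ζ : ℂ => 1 + ζ * wc e v) (wc e v) 0 := by
    have := ((hasDerivAt_id (0:ℂ)).mul_const (wc e v)).const_add 1
    simpa using this
  have h3 : HasDerivAt (fun ζ : ℂ => (1 + ζ * wc e v)⁻¹ * ζ) 1 0 := by
    exact ((h2.fun_inv (by simp)).fun_mul (hasDerivAt_id' (0:ℂ))).congr_deriv (by simp)
  have h4 : HasDerivAt (fun ζ : ℂ => I * (1 - ζ * wc e v) / (1 + ζ * wc e v)) (-2 * I * wc e v) 0 := by
    have h5 : HasDerivAt (fun ζ : ℂ => I * (1 - ζ * wc e v)) (I * (-wc e v)) 0 := by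
      have := (((hasDerivAt_id (0:ℂ)).mul_const (wc e v)).const_sub 1).const_mul I
      simpa using this
    exact (h5.fun_div h2 (by simp)).congr_deriv (by simp; ring)
  have := (h3.smul_const (pz e v)).add (h4.smul_const e)
  rw [one_smul] at this
  refine this.congr_of_eventuallyEq (Eventually.of_forall fun ζ => ?_)
  simp [cay, smul_smul]

lemma cayi_fderiv (he : ‖e‖ = 1) : fderiv ℂ (cayi e) (I • e) = Tci e := by
  have hd : DifferentiableAt ℂ (cayi e) (I • e) :=
    (cayi_diff e).differentiableAt ((Sg_open e).mem_nhds (o_mem he))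
  ext v
  have h1 := deriv_comp_line v hd
  refine h1.unique ?_
  rw [Tci_apply]
  have hI : I + I ≠ 0 := by rw [← two_mul]; simp
  have h2 : HasDerivAt (fun ζ : ℂ => I + (I + ζ * wc e v)) (wc e v) 0 := by
    have := (((hasDerivAt_id (0:ℂ)).mul_const (wc e v)).const_add I).const_add I
    simpa using this
  have h3 : HasDerivAt (fun ζ : ℂ => 2 * I / (I + (I + ζ * wc e v)) * ζ) 1 0 := by
    exact (((hasDerivAt_const (0:ℂ) (2 * I)).fun_div h2 (by simpa using hI)).fun_mul
      (hasDerivAt_id' (0:ℂ))).congr_deriv (by simp [← two_mul])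
  have h4 : HasDerivAt (fun ζ : ℂ => (I - (I + ζ * wc e v)) / (I + (I + ζ * wc e v)))
      (I / 2 * wc e v) 0 := by
    have h5 : HasDerivAt (fun ζ : ℂ => I - (I + ζ * wc e v)) (-wc e v) 0 := by
      have := (((hasDerivAt_id (0:ℂ)).mul_const (wc e v)).const_add I).const_sub I
      simpa using this
    refine (h5.fun_div h2 (by simpa using hI)).congr_deriv ?_
    have : I ≠ 0 := I_ne_zero
    simp
    field_simp
    simp
    ring_nf
    exact Or.inl trivial
  have := (h3.smul_const (pz e v)).add (h4.smul_const e)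
  rw [one_smul] at this
  refine this.congr_of_eventuallyEq (Eventually.of_forall fun ζ => ?_)
  simp [cayi, smul_smul, wc_e he, pz_e he]

lemma Tci_Tc (he : ‖e‖ = 1) (v:E) : Tci e (Tc e v) = v := by
  rw [Tci_apply, Tc_apply, pz_mk he (wc_pz he v), wc_mk he (wc_pz he v)]
  conv_rhs => rw [← decomp e v]
  congr 2
  linear_combination (-wc e v) * I_mul_I

lemma Tc_Tci (he : ‖e‖ = 1) (v:E) : Tc e (Tci e v) = v := by
  rw [Tc_apply, Tci_apply, pz_mk he (wc_pz he v), wc_mk he (wc_pz he v)]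
  conv_rhs => rw [← decomp e v]
  congr 2
  linear_combination (-wc e v) * I_mul_I

noncomputable def om (e v:E) : ℝ := ‖pz e v‖ ^ 2 + ‖wc e v‖ ^ 2 / 4

lemma Tci_norm (he : ‖e‖ = 1) (v:E) : ‖Tci e v‖ ^ 2 = om e v := by
  rw [Tci_apply, norm_sq_mk he (wc_pz he v), om, norm_mul, norm_div]
  simp; ring

/-- conjugated map on the ball -/
noncomputable def gb (e:E) (ψ : E → E) : E → E := fun b => cayi e (ψ (cay e b))

lemma gb_diff (he : ‖e‖ = 1) {ψ : E → E} (hψ : DifferentiableOn ℂ ψ (Sg e)) (hm : MapsTo ψ (Sg e) (Sg e)) :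
  DifferentiableOn ℂ (gb e ψ) (ball 0 1) := by
  have h1 : MapsTo (cay e) (ball 0 1) (Sg e) := fun b hb => cay_mem he (mem_ball_zero_iff.1 hb)
  exact (cayi_diff e).comp (hψ.comp (cay_diff he) h1) (hm.comp h1)

lemma gb_maps (he : ‖e‖ = 1) {ψ : E → E} (hm : MapsTo ψ (Sg e) (Sg e)) :
  MapsTo (gb e ψ) (ball 0 1) (ball 0 1) := fun b hb => by
  rw [mem_ball_zero_iff]
  exact cayi_lt he (hm (cay_mem he (mem_ball_zero_iff.1 hb)))

lemma gb_zero (he : ‖e‖ = 1) {ψ : E → E} (ho : ψ (I • e) = I • e) : gb e ψ 0 = 0 := by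
  rw [gb, cay_zero, ho, cayi_o he]

lemma gb_norm (he : ‖e‖ = 1) {ψ : E → E} (hψ : DifferentiableOn ℂ ψ (Sg e)) (hm : MapsTo ψ (Sg e) (Sg e))
  (ho : ψ (I • e) = I • e) {b:E} (hb : ‖b‖ < 1) : ‖gb e ψ b‖ ≤ ‖b‖ :=
  Complex.norm_le_norm_of_mapsTo_ball (gb_diff he hψ hm) ((gb_maps he hm).mono_right ball_subset_closedBall)
    (gb_zero he ho) hb

lemma gb_fderiv (he : ‖e‖ = 1) {ψ : E → E} (hψ : DifferentiableOn ℂ ψ (Sg e))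
  (ho : ψ (I • e) = I • e) :
  fderiv ℂ (gb e ψ) 0 = (Tci e).comp ((fderiv ℂ ψ (I • e)).comp (Tc e)) := by
  have h1 : HasFDerivAt (cay e) (Tc e) 0 := by
    rw [← cay_fderiv he]
    exact ((cay_diff he).differentiableAt (ball_mem_nhds _ one_pos)).hasFDerivAt
  have h2 : HasFDerivAt ψ (fderiv ℂ ψ (I • e)) (cay e 0) := by
    rw [cay_zero]
    exact (hψ.differentiableAt ((Sg_open e).mem_nhds (o_mem he))).hasFDerivAt
  have h3 : HasFDerivAt (cayi e) (Tci e) ((ψ ∘ cay e) 0) := by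
    rw [Function.comp, cay_zero, ho, ← cayi_fderiv he]
    exact ((cayi_diff e).differentiableAt ((Sg_open e).mem_nhds (o_mem he))).hasFDerivAt
  exact (h3.comp 0 (h2.comp 0 h1)).fderiv

lemma schwarz_om (he : ‖e‖ = 1) {ψ : E → E} (hψ : DifferentiableOn ℂ ψ (Sg e)) (hm : MapsTo ψ (Sg e) (Sg e))
  (ho : ψ (I • e) = I • e) (v:E) : om e (fderiv ℂ ψ (I • e) v) ≤ om e v := by
  have h1 : ‖fderiv ℂ (gb e ψ) 0‖ ≤ 1 := Complex.norm_fderiv_le_one_of_mapsTo_ball (gb_diff he hψ hm)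
    (by rw [gb_zero he ho]; exact (gb_maps he hm).mono_right ball_subset_closedBall) one_pos
  have h2 := (fderiv ℂ (gb e ψ) 0).le_opNorm (Tci e v)
  rw [gb_fderiv he hψ ho] at h2 h1
  simp only [ContinuousLinearMap.comp_apply, Tc_Tci he] at h2
  rw [← Tci_norm he, ← Tci_norm he]
  gcongr
  refine h2.trans (mul_le_of_le_one_left (norm_nonneg _) h1)

end
end

section
variable {e:E}
section

/-- linear part of the affine automorphism moving `I • e` to `x0` -/
noncomputable def Al (e x0:E) : E →L[ℂ] E :=
  ((√(rr e x0):ℝ):ℂ) • pz e + (((rr e x0:ℝ):ℂ) • wc e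
    + (2 * I * ((√(rr e x0):ℝ):ℂ)) • innerSL ℂ (pz e x0)).smulRight e
noncomputable def Ali (e x0:E) : E →L[ℂ] E :=
  ((√(rr e x0):ℝ):ℂ)⁻¹ • pz e + (((rr e x0:ℝ):ℂ)⁻¹ • (wc e
    - (2 * I) • innerSL ℂ (pz e x0))).smulRight e
noncomputable def c0 (e x0:E) : E :=
  pz e x0 + (((wc e x0).re:ℂ) + I * ((‖pz e x0‖ ^ 2:ℝ):ℂ)) • e
noncomputable def al (e x0 x:E) : E := c0 e x0 + Al e x0 x
noncomputable def ali (e x0 y:E) : E := Ali e x0 (y - c0 e x0)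

lemma Al_apply (e x0 x:E) : Al e x0 x = ((√(rr e x0):ℝ):ℂ) • pz e x +
  (((rr e x0:ℝ):ℂ) * wc e x + 2 * I * ((√(rr e x0):ℝ):ℂ) * inner ℂ (pz e x0) x) • e := by
  simp [Al]
lemma Ali_apply (e x0 x:E) : Ali e x0 x = ((√(rr e x0):ℝ):ℂ)⁻¹ • pz e x +
  (((rr e x0:ℝ):ℂ)⁻¹ * (wc e x - 2 * I * inner ℂ (pz e x0) x)) • e := by
  simp [Ali]

lemma inner_pz_e (he : ‖e‖ = 1) (x:E) : inner ℂ (pz e x) e = (0:ℂ) := by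
  rw [← inner_conj_symm, ← wc_apply, wc_pz he]; simp
lemma inner_pz_pz (he : ‖e‖ = 1) (x y:E) : inner ℂ (pz e x) (pz e y) = (inner ℂ (pz e x) y:ℂ) := by
  rw [pz_apply e y, inner_sub_right, inner_smul_right, inner_pz_e he]; simp

lemma sqrt_c {t:ℝ} (ht : 0 ≤ t) : ((√t:ℝ):ℂ) * ((√t:ℝ):ℂ) = (t:ℂ) := by
  rw [← ofReal_mul, mul_self_sqrt ht]

lemma sqrt_c_ne {t:ℝ} (ht : 0 < t) : ((√t:ℝ):ℂ) ≠ 0 := by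
  rw [Complex.ofReal_ne_zero]; exact (sqrt_pos.2 ht).ne'

lemma pz_Al (he : ‖e‖ = 1) (x0 x:E) : pz e (Al e x0 x) = ((√(rr e x0):ℝ):ℂ) • pz e x := by
  rw [Al_apply, pz_mk he (wc_smul_pz he _ _)]
lemma wc_Al (he : ‖e‖ = 1) (x0 x:E) : wc e (Al e x0 x) =
  ((rr e x0:ℝ):ℂ) * wc e x + 2 * I * ((√(rr e x0):ℝ):ℂ) * inner ℂ (pz e x0) x := by
  rw [Al_apply, wc_mk he (wc_smul_pz he _ _)]
lemma pz_Ali (he : ‖e‖ = 1) (x0 x:E) : pz e (Ali e x0 x) = ((√(rr e x0):ℝ):ℂ)⁻¹ • pz e x := by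
  rw [Ali_apply, pz_mk he (wc_smul_pz he _ _)]

lemma Ali_Al (he : ‖e‖ = 1) {x0:E} (h0 : x0 ∈ Sg e) (x:E) : Ali e x0 (Al e x0 x) = x := by
  have h : 0 < rr e x0 := h0
  have h1 := sqrt_c_ne h
  have h2 := sqrt_c h.le
  have h3 : ((rr e x0:ℝ):ℂ) ≠ 0 := Complex.ofReal_ne_zero.2 h.ne'
  have h4 : inner ℂ (pz e x0) (Al e x0 x) = ((√(rr e x0):ℝ):ℂ) * (inner ℂ (pz e x0) x:ℂ) := by
    rw [Al_apply, inner_add_right, inner_smul_right, inner_smul_right, inner_pz_e he, inner_pz_pz he]; simp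
  rw [Ali_apply, pz_Al he, wc_Al he, h4, smul_smul, inv_mul_cancel₀ h1, one_smul]
  conv_rhs => rw [← decomp e x]
  congr 2
  field_simp
  ring

lemma Al_Ali (he : ‖e‖ = 1) {x0:E} (h0 : x0 ∈ Sg e) (x:E) : Al e x0 (Ali e x0 x) = x := by
  have h1 : Function.LeftInverse (Ali e x0 : E →ₗ[ℂ] E) (Al e x0 : E →ₗ[ℂ] E) := Ali_Al he h0
  have h2 : (Ali e x0 : E →ₗ[ℂ] E) ∘ₗ (Al e x0 : E →ₗ[ℂ] E) = LinearMap.id := LinearMap.ext h1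
  have h3 := (LinearMap.comp_eq_id_comm ℂ E).1 h2
  exact LinearMap.congr_fun h3 x

lemma rr_al (he : ‖e‖ = 1) {x0:E} (h0 : x0 ∈ Sg e) (x:E) : rr e (al e x0 x) = rr e x0 * rr e x := by
  have h : 0 < rr e x0 := h0
  have h1 : wc e (al e x0 x) = (((wc e x0).re:ℂ) + I * ((‖pz e x0‖ ^ 2:ℝ):ℂ)) +
      (((rr e x0:ℝ):ℂ) * wc e x + 2 * I * ((√(rr e x0):ℝ):ℂ) * inner ℂ (pz e x0) x) := by
    rw [al, map_add, wc_Al he, c0, wc_mk he (wc_pz he _)]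
  have h2 : pz e (al e x0 x) = pz e x0 + ((√(rr e x0):ℝ):ℂ) • pz e x := by
    rw [al, map_add, pz_Al he, c0, pz_mk he (wc_pz he _)]
  have h3 : ‖pz e x0 + ((√(rr e x0):ℝ):ℂ) • pz e x‖ ^ 2 = ‖pz e x0‖ ^ 2 +
      2 * √(rr e x0) * (inner ℂ (pz e x0) x:ℂ).re + rr e x0 * ‖pz e x‖ ^ 2 := by
    have := norm_add_sq (𝕜 := ℂ) (pz e x0) (((√(rr e x0):ℝ):ℂ) • pz e x)
    rw [inner_smul_right, inner_pz_pz he, norm_smul, norm_real, norm_of_nonneg (sqrt_nonneg _),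
      mul_pow, sq_sqrt h.le] at this
    rw [this]
    simp
    ring
  rw [rr, h1, h2, h3]
  conv_rhs => rw [rr]
  simp [rr, ← ofReal_pow]
  ring

lemma al_o (he : ‖e‖ = 1) (x0:E) : al e x0 (I • e) = x0 := by
  rw [al, Al_apply, map_smul, map_smul, wc_e he, pz_e he, inner_smul_right, inner_pz_e he, c0]
  simp only [smul_zero, mul_zero, add_zero, zero_add, smul_eq_mul, mul_one]
  rw [add_assoc, ← add_smul]
  conv_rhs => rw [← decomp e x0]
  congr 2
  apply Complex.ext <;> simp [rr, ← ofReal_pow]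

lemma ali_al (he : ‖e‖ = 1) {x0:E} (h0 : x0 ∈ Sg e) (x:E) : ali e x0 (al e x0 x) = x := by
  rw [ali, al, add_sub_cancel_left, Ali_Al he h0]
lemma al_ali (he : ‖e‖ = 1) {x0:E} (h0 : x0 ∈ Sg e) (x:E) : al e x0 (ali e x0 x) = x := by
  rw [ali, al, Al_Ali he h0]; abel
lemma ali_self (he : ‖e‖ = 1) {x0:E} (h0 : x0 ∈ Sg e) : ali e x0 x0 = I • e := by
  have := ali_al he h0 (I • e)
  rwa [al_o he] at this
lemma al_mem (he : ‖e‖ = 1) {x0:E} (h0 : x0 ∈ Sg e) {x:E} (hx : x ∈ Sg e) : al e x0 x ∈ Sg e := by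
  change 0 < rr e _; rw [rr_al he h0]; exact mul_pos h0 hx
lemma rr_ali (he : ‖e‖ = 1) {x0:E} (h0 : x0 ∈ Sg e) (x:E) : rr e (ali e x0 x) = rr e x / rr e x0 := by
  have h : 0 < rr e x0 := h0
  have := rr_al he h0 (ali e x0 x)
  rw [al_ali he h0] at this
  rw [this]; field_simp
lemma ali_mem (he : ‖e‖ = 1) {x0:E} (h0 : x0 ∈ Sg e) {x:E} (hx : x ∈ Sg e) : ali e x0 x ∈ Sg e := by
  change 0 < rr e _; rw [rr_ali he h0]; exact div_pos hx h0
lemma al_fderiv (e x0 x:E) : HasFDerivAt (al e x0) (Al e x0) x := (Al e x0).hasFDerivAt.const_add _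
lemma ali_fderiv (e x0 x:E) : HasFDerivAt (ali e x0) (Ali e x0) x := by
  have := (Ali e x0).hasFDerivAt.comp x ((hasFDerivAt_id (𝕜 := ℂ) x).sub_const (c0 e x0))
  rw [ContinuousLinearMap.comp_id] at this
  exact this
lemma al_vert (he : ‖e‖ = 1) (x0:E) (s:ℝ) :
  al e x0 (((1 + s:ℝ):ℂ) • I • e) = x0 + ((s * rr e x0:ℝ):ℂ) • I • e := by
  have h1 := al_o he x0
  have h2 : Al e x0 (I • e) = ((rr e x0:ℝ):ℂ) • I • e := by
    rw [Al_apply, map_smul, map_smul, wc_e he, pz_e he, inner_smul_right, inner_pz_e he, smul_smul]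
    simp only [smul_zero, mul_zero, add_zero, zero_add, smul_eq_mul, mul_one]
    rw [smul_smul]
  rw [al, h2] at h1
  rw [al, map_smul, h2]
  generalize rr e x0 = t at *
  conv_rhs => rw [← h1]
  push_cast
  module

lemma norm_det_Al (he : ‖e‖ = 1) {x0:E} (h0 : x0 ∈ Sg e) :
  ‖(Al e x0).det‖ ^ 2 = rr e x0 ^ (Module.finrank ℂ E + 1) := by
  have h : 0 < rr e x0 := h0
  have h1 := sqrt_c_ne h
  let ℓ : E →ₗ[ℂ] ℂ := (((√(rr e x0):ℝ):ℂ) - 1) • (wc e : E →ₗ[ℂ] ℂ) +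
    (2 * I) • (innerSL ℂ (pz e x0) : E →ₗ[ℂ] ℂ)
  have h2 : (Al e x0 : E →ₗ[ℂ] E) = ((√(rr e x0):ℝ):ℂ) • LinearMap.transvection ℓ e := by
    ext x
    rw [LinearMap.smul_apply, LinearMap.transvection.apply]
    change Al e x0 x = _
    rw [Al_apply]
    have : ℓ x = (((√(rr e x0):ℝ):ℂ) - 1) * wc e x + 2 * I * inner ℂ (pz e x0) x := by
      simp [ℓ]
    rw [this, pz_apply, ← sqrt_c h.le]
    module
  have h3 : ℓ e = ((√(rr e x0):ℝ):ℂ) - 1 := by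
    have : ℓ e = (((√(rr e x0):ℝ):ℂ) - 1) * wc e e + 2 * I * inner ℂ (pz e x0) e := by
      simp [ℓ]
    rw [this, wc_e he, inner_pz_e he]; ring
  rw [ContinuousLinearMap.det, h2, LinearMap.det_smul, LinearMap.transvection.det, h3]
  rw [show 1 + (((√(rr e x0):ℝ):ℂ) - 1) = ((√(rr e x0):ℝ):ℂ) by ring, ← pow_succ, norm_pow, norm_real,
    norm_of_nonneg (sqrt_nonneg _), ← pow_mul, mul_comm, pow_mul, sq_sqrt h.le]

lemma Al_norm (he : ‖e‖ = 1) {x0:E} (h0 : x0 ∈ Sg e) (v:E) :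
  ‖Al e x0 v‖ ≤ (√(rr e x0) + rr e x0 + 2 * √(rr e x0) * ‖x0‖) * ‖v‖ := by
  have h : 0 < rr e x0 := h0
  have hs := sqrt_nonneg (rr e x0)
  have h1 : ‖pz e v‖ ≤ ‖v‖ := by
    have := norm_sq_decomp he v
    refine abs_le_of_sq_le_sq' (by nlinarith [sq_nonneg ‖wc e v‖]) (norm_nonneg _) |>.2
  have h1' : ‖pz e x0‖ ≤ ‖x0‖ := by
    have := norm_sq_decomp he x0
    refine abs_le_of_sq_le_sq' (by nlinarith [sq_nonneg ‖wc e x0‖]) (norm_nonneg _) |>.2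
  have h2 := wc_norm_le he v
  have h3 : ‖(inner ℂ (pz e x0) v:ℂ)‖ ≤ ‖x0‖ * ‖v‖ :=
    (norm_inner_le_norm _ _).trans (by gcongr)
  rw [Al_apply]
  refine (norm_add_le _ _).trans ?_
  rw [norm_smul, norm_smul, he, mul_one, norm_real, norm_of_nonneg hs]
  have h4 := norm_add_le (((rr e x0:ℝ):ℂ) * wc e v) (2 * I * ((√(rr e x0):ℝ):ℂ) * inner ℂ (pz e x0) v)
  rw [norm_mul, norm_mul, norm_mul, norm_mul, norm_real, norm_real, norm_of_nonneg hs,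
    norm_of_nonneg h.le] at h4
  simp only [Complex.norm_ofNat, norm_I, mul_one] at h4
  have h5 : √(rr e x0) * ‖pz e v‖ ≤ √(rr e x0) * ‖v‖ := by gcongr
  have h6 : rr e x0 * ‖wc e v‖ ≤ rr e x0 * ‖v‖ := by gcongr
  have h7 : 2 * √(rr e x0) * ‖(inner ℂ (pz e x0) v:ℂ)‖ ≤ 2 * √(rr e x0) * (‖x0‖ * ‖v‖) := by gcongr
  linarith

/-- normalised map -/
noncomputable def nm (e:E) (ψ : E → E) (x:E) : E → E := fun y => ali e (ψ x) (ψ (al e x y))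

/-- self maps of the Siegel domain -/
structure SM (e:E) (ψ : E → E) : Prop where
  hol : DifferentiableOn ℂ ψ (Sg e)
  maps : MapsTo ψ (Sg e) (Sg e)

variable {e:E} {ψ : E → E}

lemma SM.nm (he : ‖e‖ = 1) (H : SM e ψ) {x:E} (hx : x ∈ Sg e) : SM e (nm e ψ x) := by
  constructor
  · intro y hy
    have h1 := (H.hol.differentiableAt ((Sg_open e).mem_nhds (al_mem he hx hy)))
    exact ((ali_fderiv e (ψ x) _).differentiableAt.comp y
      (h1.comp y (al_fderiv e x y).differentiableAt)).differentiableWithinAt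
  · intro y hy
    exact ali_mem he (H.maps hx) (H.maps (al_mem he hx hy))

lemma SM.nm_o (he : ‖e‖ = 1) (H : SM e ψ) {x:E} (hx : x ∈ Sg e) : PMH.nm e ψ x (I • e) = I • e := by
  rw [PMH.nm, al_o he, ali_self he (H.maps hx)]

lemma SM.nm_fderiv (he : ‖e‖ = 1) (H : SM e ψ) {x y:E} (hx : x ∈ Sg e) (hy : y ∈ Sg e) :
  fderiv ℂ (PMH.nm e ψ x) y = (Ali e (ψ x)).comp ((fderiv ℂ ψ (al e x y)).comp (Al e x)) := by
  have h1 := (H.hol.differentiableAt ((Sg_open e).mem_nhds (al_mem he hx hy))).hasFDerivAt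
  exact ((ali_fderiv e (ψ x) _).comp y (h1.comp y (al_fderiv e x y))).fderiv

lemma SM.rr_nm (he : ‖e‖ = 1) (H : SM e ψ) {x:E} (hx : x ∈ Sg e) (y:E) :
  rr e (PMH.nm e ψ x y) = rr e (ψ (al e x y)) / rr e (ψ x) := rr_ali he (H.maps hx) _

/-- vertical monotonicity -/
lemma SM.vert_o (he : ‖e‖ = 1) (H : SM e ψ) (ho : ψ (I • e) = I • e) {s:ℝ} (hs : 0 ≤ s) :
  rr e (ψ (((1 + s:ℝ):ℂ) • I • e)) ≤ 1 + s := by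
  set x : E := ((1 + s:ℝ):ℂ) • I • e with hxdef
  have hw : wc e x = ((1 + s:ℝ):ℂ) * I := by simp [hxdef, wc_e he]
  have hp : pz e x = 0 := by simp [hxdef, pz_e he]
  have hr : rr e x = 1 + s := by rw [rr, hw, hp]; simp
  have hx : x ∈ Sg e := by change 0 < rr e x; rw [hr]; linarith
  have hb := cayi_lt he hx
  have h1 := cayi_norm he hx
  have h2 : ‖I + wc e x‖ = 2 + s := by
    rw [hw, show I + ((1 + s:ℝ):ℂ) * I = ((2 + s:ℝ):ℂ) * I by push_cast; ring, norm_mul,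
      norm_real, norm_I, norm_of_nonneg (by linarith), mul_one]
  rw [h2, hr] at h1
  have h3 : ‖cayi e x‖ = s / (2 + s) := by
    have : ‖cayi e x‖ ^ 2 = (s / (2 + s)) ^ 2 := by
      have h4 : ‖cayi e x‖ ^ 2 = 1 - 4 * (1 + s) / (2 + s) ^ 2 := by linarith
      rw [h4]; field_simp; ring
    exact (pow_left_inj₀ (norm_nonneg _) (by positivity) two_ne_zero).1 this
  have h4 := gb_norm he H.hol H.maps ho hb
  rw [gb, cay_cayi he hx, h3] at h4
  have hy := H.maps hx
  have h5 := cayi_lt he hy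
  have h6 := rr_cay he h5
  rw [cay_cayi he hy] at h6
  rw [h6]
  set b := cayi e (ψ x)
  have h7 := wc_norm_le he b
  have h8 : 1 - ‖b‖ ≤ ‖1 + wc e b‖ := by
    have := norm_sub_norm_le (1:ℂ) (-wc e b)
    rw [norm_one, norm_neg, sub_neg_eq_add] at this
    linarith
  have h9 : 0 < 1 - ‖b‖ := by linarith
  rw [div_le_iff₀ (by have : 0 < ‖1 + wc e b‖ := by linarith
                      positivity)]
  have h10 : (1 - ‖b‖) ^ 2 ≤ ‖1 + wc e b‖ ^ 2 := by gcongr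
  have h11 : 1 + ‖b‖ ≤ (1 + s) * (1 - ‖b‖) := by
    have : ‖b‖ * (2 + s) ≤ s := by rwa [le_div_iff₀ (by linarith)] at h4
    nlinarith
  have h12 : (1 - ‖b‖) * (1 + ‖b‖) ≤ (1 - ‖b‖) * ((1 + s) * (1 - ‖b‖)) := by gcongr
  have h13 : (1 + s) * (1 - ‖b‖) ^ 2 ≤ (1 + s) * ‖1 + wc e b‖ ^ 2 := by gcongr
  nlinarith

lemma SM.vert (he : ‖e‖ = 1) (H : SM e ψ) {x:E} (hx : x ∈ Sg e) {s:ℝ} (hs : 0 ≤ s) :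
  rr e (ψ (x + (s:ℂ) • I • e)) / rr e (x + (s:ℂ) • I • e) ≤ rr e (ψ x) / rr e x := by
  have h : 0 < rr e x := hx
  have h' : 0 < rr e (ψ x) := H.maps hx
  have h1 := (H.nm he hx).vert_o he (H.nm_o he hx) (s := s / rr e x) (by positivity)
  rw [H.rr_nm he hx, al_vert he, div_mul_cancel₀ _ h.ne'] at h1
  have h2 : rr e (x + (s:ℂ) • I • e) = rr e x + s := by
    have : rr e (x + (s:ℂ) • I • e) = (wc e x + (s:ℂ) * I).im - ‖pz e x‖ ^ 2 := by
      simp [rr, wc_e he, pz_e he]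
    rw [this, rr]; simp; ring
  rw [h2]
  rw [div_le_iff₀ h'] at h1
  rw [div_le_div_iff₀ (by linarith) h]
  calc _ ≤ (1 + s / rr e x) * rr e (ψ x) * rr e x := by gcongr
    _ = _ := by field_simp

end
end

section

lemma det_contr_aux (B : E →L[ℂ] E) (hB : ∀ v, ‖B v‖ ≤ ‖v‖) :
  ‖B.det‖ ≤ 1 ∧ (‖B.det‖ = 1 → ∀ v, ‖B v‖ = ‖v‖) := by
  set T : E →ₗ[ℂ] E := (B : E →ₗ[ℂ] E).adjoint ∘ₗ (B : E →ₗ[ℂ] E) with hT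
  have hs : T.IsSymmetric := LinearMap.isSymmetric_adjoint_comp_self _
  have h1 : ‖B.det‖ ^ 2 = ∏ i, hs.eigenvalues rfl i := by
    have h2 := LinearMap.normDet_sq (B : E →ₗ[ℂ] E)
    rw [LinearMap.normDet_eq_norm_det, ← hT, hs.det_eq_prod_eigenvalues rfl] at h2
    exact_mod_cast h2
  have hin : ∀ v w, inner ℂ v (T w) = (inner ℂ (B v) (B w):ℂ) := by
    intro v w
    rw [hT, LinearMap.comp_apply, LinearMap.adjoint_inner_right]; rfl
  have h3 : ∀ i, hs.eigenvalues rfl i = ‖B (hs.eigenvectorBasis rfl i)‖ ^ 2 := by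
    intro i
    have h4 := hs.apply_eigenvectorBasis rfl i
    have h5 := hin (hs.eigenvectorBasis rfl i) (hs.eigenvectorBasis rfl i)
    rw [h4, inner_smul_right, inner_self_eq_norm_sq_to_K, inner_self_eq_norm_sq_to_K,
      (hs.eigenvectorBasis rfl).norm_eq_one] at h5
    simp only [Complex.coe_algebraMap, Complex.ofReal_one, one_pow, mul_one] at h5
    exact_mod_cast h5
  have h4 : ∀ i, 0 ≤ hs.eigenvalues rfl i := fun i => by rw [h3]; positivity
  have h5 : ∀ i, hs.eigenvalues rfl i ≤ 1 := fun i => by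
    rw [h3]
    have := hB (hs.eigenvectorBasis rfl i)
    rw [(hs.eigenvectorBasis rfl).norm_eq_one] at this
    exact pow_le_one₀ (norm_nonneg _) this
  have h6 : ∏ i, hs.eigenvalues rfl i ≤ 1 := Finset.prod_le_one (fun i _ => h4 i) (fun i _ => h5 i)
  refine ⟨?_, fun hd v => ?_⟩
  · rw [← h1] at h6
    exact (sq_le_one_iff₀ (norm_nonneg _)).1 h6
  · have h7 : ∀ i, hs.eigenvalues rfl i = 1 := by
      intro i
      refine le_antisymm (h5 i) ?_
      have h8 := Finset.mul_prod_erase Finset.univ (fun i => hs.eigenvalues rfl i) (Finset.mem_univ i)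
      have h9 : ∏ j ∈ Finset.univ.erase i, hs.eigenvalues rfl j ≤ 1 :=
        Finset.prod_le_one (fun i _ => h4 i) (fun i _ => h5 i)
      rw [hd, one_pow] at h1
      rw [← h1] at h8
      nlinarith [h4 i]
    have h8 : T = LinearMap.id := by
      refine (hs.eigenvectorBasis rfl).toBasis.ext fun i => ?_
      rw [OrthonormalBasis.coe_toBasis, hs.apply_eigenvectorBasis, h7]
      simp
    have h9 := hin v v
    rw [h8, LinearMap.id_apply, inner_self_eq_norm_sq_to_K, inner_self_eq_norm_sq_to_K] at h9
    have h10 : ‖v‖ ^ 2 = ‖B v‖ ^ 2 := by exact_mod_cast h9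
    exact ((pow_left_inj₀ (norm_nonneg _) (norm_nonneg _) two_ne_zero).1 h10).symm

lemma det_isom (B : E →L[ℂ] E) (hB : ∀ v, ‖B v‖ = ‖v‖) : ‖B.det‖ = 1 := by
  have := LinearIsometry.normDet_eq_one (⟨(B : E →ₗ[ℂ] E), hB⟩ : E →ₗᵢ[ℂ] E)
  rw [← this]
  exact (LinearMap.normDet_eq_norm_det (B : E →ₗ[ℂ] E)).symm

lemma det_Tc {e:E} (he : ‖e‖ = 1) (B : E →L[ℂ] E) : ((Tci e).comp (B.comp (Tc e))).det = B.det := by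
  have h1 : ((Tci e).comp (Tc e)) = ContinuousLinearMap.id ℂ E := ContinuousLinearMap.ext (Tci_Tc he)
  have h2 : (Tci e).det * (Tc e).det = 1 := by
    have := congrArg ContinuousLinearMap.det h1
    rw [ContinuousLinearMap.det, toLinearMap_comp, LinearMap.det_comp] at this
    rw [ContinuousLinearMap.det, ContinuousLinearMap.det, this]
    simp [ContinuousLinearMap.det]
  rw [ContinuousLinearMap.det, toLinearMap_comp, toLinearMap_comp, LinearMap.det_comp,
    LinearMap.det_comp]
  change (Tci e).det * (B.det * (Tc e).det) = B.det
  linear_combination B.det * h2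

lemma HasLap.norm_sq_zero {γ : ℂ → E} (hγ : DifferentiableAt ℂ γ 0) (h0 : γ 0 = 0) :
  HasLap (fun ζ => ‖γ ζ‖ ^ 2) (‖deriv γ 0‖ ^ 2) 0 := by
  refine ⟨0, ?_⟩
  have h1 := hγ.hasDerivAt.isLittleO
  simp only [h0, sub_zero] at h1 ⊢
  have h2 : (fun ζ : ℂ => ζ • deriv γ 0) =O[𝓝 0] fun ζ : ℂ => ζ :=
    IsBigO.of_bound ‖deriv γ 0‖ (Eventually.of_forall fun ζ => by rw [norm_smul, mul_comm])
  have h3 : (fun ζ => γ ζ) =O[𝓝 0] fun ζ : ℂ => ζ :=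
    ((h1.isBigO.add h2).congr_left fun ζ => by abel)
  have h4 : (fun ζ => ‖γ ζ‖ - ‖ζ • deriv γ 0‖) =o[𝓝 0] fun ζ : ℂ => ζ := by
    refine IsBigO.trans_isLittleO (IsBigO.of_bound 1 (Eventually.of_forall fun ζ => ?_)) h1
    rw [one_mul, norm_eq_abs]
    exact abs_norm_sub_norm_le _ _
  have h5 := h4.mul_isBigO (h3.norm_left.add h2.norm_left)
  refine (h5.congr_left fun ζ => ?_).norm_right.congr_right fun ζ => ?_
  · rw [norm_smul]; simp; ring
  · rw [norm_mul, sq]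

lemma HasLap.ex {s : ℂ → ℝ} {c c':ℝ} {b:ℂ} (h : HasLap s c b) (hc : c = c') : ∃ b, HasLap s c' b :=
  ⟨b, hc ▸ h⟩

lemma HasLap.log_one {s : ℂ → ℝ} {c:ℝ} {b:ℂ} (hs : HasLap s c b) (h0 : s 0 = 1) :
  HasLap (fun ζ => log (s ζ)) (c - ‖b‖ ^ 2 / 4) b := by
  have h := hs.comp_contDiff (φ := log) (I := Ioi 0) isOpen_Ioi
    (fun x hx => (Real.contDiffAt_log.2 (ne_of_gt hx)).contDiffWithinAt) (by rw [h0]; exact one_pos (α := ℝ))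
  rw [h0, Real.deriv_log', inv_one] at h
  have h2 : deriv (fun x : ℝ => x⁻¹) 1 = -1 := by simp
  rw [h2] at h
  convert h using 1
  · ring
  · simp

variable {e:E} {ψ : E → E}

lemma lap_log_rr (he : ‖e‖ = 1) {γ : ℂ → E} {R:ℝ} (hR : 0 < R) (hγ : DifferentiableOn ℂ γ (ball 0 R))
  (h0 : γ 0 = I • e) : ∃ b, HasLap (fun ζ => log (rr e (γ ζ))) (-om e (deriv γ 0)) b := by
  have hd := hγ.differentiableAt (ball_mem_nhds (0:ℂ) hR)
  have h1 : DifferentiableAt ℂ (fun ζ => pz e (γ ζ)) 0 := (pz e).differentiableAt.comp _ hd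
  have h1' : deriv (fun ζ => pz e (γ ζ)) 0 = pz e (deriv γ 0) :=
    ((pz e).hasFDerivAt.comp_hasDerivAt (0:ℂ) hd.hasDerivAt).deriv
  have h2 := HasLap.norm_sq_zero h1 (by simp [h0, pz_e he])
  rw [h1'] at h2
  have h3 : DifferentiableOn ℂ (fun ζ => -I * wc e (γ ζ)) (ball 0 R) :=
    ((wc e).differentiable.comp_differentiableOn hγ).const_mul _
  have h3' : deriv (fun ζ => -I * wc e (γ ζ)) 0 = -I * wc e (deriv γ 0) :=
    (((wc e).hasFDerivAt.comp_hasDerivAt (0:ℂ) hd.hasDerivAt).const_mul _).deriv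
  have h4 := HasLap.re_hol hR h3
  rw [h3'] at h4
  have h5 : HasLap (fun ζ => rr e (γ ζ)) _ _ := (h4.sub h2).congr (Eventually.of_forall fun ζ => by simp [rr])
  have h6 := h5.log_one (by rw [h0, rr_o he])
  refine h6.ex ?_
  rw [om]; simp
  ring

/-- `log (rr ∘ ψ / rr)` -/
noncomputable def ph (e:E) (ψ : E → E) (x:E) : ℝ := log (rr e (ψ x)) - log (rr e x)

lemma line_ball {x:E} {S : Set E} (hS : IsOpen S) (hx : x ∈ S) (v:E) :
  ∃ R > (0:ℝ), ∀ ζ ∈ ball (0:ℂ) R, x + ζ • v ∈ S := by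
  have h1 : Continuous fun ζ : ℂ => x + ζ • v := by fun_prop
  have h2 : (fun ζ : ℂ => x + ζ • v) ⁻¹' S ∈ 𝓝 (0:ℂ) := (hS.preimage h1).mem_nhds (by simpa using hx)
  obtain ⟨R, hR, h⟩ := Metric.mem_nhds_iff.1 h2
  exact ⟨R, hR, h⟩

lemma SM.lap_ph (he : ‖e‖ = 1) (H : SM e ψ) (ho : ψ (I • e) = I • e) (v:E) :
  ∃ b, HasLap (fun ζ : ℂ => ph e ψ (I • e + ζ • v)) (om e v - om e (fderiv ℂ ψ (I • e) v)) b := by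
  obtain ⟨R, hR, hb⟩ := line_ball (Sg_open e) (o_mem he) v
  have h1 : DifferentiableOn ℂ (fun ζ : ℂ => I • e + ζ • v) (ball 0 R) := by
    refine Differentiable.differentiableOn ?_; fun_prop
  have h2 : DifferentiableOn ℂ (fun ζ : ℂ => ψ (I • e + ζ • v)) (ball 0 R) := H.hol.comp h1 hb
  obtain ⟨b, h3⟩ := lap_log_rr he hR h1 (by simp)
  obtain ⟨b', h4⟩ := lap_log_rr he hR h2 (by simpa using ho)
  have h5 : deriv (fun ζ : ℂ => I • e + ζ • v) 0 = v := by
    have := ((hasDerivAt_id (0:ℂ)).smul_const v).const_add (I • e)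
    simpa using this.deriv
  have h6 := (deriv_comp_line v (H.hol.differentiableAt ((Sg_open e).mem_nhds (o_mem he)))).deriv
  rw [h5] at h3
  rw [h6] at h4
  refine (h4.sub h3).ex ?_
  ring

lemma SM.ph_nm (he : ‖e‖ = 1) (H : SM e ψ) {x y:E} (hx : x ∈ Sg e) (hy : y ∈ Sg e) :
  ph e (PMH.nm e ψ x) y = ph e ψ (al e x y) - ph e ψ x := by
  have h1 : 0 < rr e x := hx
  have h2 : 0 < rr e y := hy
  have h3 : 0 < rr e (ψ x) := H.maps hx
  have h4 : 0 < rr e (ψ (al e x y)) := H.maps (al_mem he hx hy)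
  rw [ph, ph, ph, H.rr_nm he hx, rr_al he hx, log_div h4.ne' h3.ne', log_mul h1.ne' h2.ne']
  ring

/-- normalised Jacobian -/
noncomputable def GG (e:E) (ψ : E → E) (x:E) : ℝ :=
  ‖Jac ψ x‖ ^ 2 * (rr e x / rr e (ψ x)) ^ (Module.finrank ℂ E + 1)

lemma SM.GG_nm (he : ‖e‖ = 1) (H : SM e ψ) {x y:E} (hx : x ∈ Sg e) (hy : y ∈ Sg e) :
  GG e (PMH.nm e ψ x) y = GG e ψ (al e x y) := by
  have h1 : 0 < rr e x := hx
  have h2 : 0 < rr e y := hy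
  have h3 : 0 < rr e (ψ x) := H.maps hx
  have h4 : 0 < rr e (ψ (al e x y)) := H.maps (al_mem he hx hy)
  have h5 : (Ali e (ψ x)).det * (Al e (ψ x)).det = 1 := by
    have h6 : ((Ali e (ψ x)).comp (Al e (ψ x))) = ContinuousLinearMap.id ℂ E :=
      ContinuousLinearMap.ext (Ali_Al he (H.maps hx))
    have := congrArg ContinuousLinearMap.det h6
    rw [ContinuousLinearMap.det, toLinearMap_comp, LinearMap.det_comp] at this
    rw [ContinuousLinearMap.det, ContinuousLinearMap.det, this]
    simp [ContinuousLinearMap.det]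
  have h6 : ‖(Ali e (ψ x)).det‖ ^ 2 * rr e (ψ x) ^ (Module.finrank ℂ E + 1) = 1 := by
    rw [← norm_det_Al he (H.maps hx), ← mul_pow, ← norm_mul, h5]; simp
  have h7 : Jac (PMH.nm e ψ x) y = (Ali e (ψ x)).det * (Jac ψ (al e x y) * (Al e x).det) := by
    rw [Jac, H.nm_fderiv he hx hy, ContinuousLinearMap.det, toLinearMap_comp,
      toLinearMap_comp, LinearMap.det_comp, LinearMap.det_comp]
    rfl
  rw [GG, GG, h7, H.rr_nm he hx, rr_al he hx, norm_mul, norm_mul, mul_pow, mul_pow, norm_det_Al he hx]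
  generalize Module.finrank ℂ E + 1 = m at *
  have h8 : ‖(Ali e (ψ x)).det‖ ^ 2 = (rr e (ψ x) ^ m)⁻¹ := eq_inv_of_mul_eq_one_left h6
  rw [h8]
  simp only [div_pow, mul_pow]
  field_simp

lemma GG_o (he : ‖e‖ = 1) (ho : ψ (I • e) = I • e) :
  GG e ψ (I • e) = ‖Jac ψ (I • e)‖ ^ 2 := by
  rw [GG, ho, rr_o he]; simp

lemma SM.gb_contr (he : ‖e‖ = 1) (H : SM e ψ) (ho : ψ (I • e) = I • e) (v:E) :
  ‖fderiv ℂ (gb e ψ) 0 v‖ ≤ ‖v‖ := by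
  have h1 : ‖fderiv ℂ (gb e ψ) 0‖ ≤ 1 := Complex.norm_fderiv_le_one_of_mapsTo_ball (gb_diff he H.hol H.maps)
    (by rw [gb_zero he ho]; exact (gb_maps he H.maps).mono_right ball_subset_closedBall) one_pos
  exact ((fderiv ℂ (gb e ψ) 0).le_opNorm v).trans (mul_le_of_le_one_left (norm_nonneg _) h1)

lemma SM.gb_det (he : ‖e‖ = 1) (H : SM e ψ) (ho : ψ (I • e) = I • e) :
  (fderiv ℂ (gb e ψ) 0).det = Jac ψ (I • e) := by
  rw [gb_fderiv he H.hol ho, det_Tc he]; rfl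

lemma SM.GG_le (he : ‖e‖ = 1) (H : SM e ψ) {x:E} (hx : x ∈ Sg e) : GG e ψ x ≤ 1 := by
  have h1 := H.GG_nm he hx (o_mem he)
  rw [al_o he] at h1
  have H' := H.nm he hx
  have ho := H.nm_o he hx
  rw [← h1, GG_o he ho, ← H'.gb_det he ho]
  exact pow_le_one₀ (norm_nonneg _) (det_contr_aux _ (H'.gb_contr he ho)).1

/-- om-isometry gives unit Jacobian -/
lemma SM.GG_of_isom (he : ‖e‖ = 1) (H : SM e ψ) (ho : ψ (I • e) = I • e)
  (hi : ∀ v, om e v ≤ om e (fderiv ℂ ψ (I • e) v)) : GG e ψ (I • e) = 1 := by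
  rw [GG_o he ho, ← H.gb_det he ho, det_isom, one_pow]
  intro v
  refine le_antisymm (H.gb_contr he ho v) ?_
  have h1 := hi (Tc e v)
  rw [← Tci_norm he, ← Tci_norm he, Tci_Tc he] at h1
  rw [gb_fderiv he H.hol ho]
  exact (abs_le_of_sq_le_sq' h1 (norm_nonneg _)).2

lemma SM.lap_log_GG (he : ‖e‖ = 1) (H : SM e ψ) (ho : ψ (I • e) = I • e)
  (hG : GG e ψ (I • e) ≠ 0) (v:E) :
  ∃ b, HasLap (fun ζ : ℂ => log (GG e ψ (I • e + ζ • v)))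
  (-(Module.finrank ℂ E + 1:ℝ) * (om e v - om e (fderiv ℂ ψ (I • e) v))) b := by
  obtain ⟨b, h1⟩ := H.lap_ph he ho v
  obtain ⟨R, hR, hb⟩ := line_ball (Sg_open e) (o_mem he) v
  have hl : DifferentiableOn ℂ (fun ζ : ℂ => I • e + ζ • v) (ball 0 R) := by
    refine Differentiable.differentiableOn ?_; fun_prop
  have hJ : DifferentiableOn ℂ (fun ζ : ℂ => Jac ψ (I • e + ζ • v)) (ball 0 R) :=
    (Jac_differentiableOn (Sg_open e) H.hol).comp hl hb
  have hJ0 : Jac ψ (I • e + (0:ℂ) • v) ≠ 0 := by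
    rw [GG_o he ho] at hG
    rw [zero_smul, add_zero]
    intro h
    rw [h] at hG; simp at hG
  have h2 := HasLap.log_norm hR hJ hJ0
  have hne : ∀ᶠ ζ in 𝓝 (0:ℂ), Jac ψ (I • e + ζ • v) ≠ 0 :=
    (hJ.continuousOn.continuousAt (ball_mem_nhds _ hR)).eventually_ne hJ0
  refine HasLap.ex (((h2.const_mul 2).add (h1.const_mul (-(Module.finrank ℂ E + 1:ℝ)))).congr ?_) ?_
  · filter_upwards [hne, ball_mem_nhds (0:ℂ) hR] with ζ h3 h4
    have h5 : 0 < rr e (I • e + ζ • v) := hb ζ h4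
    have h6 : 0 < rr e (ψ (I • e + ζ • v)) := H.maps (hb ζ h4)
    rw [GG, log_mul (by simpa using h3) (by positivity), log_pow, log_pow, log_div h5.ne' h6.ne', ph]
    push_cast
    ring
  · ring

end

section
variable {e:E} {ψ : E → E}

lemma SM.local_bound (he : ‖e‖ = 1) {y:E} (hy : y ∈ Sg e) :
  ∃ R > (0:ℝ), ∃ M, ball y R ⊆ Sg e ∧ ∀ ψ : E → E, SM e ψ → ψ (I • e) = I • e →
  ∀ x ∈ ball y R, ‖ψ x‖ ≤ M := by
  haveI : ProperSpace E := FiniteDimensional.proper ℂ E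
  obtain ⟨R, hR, hb⟩ := Metric.nhds_basis_closedBall.mem_iff.1 ((Sg_open e).mem_nhds hy)
  have hK : IsCompact (closedBall y R) := isCompact_closedBall _ _
  obtain ⟨x0, hx0, hmax⟩ := hK.exists_isMaxOn ⟨y, mem_closedBall_self hR.le⟩
    ((cayi_diff e).continuousOn.mono hb).norm
  have h1 := cayi_lt he (hb hx0)
  have hK2 : IsCompact (closedBall (0:E) ‖cayi e x0‖) := isCompact_closedBall _ _
  obtain ⟨M, hM⟩ := hK2.exists_bound_of_continuousOn ((cay_diff he).continuousOn.mono (closedBall_subset_ball h1))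
  refine ⟨R, hR, M, ball_subset_closedBall.trans hb, fun ψ H ho x hx => ?_⟩
  have hx' := ball_subset_closedBall hx
  have h2 := gb_norm he H.hol H.maps ho (cayi_lt he (hb hx'))
  rw [gb, cay_cayi he (hb hx')] at h2
  have h3 := hM (cayi e (ψ x)) (by rw [mem_closedBall_zero_iff]; exact h2.trans (hmax hx'))
  rwa [cay_cayi he (H.maps (hb hx'))] at h3

lemma SM.limit {ι : Type*} (he : ‖e‖ = 1) (𝒰 : Ultrafilter ι) (g : ι → E → E) (H : ∀ j, SM e (g j))
  (ho : ∀ j, g j (I • e) = I • e) :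
  ∃ ψ : E → E, SM e ψ ∧ ψ (I • e) = I • e ∧
  ∀ y ∈ Sg e, Tendsto (fun j => g j y) 𝒰 (𝓝 (ψ y)) ∧ Tendsto (fun j => fderiv ℂ (g j) y) 𝒰 (𝓝 (fderiv ℂ ψ y)) := by
  haveI : ProperSpace E := FiniteDimensional.proper ℂ E
  have h1 : ∀ b : E, ∃ L, ‖b‖ < 1 → Tendsto (fun j => gb e (g j) b) 𝒰 (𝓝 L) ∧ ‖L‖ ≤ ‖b‖ := by
    intro b
    by_cases hb : ‖b‖ < 1
    · obtain ⟨L, h2, h3⟩ := ultra_lim 𝒰 (fun j => gb e (g j) b) ‖b‖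
        (Eventually.of_forall fun j => gb_norm he (H j).hol (H j).maps (ho j) hb)
      exact ⟨L, fun _ => ⟨h2, h3⟩⟩
    · exact ⟨0, fun h => absurd h hb⟩
  choose L hL using h1
  let ψ : E → E := fun y => cay e (L (cayi e y))
  have hlim : ∀ y ∈ Sg e, Tendsto (fun j => g j y) 𝒰 (𝓝 (ψ y)) := by
    intro y hy
    obtain ⟨h2, h3⟩ := hL _ (cayi_lt he hy)
    have h4 : ‖L (cayi e y)‖ < 1 := h3.trans_lt (cayi_lt he hy)
    have h5 : ContinuousAt (cay e) (L (cayi e y)) :=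
      (cay_diff he).continuousOn.continuousAt (isOpen_ball.mem_nhds (mem_ball_zero_iff.2 h4))
    refine (h5.tendsto.comp h2).congr fun j => ?_
    simp only [Function.comp, gb, cay_cayi he hy, cay_cayi he ((H j).maps hy)]
  have hder : ∀ y ∈ Sg e, HasFDerivAt ψ (fderiv ℂ ψ y) y ∧
      Tendsto (fun j => fderiv ℂ (g j) y) 𝒰 (𝓝 (fderiv ℂ ψ y)) := by
    intro y hy
    obtain ⟨R, hR, M, hb, hM⟩ := SM.local_bound he hy
    exact limit_hasFDerivAt 𝒰 g ψ hR (Eventually.of_forall fun j => (H j).hol.mono hb)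
      (Eventually.of_forall fun j => hM _ (H j) (ho j)) (fun z hz => hlim z (hb hz))
  refine ⟨ψ, ⟨fun y hy => (hder y hy).1.differentiableAt.differentiableWithinAt, fun y hy => ?_⟩, ?_,
    fun y hy => ⟨hlim y hy, (hder y hy).2⟩⟩
  · obtain ⟨h2, h3⟩ := hL _ (cayi_lt he hy)
    exact cay_mem he (h3.trans_lt (cayi_lt he hy))
  · have h2 := hlim _ (o_mem he)
    simp only [ho] at h2
    exact (tendsto_nhds_unique h2 tendsto_const_nhds)

lemma SM.limit_ph {ι : Type*} {𝒰 : Filter ι} {g : ι → E → E} (H : SM e ψ) {y:E} (hy : y ∈ Sg e)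
  (h : Tendsto (fun j => g j y) 𝒰 (𝓝 (ψ y))) : Tendsto (fun j => ph e (g j) y) 𝒰 (𝓝 (ph e ψ y)) := by
  have h1 : 0 < rr e (ψ y) := H.maps hy
  unfold ph
  exact (((rr_cont e).tendsto _).comp h |>.log h1.ne').sub_const _

lemma SM.limit_GG {ι : Type*} {𝒰 : Filter ι} {g : ι → E → E} (H : SM e ψ) {y:E} (hy : y ∈ Sg e)
  (h : Tendsto (fun j => g j y) 𝒰 (𝓝 (ψ y))) (h' : Tendsto (fun j => fderiv ℂ (g j) y) 𝒰 (𝓝 (fderiv ℂ ψ y))) :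
  Tendsto (fun j => GG e (g j) y) 𝒰 (𝓝 (GG e ψ y)) := by
  have h1 : 0 < rr e (ψ y) := H.maps hy
  unfold GG Jac
  have h2 : Tendsto (fun j => (fderiv ℂ (g j) y).det) 𝒰 (𝓝 ((fderiv ℂ ψ y).det)) :=
    (det_differentiable.continuous.tendsto _).comp h'
  exact (h2.norm.pow 2).mul (((tendsto_const_nhds).div (((rr_cont e).tendsto _).comp h) h1.ne').pow _)

lemma SM.ph_cont (H : SM e ψ) : ContinuousOn (ph e ψ) (Sg e) := by
  unfold ph
  refine ContinuousOn.sub (ContinuousOn.log ((rr_cont e).comp_continuousOn H.hol.continuousOn) fun x hx => ?_)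
    (ContinuousOn.log (rr_cont e).continuousOn fun x hx => ?_)
  · exact ne_of_gt (H.maps hx)
  · exact ne_of_gt hx

lemma SM.GG_cont (H : SM e ψ) : ContinuousOn (GG e ψ) (Sg e) := by
  unfold GG
  refine ((Jac_differentiableOn (Sg_open e) H.hol).continuousOn.norm.pow 2).mul
    (((rr_cont e).continuousOn.div ((rr_cont e).comp_continuousOn H.hol.continuousOn) fun x hx => ?_).pow _)
  exact ne_of_gt (H.maps hx)

lemma ph_o (ho : ψ (I • e) = I • e) : ph e ψ (I • e) = 0 := by
  rw [ph, ho, sub_self]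

/-- near the supremum of `ph` the map is nearly an automorphism -/
lemma SM.claim1 (he : ‖e‖ = 1) (H : SM e ψ) {S:ℝ} (hS : ∀ x ∈ Sg e, ph e ψ x ≤ S) :
  ∃ ε > 0, ∀ x ∈ Sg e, S - ε < ph e ψ x → 1 / 2 ≤ GG e ψ x := by
  by_contra hcon
  push Not at hcon
  have h1 : ∀ j : ℕ, ∃ x ∈ Sg e, S - 1 / ((j:ℝ) + 1) < ph e ψ x ∧ GG e ψ x < 1 / 2 := fun j =>
    hcon _ (by positivity)
  choose x hx hp hG using h1
  let 𝒰 : Ultrafilter ℕ := Filter.hyperfilter ℕ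
  have h𝒰 : (𝒰 : Filter ℕ) ≤ atTop := by rw [← Nat.cofinite_eq_atTop]; exact Filter.hyperfilter_le_cofinite
  obtain ⟨φ, Hφ, hφo, hlim⟩ := SM.limit he 𝒰 (fun j => PMH.nm e ψ (x j)) (fun j => H.nm he (hx j))
    (fun j => H.nm_o he (hx j))
  have h2 : ∀ y ∈ Sg e, ph e φ y ≤ 0 := by
    intro y hy
    have h3 := Hφ.limit_ph hy (hlim y hy).1
    have h4 : Tendsto (fun j : ℕ => 1 / ((j:ℝ) + 1)) 𝒰 (𝓝 0) := tendsto_one_div_add_atTop_nhds_zero_nat.mono_left h𝒰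
    refine le_of_tendsto_of_tendsto' h3 h4 fun j => ?_
    rw [H.ph_nm he (hx j) hy]
    have := hS _ (al_mem he (hx j) hy)
    have := hp j
    linarith
  have h3 : GG e φ (I • e) = 1 := by
    refine Hφ.GG_of_isom he hφo fun v => ?_
    obtain ⟨b, hb⟩ := Hφ.lap_ph he hφo v
    obtain ⟨R, hR, hb'⟩ := line_ball (Sg_open e) (o_mem he) v
    have := hb.nonpos (by
      filter_upwards [ball_mem_nhds (0:ℂ) hR] with ζ hζ
      rw [zero_smul, add_zero, ph_o hφo]
      exact h2 _ (hb' ζ hζ))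
    linarith
  have h4 := Hφ.limit_GG (o_mem he) (hlim _ (o_mem he)).1 (hlim _ (o_mem he)).2
  rw [h3] at h4
  have h5 : (1:ℝ) ≤ 1 / 2 := by
    refine le_of_tendsto h4 (Eventually.of_forall fun j => ?_)
    rw [H.GG_nm he (hx j) (o_mem he), al_o he]
    exact (hG j).le
  norm_num at h5

/-- reduction: some normalisation of `ψ` has `GG ≥ 1/2` on a boundary neighbourhood -/
lemma SM.region (he : ‖e‖ = 1) (H : SM e ψ) {B:ℝ} (hB : ∀ x ∈ Sg e, ph e ψ x ≤ B) :
  ∃ x0 ∈ Sg e, ∃ δ > 0, ∀ y ∈ Sg e, (wc e y).im ≤ 1 → ‖pz e y‖ ^ 2 + (wc e y).re ^ 2 < δ ^ 2 →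
  1 / 2 ≤ GG e (PMH.nm e ψ x0) y := by
  set S := sSup (ph e ψ '' Sg e) with hSdef
  have hbdd : BddAbove (ph e ψ '' Sg e) := ⟨B, by rintro _ ⟨x, hx, rfl⟩; exact hB x hx⟩
  have hne : (ph e ψ '' Sg e).Nonempty := ⟨_, mem_image_of_mem _ (o_mem he)⟩
  obtain ⟨ε, hε, h1⟩ := H.claim1 he (S := S) fun x hx => le_csSup hbdd (mem_image_of_mem _ hx)
  obtain ⟨_, ⟨x0, hx0, rfl⟩, h2⟩ := exists_lt_of_lt_csSup hne (show S - ε < S by linarith)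
  have H' := H.nm he hx0
  have ho := H.nm_o he hx0
  have hc : ContinuousAt (ph e (PMH.nm e ψ x0)) (I • e) :=
    H'.ph_cont.continuousAt ((Sg_open e).mem_nhds (o_mem he))
  have h3 : ∀ᶠ y in 𝓝 (I • e), (S - ε) - ph e ψ x0 < ph e (PMH.nm e ψ x0) y :=
    hc.eventually_const_lt (by rw [ph_o ho]; linarith)
  obtain ⟨δ, hδ, h4⟩ := Metric.eventually_nhds_iff_ball.1 h3
  refine ⟨x0, hx0, δ, hδ, fun y hy him hre => ?_⟩
  have h5 : 0 ≤ 1 - (wc e y).im := by linarith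
  set y' := y + (((1 - (wc e y).im:ℝ)):ℂ) • I • e with hy'
  have h6 := H'.vert he hy h5
  rw [← hy'] at h6
  have hwy : wc e y' = (((wc e y).re:ℝ):ℂ) + I := by
    rw [hy', map_add, map_smul, map_smul, wc_e he]
    apply Complex.ext <;> simp
  have hpy : pz e y' = pz e y := by rw [hy', map_add, map_smul, map_smul, pz_e he]; simp
  have hr : rr e y' = rr e y + (1 - (wc e y).im) := by
    rw [rr, rr, hwy, hpy]; simp
  have hyS : y' ∈ Sg e := by
    change 0 < rr e y'
    have : 0 < rr e y := hy
    linarith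
  have h7 : y' ∈ ball (I • e) δ := by
    rw [mem_ball_iff_norm]
    have h8 : y' - I • e = pz e y + (((wc e y).re:ℝ):ℂ) • e := by
      conv_lhs => rw [← decomp e y', hwy, hpy]
      module
    have h9 := norm_sq_mk he (wc_pz he y) (((wc e y).re:ℝ):ℂ)
    rw [← h8, norm_real, norm_eq_abs, sq_abs] at h9
    exact lt_of_pow_lt_pow_left₀ 2 hδ.le (by rw [h9]; exact hre)
  have h8 := h4 y' h7
  have h9 : ph e (PMH.nm e ψ x0) y' ≤ ph e (PMH.nm e ψ x0) y := by
    have a1 : 0 < rr e y := hy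
    have a2 : 0 < rr e y' := hyS
    have a3 : 0 < rr e (PMH.nm e ψ x0 y) := H'.maps hy
    have a4 : 0 < rr e (PMH.nm e ψ x0 y') := H'.maps hyS
    rw [ph, ph, ← log_div a4.ne' a2.ne', ← log_div a3.ne' a1.ne']
    exact log_le_log (by positivity) h6
  rw [H.GG_nm he hx0 hy]
  refine h1 _ (al_mem he hx0 hy) ?_
  rw [H.ph_nm he hx0 hy] at h9
  linarith

end

section
variable {e:E} {ψ : E → E}

lemma al_add (he : ‖e‖ = 1) (x u:E) : al e x (I • e + u) = x + Al e x u := by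
  have := al_o he x
  rw [al] at this ⊢
  rw [map_add, ← add_assoc, this]

lemma al_tendsto {ι : Type*} {l : Filter ι} (he : ‖e‖ = 1) {x : ι → E} (hx : ∀ j, x j ∈ Sg e) {p:E}
  (hp : rr e p = 0) (h : Tendsto x l (𝓝 p)) (y:E) : Tendsto (fun j => al e (x j) y) l (𝓝 p) := by
  have h1 : ∀ j, al e (x j) y = x j + Al e (x j) (y - I • e) := by
    intro j
    rw [← al_add he, add_sub_cancel]
  have hr : Tendsto (fun j => rr e (x j)) l (𝓝 0) := by
    have := ((rr_cont e).tendsto p).comp h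
    rwa [hp] at this
  have h2 : Tendsto (fun j => (√(rr e (x j)) + rr e (x j) + 2 * √(rr e (x j)) * ‖x j‖) * ‖y - I • e‖) l (𝓝 0) := by
    have hs : Tendsto (fun j => √(rr e (x j))) l (𝓝 0) := by
      have := hr.sqrt; rwa [sqrt_zero] at this
    have := (((hs.add hr).add ((hs.const_mul 2).mul h.norm)).mul_const ‖y - I • e‖)
    simpa using this
  have h3 : Tendsto (fun j => Al e (x j) (y - I • e)) l (𝓝 0) :=
    squeeze_zero_norm (fun j => Al_norm he (hx j) _) h2
  have := h.add h3
  rw [add_zero] at this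
  exact this.congr fun j => (h1 j).symm

lemma SM.boundary (he : ‖e‖ = 1) (H : SM e ψ) {p:E} (hp : rr e p = 0) (hpc : ∃ᶠ x in 𝓝 p, x ∈ Sg e)
  (hG : ∀ᶠ x in 𝓝 p, x ∈ Sg e → 1 / 2 ≤ GG e ψ x) {a:ℝ} (ha : a < 1) :
  ∀ᶠ x in 𝓝 p, x ∈ Sg e → a ≤ GG e ψ x := by
  set A : Set ℝ := {a | ∀ᶠ x in 𝓝 p, x ∈ Sg e → a ≤ GG e ψ x} with hA
  have hbdd : BddAbove A := ⟨1, fun a ha => by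
    obtain ⟨x, hx, h1⟩ := (hpc.and_eventually ha).exists
    exact (h1 hx).trans (H.GG_le he hx)⟩
  set g0 := sSup A with hg0
  have hhalf : 1 / 2 ≤ g0 := le_csSup hbdd hG
  have hlow : ∀ b < g0, b ∈ A := by
    intro b hb
    obtain ⟨c, hc, hbc⟩ := exists_lt_of_lt_csSup (s := A) ⟨1 / 2, hG⟩ hb
    have hc' : ∀ᶠ x in 𝓝 p, x ∈ Sg e → c ≤ GG e ψ x := hc
    filter_upwards [hc'] with x hx hxS using hbc.le.trans (hx hxS)
  suffices h1 : 1 ≤ g0 from hlow a (by linarith)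
  have h2 : ∀ j : ℕ, ∃ x ∈ Sg e, dist x p < 1 / ((j:ℝ) + 1) ∧ GG e ψ x < g0 + 1 / ((j:ℝ) + 1) := by
    intro j
    have hj : (0:ℝ) < 1 / ((j:ℝ) + 1) := by positivity
    by_contra hcon
    push Not at hcon
    have : g0 + 1 / ((j:ℝ) + 1) ∈ A := by
      change ∀ᶠ x in 𝓝 p, x ∈ Sg e → _
      filter_upwards [ball_mem_nhds p hj] with x hx hxS using hcon x hxS hx
    have := le_csSup hbdd this
    linarith
  choose x hx hxp hxG using h2
  let 𝒰 : Ultrafilter ℕ := Filter.hyperfilter ℕ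
  have h𝒰 : (𝒰 : Filter ℕ) ≤ atTop := by rw [← Nat.cofinite_eq_atTop]; exact Filter.hyperfilter_le_cofinite
  have h0 : Tendsto (fun j : ℕ => 1 / ((j:ℝ) + 1)) 𝒰 (𝓝 0) := tendsto_one_div_add_atTop_nhds_zero_nat.mono_left h𝒰
  have hxt : Tendsto x 𝒰 (𝓝 p) := by
    rw [tendsto_iff_dist_tendsto_zero]
    exact squeeze_zero (fun _ => dist_nonneg) (fun j => (hxp j).le) h0
  obtain ⟨φ, Hφ, hφo, hlim⟩ := SM.limit he 𝒰 (fun j => PMH.nm e ψ (x j)) (fun j => H.nm he (hx j))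
    (fun j => H.nm_o he (hx j))
  have hGlim : ∀ y ∈ Sg e, Tendsto (fun j => GG e ψ (al e (x j) y)) 𝒰 (𝓝 (GG e φ y)) := by
    intro y hy
    refine (Hφ.limit_GG hy (hlim y hy).1 (hlim y hy).2).congr fun j => ?_
    exact H.GG_nm he (hx j) hy
  have hge : ∀ y ∈ Sg e, g0 ≤ GG e φ y := by
    intro y hy
    refine le_of_forall_lt fun b hb => ?_
    obtain ⟨b', hb1, hb2⟩ := exists_between hb
    refine hb1.trans_le (ge_of_tendsto (hGlim y hy) ?_)
    have h3 : ∀ᶠ x in 𝓝 p, x ∈ Sg e → b' ≤ GG e ψ x := hlow b' hb2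
    filter_upwards [(al_tendsto he hx hp hxt y).eventually h3] with j hj
    exact hj (al_mem he (hx j) hy)
  have hle : GG e φ (I • e) ≤ g0 := by
    have h3 := hGlim _ (o_mem he)
    have h4 := (tendsto_const_nhds (x := g0)).add h0
    rw [add_zero] at h4
    refine le_of_tendsto_of_tendsto' h3 h4 fun j => ?_
    rw [al_o he]; exact (hxG j).le
  have heq : GG e φ (I • e) = 1 := by
    refine Hφ.GG_of_isom he hφo fun v => ?_
    have hpos : 0 < GG e φ (I • e) := by linarith [hge _ (o_mem he)]
    obtain ⟨b, hb⟩ := Hφ.lap_log_GG he hφo hpos.ne' v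
    obtain ⟨R, hR, hb'⟩ := line_ball (Sg_open e) (o_mem he) v
    have := (hb.const_mul (-1)).nonpos (by
      filter_upwards [ball_mem_nhds (0:ℂ) hR] with ζ hζ
      have h5 : log (GG e φ (I • e)) ≤ log (GG e φ (I • e + ζ • v)) :=
        log_le_log hpos (hle.trans (hge _ (hb' ζ hζ)))
      simp only [zero_smul, add_zero]
      linarith)
    have h6 : (0:ℝ) < Module.finrank ℂ E + 1 := by positivity
    nlinarith
  linarith

lemma SM.lap_log_GG' (he : ‖e‖ = 1) (H : SM e ψ) {x:E} (hx : x ∈ Sg e) (hG : GG e ψ x ≠ 0) (v:E) :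
  ∃ c ≤ 0, ∃ b, HasLap (fun ζ : ℂ => log (GG e ψ (x + ζ • v))) c b := by
  have H' := H.nm he hx
  have ho := H.nm_o he hx
  obtain ⟨b, hb⟩ := H'.lap_log_GG he ho (by rwa [H.GG_nm he hx (o_mem he), al_o he]) (Ali e x v)
  have h1 := schwarz_om he H'.hol H'.maps ho (Ali e x v)
  refine ⟨_, ?_, b, hb.congr ?_⟩
  · have : (0:ℝ) < Module.finrank ℂ E + 1 := by positivity
    nlinarith
  · obtain ⟨R, hR, hb'⟩ := line_ball (Sg_open e) (o_mem he) (Ali e x v)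
    filter_upwards [ball_mem_nhds (0:ℂ) hR] with ζ hζ
    rw [H.GG_nm he hx (hb' ζ hζ)]
    congr 2
    rw [al_add he, map_smul (Al e x) ζ, Al_Ali he hx]

lemma SM.slice (he : ‖e‖ = 1) (H : SM e ψ) {v:E} (hv : v ≠ 0) (hwv : wc e v = 0) {δ:ℝ} (hδ : 0 < δ)
  (hG : ∀ y ∈ Sg e, (wc e y).im ≤ 1 → ‖pz e y‖ ^ 2 + (wc e y).re ^ 2 < δ ^ 2 → 1 / 2 ≤ GG e ψ y) :
  ∃ x ∈ Sg e, GG e ψ x = 1 := by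
  haveI : ProperSpace E := FiniteDimensional.proper ℂ E
  obtain ⟨t, ht, htlt⟩ : ∃ t : ℝ, 0 < t ∧ t < min 1 (δ ^ 2) := exists_between (by positivity)
  have ht1 := htlt.trans_le (min_le_left _ _)
  have ht2 := htlt.trans_le (min_le_right _ _)
  set x0 : E := (t:ℂ) • I • e with hx0
  have hw0 : wc e x0 = (t:ℂ) * I := by simp [hx0, wc_e he]
  have hp0 : pz e x0 = 0 := by simp [hx0, pz_e he]
  have hrz : ∀ z, wc e z = 0 → rr e (x0 + z) = t - ‖z‖ ^ 2 := by
    intro z hz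
    rw [rr, map_add, map_add, hw0, hp0, hz, pz_of hz]; simp
  have hwz : ∀ z, wc e z = 0 → wc e (x0 + z) = (t:ℂ) * I := by
    intro z hz; rw [map_add, hw0, hz, add_zero]
  have hpz : ∀ z, wc e z = 0 → pz e (x0 + z) = z := by
    intro z hz; rw [map_add, hp0, pz_of hz, zero_add]
  have hx0S : x0 ∈ Sg e := by
    have := hrz 0 (by simp)
    change 0 < rr e x0
    rw [add_zero] at this; rw [this]; simpa using ht
  by_contra hcon
  push Not at hcon
  have hlt : GG e ψ x0 < 1 := lt_of_le_of_ne (H.GG_le he hx0S) (hcon _ hx0S)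
  have hGh : ∀ z, wc e z = 0 → ‖z‖ ^ 2 < t → 1 / 2 ≤ GG e ψ (x0 + z) := by
    intro z hz hzt
    refine hG _ (by change 0 < rr e _; rw [hrz z hz]; linarith) ?_ ?_
    · rw [hwz z hz]; simpa using ht1.le
    · rw [hwz z hz, hpz z hz]; simp; linarith
  set k : ℝ := -log (GG e ψ x0) / (2 * t) with hk
  have hG0 : 1 / 2 ≤ GG e ψ x0 := by have := hGh 0 (by simp) (by simpa using ht); rwa [add_zero] at this
  have hlog : log (GG e ψ x0) < 0 := Real.log_neg (by linarith) hlt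
  have hkpos : 0 < k := by rw [hk]; apply div_pos <;> linarith
  let D : Set E := {z | wc e z = 0 ∧ ‖z‖ ^ 2 < t}
  let s : E → ℝ := fun z => k * ‖z‖ ^ 2 - log (GG e ψ (x0 + z))
  have hs0 : s 0 = 2 * t * k := by
    have : (2 * t) * k = -log (GG e ψ x0) := by rw [hk]; field_simp
    simp [s, this]
  have hbdd : BddAbove (s '' D) := by
    refine ⟨k * t + log 2, ?_⟩
    rintro _ ⟨z, ⟨hz, hzt⟩, rfl⟩
    have h1 := log_le_log (by norm_num) (hGh z hz hzt)
    rw [one_div, Real.log_inv] at h1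
    have : k * ‖z‖ ^ 2 ≤ k * t := by gcongr
    change k * ‖z‖ ^ 2 - log (GG e ψ (x0 + z)) ≤ _
    linarith
  have h0D : (0:E) ∈ D := ⟨by simp, by simpa using ht⟩
  set S := sSup (s '' D) with hS
  have hS0 : 2 * t * k ≤ S := hs0 ▸ le_csSup hbdd (mem_image_of_mem _ h0D)
  have h1 : ∀ j : ℕ, ∃ z ∈ D, S - 1 / ((j:ℝ) + 1) < s z := by
    intro j
    obtain ⟨_, ⟨z, hz, rfl⟩, h2⟩ := exists_lt_of_lt_csSup ⟨_, mem_image_of_mem s h0D⟩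
      (show S - 1 / ((j:ℝ) + 1) < S by have : (0:ℝ) < 1 / ((j:ℝ) + 1) := by positivity
                                       linarith)
    exact ⟨z, hz, h2⟩
  choose z hzD hz using h1
  let 𝒰 : Ultrafilter ℕ := Filter.hyperfilter ℕ
  have h𝒰 : (𝒰 : Filter ℕ) ≤ atTop := by rw [← Nat.cofinite_eq_atTop]; exact Filter.hyperfilter_le_cofinite
  have h0 : Tendsto (fun j : ℕ => 1 / ((j:ℝ) + 1)) 𝒰 (𝓝 0) := tendsto_one_div_add_atTop_nhds_zero_nat.mono_left h𝒰
  obtain ⟨ζ, hζ, -⟩ := ultra_lim 𝒰 z (√t) (Eventually.of_forall fun j => le_sqrt_of_sq_le (hzD j).2.le)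
  have hζw : wc e ζ = 0 := by
    have := ((wc e).continuous.tendsto ζ).comp hζ
    refine tendsto_nhds_unique this (tendsto_const_nhds.congr fun j => ?_)
    exact (hzD j).1.symm
  have hζt : ‖ζ‖ ^ 2 ≤ t := le_of_tendsto (hζ.norm.pow 2) (Eventually.of_forall fun j => (hzD j).2.le)
  have hSlim : Tendsto (fun j : ℕ => S - 1 / ((j:ℝ) + 1)) 𝒰 (𝓝 S) := by
    simpa using (tendsto_const_nhds (x := S)).sub h0
  have hζt' : ‖ζ‖ ^ 2 < t := by
    refine lt_of_le_of_ne hζt fun heq => ?_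
    have hxz : Tendsto (fun j => x0 + z j) 𝒰 (𝓝 (x0 + ζ)) := hζ.const_add _
    have hmem : ∀ j, x0 + z j ∈ Sg e := fun j => by
      change 0 < rr e _; rw [hrz _ (hzD j).1]; linarith [(hzD j).2]
    have hev : ∀ᶠ x in 𝓝 (x0 + ζ), x ∈ Sg e → 1 / 2 ≤ GG e ψ x := by
      have c1 : ∀ᶠ x in 𝓝 (x0 + ζ), (wc e x).im < 1 := by
        have : Continuous fun x => (wc e x).im := by fun_prop
        exact this.continuousAt.eventually_lt_const (by beta_reduce; rw [hwz _ hζw]; simpa using ht1)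
      have c2 : ∀ᶠ x in 𝓝 (x0 + ζ), ‖pz e x‖ ^ 2 + (wc e x).re ^ 2 < δ ^ 2 := by
        have : Continuous fun x => ‖pz e x‖ ^ 2 + (wc e x).re ^ 2 := by fun_prop
        exact this.continuousAt.eventually_lt_const (by beta_reduce; rw [hwz _ hζw, hpz _ hζw, heq]; simpa using ht2)
      filter_upwards [c1, c2] with x h1 h2 h3 using hG x h3 h1.le h2
    have hb := H.boundary he (p := x0 + ζ) (by rw [hrz _ hζw, heq, sub_self])
      (hxz.frequently (Eventually.of_forall hmem).frequently) hev (a := exp (-(t * k / 2)))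
      (Real.exp_lt_one_iff.2 (by nlinarith [mul_pos ht hkpos]))
    have h3 : S ≤ k * t + t * k / 2 := by
      refine le_of_tendsto hSlim ?_
      filter_upwards [hxz.eventually hb] with j hj
      have h4 := log_le_log (exp_pos _) (hj (hmem j))
      rw [log_exp] at h4
      have h5 : k * ‖z j‖ ^ 2 ≤ k * t := by have := (hzD j).2.le; gcongr
      have h6 : S - 1 / ((j:ℝ) + 1) < k * ‖z j‖ ^ 2 - log (GG e ψ (x0 + z j)) := hz j
      linarith
    nlinarith [mul_pos ht hkpos]
  have hζS : x0 + ζ ∈ Sg e := by change 0 < rr e _; rw [hrz _ hζw]; linarith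
  have hGζ := hGh ζ hζw hζt'
  have hsζ : S ≤ s ζ := by
    have c1 : ContinuousAt (fun z => GG e ψ (x0 + z)) ζ := by
      have : ContinuousAt (GG e ψ) (x0 + ζ) := H.GG_cont.continuousAt ((Sg_open e).mem_nhds hζS)
      exact ContinuousAt.comp (f := fun z => x0 + z) this (by fun_prop)
    have c2 : ContinuousAt s ζ := by
      refine ContinuousAt.sub (by fun_prop) (c1.log (by linarith))
    exact le_of_tendsto_of_tendsto hSlim (c2.tendsto.comp hζ) (Eventually.of_forall fun j => (hz j).le)
  obtain ⟨c, hc, b, hb⟩ := H.lap_log_GG' he hζS (by linarith) v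
  have hR : DifferentiableOn ℂ (fun η : ℂ => ζ + η • v) (ball 0 1) := by
    refine Differentiable.differentiableOn ?_; fun_prop
  obtain ⟨b', hb'⟩ := HasLap.norm_sq_curve one_pos hR
  have hder : deriv (fun η : ℂ => ζ + η • v) 0 = v := by
    have := ((hasDerivAt_id (0:ℂ)).smul_const v).const_add ζ
    simpa using this.deriv
  rw [hder] at hb'
  have hfin := ((hb'.const_mul k).sub hb).nonpos (by
    have c3 : ∀ᶠ η in 𝓝 (0:ℂ), ‖ζ + η • v‖ ^ 2 < t := by
      have : Continuous fun η : ℂ => ‖ζ + η • v‖ ^ 2 := by fun_prop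
      exact this.continuousAt.eventually_lt_const (by simpa using hζt')
    filter_upwards [c3] with η hη
    have h7 : s (ζ + η • v) ≤ S := le_csSup hbdd (mem_image_of_mem _ ⟨by rw [map_add, map_smul, hζw, hwv]; simp, hη⟩)
    have h8 : s (ζ + η • v) = k * ‖ζ + η • v‖ ^ 2 - log (GG e ψ (x0 + ζ + η • v)) := by
      simp only [s, add_assoc]
    simp only [zero_smul, add_zero]
    rw [← h8]
    exact h7.trans hsζ)
  have : 0 < k * ‖v‖ ^ 2 := by have := norm_pos_iff.2 hv; positivity
  linarith

end

section
variable {e:E} {ψ : E → E}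

lemma SM.rigid (he : ‖e‖ = 1) (H : SM e ψ) (ho : ψ (I • e) = I • e)
  (hG : GG e ψ (I • e) = 1) : ∃ U : E →L[ℂ] E, (∀ v, ‖U v‖ = ‖v‖) ∧ ∀ b, ‖b‖ < 1 → gb e ψ b = U b := by
  have hiso : ∀ v, ‖fderiv ℂ (gb e ψ) 0 v‖ = ‖v‖ := by
    refine (det_contr_aux _ (H.gb_contr he ho)).2 ?_
    rw [H.gb_det he ho]
    rw [GG_o he ho] at hG
    exact (pow_eq_one_iff_of_nonneg (norm_nonneg _) two_ne_zero).1 hG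
  refine ⟨fderiv ℂ (gb e ψ) 0, hiso, fun b hb => ?_⟩
  by_cases hb0 : b = 0
  · rw [hb0, gb_zero he ho, map_zero]
  have hn : ‖b‖ ≠ 0 := norm_ne_zero_iff.2 hb0
  set u : E := ((‖b‖:ℝ):ℂ)⁻¹ • b with hu
  have hnu : ‖u‖ = 1 := by rw [hu, norm_smul, norm_inv, norm_real, norm_norm, inv_mul_cancel₀ hn]
  have hbu : b = ((‖b‖:ℝ):ℂ) • u := by
    rw [hu, smul_smul, mul_inv_cancel₀ (Complex.ofReal_ne_zero.2 hn), one_smul]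
  let f : ℂ → E := fun ζ => gb e ψ (0 + ζ • u)
  have hin : ∀ ζ ∈ ball (0:ℂ) 1, 0 + ζ • u ∈ ball (0:E) 1 := by
    intro ζ hζ
    rw [zero_add, mem_ball_zero_iff, norm_smul, hnu, mul_one]; simpa using hζ
  have hfd : DifferentiableOn ℂ f (ball 0 1) := (gb_diff he H.hol H.maps).comp
    (Differentiable.differentiableOn (by fun_prop)) hin
  have hf0 : f 0 = 0 := by simp only [f, zero_smul, add_zero]; exact gb_zero he ho
  have hder : deriv f 0 = fderiv ℂ (gb e ψ) 0 u :=
    (deriv_comp_line u ((gb_diff he H.hol H.maps).differentiableAt (ball_mem_nhds _ one_pos))).deriv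
  haveI : StrictConvexSpace ℝ E := by
    letI : InnerProductSpace ℝ E := InnerProductSpace.rclikeToReal ℂ E
    haveI : UniformConvexSpace E := InnerProductSpace.toUniformConvexSpace
    exact UniformConvexSpace.toStrictConvexSpace
  have hst := Complex.affine_of_mapsTo_ball_of_norm_dslope_eq_div (R₂ := 1) hfd
    (by rw [hf0]; exact fun ζ hζ => ball_subset_closedBall (gb_maps he H.maps (hin ζ hζ)))
    (mem_ball_self one_pos) (by rw [dslope_same, hder, hiso, hnu]; simp)
  have := hst (show ((‖b‖:ℝ):ℂ) ∈ ball (0:ℂ) 1 by simpa using hb)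
  simp only [f, dslope_same] at this
  rw [show deriv (fun ζ : ℂ => gb e ψ (0 + ζ • u)) 0 = _ from hder] at this
  simp only [zero_add, zero_smul, sub_zero, gb_zero he ho] at this
  rw [← hbu] at this
  rw [this, ← map_smul, ← hbu]

lemma SM.linear (he : ‖e‖ = 1) (H : SM e ψ) (ho : ψ (I • e) = I • e)
  (hG : GG e ψ (I • e) = 1) {c:ℝ} (hc : 0 < c) (hlo : ∀ x ∈ Sg e, c * rr e x ≤ rr e (ψ x)) :
  ∃ U : E →L[ℂ] E, (∀ v, ‖U v‖ = ‖v‖) ∧ (∀ v, pz e (U v) = U (pz e v)) ∧ ∀ x ∈ Sg e, ψ x = U x := by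
  obtain ⟨U, hU, hgb⟩ := H.rigid he ho hG
  have hψ : ∀ b, ‖b‖ < 1 → ψ (cay e b) = cay e (U b) := by
    intro b hb
    rw [← hgb b hb, gb, cay_cayi he (H.maps (cay_mem he hb))]
  have h1 : ∀ b, ‖b‖ < 1 → c * ‖1 + wc e (U b)‖ ^ 2 ≤ ‖1 + wc e b‖ ^ 2 := by
    intro b hb
    have h2 := hlo _ (cay_mem he hb)
    have hb' : ‖U b‖ < 1 := by rwa [hU]
    have n1 := norm_pos_iff.2 (one_add_wc_ne he hb)
    have n2 := norm_pos_iff.2 (one_add_wc_ne he hb')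
    have n3 : 0 < 1 - ‖b‖ ^ 2 := by nlinarith [norm_nonneg b]
    rw [hψ b hb, rr_cay he hb, rr_cay he hb', hU, mul_div_assoc', div_le_div_iff₀ (by positivity) (by positivity)] at h2
    refine le_of_mul_le_mul_left ?_ n3
    linarith
  have h2 : wc e (U e) = 1 := by
    have h3 : ∀ s ∈ Ico (0:ℝ) 1, c * ‖1 - (s:ℂ) * wc e (U e)‖ ^ 2 ≤ (1 - s) ^ 2 := by
      intro s hs
      have h4 := h1 (-((s:ℂ) • e)) (by rw [norm_neg, norm_smul, he, mul_one, norm_real, norm_of_nonneg hs.1]; exact hs.2)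
      rw [map_neg, map_neg, map_neg, map_smul, map_smul, map_smul, wc_e he] at h4
      have h5 : ‖(1:ℂ) + -((s:ℂ) • 1)‖ = 1 - s := by
        rw [smul_eq_mul, mul_one, ← sub_eq_add_neg, ← Complex.ofReal_one, ← ofReal_sub, norm_real,
          norm_of_nonneg (by linarith [hs.2])]
      rw [h5, smul_eq_mul, ← sub_eq_add_neg] at h4
      exact h4
    have h4 : c * ‖1 - ((1:ℝ):ℂ) * wc e (U e)‖ ^ 2 ≤ (1 - (1:ℝ)) ^ 2 := by
      have c1 : Continuous fun s : ℝ => c * ‖1 - (s:ℂ) * wc e (U e)‖ ^ 2 := by fun_prop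
      have c2 : Continuous fun s : ℝ => (1 - s) ^ 2 := by fun_prop
      have hcl : (1:ℝ) ∈ closure (Ico (0:ℝ) 1) := by rw [closure_Ico zero_ne_one]; simp
      exact closure_minimal h3 (isClosed_le c1 c2) hcl
    have h5 : ‖1 - wc e (U e)‖ ^ 2 ≤ 0 := by
      simp at h4; nlinarith
    have h6 : 1 - wc e (U e) = 0 := by
      rw [← norm_eq_zero]; exact pow_eq_zero_iff two_ne_zero |>.1 (le_antisymm h5 (sq_nonneg _))
    linear_combination -h6
  have h3 : U e = e := by
    have h4 := norm_sq_decomp he (U e)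
    rw [hU, he, h2] at h4
    have h5 : pz e (U e) = 0 := by
      rw [← norm_eq_zero]; simp at h4; simpa using h4
    have := decomp e (U e)
    rw [h5, h2] at this
    simpa using this.symm
  let UI : E →ₗᵢ[ℂ] E := ⟨(U : E →ₗ[ℂ] E), hU⟩
  have h4 : ∀ v, wc e (U v) = wc e v := by
    intro v
    have := UI.inner_map_map e v
    change inner ℂ (U e) (U v) = _ at this
    rwa [h3] at this
  have h5 : ∀ v, pz e (U v) = U (pz e v) := by
    intro v
    rw [pz_apply, pz_apply, h4, map_sub, map_smul, h3]
  refine ⟨U, hU, h5, fun x hx => ?_⟩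
  have h6 := hψ _ (cayi_lt he hx)
  rw [cay_cayi he hx] at h6
  have h7 : U x = U (cay e (cayi e x)) := by rw [cay_cayi he hx]
  rw [h6, h7, cay, cay, h4, h5, map_add, map_smul, map_smul, h3]

lemma SM.main (he : ‖e‖ = 1) (H : SM e ψ) {c C:ℝ} (hc : 0 < c) (hlo : ∀ x ∈ Sg e, c * rr e x ≤ rr e (ψ x))
  (hhi : ∀ x ∈ Sg e, rr e (ψ x) ≤ C * rr e x) {v:E} (hv : v ≠ 0) (hwv : wc e v = 0) :
  pz e (fderiv ℂ ψ (I • e) v) ≠ 0 := by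
  have hB : ∀ x ∈ Sg e, ph e ψ x ≤ log C := by
    intro x hx
    have a1 : 0 < rr e x := hx
    have a2 : 0 < rr e (ψ x) := H.maps hx
    have hC : 0 < C := by
      by_contra h
      have := hhi x hx
      nlinarith
    have := log_le_log a2 (hhi x hx)
    rw [log_mul hC.ne' a1.ne'] at this
    rw [ph]; linarith
  obtain ⟨x0, hx0, δ, hδ, hreg⟩ := H.region he hB
  obtain ⟨x1, hx1, hG1⟩ := (H.nm he hx0).slice he hv hwv hδ hreg
  rw [H.GG_nm he hx0 hx1] at hG1
  set x := al e x0 x1 with hxdef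
  have hx : x ∈ Sg e := al_mem he hx0 hx1
  clear_value x
  have b1 : 0 < rr e x := hx
  have b2 : 0 < rr e (ψ x) := H.maps hx
  obtain ⟨U, hU, hUp, hlin⟩ := (H.nm he hx).linear he (H.nm_o he hx)
    (by rw [H.GG_nm he hx (o_mem he), al_o he, hG1]) (c := c * rr e x / rr e (ψ x)) (by positivity) (by
      intro y hy
      rw [H.rr_nm he hx]
      have := hlo _ (al_mem he hx hy)
      rw [rr_al he hx] at this
      rw [div_mul_eq_mul_div]
      gcongr
      linarith)
  have hψ : ∀ y ∈ Sg e, al e (ψ x) (U (ali e x y)) = ψ y := by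
    intro y hy
    rw [← hlin _ (ali_mem he hx hy), PMH.nm, al_ali he hx, al_ali he (H.maps hx)]
  have hd : fderiv ℂ ψ (I • e) = (Al e (ψ x)).comp (U.comp (Ali e x)) := by
    have h1 : HasFDerivAt (fun y => al e (ψ x) (U (ali e x y))) ((Al e (ψ x)).comp (U.comp (Ali e x))) (I • e) :=
      (al_fderiv e (ψ x) _).comp (I • e) (U.hasFDerivAt.comp _ (ali_fderiv e x _))
    refine (h1.congr_of_eventuallyEq ?_).fderiv
    filter_upwards [(Sg_open e).mem_nhds (o_mem he)] with y hy using (hψ y hy).symm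
  rw [hd]
  change pz e (Al e (ψ x) (U (Ali e x v))) ≠ 0
  rw [pz_Al he, hUp, pz_Ali he, pz_of hwv]
  refine smul_ne_zero (sqrt_c_ne b2) ?_
  rw [← norm_ne_zero_iff, hU, norm_ne_zero_iff]
  exact smul_ne_zero (inv_ne_zero (sqrt_c_ne b1)) hv

end

section

lemma levi_diff (κ : E → ℝ) (p a b:E) :
  |levi κ p (a + b) - levi κ p a| ≤ ‖Hess κ p‖ * (‖a‖ + ‖b‖) * ‖b‖ := by
  have e : levi κ p (a + b) - levi κ p a = 1 / 4 * (Hess κ p a b + Hess κ p b a + Hess κ p b b +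
      (Hess κ p (I • a) (I • b) + Hess κ p (I • b) (I • a)
        + Hess κ p (I • b) (I • b))) := by
    simp only [levi, smul_add, map_add, add_apply]; ring
  have h1 := hess_le κ p a b
  have h2 := hess_le κ p b a
  have h3 := hess_le κ p b b
  have h4 := hess_le κ p (I • a) (I • b)
  have h5 := hess_le κ p (I • b) (I • a)
  have h6 := hess_le κ p (I • b) (I • b)
  rw [norm_I_smul, norm_I_smul] at h4 h5
  rw [norm_I_smul] at h6
  have h7 : 0 ≤ ‖Hess κ p‖ * ‖b‖ * ‖b‖ := by positivity
  rw [abs_le] at *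
  rw [e]
  constructor <;> nlinarith

lemma exists_isom {e a:E} (he : ‖e‖ = 1) (ha : ‖a‖ = 1) : ∃ V : E ≃ₗᵢ[ℂ] E, V e = a := by
  let L : (Submodule.span ℂ {e}) →ₗᵢ[ℂ] E := (Submodule.subtypeₗᵢ _).comp
    ((LinearIsometryEquiv.toSpanUnitSingleton (𝕜 := ℂ) a ha).toLinearIsometry.comp
      (LinearIsometryEquiv.toSpanUnitSingleton (𝕜 := ℂ) e he).symm.toLinearIsometry)
  refine ⟨L.extend.toLinearIsometryEquiv rfl, ?_⟩
  have h := L.extend_apply ⟨e, Submodule.mem_span_singleton_self e⟩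
  change L.extend e = a
  rw [h]
  have h2 : (LinearIsometryEquiv.toSpanUnitSingleton (𝕜 := ℂ) e he).symm ⟨e, Submodule.mem_span_singleton_self e⟩ = 1 := by
    rw [LinearIsometryEquiv.symm_apply_eq, LinearIsometryEquiv.toSpanUnitSingleton_apply]
    ext; simp
  change ((LinearIsometryEquiv.toSpanUnitSingleton (𝕜 := ℂ) a ha
    ((LinearIsometryEquiv.toSpanUnitSingleton (𝕜 := ℂ) e he).symm ⟨e, Submodule.mem_span_singleton_self e⟩) :
      Submodule.span ℂ {a}):E) = a
  rw [h2, LinearIsometryEquiv.toSpanUnitSingleton_apply]; exact one_smul _ _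

lemma levi_sqrt {κ : E → ℝ} {V : Set E} (hV : IsOpen V) (hκ : ContDiffOn ℝ 2 κ V) {x:E}
  (hx : x ∈ V) (hpos : ∀ v, 0 ≤ levi κ x v) : ∃ S : E →L[ℂ] E, ∀ v, ‖S v‖ ^ 2 = levi κ x v := by
  haveI : CompleteSpace E := FiniteDimensional.complete ℂ E
  let T0 : E →ₗ[ℂ] E :=
    { toFun := fun v => (InnerProductSpace.toDual ℂ E).symm (LsL κ x v)
      map_add' := fun a b => by
        rw [← map_add]; congr 1; ext Y
        simp only [add_apply, LsL_apply]
        rw [Ls_conj hV hκ hx, ← LsL_apply, map_add, map_add, LsL_apply, LsL_apply, ← Ls_conj hV hκ hx, ← Ls_conj hV hκ hx]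
      map_smul' := fun c a => by
        rw [RingHom.id_apply, ← Complex.conj_conj c, ← map_smulₛₗ]; congr 1; ext Y
        simp only [smul_apply, LsL_apply, Complex.conj_conj]
        rw [Ls_conj hV hκ hx, ← LsL_apply, map_smul, smul_eq_mul, map_mul, LsL_apply, ← Ls_conj hV hκ hx, smul_eq_mul] }
  let T : E →L[ℂ] E := LinearMap.toContinuousLinearMap T0
  have hT : ∀ v, inner ℂ (T v) v = ((2 * levi κ x v:ℝ):ℂ) := by
    intro v
    change inner ℂ ((InnerProductSpace.toDual ℂ E).symm (LsL κ x v)) v = _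
    rw [InnerProductSpace.toDual_symm_apply, LsL_apply, Ls_self hV hκ hx]
  have hTp : 0 ≤ T := by
    rw [ContinuousLinearMap.nonneg_iff_isPositive, ContinuousLinearMap.isPositive_iff_complex]
    intro v
    rw [hT]
    have := hpos v
    constructor
    · simp
    · simpa using this
  obtain ⟨S, hS⟩ := CStarAlgebra.nonneg_iff_eq_star_mul_self.1 hTp
  refine ⟨((√2)⁻¹:ℂ) • S, fun v => ?_⟩
  have h1 := hT v
  rw [hS, ContinuousLinearMap.mul_apply, ContinuousLinearMap.star_eq_adjoint, ContinuousLinearMap.adjoint_inner_left,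
    inner_self_eq_norm_sq_to_K] at h1
  have h2 : ‖S v‖ ^ 2 = 2 * levi κ x v := by
    rw [← Complex.ofReal_inj, ← h1]; push_cast; rfl
  rw [smul_apply, norm_smul, mul_pow, h2, norm_inv, norm_real, norm_of_nonneg (by positivity), inv_pow,
    sq_sqrt (by norm_num)]
  ring

/-- normalising linear data at a boundary point -/
structure NC (D : Dom E) (e:E) (K:ℝ) (p ν:E) (g:ℝ) (A B : E →L[ℂ] E) : Prop where
  fr : p ∈ frontier D.Ω
  nν : ‖ν‖ = 1
  hg : D.c ≤ g
  hdl : ∀ v, dl D.r p v = -(g:ℂ) * inner ℂ ν v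
  hA : ∀ v, ‖A v‖ ≤ K * ‖v‖
  hB : ∀ v, ‖B v‖ ≤ K * ‖v‖
  wA : ∀ v, wc e (A v) = 0
  lA : ∀ v, ‖A v‖ ^ 2 = levi D.r p (v - (inner ℂ ν v:ℂ) • ν)
  dB : ∀ x, wc e x = 0 → dl D.r p (B x) = 0
  lB : ∀ x, wc e x = 0 → levi D.r p (B x) = ‖x‖ ^ 2
  BA : ∀ v, B (A v) = v - (inner ℂ ν v:ℂ) • ν

lemma Dom.exists_NC (D : Dom E) {e:E} (he : ‖e‖ = 1) : ∃ K > 0, ∀ p ∈ frontier D.Ω, ∀ ν : E, ‖ν‖ = 1 → ∀ g : ℝ, D.c ≤ g →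
  (∀ v, dl D.r p v = -(g:ℂ) * inner ℂ ν v) → ∃ A B, NC D e K p ν g A B := by
  haveI : CompleteSpace E := FiniteDimensional.complete ℂ E
  obtain ⟨M, hM, hMb⟩ := D.hess_bd
  have hc := D.c_pos
  refine ⟨2 * √M + 1 / √D.c, by positivity, fun p hp ν hν g hg hdl => ?_⟩
  have hpc := (D.mem_frontier.1 hp).1
  have hlev := D.levi_ge p hpc (by rw [(D.mem_frontier.1 hp).2]; linarith [D.δ_pos])
  have hgp : 0 < g := hc.trans_le hg
  obtain ⟨S, hS⟩ := levi_sqrt D.openU D.C2 (D.sub hpc) (fun v => (by have := hlev v; nlinarith [mul_nonneg hc.le (sq_nonneg ‖v‖)]))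
  have hSlo : ∀ v, √D.c * ‖v‖ ≤ ‖S v‖ := by
    intro v
    refine abs_le_of_sq_le_sq' ?_ (norm_nonneg _) |>.2
    rw [mul_pow, sq_sqrt hc.le, hS]; exact hlev v
  have hShi : ∀ v, ‖S v‖ ≤ √M * ‖v‖ := by
    intro v
    refine abs_le_of_sq_le_sq' ?_ (by positivity) |>.2
    rw [mul_pow, sq_sqrt hM.le, hS]
    have h1 := levi_diff D.r p 0 v
    have h2 : levi D.r p 0 = 0 := by simp [levi]
    rw [zero_add, h2, norm_zero, zero_add, sub_zero] at h1
    have h3 := mul_le_mul_of_nonneg_right (hMb p hpc) (mul_nonneg (norm_nonneg v) (norm_nonneg v))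
    have := (abs_le.1 h1).2
    nlinarith
  have hcs : 0 < √D.c := sqrt_pos.2 hc
  obtain ⟨u, hu⟩ := isUnit_of_bound (A := S) (C := 1 / √D.c) (fun x => by
    rw [one_div, ← div_eq_inv_mul, le_div_iff₀ hcs]; linarith [hSlo x])
  let Si : E →L[ℂ] E := ↑u⁻¹
  have hSSi : ∀ x, S (Si x) = x := fun x => by
    rw [← hu]; change ((u : E →L[ℂ] E) * ↑u⁻¹) x = x; rw [Units.mul_inv]; rfl
  have hSiS : ∀ x, Si (S x) = x := fun x => by
    rw [← hu]; change ((↑u⁻¹ : E →L[ℂ] E) * u) x = x; rw [Units.inv_mul]; rfl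
  let ℓ : E →L[ℂ] ℂ := (wc ν).comp Si
  let a : E := (InnerProductSpace.toDual ℂ E).symm ℓ
  have ha : ∀ x, inner ℂ a x = inner ℂ ν (Si x) := fun x => by
    simp only [a, InnerProductSpace.toDual_symm_apply]; rfl
  have ha0 : a ≠ 0 := by
    intro h
    have := ha (S ν)
    rw [h, inner_zero_left, hSiS, inner_self_eq_norm_sq_to_K, hν] at this
    simp at this
  have han := norm_ne_zero_iff.2 ha0
  obtain ⟨V, hV⟩ := exists_isom (e := e) (a := ((‖a‖:ℂ)⁻¹) • a) he (by
    rw [norm_smul, norm_inv, norm_real, norm_norm, inv_mul_cancel₀ han])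
  have hVw : ∀ x, inner ℂ ν (Si (V x)) = (‖a‖:ℂ) * wc e x := by
    intro x
    rw [← ha, wc_apply, ← V.inner_map_map e x, hV, inner_smul_left, map_inv₀, conj_ofReal, ← mul_assoc, mul_inv_cancel₀, one_mul]
    exact_mod_cast han
  have hPν : ∀ v : E, inner ℂ ν (pz ν v) = 0 := fun v => wc_pz hν v
  have hP : ∀ v, ‖pz ν v‖ ≤ 2 * ‖v‖ := by
    intro v
    rw [pz_apply]
    refine (norm_sub_le _ _).trans ?_
    rw [norm_smul, hν, mul_one]
    linarith [wc_norm_le hν v]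
  refine ⟨(V.symm : E →L[ℂ] E).comp (S.comp (pz ν)), Si.comp (V : E →L[ℂ] E), hp, hν, hg, hdl, ?_, ?_, ?_, ?_, ?_, ?_, ?_⟩
  · intro v
    change ‖V.symm (S (pz ν v))‖ ≤ _
    rw [LinearIsometryEquiv.norm_map]
    refine (hShi _).trans ?_
    have := mul_le_mul_of_nonneg_left (hP v) (sqrt_nonneg M)
    have h2 : 0 ≤ 1 / √D.c * ‖v‖ := by positivity
    nlinarith
  · intro v
    change ‖Si (V v)‖ ≤ _
    have h1 := hSlo (Si (V v))
    rw [hSSi, LinearIsometryEquiv.norm_map] at h1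
    have h2 : ‖Si (V v)‖ ≤ 1 / √D.c * ‖v‖ := by rw [one_div, ← div_eq_inv_mul, le_div_iff₀ hcs]; linarith
    have h3 : 0 ≤ 2 * √M * ‖v‖ := by positivity
    nlinarith
  · intro v
    have h1 := hVw (V.symm (S (pz ν v)))
    rw [V.apply_symm_apply, hSiS, hPν] at h1
    exact (mul_eq_zero.1 h1.symm).resolve_left (by exact_mod_cast han)
  · intro v
    change ‖V.symm (S (pz ν v))‖ ^ 2 = _
    rw [LinearIsometryEquiv.norm_map, hS, pz_apply, wc_apply]
  · intro x hx
    change dl D.r p (Si (V x)) = 0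
    rw [hdl, hVw, hx]; simp
  · intro x hx
    change levi D.r p (Si (V x)) = _
    rw [← hS, hSSi, LinearIsometryEquiv.norm_map]
  · intro v
    change Si (V (V.symm (S (pz ν v)))) = _
    rw [V.apply_symm_apply, hSiS, pz_apply, wc_apply]
end

section

lemma quad_fderiv {b : E →L[ℂ] E →L[ℂ] ℂ} (hs : ∀ x y, b x y = b y x) (x:E) :
  ∃ L : E →L[ℂ] ℂ, HasFDerivAt (fun y => 1 / 2 * b y y) L x ∧ ∀ v, L v = b x v := by
  have h1 := (b.hasFDerivAt (x := x)).clm_apply (hasFDerivAt_id x)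
  refine ⟨_, h1.const_mul (1/2), fun v => ?_⟩
  simp [hs v x]; ring

noncomputable def hh (D : Dom E) (e p:E) (g:ℝ) (B : E →L[ℂ] E) (x:E) : ℂ :=
  (-I / g) * (wc e x + I * (1 / 2 * BL D.r p (B (pz e x)) (B (pz e x))))

/-- source scaling -/
noncomputable def Th (D : Dom E) (e p ν:E) (g:ℝ) (B : E →L[ℂ] E) (σ:ℝ) (x:E) : E :=
  p + ((σ:ℂ) • B (pz e x) + ((σ:ℂ) ^ 2 * hh D e p g B x) • ν)

variable {D : Dom E} {e p ν:E} {K g:ℝ} {A B : E →L[ℂ] E}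

lemma pz_norm_le (he : ‖e‖ = 1) (x:E) : ‖pz e x‖ ≤ ‖x‖ :=
  (abs_le_of_sq_le_sq' (by rw [norm_sq_decomp he x]; nlinarith [sq_nonneg ‖wc e x‖]) (norm_nonneg _)).2

lemma NC.cl (N : NC D e K p ν g A B) : p ∈ closure D.Ω := (D.mem_frontier.1 N.fr).1
lemma NC.gpos (N : NC D e K p ν g A B) : 0 < g := D.c_pos.trans_le N.hg
lemma NC.symm (N : NC D e K p ν g A B) (a b:E) : BL D.r p a b = BL D.r p b a := BL_symm D.openU D.C2 (D.sub N.cl) a b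

lemma BL_le {M:ℝ} (hM : ‖Hess D.r p‖ ≤ M) (a b:E) : ‖BL D.r p a b‖ ≤ 2 * M * ‖a‖ * ‖b‖ := by
  rw [BL_apply]
  refine (Bf_Ls_le D.r p a b).1.trans ?_
  gcongr

lemma NC.hh_le (N : NC D e K p ν g A B) (he : ‖e‖ = 1) (hK : 0 < K) {M R:ℝ} (hM : ‖Hess D.r p‖ ≤ M) {x:E} (hx : ‖x‖ ≤ R) :
  ‖B (pz e x)‖ ≤ K * R ∧ ‖hh D e p g B x‖ ≤ 1 / D.c * (R + M * (K * R) ^ 2) := by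
  have h1 : ‖B (pz e x)‖ ≤ K * R := (N.hB _).trans (by gcongr; exact (pz_norm_le he x).trans hx)
  have hM0 : 0 ≤ M := le_trans (norm_nonneg (Hess D.r p)) hM
  have hR : 0 ≤ R := (norm_nonneg _).trans hx
  have hc := D.c_pos
  refine ⟨h1, ?_⟩
  rw [hh, norm_mul, norm_div, norm_neg, norm_I, norm_real, norm_of_nonneg N.gpos.le]
  gcongr
  · exact N.hg
  · refine (norm_add_le _ _).trans (add_le_add ((wc_norm_le he x).trans hx) ?_)
    rw [norm_mul, norm_I, one_mul, norm_mul]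
    have h2 := BL_le hM (B (pz e x)) (B (pz e x))
    have h3 : ‖(1/2:ℂ)‖ = 1/2 := by simp
    rw [h3]
    have h4 : 2 * M * ‖B (pz e x)‖ * ‖B (pz e x)‖ ≤ 2 * M * (K * R) * (K * R) := by gcongr
    nlinarith

set_option maxHeartbeats 800000 in
lemma Dom.scale1 (D : Dom E) (he : ‖e‖ = 1) (hK : 0 < K) {R ε:ℝ} (hR : 0 < R) (hε : 0 < ε) : ∃ σ0 > 0, ∀ p ν g A B, NC D e K p ν g A B →
  ∀ σ > 0, σ < σ0 → ∀ x, ‖x‖ ≤ R → Th D e p ν g B σ x ∈ D.U ∧ |D.r (Th D e p ν g B σ x) + σ ^ 2 * rr e x| ≤ ε * σ ^ 2 := by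
  obtain ⟨M, hM, hMb⟩ := D.hess_bd
  have hc := D.c_pos
  set H := 1 / D.c * (R + M * (K * R) ^ 2) with hH
  have hHp : 0 < H := by positivity
  clear_value H
  set k := K * R with hk
  have hkp : 0 < k := by positivity
  clear_value k
  set Q := 2 * M * k * H + M * H ^ 2 + M * (k + H) * H with hQ
  have hQp : 0 < Q := by positivity
  obtain ⟨δ, hδ, ht⟩ := D.taylor (ε := ε / (2 * (k + H) ^ 2)) (by positivity)
  refine ⟨min 1 (min (δ / (k + H)) (ε / (2 * Q))), by positivity, fun p ν g A B N σ hσ hσ' x hx => ?_⟩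
  obtain ⟨s1, s2⟩ := lt_min_iff.1 hσ'
  obtain ⟨s2, s3⟩ := lt_min_iff.1 s2
  rw [lt_div_iff₀ (by positivity)] at s2 s3
  have hMp := hMb p N.cl
  obtain ⟨h1, h2⟩ := N.hh_le he hK hMp hx
  rw [← hk] at h1 h2; rw [← hH] at h2
  have hz := wc_pz he x
  set a := B (pz e x) with ha
  have hlev : levi D.r p a = ‖pz e x‖ ^ 2 := N.lB _ hz
  have hdla : dl D.r p a = 0 := N.dB _ hz
  set h := hh D e p g B x with hhd
  have hgh : -(g:ℂ) * h = I * wc e x - 1 / 2 * BL D.r p a a := by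
    have : (g:ℂ) ≠ 0 := by exact_mod_cast N.gpos.ne'
    rw [hhd, hh, ← ha]; field_simp; ring_nf; simp; ring
  clear_value h a
  have hνν : inner ℂ ν ν = (1:ℂ) := by rw [inner_self_eq_norm_sq_to_K, N.nν]; simp
  have hun : ‖((σ:ℂ) ^ 2 * h) • ν‖ ≤ σ ^ 2 * H := by
    rw [norm_smul, N.nν, mul_one, norm_mul, norm_pow, norm_real, norm_of_nonneg hσ.le]; gcongr
  have hua : ‖(σ:ℂ) • a‖ ≤ σ * k := by
    rw [norm_smul, norm_real, norm_of_nonneg hσ.le]; gcongr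
  have hσ2 : σ ^ 2 ≤ σ := by nlinarith
  set u := (σ:ℂ) • a + ((σ:ℂ) ^ 2 * h) • ν with hu
  have hTh : Th D e p ν g B σ x = p + u := by rw [Th, ← ha, ← hhd]
  have hul : ‖u‖ ≤ σ * (k + H) := (norm_add_le _ _).trans (by nlinarith)
  have huδ : ‖u‖ < δ := hul.trans_lt s2
  obtain ⟨t1, t2⟩ := ht p N.cl
  have t2 := t2 u huδ
  have hpol : D.pol p u = (σ:ℂ) ^ 2 * (I * wc e x) + ((σ:ℂ) ^ 3 * h * BL D.r p a ν + 1 / 2 * (σ:ℂ) ^ 4 * h ^ 2 * BL D.r p ν ν) := by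
    rw [Dom.pol, hu, map_add, map_smul, map_smul, hdla, N.hdl, hνν]
    simp only [map_add, map_smul, add_apply, smul_apply, smul_eq_mul]
    rw [N.symm ν a]
    linear_combination (σ:ℂ) ^ 2 * hgh
  have hrem : ‖(σ:ℂ) ^ 3 * h * BL D.r p a ν + 1 / 2 * (σ:ℂ) ^ 4 * h ^ 2 * BL D.r p ν ν‖ ≤ σ ^ 3 * (2 * M * k * H + M * H ^ 2) := by
    have b1 := BL_le hMp a ν
    have b2 := BL_le hMp ν ν
    rw [N.nν, mul_one] at b1 b2
    rw [mul_one] at b2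
    refine (norm_add_le _ _).trans ?_
    simp only [norm_mul, norm_pow, norm_real, norm_of_nonneg hσ.le]
    have h3 : ‖(1/2:ℂ)‖ = 1/2 := by simp
    rw [h3]
    have c1 : σ ^ 3 * ‖h‖ * ‖BL D.r p a ν‖ ≤ σ ^ 3 * H * (2 * M * k) := by
      gcongr; exact b1.trans (by gcongr)
    have c2 : 1 / 2 * σ ^ 4 * ‖h‖ ^ 2 * ‖BL D.r p ν ν‖ ≤ 1 / 2 * σ ^ 3 * H ^ 2 * (2 * M) := by
      have h4 : σ ^ 4 ≤ σ ^ 3 := by rw [pow_succ]; exact mul_le_of_le_one_right (by positivity) s1.le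
      gcongr
    linarith
  have hle : |levi D.r p u - σ ^ 2 * ‖pz e x‖ ^ 2| ≤ σ ^ 3 * (M * (k + H) * H) := by
    have h3 := levi_diff D.r p ((σ:ℂ) • a) (((σ:ℂ) ^ 2 * h) • ν)
    rw [← hu, levi_smul, hlev, norm_real, norm_of_nonneg hσ.le] at h3
    refine h3.trans ?_
    have : ‖Hess D.r p‖ * (‖(σ:ℂ) • a‖ + ‖((σ:ℂ) ^ 2 * h) • ν‖) * ‖((σ:ℂ) ^ 2 * h) • ν‖ ≤ M * (σ * k + σ * H) * (σ ^ 2 * H) := by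
      gcongr
      exact hun.trans (by gcongr)
    linarith
  refine ⟨hTh ▸ t1 (by simpa using huδ), ?_⟩
  rw [hTh]
  rw [(D.mem_frontier.1 N.fr).2, sub_zero, hpol, add_re] at t2
  have h5 : ((σ:ℂ) ^ 2 * (I * wc e x)).re = - σ ^ 2 * (wc e x).im := by
    rw [← ofReal_pow, re_ofReal_mul, Complex.I_mul_re]; ring
  rw [h5] at t2
  have h6 := (abs_re_le_norm _).trans hrem
  have h7 : ε / (2 * (k + H) ^ 2) * ‖u‖ ^ 2 ≤ ε / 2 * σ ^ 2 := by
    calc _ ≤ ε / (2 * (k + H) ^ 2) * (σ * (k + H)) ^ 2 := by gcongr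
      _ = _ := by field_simp
  have h8 : σ ^ 3 * Q ≤ ε / 2 * σ ^ 2 := by nlinarith [sq_nonneg σ]
  rw [rr]
  rw [hQ] at h8
  rw [abs_le] at *
  constructor <;> linarith
end

section
variable {D D1 D2 : Dom E} {e p ν:E} {K g:ℝ} {A B : E →L[ℂ] E} {f : E → E}

lemma NC.fderivTh (N : NC D e K p ν g A B) (σ:ℝ) (x:E) : ∃ L : E →L[ℂ] E, HasFDerivAt (Th D e p ν g B σ) L x ∧
  ∀ v, L v = (σ:ℂ) • B (pz e v) + ((σ:ℂ) ^ 2 * ((-I / g) * (wc e v + I * BL D.r p (B (pz e x)) (B (pz e v))))) • ν := by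
  obtain ⟨L, hL, hLv⟩ := quad_fderiv (b := BL D.r p) N.symm (B (pz e x))
  have h1 : HasFDerivAt (fun y => B (pz e y)) (B.comp (pz e)) x := (B.comp (pz e)).hasFDerivAt
  have h2 := hL.comp x h1
  have h3 := ((((wc e).hasFDerivAt (x := x)).add (h2.const_mul I)).const_mul (-I / g)).const_mul ((σ:ℂ) ^ 2)
  have h4 := ((h1.const_smul (σ:ℂ)).add (h3.smul_const ν)).const_add p
  refine ⟨_, h4, fun v => ?_⟩
  simp [hLv]
  congr 1; ring

lemma Dom.scale2 (D : Dom E) (he : ‖e‖ = 1) (hK : 0 < K) {R:ℝ} (hR : 0 < R) : ∃ C > 0, ∃ σ0 > 0, ∀ p ν g A B, NC D e K p ν g A B →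
  ∀ σ > 0, σ < σ0 → ∀ x, ‖x‖ ≤ R → ∃ L : E →L[ℂ] E, HasFDerivAt (Th D e p ν g B σ) L x ∧
  ∀ v, ‖L v‖ ≤ C * σ * ‖v‖ ∧ ‖dl D.r (Th D e p ν g B σ x) (L v)‖ ≤ C * σ ^ 2 * ‖v‖ := by
  obtain ⟨M, hM, hMb⟩ := D.hess_bd
  obtain ⟨C1, hC1, δ, hδ, hlip⟩ := D.dl_lip
  have hc := D.c_pos
  set H := 1 / D.c * (R + M * (K * R) ^ 2) with hH
  have hHp : 0 < H := by positivity
  set H2 := 1 + 2 * M * (K * R) * K with hH2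
  have hH2p : 0 < H2 := by positivity
  set C2 := K + 1 / D.c * H2 with hC2
  have hC2p : 0 < C2 := by positivity
  refine ⟨C2 + (H2 + C1 * (K * R + H) * C2), by positivity, min 1 (δ / (K * R + H)), by positivity, fun p ν g A B N σ hσ hσ' x hx => ?_⟩
  obtain ⟨s1, s2⟩ := lt_min_iff.1 hσ'
  rw [lt_div_iff₀ (by positivity)] at s2
  have hMp := hMb p N.cl
  obtain ⟨h1, h2⟩ := N.hh_le he hK hMp hx
  rw [← hH] at h2
  have hσ2 : σ ^ 2 ≤ σ := by nlinarith
  have hu : ‖(σ:ℂ) • B (pz e x) + ((σ:ℂ) ^ 2 * hh D e p g B x) • ν‖ ≤ σ * (K * R + H) := by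
    refine (norm_add_le _ _).trans ?_
    rw [norm_smul, norm_smul, N.nν, mul_one, norm_mul, norm_pow, norm_real, norm_of_nonneg hσ.le]
    have : σ ^ 2 * ‖hh D e p g B x‖ ≤ σ * H := by gcongr
    have : σ * ‖B (pz e x)‖ ≤ σ * (K * R) := by gcongr
    linarith
  obtain ⟨L, hL, hLv⟩ := N.fderivTh σ x
  refine ⟨L, hL, fun v => ?_⟩
  set ω := wc e v + I * BL D.r p (B (pz e x)) (B (pz e v)) with hω
  have hBv : ‖B (pz e v)‖ ≤ K * ‖v‖ := (N.hB _).trans (by gcongr; exact pz_norm_le he v)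
  have hωn : ‖ω‖ ≤ H2 * ‖v‖ := by
    refine (norm_add_le _ _).trans ?_
    rw [norm_mul, norm_I, one_mul]
    have h3 := BL_le hMp (B (pz e x)) (B (pz e v))
    have h4 : 2 * M * ‖B (pz e x)‖ * ‖B (pz e v)‖ ≤ 2 * M * (K * R) * (K * ‖v‖) := by gcongr
    have := wc_norm_le he v
    rw [hH2]; linarith
  have hn : ‖L v‖ ≤ C2 * σ * ‖v‖ := by
    rw [hLv]
    refine (norm_add_le _ _).trans ?_
    rw [norm_smul, norm_smul, N.nν, mul_one, norm_mul, norm_mul, norm_pow, norm_real, norm_of_nonneg hσ.le,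
      norm_div, norm_neg, norm_I, norm_real, norm_of_nonneg N.gpos.le]
    have h3 : 1 / g * ‖ω‖ ≤ 1 / D.c * (H2 * ‖v‖) := by gcongr; exact N.hg
    have h4 : σ ^ 2 * (1 / g * ‖ω‖) ≤ σ * (1 / D.c * (H2 * ‖v‖)) := by
      have := N.gpos; gcongr
    have h5 : σ * ‖B (pz e v)‖ ≤ σ * (K * ‖v‖) := by gcongr
    rw [hC2]; linarith
  have hdp : dl D.r p (L v) = (σ:ℂ) ^ 2 * (I * ω) := by
    have hνν : inner ℂ ν ν = (1:ℂ) := by rw [inner_self_eq_norm_sq_to_K, N.nν]; simp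
    have : (g:ℂ) ≠ 0 := by exact_mod_cast N.gpos.ne'
    rw [hLv, map_add, map_smul, N.dB _ (wc_pz he v), map_smul, N.hdl, hνν, ← hω]
    simp only [smul_eq_mul]; field_simp; ring
  have hdn : ‖dl D.r p (L v)‖ ≤ σ ^ 2 * (H2 * ‖v‖) := by
    rw [hdp, norm_mul, norm_mul, norm_pow, norm_real, norm_of_nonneg hσ.le, norm_I, one_mul]; gcongr
  have h3 := hlip p N.cl _ (hu.trans_lt s2) (L v)
  have h4 : C1 * ‖(σ:ℂ) • B (pz e x) + ((σ:ℂ) ^ 2 * hh D e p g B x) • ν‖ * ‖L v‖ ≤ C1 * (σ * (K * R + H)) * (C2 * σ * ‖v‖) := by gcongr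
  have h5 := norm_le_norm_add_norm_sub' (dl D.r (Th D e p ν g B σ x) (L v)) (dl D.r p (L v))
  have h6 : 0 ≤ σ * ‖v‖ := by positivity
  have h7 : 0 ≤ (H2 + C1 * (K * R + H) * C2) * (σ * ‖v‖) := by positivity
  have h8 : 0 ≤ C2 * (σ ^ 2 * ‖v‖) := by positivity
  constructor
  · linarith
  · refine h5.trans ?_
    have h9 := h3.trans h4
    have : ‖dl D.r (Th D e p ν g B σ x) (L v) - dl D.r p (L v)‖ ≤ C1 * (σ * (K * R + H)) * (C2 * σ * ‖v‖) := h9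
    linarith

lemma rr_le (he : ‖e‖ = 1) (x:E) : rr e x ≤ ‖x‖ := by
  have := (le_abs_self _).trans (abs_im_le_norm (wc e x))
  have := wc_norm_le he x
  rw [rr]; nlinarith [sq_nonneg ‖pz e x‖]

lemma PMap.src (P : PMap D1 D2 f) (he : ‖e‖ = 1) (hK : 0 < K) {R κ:ℝ} (hR : 0 < R) (hκ : 0 < κ) :
  ∃ C > 0, ∃ σ0 > 0, ∀ p ν g A B, NC D1 e K p ν g A B → ∀ σ > 0, σ < σ0 → ∀ x, ‖x‖ ≤ R → κ ≤ rr e x →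
  Th D1 e p ν g B σ x ∈ D1.Ω ∧ ∃ L : E →L[ℂ] E, HasFDerivAt (fun y => f (Th D1 e p ν g B σ y)) L x ∧
  ∀ v, ‖L v‖ ≤ C * σ * ‖v‖ ∧ ‖dl D2.r (f (Th D1 e p ν g B σ x)) (L v)‖ ≤ C * σ ^ 2 * ‖v‖ := by
  obtain ⟨C2, hC2, σ1, hσ1, h1⟩ := D1.scale2 he hK hR
  obtain ⟨σ2, hσ2, h2⟩ := D1.scale1 he hK hR (half_pos hκ)
  obtain ⟨Ca, hCa, han⟩ := P.aniso
  refine ⟨Ca * (C2 + C2 / √(κ / 2)) + Ca * (√(R + κ) * C2 + C2), by positivity, min σ1 σ2, by positivity, fun p ν g A B N σ hσ hσ' x hx hxr => ?_⟩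
  obtain ⟨s1, s2⟩ := lt_min_iff.1 hσ'
  obtain ⟨L, hL, hLv⟩ := h1 p ν g A B N σ hσ s1 x hx
  obtain ⟨hU, hr⟩ := h2 p ν g A B N σ hσ s2 x hx
  set y := Th D1 e p ν g B σ x with hy
  obtain ⟨r1, r2⟩ := abs_le.1 hr
  have hlo : σ ^ 2 * (κ / 2) ≤ -D1.r y := by nlinarith [sq_nonneg σ]
  have hhi : -D1.r y ≤ σ ^ 2 * (R + κ) := by
    have := (rr_le he x).trans hx
    nlinarith [sq_nonneg σ]
  have hyΩ : y ∈ D1.Ω := (D1.mem hU).2 (by have : 0 < σ ^ 2 * (κ / 2) := by positivity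
                                           linarith)
  have q1 : σ * √(κ / 2) ≤ √(-D1.r y) := by
    refine le_sqrt_of_sq_le ?_
    rwa [mul_pow, sq_sqrt (by positivity)]
  have q2 : √(-D1.r y) ≤ σ * √(R + κ) := by
    refine Real.sqrt_le_iff.2 ⟨by positivity, ?_⟩
    rwa [mul_pow, sq_sqrt (by positivity)]
  refine ⟨hyΩ, (fderiv ℂ f y).comp L, ((P.hol.differentiableAt (D1.isOpen.mem_nhds hyΩ)).hasFDerivAt).comp x hL, fun v => ?_⟩
  obtain ⟨a1, a2⟩ := han y hyΩ (L v)
  obtain ⟨l1, l2⟩ := hLv v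
  have hs : 0 < √(κ / 2) := by positivity
  have b1 : ‖dl D1.r y (L v)‖ / √(-D1.r y) ≤ C2 / √(κ / 2) * σ * ‖v‖ := by
    calc _ ≤ C2 * σ ^ 2 * ‖v‖ / (σ * √(κ / 2)) := by gcongr
      _ = _ := by field_simp
  have b2 : √(-D1.r y) * ‖L v‖ ≤ σ * √(R + κ) * (C2 * σ * ‖v‖) := by gcongr
  have c1 : 0 ≤ Ca * (C2 + C2 / √(κ / 2)) * (σ ^ 2 * ‖v‖) := by positivity
  have c2 : 0 ≤ Ca * (√(R + κ) * C2 + C2) * (σ * ‖v‖) := by positivity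
  change ‖fderiv ℂ f y (L v)‖ ≤ _ ∧ ‖dl D2.r (f y) (fderiv ℂ f y (L v))‖ ≤ _
  constructor
  · refine a1.trans ?_
    have := mul_le_mul_of_nonneg_left (add_le_add l1 b1) hCa.le
    linarith
  · refine a2.trans ?_
    have := mul_le_mul_of_nonneg_left (add_le_add b2 l2) hCa.le
    linarith
end

section
variable {D D1 D2 : Dom E} {e p ν:E} {K g:ℝ} {A B : E →L[ℂ] E} {f : E → E}

/-- target scaling -/
noncomputable def Gt (D : Dom E) (e q:E) (A : E →L[ℂ] E) (σ:ℝ) (y:E) : E :=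
  (σ:ℂ)⁻¹ • A (y - q) + ((-I / (σ:ℂ) ^ 2) * D.pol q (y - q)) • e

lemma NC.rr_Gt (N : NC D e K p ν g A B) (he : ‖e‖ = 1) {σ:ℝ} (hσ : 0 < σ) (y:E) :
  wc e (Gt D e p A σ y) = (-I / (σ:ℂ) ^ 2) * D.pol p (y - p) ∧ pz e (Gt D e p A σ y) = (σ:ℂ)⁻¹ • A (y - p) ∧
  σ ^ 2 * rr e (Gt D e p A σ y) = -(D.pol p (y - p)).re - ‖A (y - p)‖ ^ 2 := by
  have h1 : wc e ((σ:ℂ)⁻¹ • A (y - p)) = 0 := by rw [map_smul, N.wA, smul_zero]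
  refine ⟨wc_mk he h1 _, pz_mk he h1 _, ?_⟩
  rw [Gt, rr_mk he h1, norm_smul, norm_inv, norm_real, norm_of_nonneg hσ.le]
  have h2 : (-I / (σ:ℂ) ^ 2 * D.pol p (y - p)).im = -(D.pol p (y - p)).re / σ ^ 2 := by
    rw [← ofReal_pow, div_mul_eq_mul_div, Complex.div_ofReal_im]; simp
  rw [h2]; field_simp

lemma NC.fderivGt (N : NC D e K p ν g A B) (σ:ℝ) (y:E) : ∃ L : E →L[ℂ] E, HasFDerivAt (Gt D e p A σ) L y ∧
  ∀ Y, L Y = (σ:ℂ)⁻¹ • A Y + ((-I / (σ:ℂ) ^ 2) * (dl D.r p Y + BL D.r p (y - p) Y)) • e := by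
  obtain ⟨L, hL, hLv⟩ := quad_fderiv (b := BL D.r p) N.symm (y - p)
  have h0 : HasFDerivAt (fun y => y - p) (ContinuousLinearMap.id ℂ E) y := (hasFDerivAt_id y).sub_const p
  have h1 := (A.hasFDerivAt (x := y - p)).comp y h0
  have h2 := hL.comp y h0
  have h3 := ((LinearMap.toContinuousLinearMap (dl D.r p)).hasFDerivAt (x := y - p)).comp y h0
  have h4 := (h1.const_smul (σ:ℂ)⁻¹).add (((h3.add h2).const_mul (-I / (σ:ℂ) ^ 2)).smul_const e)
  refine ⟨_, h4, fun Y => ?_⟩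
  simp [hLv]
  congr 1; ring

set_option maxHeartbeats 1000000 in
lemma Dom.tgt (D : Dom E) (he : ‖e‖ = 1) (hK : 0 < K) {R C0 C3 ε:ℝ} (hR : 0 < R) (hC0 : 0 < C0) (hC3 : 0 < C3) (hε : 0 < ε) :
  ∃ C > 0, ∃ σ0 > 0, ∀ q ν g A B, NC D e K q ν g A B → ∀ σ > 0, σ < σ0 → ∀ (S : Set E) (F : E → E) (o:E), Convex ℝ S → o ∈ S →
  (∀ x ∈ S, ‖x - o‖ ≤ R) → ‖F o - q‖ ≤ C0 * σ ^ 2 →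
  (∀ x ∈ S, ∃ L : E →L[ℂ] E, HasFDerivAt F L x ∧ ∀ v, ‖L v‖ ≤ C3 * σ * ‖v‖ ∧ ‖dl D.r (F x) (L v)‖ ≤ C3 * σ ^ 2 * ‖v‖) →
  ∀ x ∈ S, ‖Gt D e q A σ (F x)‖ ≤ C ∧ |σ ^ 2 * rr e (Gt D e q A σ (F x)) + D.r (F x)| ≤ ε * σ ^ 2 := by
  obtain ⟨M, hM, hMb⟩ := D.hess_bd
  obtain ⟨C1, hC1, δ, hδ, hlip⟩ := D.dl_lip
  obtain ⟨Cd, hCd, hdl⟩ := D.dl_bd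
  have hc := D.c_pos
  set C4 := C3 * R + C0 with hC4
  have hC4p : 0 < C4 := by positivity
  set C6 := K * C3 + (C3 + C1 * C4 * C3 + 2 * M * C4 * C3) with hC6
  have hC6p : 0 < C6 := by positivity
  set C7 := C6 * R + (K * C0 + (Cd * C0 + M * C0 ^ 2)) with hC7
  have hC7p : 0 < C7 := by positivity
  set C8 := 1 / D.c * (C7 + M * C4 ^ 2) with hC8
  have hC8p : 0 < C8 := by positivity
  obtain ⟨δ2, hδ2, ht⟩ := D.taylor (ε := ε / (2 * C4 ^ 2)) (by positivity)
  refine ⟨C7, hC7p, min 1 (min (δ / C4) (min (δ2 / C4) (ε / (2 * (M * (C4 + C8) * C8))))), by positivity,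
    fun q ν g A B N σ hσ hσ' S F o hS ho hSR hFo hder => ?_⟩
  obtain ⟨s1, s2⟩ := lt_min_iff.1 hσ'
  obtain ⟨s2, s3⟩ := lt_min_iff.1 s2
  obtain ⟨s3, s4⟩ := lt_min_iff.1 s3
  rw [lt_div_iff₀ (by positivity)] at s2 s3 s4
  have hMp := hMb q N.cl
  have hσ2 : σ ^ 2 ≤ σ := by nlinarith
  choose! L hL hLv using hder
  have hLn : ∀ x ∈ S, ‖L x‖ ≤ C3 * σ := fun x hx => (L x).opNorm_le_bound (by positivity) fun v => (hLv x hx v).1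
  have hv0 : ∀ x ∈ S, ‖F x - q‖ ≤ C4 * σ := by
    intro x hx
    have h1 := hS.norm_image_sub_le_of_norm_hasFDerivWithin_le (𝕜 := ℂ) (fun y hy => (hL y hy).hasFDerivWithinAt) hLn ho hx
    have h2 : C3 * σ * ‖x - o‖ ≤ C3 * σ * R := by gcongr; exact hSR x hx
    have h3 : ‖F x - q‖ ≤ ‖F x - F o‖ + ‖F o - q‖ := norm_sub_le_norm_sub_add_norm_sub _ _ _
    have h4 : C0 * σ ^ 2 ≤ C0 * σ := by gcongr
    rw [hC4]; linarith
  have hcoef : ‖-I / (σ:ℂ) ^ 2‖ = 1 / σ ^ 2 := by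
    rw [norm_div, norm_neg, norm_I, norm_pow, norm_real, norm_of_nonneg hσ.le]
  have hinv : ‖(σ:ℂ)⁻¹‖ = 1 / σ := by rw [norm_inv, norm_real, norm_of_nonneg hσ.le, one_div]
  have hψd : ∀ x ∈ S, ∃ T : E →L[ℂ] E, HasFDerivAt (fun y => Gt D e q A σ (F y)) T x ∧ ‖T‖ ≤ C6 := by
    intro x hx
    obtain ⟨T, hT, hTv⟩ := N.fderivGt σ (F x)
    refine ⟨T.comp (L x), hT.comp x (hL x hx), opNorm_le_bound _ hC6p.le fun v => ?_⟩
    change ‖T (L x v)‖ ≤ _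
    set Y := L x v with hY
    obtain ⟨l1, l2⟩ := hLv x hx v
    rw [← hY] at l1 l2
    rw [hTv]
    refine (norm_add_le _ _).trans ?_
    rw [norm_smul, norm_smul, he, mul_one, norm_mul, hcoef, hinv]
    have v0 := hv0 x hx
    have a1 := hlip q N.cl (F x - q) (v0.trans_lt (by linarith)) Y
    rw [add_sub_cancel] at a1
    have a2 : C1 * ‖F x - q‖ * ‖Y‖ ≤ C1 * (C4 * σ) * (C3 * σ * ‖v‖) := by gcongr
    have a3 := norm_le_norm_add_norm_sub (dl D.r (F x) Y) (dl D.r q Y)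
    have a4 := BL_le hMp (F x - q) Y
    have a5 : 2 * M * ‖F x - q‖ * ‖Y‖ ≤ 2 * M * (C4 * σ) * (C3 * σ * ‖v‖) := by gcongr
    have a6 : ‖dl D.r q Y + BL D.r q (F x - q) Y‖ ≤ σ ^ 2 * ((C3 + C1 * C4 * C3 + 2 * M * C4 * C3) * ‖v‖) :=
      (norm_add_le _ _).trans (by linarith)
    have a7 : 1 / σ ^ 2 * ‖dl D.r q Y + BL D.r q (F x - q) Y‖ ≤ (C3 + C1 * C4 * C3 + 2 * M * C4 * C3) * ‖v‖ := by
      rw [one_div, ← div_eq_inv_mul, div_le_iff₀ (by positivity)]; linarith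
    have a8 : 1 / σ * ‖A Y‖ ≤ K * C3 * ‖v‖ := by
      rw [one_div, ← div_eq_inv_mul, div_le_iff₀ (by positivity)]
      refine (N.hA Y).trans ?_
      have := mul_le_mul_of_nonneg_left l1 hK.le
      linarith
    rw [hC6]; linarith
  choose! T hT hTn using hψd
  have hψo : ‖Gt D e q A σ (F o)‖ ≤ K * C0 + (Cd * C0 + M * C0 ^ 2) := by
    refine (norm_add_le _ _).trans ?_
    rw [norm_smul, norm_smul, he, mul_one, norm_mul, hcoef, hinv]
    refine add_le_add ?_ ?_
    · rw [one_div, ← div_eq_inv_mul, div_le_iff₀ (by positivity)]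
      refine (N.hA _).trans ?_
      calc K * ‖F o - q‖ ≤ K * (C0 * σ) := by gcongr; exact hFo.trans (by gcongr)
        _ = _ := by ring
    · rw [one_div, ← div_eq_inv_mul, div_le_iff₀ (by positivity)]
      refine (norm_add_le _ _).trans ?_
      rw [norm_mul]
      have a1 := hdl q N.cl (F o - q)
      have a2 := BL_le hMp (F o - q) (F o - q)
      have a3 : ‖(1/2:ℂ)‖ = 1/2 := by simp
      have a4 : 2 * M * ‖F o - q‖ * ‖F o - q‖ ≤ 2 * M * (C0 * σ) * (C0 * σ) := by
        have : ‖F o - q‖ ≤ C0 * σ := hFo.trans (by gcongr)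
        gcongr
      have a5 : Cd * ‖F o - q‖ ≤ Cd * (C0 * σ ^ 2) := by gcongr
      rw [a3]; linarith
  intro x hx
  have hψx : ‖Gt D e q A σ (F x)‖ ≤ C7 := by
    have h1 := hS.norm_image_sub_le_of_norm_hasFDerivWithin_le (𝕜 := ℂ) (fun y hy => (hT y hy).hasFDerivWithinAt) hTn ho hx
    have h2 : C6 * ‖x - o‖ ≤ C6 * R := by gcongr; exact hSR x hx
    have h3 := norm_le_norm_add_norm_sub' (Gt D e q A σ (F x)) (Gt D e q A σ (F o))
    rw [hC7]; linarith
  refine ⟨hψx, ?_⟩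
  obtain ⟨w1, w2, w3⟩ := N.rr_Gt he hσ (F x)
  have v0 := hv0 x hx
  set v := F x - q with hv
  have hFx : F x = q + v := by rw [hv]; abel
  have hpol : ‖D.pol q v‖ ≤ σ ^ 2 * C7 := by
    have h1 := (wc_norm_le he _).trans hψx
    rw [w1, norm_mul, hcoef, one_div, ← div_eq_inv_mul, div_le_iff₀ (by positivity)] at h1
    linarith
  have hBv : ‖BL D.r q v v‖ ≤ 2 * (M * C4 ^ 2 * σ ^ 2) := by
    refine (BL_le hMp v v).trans ?_
    calc 2 * M * ‖v‖ * ‖v‖ ≤ 2 * M * (C4 * σ) * (C4 * σ) := by gcongr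
      _ = _ := by ring
  have hdv : ‖dl D.r q v‖ ≤ σ ^ 2 * (C7 + M * C4 ^ 2) := by
    have h1 : dl D.r q v = D.pol q v - 1 / 2 * BL D.r q v v := by rw [Dom.pol]; ring
    rw [h1]
    refine (norm_sub_le _ _).trans ?_
    rw [norm_mul]
    have a3 : ‖(1/2:ℂ)‖ = 1/2 := by simp
    rw [a3]; linarith
  have hin : ‖(inner ℂ ν v:ℂ)‖ ≤ C8 * σ ^ 2 := by
    rw [N.hdl, norm_mul, norm_neg, norm_real, norm_of_nonneg N.gpos.le] at hdv
    have : D.c * ‖(inner ℂ ν v:ℂ)‖ ≤ g * ‖(inner ℂ ν v:ℂ)‖ := by gcongr; exact N.hg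
    rw [hC8, mul_comm (1 / D.c), mul_one_div, div_mul_eq_mul_div, le_div_iff₀ hc]
    linarith
  have hlev : |‖A v‖ ^ 2 - levi D.r q v| ≤ σ ^ 3 * (M * (C4 + C8) * C8) := by
    rw [N.lA, sub_eq_add_neg v]
    refine (levi_diff _ _ _ _).trans ?_
    rw [norm_neg, norm_smul, N.nν, mul_one]
    have hin' : ‖(inner ℂ ν v:ℂ)‖ ≤ C8 * σ := hin.trans (by gcongr)
    calc _ ≤ M * (C4 * σ + C8 * σ) * (C8 * σ ^ 2) := by gcongr
      _ = _ := by ring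
  have t2 := (ht q N.cl).2 v (v0.trans_lt (by linarith))
  rw [(D.mem_frontier.1 N.fr).2, sub_zero, ← hFx] at t2
  have h7 : ε / (2 * C4 ^ 2) * ‖v‖ ^ 2 ≤ ε / 2 * σ ^ 2 := by
    calc _ ≤ ε / (2 * C4 ^ 2) * (C4 * σ) ^ 2 := by gcongr
      _ = _ := by field_simp
  have h8 : σ ^ 3 * (M * (C4 + C8) * C8) ≤ ε / 2 * σ ^ 2 := by
    have := mul_le_mul_of_nonneg_left s4.le (sq_nonneg σ)
    linarith
  rw [w3]
  rw [abs_le] at *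
  constructor <;> linarith
end

section
variable {D D1 D2 : Dom E} {e p ν:E} {K g:ℝ} {A B : E →L[ℂ] E} {f : E → E}

lemma NC.mono (N : NC D e K p ν g A B) {K':ℝ} (h : K ≤ K') : NC D e K' p ν g A B :=
  { N with
    hA := fun v => (N.hA v).trans (by gcongr)
    hB := fun v => (N.hB v).trans (by gcongr) }

lemma PMap.fail (P : PMap D1 D2 f) (h : ¬ NDp D1 f) : ∃ C > 0, ∃ L > 0, ∀ ε > 0, ∃ z ∈ D1.Ω, -D1.r z < ε ∧
  ∃ p ∈ frontier D1.Ω, ∃ ν : E, ‖ν‖ = 1 ∧ ∃ s > 0, ∃ g : ℝ, D1.c ≤ g ∧ g ≤ L ∧ s ≤ C * (-D1.r z) ∧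
  z = p + (s:ℂ) • ν ∧ (∀ v, dl D1.r p v = -(g:ℂ) * inner ℂ ν v) ∧
  ∃ X : E, inner ℂ ν X = (0:ℂ) ∧ 1 / 2 ≤ ‖X‖ ∧ ‖X‖ ≤ 2 ∧ ‖fderiv ℂ f z X‖ ≤ ε := by
  obtain ⟨C, hC, L, hL, η, hη, hrep⟩ := D1.normal_rep
  obtain ⟨C1, hC1, δ, hδ, hlip⟩ := D1.dl_lip
  obtain ⟨Ca, hCa, han⟩ := P.aniso
  obtain ⟨Cd, hCd, hdl⟩ := D1.dl_bd
  have hc := D1.c_pos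
  refine ⟨C, hC, L, hL, fun ε hε => ?_⟩
  set Q := (1 + C1 * C) / D1.c with hQ
  have hQp : 0 < Q := by positivity
  set τ := min (min 1 (min η (δ / C))) (min ε (min (1 / (2 * Q)) (ε / (1 + Q * (Ca * (1 + Cd)))))) with hτ
  have hτp : 0 < τ := by positivity
  have t1 : τ ≤ 1 := (min_le_left _ _).trans (min_le_left _ _)
  have t2 : τ ≤ η := (min_le_left _ _).trans ((min_le_right _ _).trans (min_le_left _ _))
  have t3 : τ ≤ δ / C := (min_le_left _ _).trans ((min_le_right _ _).trans (min_le_right _ _))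
  have t4 : τ ≤ ε := (min_le_right _ _).trans (min_le_left _ _)
  have t5 : τ ≤ 1 / (2 * Q) := (min_le_right _ _).trans ((min_le_right _ _).trans (min_le_left _ _))
  have t6 : τ ≤ ε / (1 + Q * (Ca * (1 + Cd))) := (min_le_right _ _).trans ((min_le_right _ _).trans (min_le_right _ _))
  clear_value τ
  rw [le_div_iff₀ (by positivity)] at t3 t5 t6
  unfold NDp at h
  push Not at h
  obtain ⟨z, hz, hzτ, X0, hX0⟩ := h (1 / τ) (by positivity) (τ ^ 2) (by positivity)
  have hd : 0 < -D1.r z := by linarith [D1.neg hz]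
  set d := -D1.r z with hdd
  set sd := √d with hsd
  have hsp : 0 < sd := sqrt_pos.2 hd
  have hsq : sd ^ 2 = d := sq_sqrt hd.le
  have hsτ : sd ≤ τ := by nlinarith
  have hττ : τ ^ 2 ≤ τ := by nlinarith
  have hX0n : 0 < ‖X0‖ := by
    refine lt_of_le_of_lt ?_ hX0; positivity
  set X1 : E := ((‖X0‖:ℝ):ℂ)⁻¹ • X0 with hX1
  have hX1n : ‖X1‖ = 1 := by rw [hX1, norm_smul, norm_inv, norm_real, norm_norm, inv_mul_cancel₀ hX0n.ne']
  have hsm : ‖fderiv ℂ f z X1‖ + ‖dl D1.r z X1‖ / sd ≤ τ := by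
    rw [hX1, map_smul, map_smul, norm_smul, norm_smul, norm_inv, norm_real, norm_norm]
    rw [one_div, ← div_eq_inv_mul, div_lt_iff₀ hτp] at hX0
    have : ‖X0‖⁻¹ * (‖fderiv ℂ f z X0‖ + ‖dl D1.r z X0‖ / sd) ≤ ‖X0‖⁻¹ * (‖X0‖ * τ) := by gcongr
    rw [inv_mul_cancel_left₀ hX0n.ne'] at this
    refine le_trans (le_of_eq ?_) this
    ring
  have hf1 : ‖fderiv ℂ f z X1‖ ≤ τ := by have : 0 ≤ ‖dl D1.r z X1‖ / sd := by positivity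
                                         linarith
  have hd1 : ‖dl D1.r z X1‖ ≤ τ * sd := by
    rw [← div_le_iff₀ hsp]; linarith [norm_nonneg (fderiv ℂ f z X1)]
  clear_value X1
  obtain ⟨p, hp, ν, hν, s, hs, g, hg, hgL, hsC, hzp, -, hdlp⟩ := hrep z hz (by linarith)
  have hgp : 0 < g := hc.trans_le hg
  have hsn : ‖(s:ℂ) • ν‖ = s := by rw [norm_smul, hν, mul_one, norm_real, norm_of_nonneg hs.le]
  have hsδ : s < δ := by
    calc s ≤ C * d := hsC
      _ < C * τ := by gcongr; linarith
      _ ≤ δ := by linarith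
  have hin : ‖(inner ℂ ν X1:ℂ)‖ ≤ Q * (τ * sd) := by
    have h1 := hlip p (D1.mem_frontier.1 hp).1 _ (hsn.trans_lt hsδ) X1
    rw [← hzp, hsn, hX1n, mul_one] at h1
    have h2 := norm_le_norm_add_norm_sub (dl D1.r z X1) (dl D1.r p X1)
    have h4 : C1 * s ≤ C1 * (C * (sd * τ)) := by
      have hq : d ≤ sd * τ := by nlinarith
      have : C * d ≤ C * (sd * τ) := by gcongr
      have : s ≤ C * (sd * τ) := hsC.trans this
      gcongr
    rw [hdlp, norm_mul, norm_neg, norm_real, norm_of_nonneg hgp.le] at h2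
    have h3 : D1.c * ‖(inner ℂ ν X1:ℂ)‖ ≤ g * ‖(inner ℂ ν X1:ℂ)‖ := by gcongr
    rw [hdlp, norm_sub_rev, ← norm_sub_rev] at h1
    rw [hQ, div_mul_eq_mul_div, le_div_iff₀ hc]
    linarith
  have hfν : ‖fderiv ℂ f z ν‖ * sd ≤ Ca * (1 + Cd) := by
    have h1 := (han z hz ν).1
    rw [hν] at h1
    have h2 := hdl z (subset_closure hz) ν
    rw [hν, mul_one] at h2
    have h3 : Ca * (1 + ‖dl D1.r z ν‖ / sd) * sd = Ca * (sd + ‖dl D1.r z ν‖) := by field_simp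
    calc _ ≤ Ca * (1 + ‖dl D1.r z ν‖ / sd) * sd := by gcongr
      _ = Ca * (sd + ‖dl D1.r z ν‖) := h3
      _ ≤ _ := by gcongr; linarith
  refine ⟨z, hz, by linarith, p, hp, ν, hν, s, hs, g, hg, hgL, hsC, hzp, hdlp, pz ν X1, wc_pz hν X1, ?_, ?_, ?_⟩
  · have h1 : ‖wc ν X1‖ ≤ 1 / 2 := by
      rw [wc_apply]; refine hin.trans ?_
      have : Q * (τ * sd) ≤ Q * (τ * 1) := by gcongr; linarith
      linarith
    have h2 := norm_le_norm_add_norm_sub' X1 (wc ν X1 • ν)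
    rw [norm_smul, hν, hX1n] at h2
    rw [pz_apply]
    linarith
  · linarith [pz_norm_le hν X1]
  · rw [pz_apply, map_sub, map_smul]
    refine (norm_sub_le _ _).trans ?_
    rw [norm_smul, wc_apply]
    have h1 : ‖(inner ℂ ν X1:ℂ)‖ * ‖fderiv ℂ f z ν‖ ≤ Q * (τ * sd) * ‖fderiv ℂ f z ν‖ := by gcongr
    have h2 := mul_le_mul_of_nonneg_left hfν (mul_nonneg hQp.le hτp.le)
    linarith

lemma Th_o (he : ‖e‖ = 1) (B : E →L[ℂ] E) (σ:ℝ) :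
  Th D e p ν g B σ (I • e) = p + ((σ ^ 2 / g:ℝ):ℂ) • ν := by
  have h1 : pz e (I • e) = 0 := by rw [map_smul, pz_e he, smul_zero]
  rw [Th, hh, h1, map_smul, wc_e he]
  simp only [map_zero, smul_zero, zero_add, mul_zero, add_zero, smul_eq_mul, mul_one]
  congr 2
  push_cast
  have := I_mul_I
  linear_combination (-(σ:ℂ) ^ 2 / g) * this

lemma PMap.seq (P : PMap D1 D2 f) (h : ¬ NDp D1 f) (he : ‖e‖ = 1) : ∃ K > 0, ∃ C0 > 0, ∀ ε > 0, ∃ σ > 0, σ < ε ∧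
  ∃ p ν g A B, NC D1 e K p ν g A B ∧ ∃ q ν2 g2 A2 B2, NC D2 e K q ν2 g2 A2 B2 ∧
  ‖f (Th D1 e p ν g B σ (I • e)) - q‖ ≤ C0 * σ ^ 2 ∧
  ∃ x : E, wc e x = 0 ∧ 1 / (2 * K) ≤ ‖x‖ ∧ ‖x‖ ≤ 2 * K ∧ ‖fderiv ℂ f (Th D1 e p ν g B σ (I • e)) (B x)‖ ≤ ε := by
  obtain ⟨C, hC, L, hL, hfail⟩ := P.fail h
  obtain ⟨K1, hK1, h1⟩ := D1.exists_NC he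
  obtain ⟨K2, hK2, h2⟩ := D2.exists_NC he
  obtain ⟨C2, hC2, L2, hL2, η, hη, hrep⟩ := D2.normal_rep
  obtain ⟨c, hc, hhopf⟩ := P.hopf2
  obtain ⟨σ0, hσ0, hsc⟩ := D1.scale1 he (K := K1 + K2) (by positivity) one_pos one_pos
  refine ⟨K1 + K2, by positivity, C2 * (2 / c), by positivity, fun ε hε => ?_⟩
  obtain ⟨z, hz, hzε, p, hp, ν, hν, s, hs, g, hg, hgL, hsC, hzp, hdlp, X, hX, hX1, hX2, hfX⟩ :=
    hfail (min ε (min (η * c) ((min ε σ0) ^ 2 / (L * C)))) (by positivity)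
  obtain ⟨e1, e2⟩ := lt_min_iff.1 hzε
  obtain ⟨e2, e3⟩ := lt_min_iff.1 e2
  rw [lt_div_iff₀ (by positivity)] at e3
  obtain ⟨A, B, N1⟩ := h1 p hp ν hν g hg hdlp
  have hgp := N1.gpos
  have hσ : √(g * s) < min ε σ0 := by
    rw [Real.sqrt_lt' (by positivity)]
    calc g * s ≤ L * (C * -D1.r z) := by gcongr
      _ < _ := by linarith
  obtain ⟨hσε, hσσ⟩ := lt_min_iff.1 hσ
  have hσ2 : √(g * s) ^ 2 = g * s := sq_sqrt (by positivity)
  have hTh : Th D1 e p ν g B √(g * s) (I • e) = z := by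
    rw [Th_o he, hσ2, mul_div_cancel_left₀ _ hgp.ne', hzp]
  have hfz := P.maps hz
  have hhz := hhopf z hz
  obtain ⟨q, hq, ν2, hν2, s2, hs2, g2, hg2, -, hs2C, hfq, -, hdlq⟩ := hrep (f z) hfz (by
    by_contra hh
    push Not at hh
    nlinarith)
  obtain ⟨A2, B2, N2⟩ := h2 q hq ν2 hν2 g2 hg2 hdlq
  have N1' := N1.mono (K' := K1 + K2) (by linarith)
  have hBA : B (A X) = X := by rw [N1.BA, hX, zero_smul, sub_zero]
  refine ⟨√(g * s), by positivity, hσε, p, ν, g, A, B, N1', q, ν2, g2, A2, B2, N2.mono (by linarith), ?_,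
    A X, N1.wA X, ?_, ?_, ?_⟩
  · rw [hTh, hfq, add_sub_cancel_left, norm_smul, hν2, mul_one, norm_real, norm_of_nonneg hs2.le]
    have h3 := (hsc p ν g A B N1' _ (by positivity) hσσ (I • e) (by rw [norm_smul, he]; simp)).2
    rw [hTh, rr_o he] at h3
    have h4 := (abs_le.1 h3).1
    refine hs2C.trans ?_
    rw [mul_assoc]
    gcongr
    rw [div_mul_eq_mul_div, le_div_iff₀ hc]
    linarith
  · have := N1'.hB (A X)
    rw [hBA] at this
    rw [div_le_iff₀ (by positivity)]
    linarith
  · have := N1'.hA X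
    have h5 : (K1 + K2) * ‖X‖ ≤ (K1 + K2) * 2 := by gcongr
    linarith
  · rw [hTh, hBA]; exact hfX.trans (min_le_left _ _)
end

section
variable {D D1 D2 : Dom E} {e:E} {K:ℝ} {f : E → E}

lemma rr_convex (e:E) (R κ:ℝ) : Convex ℝ {x : E | ‖x‖ ≤ R ∧ κ ≤ rr e x} := by
  have h1 : ConvexOn ℝ univ (fun x : E => ‖x‖) := convexOn_norm convex_univ
  have h2 : ConvexOn ℝ univ (fun x : E => ‖pz e x‖ ^ 2) :=
    (h1.comp_linearMap ((pz e).restrictScalars ℝ).toLinearMap).pow (fun x _ => norm_nonneg _) 2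
  have h3 : ConvexOn ℝ univ (fun x : E => -(wc e x).im) := by
    have := LinearMap.convexOn (-(Complex.imCLM.comp ((wc e).restrictScalars ℝ)).toLinearMap) (convex_univ (𝕜 := ℝ) (E := E))
    exact this
  have h4 := (h2.add h3).convex_le (-κ)
  have h5 := h1.convex_le R
  convert h5.inter h4 using 1
  ext x
  simp only [mem_setOf_eq, mem_inter_iff, mem_univ, true_and, rr, Pi.add_apply]
  constructor
  · rintro ⟨a, b⟩; exact ⟨a, by linarith⟩
  · rintro ⟨a, b⟩; exact ⟨a, by linarith⟩

/-- the uniform estimates for the rescaled maps -/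
lemma PMap.resc (P : PMap D1 D2 f) (he : ‖e‖ = 1) (hK : 0 < K) {C0:ℝ} (hC0 : 0 < C0) :
  ∃ c > 0, ∃ C' > 0, ∀ R κ ε : ℝ, 1 ≤ R → 0 < κ → κ ≤ 1 → 0 < ε → ∃ C > 0, ∃ σ0 > 0,
  ∀ p ν g A B, NC D1 e K p ν g A B → ∀ q ν2 g2 A2 B2, NC D2 e K q ν2 g2 A2 B2 → ∀ σ > 0, σ < σ0 →
  ‖f (Th D1 e p ν g B σ (I • e)) - q‖ ≤ C0 * σ ^ 2 → ∀ x, ‖x‖ ≤ R → κ ≤ rr e x →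
  Th D1 e p ν g B σ x ∈ D1.Ω ∧
  ‖Gt D2 e q A2 σ (f (Th D1 e p ν g B σ x))‖ ≤ C ∧
  DifferentiableAt ℂ (fun y => Gt D2 e q A2 σ (f (Th D1 e p ν g B σ y))) x ∧
  c * (rr e x - ε) - ε ≤ rr e (Gt D2 e q A2 σ (f (Th D1 e p ν g B σ x))) ∧
  rr e (Gt D2 e q A2 σ (f (Th D1 e p ν g B σ x))) ≤ C' * (rr e x + ε) + ε := by
  obtain ⟨c, hc, hh1⟩ := P.hopf1
  obtain ⟨c2, hc2, hh2⟩ := P.hopf2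
  refine ⟨c, hc, c2⁻¹, by positivity, fun R κ ε hR hκ hκ1 hε => ?_⟩
  have hRp : 0 < R := by linarith
  obtain ⟨C3, hC3, σ1, hσ1, h1⟩ := P.src he hK hRp hκ
  obtain ⟨σ2, hσ2, h2⟩ := D1.scale1 he hK hRp hε
  obtain ⟨C, hC, σ3, hσ3, h3⟩ := D2.tgt he hK (R := R + 1) (by positivity) hC0 hC3 hε
  refine ⟨C, hC, min σ1 (min σ2 σ3), by positivity, ?_⟩
  intro p ν g A B N q ν2 g2 A2 B2 N2 σ hσ hσ' hq x hx hxr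
  obtain ⟨s1, s2⟩ := lt_min_iff.1 hσ'
  obtain ⟨s2, s3⟩ := lt_min_iff.1 s2
  have ho : ‖I • e‖ = 1 := by rw [norm_smul, he, norm_I, mul_one]
  obtain ⟨a1, a2⟩ := h3 q ν2 g2 A2 B2 N2 σ hσ s3 {x : E | ‖x‖ ≤ R ∧ κ ≤ rr e x}
    (fun y => f (Th D1 e p ν g B σ y)) (I • e) (rr_convex e R κ)
    ⟨by rw [ho]; exact hR, by rw [rr_o he]; exact hκ1⟩
    (fun y hy => (norm_sub_le _ _).trans (by rw [ho]; linarith [hy.1])) hq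
    (fun y hy => (h1 p ν g A B N σ hσ s1 y hy.1 hy.2).2) x ⟨hx, hxr⟩
  obtain ⟨b1, L, hL, -⟩ := h1 p ν g A B N σ hσ s1 x hx hxr
  obtain ⟨-, b3⟩ := h2 p ν g A B N σ hσ s2 x hx
  obtain ⟨L2, hL2, -⟩ := N2.fderivGt σ (f (Th D1 e p ν g B σ x))
  have k1 := hh1 _ b1
  have k2 := hh2 _ b1
  obtain ⟨a3, a4⟩ := abs_le.1 a2
  obtain ⟨b4, b5⟩ := abs_le.1 b3
  have hs2 : 0 < σ ^ 2 := by positivity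
  have hdd := (HasFDerivAt.comp x hL2 hL).differentiableAt
  refine ⟨b1, a1, hdd, ?_, ?_⟩
  · refine le_of_mul_le_mul_left ?_ hs2
    have : c * (σ ^ 2 * rr e x - ε * σ ^ 2) ≤ c * (-D1.r (Th D1 e p ν g B σ x)) := by gcongr; linarith
    linarith
  · refine le_of_mul_le_mul_left ?_ hs2
    have : c2⁻¹ * (c2 * (-D2.r (f (Th D1 e p ν g B σ x)))) ≤ c2⁻¹ * (σ ^ 2 * rr e x + ε * σ ^ 2) := by
      gcongr; linarith
    rw [inv_mul_cancel_left₀ hc2.ne'] at this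
    linarith

/-- the tangential component of the derivative of a rescaled map -/
lemma resc_deriv {p ν q ν2:E} {g g2 σ:ℝ} {A B A2 B2 : E →L[ℂ] E} (hf : DifferentiableOn ℂ f D1.Ω) (he : ‖e‖ = 1)
  (N : NC D1 e K p ν g A B) (N2 : NC D2 e K q ν2 g2 A2 B2) (hσ : 0 < σ)
  (hT : Th D1 e p ν g B σ (I • e) ∈ D1.Ω) {x:E} (hx : wc e x = 0) :
  pz e (fderiv ℂ (fun y => Gt D2 e q A2 σ (f (Th D1 e p ν g B σ y))) (I • e) x) =
  A2 (fderiv ℂ f (Th D1 e p ν g B σ (I • e)) (B x)) := by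
  obtain ⟨L1, hL1, h1⟩ := N.fderivTh σ (I • e)
  have hf1 := (hf.differentiableAt (D1.isOpen.mem_nhds hT)).hasFDerivAt
  obtain ⟨L2, hL2, h2⟩ := N2.fderivGt σ (f (Th D1 e p ν g B σ (I • e)))
  have h3 : HasFDerivAt (fun y => f (Th D1 e p ν g B σ y)) _ (I • e) := hf1.comp _ hL1
  have h0 := (HasFDerivAt.comp (I • e) hL2 h3).fderiv
  have h0' : fderiv ℂ (fun y => Gt D2 e q A2 σ (f (Th D1 e p ν g B σ y))) (I • e) = _ := h0
  have hx1 : L1 x = (σ:ℂ) • B x := by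
    rw [h1, hx, pz_of hx, map_smul, pz_e he]; simp
  rw [h0']
  simp only [ContinuousLinearMap.comp_apply]
  rw [hx1, h2, pz_mk he (by rw [map_smul, N2.wA, smul_zero]), map_smul, map_smul, smul_smul,
    inv_mul_cancel₀ (by exact_mod_cast hσ.ne'), one_smul]

lemma PMap.ndp_aux (P : PMap D1 D2 f) (he : ‖e‖ = 1) : NDp D1 f := by
  by_contra h
  haveI : ProperSpace E := FiniteDimensional.proper ℂ E
  obtain ⟨K, hK, C0, hC0, hseq⟩ := P.seq h he
  obtain ⟨c, hc, C', hC', hres⟩ := P.resc he hK hC0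
  choose σ hσ hσ1 p ν g A B N q ν2 g2 A2 B2 N2 hq x hwx hxl hxu hfx using
    fun j : ℕ => hseq (1 / ((j:ℝ) + 1)) (by positivity)
  set 𝒰 := hyperfilter ℕ with h𝒰
  have hz : Tendsto (fun j : ℕ => 1 / ((j:ℝ) + 1)) 𝒰 (𝓝 0) :=
    tendsto_one_div_add_atTop_nhds_zero_nat.mono_left Nat.hyperfilter_le_atTop
  have hsm : ∀ δ > 0, ∀ᶠ j in (𝒰 : Filter ℕ), σ j < δ := fun δ hδ => by
    filter_upwards [hz.eventually_lt_const hδ] with j hj using (hσ1 j).trans hj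
  set ψ : ℕ → E → E := fun j y => Gt D2 e (q j) (A2 j) (σ j) (f (Th D1 e (p j) (ν j) (g j) (B j) (σ j) y)) with hψ
  have hres' : ∀ R κ ε : ℝ, 1 ≤ R → 0 < κ → κ ≤ 1 → 0 < ε → ∃ C > 0, ∀ᶠ j in (𝒰 : Filter ℕ), ∀ y, ‖y‖ ≤ R → κ ≤ rr e y →
      Th D1 e (p j) (ν j) (g j) (B j) (σ j) y ∈ D1.Ω ∧ ‖ψ j y‖ ≤ C ∧ DifferentiableAt ℂ (ψ j) y ∧
      c * (rr e y - ε) - ε ≤ rr e (ψ j y) ∧ rr e (ψ j y) ≤ C' * (rr e y + ε) + ε := by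
    intro R κ ε hR hκ hκ1 hε
    obtain ⟨C, hC, σ0, hσ0, h1⟩ := hres R κ ε hR hκ hκ1 hε
    refine ⟨C, hC, ?_⟩
    filter_upwards [hsm σ0 hσ0] with j hj y hy hyr
    exact h1 _ _ _ _ _ (N j) _ _ _ _ _ (N2 j) _ (hσ j) hj (hq j) y hy hyr
  have hlim : ∀ y, ∃ L, y ∈ Sg e → Tendsto (fun j => ψ j y) 𝒰 (𝓝 L) := by
    intro y
    by_cases hy : y ∈ Sg e
    · obtain ⟨C, hC, h1⟩ := hres' (1 + ‖y‖) (min 1 (rr e y)) 1 (by linarith [norm_nonneg y])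
        (lt_min one_pos hy) (min_le_left _ _) one_pos
      obtain ⟨L, hL, -⟩ := ultra_lim 𝒰 (fun j => ψ j y) C (by
        filter_upwards [h1] with j hj using (hj y (by linarith) (min_le_right _ _)).2.1)
      exact ⟨L, fun _ => hL⟩
    · exact ⟨0, fun h => absurd h hy⟩
  choose Ψ hΨ using hlim
  have hbd : ∀ y ∈ Sg e, ∀ ε > 0, c * (rr e y - ε) - ε ≤ rr e (Ψ y) ∧ rr e (Ψ y) ≤ C' * (rr e y + ε) + ε := by
    intro y hy ε hε
    obtain ⟨C, hC, h1⟩ := hres' (1 + ‖y‖) (min 1 (rr e y)) ε (by linarith [norm_nonneg y])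
        (lt_min one_pos hy) (min_le_left _ _) hε
    have h2 := ((rr_cont e).tendsto (Ψ y)).comp (hΨ y hy)
    have h3 : ∀ᶠ j in (𝒰 : Filter ℕ), _ := h1.mono fun j hj => (hj y (by linarith) (min_le_right _ _)).2.2.2
    exact ⟨ge_of_tendsto h2 (h3.mono fun j hj => hj.1), le_of_tendsto h2 (h3.mono fun j hj => hj.2)⟩
  have hlo : ∀ y ∈ Sg e, c * rr e y ≤ rr e (Ψ y) := by
    intro y hy
    refine le_of_forall_pos_le_add fun ε hε => ?_
    have := (hbd y hy (ε / (c + 1)) (by positivity)).1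
    have h2 : c * (ε / (c + 1)) + ε / (c + 1) = ε := by field_simp
    linarith
  have hhi : ∀ y ∈ Sg e, rr e (Ψ y) ≤ C' * rr e y := by
    intro y hy
    refine le_of_forall_pos_le_add fun ε hε => ?_
    have := (hbd y hy (ε / (C' + 1)) (by positivity)).2
    have h2 : C' * (ε / (C' + 1)) + ε / (C' + 1) = ε := by field_simp
    linarith
  have hder : ∀ y ∈ Sg e, HasFDerivAt Ψ (fderiv ℂ Ψ y) y ∧ Tendsto (fun j => fderiv ℂ (ψ j) y) 𝒰 (𝓝 (fderiv ℂ Ψ y)) := by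
    intro y hy
    have hy' : 0 < rr e y := hy
    obtain ⟨δ, hδ, hball⟩ := Metric.mem_nhds_iff.1 ((rr_cont e).continuousAt.eventually_const_lt (half_lt_self hy'))
    obtain ⟨C, hC, h1⟩ := hres' (1 + ‖y‖ + δ) (min 1 (rr e y / 2)) 1 (by linarith [norm_nonneg y])
        (lt_min one_pos (half_pos hy')) (min_le_left _ _) one_pos
    have key : ∀ w ∈ ball y δ, ‖w‖ ≤ 1 + ‖y‖ + δ ∧ min 1 (rr e y / 2) ≤ rr e w := by
      intro w hw
      refine ⟨?_, (min_le_right _ _).trans (le_of_lt (hball hw))⟩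
      have := norm_le_norm_add_norm_sub' w y
      rw [mem_ball_iff_norm] at hw
      linarith
    refine limit_hasFDerivAt 𝒰 ψ Ψ (R := δ) (M := C) hδ ?_ ?_ ?_
    · filter_upwards [h1] with j hj w hw
      exact (hj w (key w hw).1 (key w hw).2).2.2.1.differentiableWithinAt
    · filter_upwards [h1] with j hj w hw
      exact (hj w (key w hw).1 (key w hw).2).2.1
    · intro w hw
      exact hΨ w ((half_pos hy').trans (hball hw))
  have H : SM e Ψ := ⟨fun y hy => (hder y hy).1.differentiableAt.differentiableWithinAt,
    fun y hy => (mul_pos hc hy).trans_le (hlo y hy)⟩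
  obtain ⟨v, hv, -⟩ := ultra_lim 𝒰 x (2 * K) (Eventually.of_forall hxu)
  have hvn : 1 / (2 * K) ≤ ‖v‖ := ge_of_tendsto hv.norm (Eventually.of_forall hxl)
  have hwv : wc e v = 0 := by
    have := ((wc e).continuous.tendsto v).comp hv
    refine tendsto_nhds_unique this ?_
    exact tendsto_const_nhds.congr fun j => (hwx j).symm
  have hv0 : v ≠ 0 := by
    rintro rfl
    rw [norm_zero] at hvn
    have : 0 < 1 / (2 * K) := by positivity
    linarith
  refine SM.main he H hc hlo hhi hv0 hwv ?_
  have ho := o_mem he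
  have t1 : Tendsto (fun j => pz e (fderiv ℂ (ψ j) (I • e) (x j))) 𝒰 (𝓝 (pz e (fderiv ℂ Ψ (I • e) v))) :=
    ((pz e).continuous.tendsto _).comp
      ((isBoundedBilinearMap_apply (𝕜 := ℂ) (E := E) (F := E)).continuous.tendsto (fderiv ℂ Ψ (I • e), v) |>.comp
        ((hder _ ho).2.prodMk_nhds hv))
  refine tendsto_nhds_unique t1 ?_
  obtain ⟨C, hC, h1⟩ := hres' 1 1 1 le_rfl one_pos le_rfl one_pos
  have hz2 : Tendsto (fun j : ℕ => K * (1 / ((j:ℝ) + 1))) 𝒰 (𝓝 0) := by simpa using hz.const_mul K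
  refine squeeze_zero_norm' ?_ hz2
  filter_upwards [h1] with j hj
  have hT := (hj (I • e) (by rw [norm_smul, he, norm_I, mul_one]) (by rw [rr_o he])).1
  rw [hψ, resc_deriv P.hol he (N j) (N2 j) (hσ j) hT (hwx j)]
  refine ((N2 j).hA _).trans ?_
  have := hfx j
  gcongr

lemma PMap.ndp (P : PMap D1 D2 f) : NDp D1 f := by
  rcases subsingleton_or_nontrivial E with h | h
  · refine ⟨1, one_pos, 1, one_pos, fun z hz _ X => ?_⟩
    rw [Subsingleton.elim X 0, norm_zero]
    positivity
  · obtain ⟨v, hv⟩ := exists_ne (0:E)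
    refine P.ndp_aux (e := ((‖v‖:ℝ):ℂ)⁻¹ • v) ?_
    rw [norm_smul, norm_inv, norm_real, norm_norm, inv_mul_cancel₀ (norm_ne_zero_iff.2 hv)]
end

end PMH

/-- A proper holomorphic mapping between bounded strictly pseudoconvex
domains in `ℂⁿ` with `C²` boundaries extends to a mapping of Hölder class `C^α` on the
closure of the source domain, for every `0 ≤ α < 1`. -/
theorem proper_map_holder_extension {n : ℕ}
    (Ω₁ Ω₂ : Set (EuclideanSpace ℂ (Fin n)))
    (h₁ : IsStrictlyPseudoconvexDomain Ω₁) (h₂ : IsStrictlyPseudoconvexDomain Ω₂)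
    (f : EuclideanSpace ℂ (Fin n) → EuclideanSpace ℂ (Fin n))
    (hf : DifferentiableOn ℂ f Ω₁) (hmaps : Set.MapsTo f Ω₁ Ω₂)
    (hproper : ∀ K : Set (EuclideanSpace ℂ (Fin n)), K ⊆ Ω₂ → IsCompact K →
      IsCompact {z ∈ Ω₁ | f z ∈ K}) :
    ∀ α : ℝ, 0 ≤ α → α < 1 →
      ∃ F : EuclideanSpace ℂ (Fin n) → EuclideanSpace ℂ (Fin n),
        ContinuousOn F (closure Ω₁) ∧ Set.EqOn F f Ω₁ ∧
        ∃ C : ℝ, 0 < C ∧ ∀ z ∈ closure Ω₁, ∀ w ∈ closure Ω₁,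
          ‖F z - F w‖ ≤ C * ‖z - w‖ ^ α := by
  obtain ⟨a1, a2, a3, U, ρ, a4, a5, a6, a7, a8, a9⟩ := h₁
  obtain ⟨b1, b2, b3, U2, ρ2, b4, b5, b6, b7, b8, b9⟩ := h₂
  obtain ⟨D1, rfl⟩ := PMH.exists_dom a1 a2 a3 a4 a5 a6 a7 a8
    (fun p hp v hv h1 h2 => by
      have := a9 p hp v hv h1 h2
      simpa [leviForm, iteratedFDeriv_two_apply, PMH.levi, PMH.Hess] using this)
  obtain ⟨D2, rfl⟩ := PMH.exists_dom b1 b2 b3 b4 b5 b6 b7 b8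
    (fun p hp v hv h1 h2 => by
      have := b9 p hp v hv h1 h2
      simpa [leviForm, iteratedFDeriv_two_apply, PMH.levi, PMH.Hess] using this)
  have P : PMH.PMap D1 D2 f := ⟨hf, hmaps, hproper⟩
  intro α h0 h1
  exact P.final P.ndp h0 h1
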